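/- There exists β ∈ (0,1) such that for every T > 0 there is a function u^T : cl(S_T^+) → ℝ which is Hölder continuous with exponent β, satisfies −1 < u^T < 1 on cl(S_T^+), u^T(t₀,0) = 0 for some t₀ ∈ (−T,T), is continuously differentiable in t on S_T^+ with ∂_t u^T ≥ 0 in S_T^+, and is a minimizer of the reduced energy in S_T^+ in the sense that E_{S_T^+}(u^T) ≤ E_{S_T^+}(u^T + ψ) for every C¹ function ψ on cl(ℝ × (0,∞)) with compact support contained in S_T^+ ∪ {(t,0) : |t| < T} and such that −1 ≤ u^T + ψ ≤ 1 on S_T^+. Moreover, there is a sequence T_k → ∞ such that u^{T_k} converges uniformly on compact subsets of ℝ × [0,∞) to a classical solution u of the boundary reaction problem satisfying ∂_t u(t,0) > 0 for all t and u(t,0) → ±1 as t → ±∞. -/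

import Mathlib

open Real Filter MeasureTheory Set Topology

noncomputable def pt (u : ℝ → ℝ → ℝ) (t y : ℝ) : ℝ := deriv (fun s => u s y) t
noncomputable def py (u : ℝ → ℝ → ℝ) (t y : ℝ) : ℝ := deriv (fun z => u t z) y
noncomputable def ptt (u : ℝ → ℝ → ℝ) (t y : ℝ) : ℝ := deriv (fun s => pt u s y) t
noncomputable def pyy (u : ℝ → ℝ → ℝ) (t y : ℝ) : ℝ := deriv (fun z => py u t z) y
noncomputable def pty (u : ℝ → ℝ → ℝ) (t y : ℝ) : ℝ := deriv (fun z => pt u t z) y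

/-- The degenerate elliptic operator `H_a u = u_yy + (a/y) u_y + u_tt + (n-1) tanh t · u_t`. -/
noncomputable def Ha (n : ℕ) (a : ℝ) (u : ℝ → ℝ → ℝ) (t y : ℝ) : ℝ :=
  pyy u t y + (a / y) * py u t y + ptt u t y + ((n : ℝ) - 1) * Real.tanh t * pt u t y

/-- A classical solution of the boundary reaction problem: a bounded continuous function on
`ℝ × [0,∞)`, `C²` on `ℝ × (0,∞)`, with `H_a u = 0` there, `∂_t u` extending continuously to
`ℝ × [0,∞)`, and for every `t` the limit `lim_{y→0⁺} y^a ∂_y u(t,y)` exists and equals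
`-f(u(t,0)) = F'(u(t,0))`, where `f = -F'`. -/
structure BRSolution (n : ℕ) (a : ℝ) (F : ℝ → ℝ) (u : ℝ → ℝ → ℝ) : Prop where
  bounded : ∃ M : ℝ, ∀ t y : ℝ, 0 ≤ y → |u t y| ≤ M
  cont : ContinuousOn (fun p : ℝ × ℝ => u p.1 p.2) {p : ℝ × ℝ | 0 ≤ p.2}
  smooth : ContDiffOn ℝ 2 (fun p : ℝ × ℝ => u p.1 p.2) {p : ℝ × ℝ | 0 < p.2}
  eqn : ∀ t y : ℝ, 0 < y → Ha n a u t y = 0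
  pt_cont : ContinuousOn (fun p : ℝ × ℝ => pt u p.1 p.2) {p : ℝ × ℝ | 0 ≤ p.2}
  bc : ∀ t : ℝ, Tendsto (fun y : ℝ => y ^ a * py u t y) (𝓝[>] (0:ℝ))
        (𝓝 (deriv F (u t 0)))

/-- `F` is a smooth double-well potential: `F(±1) = 0`, `F > 0` on `(-1,1)`,
`F'(±1) = 0`, `F''(±1) > 0`. -/
def DoubleWell (F : ℝ → ℝ) : Prop :=
  ContDiff ℝ (⊤ : ℕ∞) F ∧ F (-1) = 0 ∧ F 1 = 0 ∧ (∀ s ∈ Set.Ioo (-1:ℝ) 1, 0 < F s) ∧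
    deriv F (-1) = 0 ∧ deriv F 1 = 0 ∧
    0 < iteratedDeriv 2 F (-1) ∧ 0 < iteratedDeriv 2 F 1

/-- The reduced energy of `u` on a domain `Ω ⊂ ℝ × (0,∞)`:
`E_Ω(u) = ∫_Ω ((∂_t u)² + (∂_y u)²)/2 · y^a cosh^{n-1} t dt dy
  + ∫_{cl(Ω) ∩ {y=0}} F(u(t,0)) cosh^{n-1} t dt`. -/
noncomputable def energy (n : ℕ) (a : ℝ) (F : ℝ → ℝ) (Ω : Set (ℝ × ℝ))
    (u : ℝ → ℝ → ℝ) : ℝ :=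
  (∫ p in Ω, ((pt u p.1 p.2) ^ 2 + (py u p.1 p.2) ^ 2) / 2 * p.2 ^ a
      * Real.cosh p.1 ^ (n - 1)) +
    ∫ t in {t : ℝ | (t, (0:ℝ)) ∈ closure Ω}, F (u t 0) * Real.cosh t ^ (n - 1)

/-- The open half-disc `S_T^+ = {(t,y) : t² + y² < T², y > 0}`. -/
def SHalf (T : ℝ) : Set (ℝ × ℝ) := {p : ℝ × ℝ | p.1 ^ 2 + p.2 ^ 2 < T ^ 2 ∧ 0 < p.2}

namespace BR
open ProbabilityTheory
open BoundedContinuousFunction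
open intervalIntegral (continuous_of_dominated_interval continuous_parametric_intervalIntegral_of_continuous integral_comp_neg integral_congr integral_eq_sub_of_hasDerivAt integral_hasDerivAt_right integral_interval_sub_left integral_mono_interval integral_mono_on integral_of_le integral_symm intervalIntegrable_rpow')

local notation "ℝ²" => ℝ × ℝ
local notation "ℍ" => setOf fun p : ℝ² => 0 < Prod.snd p
local notation "Cb" => BoundedContinuousFunction ℝ ℝ
local notation "γ" => gaussianReal 0 1

lemma ae_Ioi {a : ℝ} {p : ℝ → Prop} (h : ∀ x ∈ Ioi a, p x) : ∀ᵐ x ∂volume.restrict (Ioi a), p x :=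
  ae_restrict_of_forall_mem measurableSet_Ioi h

/-- The heat semigroup on the line, written as a Gaussian average. -/
noncomputable def Gam (r : ℝ) (f : ℝ → ℝ) (t : ℝ) : ℝ :=
  ∫ x, f (t + √(2 * r) * x) ∂γ

lemma integrable_gauss_of_bdd {f : ℝ → ℝ} {M : ℝ} (hf : Continuous f) (hb : ∀ t, |f t| ≤ M) :
    Integrable f γ :=
  Integrable.of_bound hf.aestronglyMeasurable M (ae_of_all _ (by simpa using hb))

lemma abs_integral_gauss_le {f : ℝ → ℝ} {M : ℝ} (hb : ∀ t, |f t| ≤ M) :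
    |∫ x, f x ∂γ| ≤ M := by
  have := norm_integral_le_of_norm_le_const (μ := γ) (f := f) (C := M)
    (ae_of_all _ (by simpa using hb))
  simpa using this

lemma Gam_le {r : ℝ} {f : ℝ → ℝ} {M : ℝ} (hb : ∀ t, |f t| ≤ M) (t : ℝ) : |Gam r f t| ≤ M :=
  abs_integral_gauss_le fun _ => hb _

lemma Gam_zero (f : ℝ → ℝ) (t : ℝ) : Gam 0 f t = f t := by simp [Gam]

lemma continuous_integral_gauss {X : Type*} [TopologicalSpace X] [FirstCountableTopology X]
    {h : X → ℝ → ℝ} (hc : Continuous fun p : X × ℝ => h p.1 p.2) {M : ℝ}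
    (hb : ∀ x t, |h x t| ≤ M) : Continuous fun x => ∫ ξ, h x ξ ∂γ := by
  refine continuous_of_dominated (bound := fun _ => M) ?_ ?_ (integrable_const _) ?_
  · intro x
    exact (hc.comp (Continuous.prodMk_right x)).aestronglyMeasurable
  · intro x; exact ae_of_all _ (by simpa using hb x)
  · exact ae_of_all _ fun t => hc.comp (Continuous.prodMk_left t)

lemma continuous_Gam {X : Type*} [TopologicalSpace X] [FirstCountableTopology X]
    {r t : X → ℝ} {h : X → ℝ → ℝ} (hr : Continuous r) (ht : Continuous t)
    (hc : Continuous fun p : X × ℝ => h p.1 p.2) {M : ℝ}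
    (hb : ∀ x t, |h x t| ≤ M) : Continuous fun x => Gam (r x) (h x) (t x) := by
  unfold Gam
  refine continuous_integral_gauss (h := fun x ξ => h x (t x + √(2 * r x) * ξ)) ?_ (M := M) ?_
  · exact hc.comp (f := fun p : X × ℝ => (p.1, t p.1 + √(2 * r p.1) * p.2)) (by fun_prop)
  · intro x ξ; exact hb _ _

lemma Gam_eq_map {r : ℝ} (hr : 0 ≤ r) {f : ℝ → ℝ} (hf : Continuous f) (t : ℝ) :
    Gam r f t = ∫ y, f (t + y) ∂(gaussianReal 0 (2 * r).toNNReal) := by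
  have h := gaussianReal_map_const_mul (μ := 0) (v := 1) (√(2 * r))
  have e : NNReal.mk (√(2 * r) ^ 2) (sq_nonneg _) * 1 = (2 * r).toNNReal := by
    rw [mul_one]
    apply NNReal.eq
    rw [coe_toNNReal _ (by positivity)]
    exact sq_sqrt (by positivity)
  rw [e, mul_zero] at h
  rw [← h, integral_map (by fun_prop) (by fun_prop), Gam]

lemma Gam_Gam {σ τ : ℝ} (hσ : 0 ≤ σ) (hτ : 0 ≤ τ) {f : ℝ → ℝ} {M : ℝ} (hf : Continuous f)
    (hb : ∀ t, |f t| ≤ M) (t : ℝ) : Gam σ (Gam τ f) t = Gam (σ + τ) f t := by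
  have hc : Continuous (Gam τ f) :=
    continuous_Gam (X := ℝ) continuous_const continuous_id (h := fun _ => f)
      (hf.comp continuous_snd) (fun _ => hb)
  rw [Gam_eq_map hσ hc, Gam_eq_map (add_nonneg hσ hτ) hf]
  have h := gaussianReal_conv_gaussianReal (m₁ := 0) (m₂ := 0)
    (v₁ := (2 * σ).toNNReal) (v₂ := (2 * τ).toNNReal)
  rw [← toNNReal_add (by positivity) (by positivity), ← mul_add, add_zero] at h
  rw [← h, integral_conv]
  · refine integral_congr_ae (ae_of_all _ fun y => ?_)
    simp only
    rw [Gam_eq_map hτ hf]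
    simp only [add_assoc]
  · exact Integrable.of_bound (by fun_prop) M (ae_of_all _ fun x => by simpa using hb _)

lemma integrable_sq_gauss : Integrable (fun x : ℝ => 1 + x ^ 2) γ :=
  (integrable_const _).add (memLp_id_gaussianReal (μ := 0) (v := 1) 2).integrable_sq

/-- The spatial derivative of the heat semigroup. -/
noncomputable def Gam' (r : ℝ) (f : ℝ → ℝ) (t : ℝ) : ℝ :=
  (√(2 * r))⁻¹ * ∫ x, x * f (t + √(2 * r) * x) ∂γ

/-- A Gaussian moment used as a constant in derivative bounds. -/
noncomputable def mom : ℝ := ∫ x, (1 + x ^ 2) ∂γ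

lemma mom_nonneg : 0 ≤ mom := integral_nonneg fun _ => by positivity

lemma abs_rpow_le {x α : ℝ} (hα : α ∈ Icc (0:ℝ) 1) : |x| * |x| ^ α ≤ 1 + x ^ 2 := by
  rw [← sq_abs]
  rcases le_total |x| 1 with h | h
  · have : |x| ^ α ≤ 1 := rpow_le_one (abs_nonneg _) h hα.1
    nlinarith [abs_nonneg x]
  · have : |x| ^ α ≤ |x| := rpow_le_self_of_one_le h hα.2
    nlinarith [abs_nonneg x]

lemma Gam'_le {r : ℝ} (hr : 0 < r) {f : ℝ → ℝ} {M H α : ℝ} (hα : α ∈ Icc (0:ℝ) 1)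
    (hf : Continuous f) (hb : ∀ t, |f t| ≤ M) (hH : ∀ t t', |f t - f t'| ≤ H * |t - t'| ^ α)
    (t : ℝ) : |Gam' r f t| ≤ mom * H * r ^ ((α - 1) / 2) := by
  have hH0 : 0 ≤ H := by simpa using (abs_nonneg _).trans (hH 0 1)
  set c := √(2 * r) with hc
  have hc0 : 0 < c := sqrt_pos.2 (by positivity)
  have hi : Integrable (fun x : ℝ => x) γ :=
    (memLp_id_gaussianReal (μ := 0) (v := 1) 1).integrable (by norm_num)
  have h1 : ∫ x, x * f (t + c * x) ∂γ =
      ∫ x, x * (f (t + c * x) - f t) ∂γ := by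
    simp_rw [mul_sub]
    rw [integral_sub _ (hi.mul_const _), integral_mul_const, integral_id_gaussianReal]
    · simp
    · exact hi.mul_bdd (c := M) (by fun_prop) (ae_of_all _ fun x => by simpa using hb _)
  have h2 : |∫ x, x * (f (t + c * x) - f t) ∂γ| ≤ H * c ^ α * mom := by
    unfold mom
    rw [← integral_const_mul]
    refine (norm_integral_le_integral_norm (G := ℝ) _).trans ?_
    refine integral_mono_of_nonneg (ae_of_all _ fun _ => norm_nonneg _)
      (integrable_sq_gauss.const_mul _) (ae_of_all _ fun x => ?_)
    simp only [norm_mul, norm_eq_abs]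
    have := hH (t + c * x) t
    rw [add_sub_cancel_left, abs_mul, abs_of_pos hc0, mul_rpow hc0.le (abs_nonneg _)] at this
    calc |x| * |f (t + c * x) - f t| ≤ |x| * (H * (c ^ α * |x| ^ α)) := by gcongr
      _ = H * c ^ α * (|x| * |x| ^ α) := by ring
      _ ≤ _ := by gcongr; exact abs_rpow_le hα
  have h3 : c⁻¹ * c ^ α ≤ r ^ ((α - 1) / 2) := by
    have : c⁻¹ * c ^ α = (2 * r) ^ ((α - 1) / 2) := by
      rw [← rpow_neg_one, ← rpow_add hc0, hc, sqrt_eq_rpow,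
        ← rpow_mul (by positivity)]
      congr 1; ring
    rw [this]
    exact rpow_le_rpow_of_nonpos hr (by linarith) (by linarith [hα.2])
  unfold Gam'
  rw [← hc, h1, abs_mul, abs_of_nonneg (by positivity : 0 ≤ c⁻¹)]
  calc c⁻¹ * |∫ x, x * (f (t + c * x) - f t) ∂γ|
      ≤ c⁻¹ * (H * c ^ α * mom) := by gcongr
    _ = mom * H * (c⁻¹ * c ^ α) := by ring
    _ ≤ _ := by have := mom_nonneg; gcongr

lemma Gam'_le_bdd {r : ℝ} (hr : 0 < r) {f : ℝ → ℝ} {M : ℝ}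
    (hf : Continuous f) (hb : ∀ t, |f t| ≤ M) (t : ℝ) :
    |Gam' r f t| ≤ 2 * mom * M * r ^ (-(1 / 2) : ℝ) := by
  have := Gam'_le hr (α := 0) (H := 2 * M) (by norm_num) hf hb
    (fun t t' => by
      rw [rpow_zero, mul_one]
      have := abs_sub (f t) (f t'); linarith [hb t, hb t']) t
  convert this using 1
  rw [show ((0:ℝ) - 1) / 2 = -(1 / 2) by norm_num]; ring

lemma continuousOn_Gam' {X : Type*} [TopologicalSpace X] [FirstCountableTopology X]
    {r t : X → ℝ} {h : X → ℝ → ℝ} (hr : Continuous r) (ht : Continuous t)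
    (hc : Continuous fun p : X × ℝ => h p.1 p.2) {M : ℝ}
    (hb : ∀ x t, |h x t| ≤ M) : ContinuousOn (fun x => Gam' (r x) (h x) (t x)) {x | 0 < r x} := by
  unfold Gam'
  refine ContinuousOn.mul (ContinuousOn.inv₀ (by fun_prop) fun x hx =>
    (sqrt_pos.2 (mul_pos two_pos hx)).ne') (Continuous.continuousOn ?_)
  have hc' : Continuous fun p : X × ℝ => h p.1 (t p.1 + √(2 * r p.1) * p.2) :=
    hc.comp (f := fun p : X × ℝ => (p.1, t p.1 + √(2 * r p.1) * p.2)) (by fun_prop)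
  refine continuous_of_dominated (bound := fun x => (1 + x ^ 2) * M) ?_ ?_
    (integrable_sq_gauss.mul_const _) ?_
  · intro x
    exact ((continuous_id.mul (hc'.comp (Continuous.prodMk_right x)))).aestronglyMeasurable
  · intro x
    refine ae_of_all _ fun ξ => ?_
    rw [norm_mul]
    have : |ξ| ≤ 1 + ξ ^ 2 := by rw [← sq_abs]; nlinarith [sq_nonneg (|ξ| - 1), abs_nonneg ξ]
    exact mul_le_mul this (hb _ _) (abs_nonneg _) (by positivity)
  · exact ae_of_all _ fun ξ => continuous_const.mul (hc'.comp (Continuous.prodMk_left ξ))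

lemma hasDerivAt_gaussKernel {f : ℝ → ℝ} {M : ℝ} (hf : Continuous f) (hb : ∀ t, |f t| ≤ M)
    {c : ℝ} (hc : 0 < c) (t : ℝ) :
    HasDerivAt (fun s => ∫ x, f (s + c * x) ∂γ)
      (c⁻¹ * ∫ x, x * f (t + c * x) ∂γ) t := by
  set K : ℝ := (√(2 * π))⁻¹ with hK
  have pdf : ∀ x, gaussianPDFReal 0 1 x = K * rexp (-x ^ 2 / 2) := by
    intro x; simp [gaussianPDFReal, hK]
  have hM : 0 ≤ M := (abs_nonneg _).trans (hb 0)
  have hK0 : 0 ≤ K := by positivity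
  have key : ∀ s, ∫ x, f (s + c * x) ∂γ =
      ∫ x, f (t + c * x) * (K * rexp (-(x - (s - t) / c) ^ 2 / 2)) := by
    intro s
    rw [integral_gaussianReal_eq_integral_smul (by norm_num)]
    rw [← integral_sub_right_eq_self _ ((s - t) / c)]
    refine integral_congr_ae (ae_of_all _ fun x => ?_)
    simp only [pdf, smul_eq_mul]
    rw [mul_comm]; congr 2; field_simp; ring
  have key2 : c⁻¹ * ∫ x, x * f (t + c * x) ∂γ =
      ∫ x, f (t + c * x) * (K * (rexp (-(x - (t - t) / c) ^ 2 / 2) * ((x - (t - t) / c) / c))) := by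
    rw [integral_gaussianReal_eq_integral_smul (by norm_num), ← integral_const_mul]
    refine integral_congr_ae (ae_of_all _ fun x => ?_)
    simp only [pdf, smul_eq_mul, sub_self, zero_div, sub_zero]
    field_simp
  rw [key2]
  simp_rw [key]
  have hint : Integrable (fun x : ℝ => M * (K * (rexp 1 * ((|x| + 1) * rexp (-(1/4) * x ^ 2)) / c))) := by
    refine ((Integrable.const_mul ?_ (rexp 1)).div_const c).const_mul K |>.const_mul M
    have h1 := (integrable_mul_exp_neg_mul_sq (b := 1/4) (by norm_num)).abs
    have h2 := integrable_exp_neg_mul_sq (b := 1/4) (by norm_num)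
    refine (h1.add h2).congr (ae_of_all _ fun x => ?_)
    simp [abs_mul]; ring
  refine (hasDerivAt_integral_of_dominated_loc_of_deriv_le
    (F' := fun s x => f (t + c * x) * (K * (rexp (-(x - (s - t) / c) ^ 2 / 2) * ((x - (s - t) / c) / c))))
    (Metric.ball_mem_nhds t hc) ?_ ?_ ?_ ?_ hint ?_).2
  · exact Eventually.of_forall fun s => by fun_prop
  · have h2 := integrable_exp_neg_mul_sq (b := 1/2) (by norm_num)
    refine (h2.const_mul K).bdd_mul (f := fun x => f (t + c * x)) (c := M) (by fun_prop)
      (ae_of_all _ fun x => by simpa using hb _) |>.congr (ae_of_all _ fun x => ?_)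
    simp only [sub_self, zero_div, sub_zero]
    ring_nf
  · fun_prop
  · refine ae_of_all _ fun x s hs => ?_
    rw [Metric.mem_ball, Real.dist_eq] at hs
    set e := (s - t) / c with he
    have he1 : |e| ≤ 1 := by
      rw [he, abs_div, abs_of_pos hc, div_le_one hc]; exact hs.le
    have h1 : |x - e| ≤ |x| + 1 := (abs_sub _ _).trans (by gcongr)
    have h2 : rexp (-(x - e) ^ 2 / 2) ≤ rexp 1 * rexp (-(1/4) * x ^ 2) := by
      rw [← exp_add]; apply exp_le_exp.2
      have := sq_abs e
      nlinarith [sq_nonneg (x - 2 * e), abs_nonneg e]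
    rw [norm_mul, norm_mul, norm_mul, norm_div]
    simp only [norm_eq_abs, abs_of_nonneg hK0, abs_exp, abs_of_pos hc]
    have := hb (t + c * x)
    calc |f (t + c * x)| * (K * (rexp (-(x - e) ^ 2 / 2) * (|x - e| / c)))
        ≤ M * (K * ((rexp 1 * rexp (-(1/4) * x ^ 2)) * ((|x| + 1) / c))) := by gcongr
      _ = _ := by ring
  · refine ae_of_all _ fun x s hs => ?_
    have h : HasDerivAt (fun s => -(x - (s - t) / c) ^ 2 / 2) _ s :=
      ((((hasDerivAt_id' s).sub_const t).div_const c).const_sub x).fun_pow 2 |>.fun_neg.div_const 2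
    have h1 := h.congr_deriv (g' := (x - (s - t) / c) / c) (by push_cast; ring)
    exact (h1.exp.const_mul K).const_mul _

lemma hasDerivAt_Gam {r : ℝ} (hr : 0 < r) {f : ℝ → ℝ} {M : ℝ} (hf : Continuous f)
    (hb : ∀ t, |f t| ≤ M) (t : ℝ) : HasDerivAt (Gam r f) (Gam' r f t) t :=
  hasDerivAt_gaussKernel hf hb (sqrt_pos.2 (by positivity)) t

lemma hasDerivAt_Gam_of_hasDerivAt (r : ℝ) {g g' : ℝ → ℝ} {M M' : ℝ} (hg : Continuous g)
    (hb : ∀ t, |g t| ≤ M) (hg' : Continuous g') (hb' : ∀ t, |g' t| ≤ M')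
    (hd : ∀ t, HasDerivAt g (g' t) t) (t : ℝ) : HasDerivAt (Gam r g) (Gam r g' t) t := by
  refine (hasDerivAt_integral_of_dominated_loc_of_deriv_le (μ := γ)
    (F := fun t x => g (t + √(2 * r) * x)) (F' := fun t x => g' (t + √(2 * r) * x))
    (bound := fun _ => M') univ_mem ?_ ?_ ?_ ?_ (integrable_const _) ?_).2
  · exact Eventually.of_forall fun s => by fun_prop
  · exact integrable_gauss_of_bdd (by fun_prop) fun _ => hb _
  · fun_prop
  · exact ae_of_all _ fun x s _ => by simpa using hb' _
  · exact ae_of_all _ fun x s _ => (hd _).comp_add_const s _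

lemma hasDerivAt_Gam_time {r : ℝ} (hr : 0 < r) {g g' g'' : ℝ → ℝ} {M M' M'' : ℝ}
    (hg : Continuous g) (hb : ∀ t, |g t| ≤ M) (hg' : Continuous g') (hb' : ∀ t, |g' t| ≤ M')
    (hg'' : Continuous g'') (hb'' : ∀ t, |g'' t| ≤ M'')
    (hd : ∀ t, HasDerivAt g (g' t) t) (hd' : ∀ t, HasDerivAt g' (g'' t) t) (t : ℝ) :
    HasDerivAt (fun r => Gam r g t) (Gam r g'' t) r := by
  have h1 := (hasDerivAt_Gam hr hg' hb' t).unique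
    (hasDerivAt_Gam_of_hasDerivAt r hg' hb' hg'' hb'' hd' t)
  rw [← h1, Gam', ← integral_const_mul]
  have hM' : 0 ≤ M' := (abs_nonneg _).trans (hb' 0)
  refine (hasDerivAt_integral_of_dominated_loc_of_deriv_le (μ := γ)
    (F := fun r x => g (t + √(2 * r) * x))
    (F' := fun r x => (√(2 * r))⁻¹ * (x * g' (t + √(2 * r) * x)))
    (bound := fun x => (√ r)⁻¹ * ((1 + x ^ 2) * M')) (Ioi_mem_nhds (half_lt_self hr)) ?_ ?_ ?_ ?_
    ((integrable_sq_gauss.mul_const _).const_mul _) ?_).2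
  · exact Eventually.of_forall fun s => by fun_prop
  · exact integrable_gauss_of_bdd (by fun_prop) fun _ => hb _
  · fun_prop
  · refine ae_of_all _ fun x s (hs : r / 2 < s) => ?_
    rw [norm_mul, norm_mul, norm_of_nonneg (by positivity)]
    have h3 : |x| ≤ 1 + x ^ 2 := by rw [← sq_abs]; nlinarith [sq_nonneg (|x| - 1), abs_nonneg x]
    have h4 : √r ≤ √(2 * s) := sqrt_le_sqrt (by linarith)
    have h5 : 0 < √r := sqrt_pos.2 hr
    gcongr
    · exact h3
    · exact hb' _
  · refine ae_of_all _ fun x s (hs : r / 2 < s) => ?_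
    have hs0 : 0 < 2 * s := by linarith
    have h6 : HasDerivAt (fun s => t + √(2 * s) * x) _ s :=
      ((((hasDerivAt_id' s).const_mul 2).sqrt hs0.ne').mul_const x).const_add t
    refine ((hd _).comp s h6).congr_deriv ?_
    field_simp

/-- The resolvent of the second derivative expressed through the heat semigroup. -/
noncomputable def Res (C : ℝ) (f : ℝ → ℝ) (t : ℝ) : ℝ := ∫ r in Ioi (0:ℝ), rexp (-(C * r)) * Gam r f t

lemma Res_eq_of_ode {C : ℝ} (hC : 0 < C) {g g' g'' : ℝ → ℝ} {M M' M'' : ℝ}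
    (hg : Continuous g) (hb : ∀ t, |g t| ≤ M) (hg' : Continuous g') (hb' : ∀ t, |g' t| ≤ M')
    (hg'' : Continuous g'') (hb'' : ∀ t, |g'' t| ≤ M'')
    (hd : ∀ t, HasDerivAt g (g' t) t) (hd' : ∀ t, HasDerivAt g' (g'' t) t) (t : ℝ) :
    Res C (fun t => C * g t - g'' t) t = g t := by
  have hexp : IntegrableOn (fun r : ℝ => rexp (-(C * r))) (Ioi 0) := by
    simpa using exp_neg_integrableOn_Ioi 0 hC
  have hlin : ∀ r, Gam r (fun t => C * g t - g'' t) t = C * Gam r g t - Gam r g'' t := by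
    intro r
    unfold Gam
    rw [integral_sub, integral_const_mul]
    · exact (integrable_gauss_of_bdd (hg.comp (by fun_prop)) fun _ => hb _).const_mul _
    · exact integrable_gauss_of_bdd (hg''.comp (by fun_prop)) fun _ => hb'' _
  have hcg : ∀ {k : ℝ → ℝ} {K : ℝ}, Continuous k → (∀ t, |k t| ≤ K) →
      Continuous fun r => Gam r k t := fun hk hK =>
    continuous_Gam continuous_id continuous_const (hk.comp continuous_snd) fun _ => hK
  have h := integral_Ioi_of_hasDerivAt_of_tendsto (a := 0) (m := 0)
    (f := fun r => -(rexp (-(C * r)) * Gam r g t))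
    (f' := fun r => rexp (-(C * r)) * Gam r (fun t => C * g t - g'' t) t) ?_ ?_ ?_ ?_
  · unfold Res
    rw [h]; simp [Gam_zero]
  · exact (Continuous.neg (by have := hcg hg hb; fun_prop)).continuousWithinAt
  · intro r hr
    have h1 : HasDerivAt (fun r => -(rexp (-(C * r)) * Gam r g t)) _ r :=
      ((((hasDerivAt_id' r).const_mul C).fun_neg.exp).fun_mul
        (hasDerivAt_Gam_time hr hg hb hg' hb' hg'' hb'' hd hd' t)).fun_neg
    refine h1.congr_deriv ?_
    rw [hlin]; ring
  · simp_rw [hlin]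
    refine Integrable.mul_bdd (c := C * M + M'') hexp ?_ (ae_of_all _ fun r => ?_)
    · have := hcg hg hb
      have := hcg hg'' hb''
      exact Continuous.aestronglyMeasurable (by fun_prop)
    · refine (abs_sub _ _).trans ?_
      rw [abs_mul, abs_of_pos hC]
      have := Gam_le (r := r) hb t
      have := Gam_le (r := r) hb'' t
      gcongr
  · rw [← neg_zero]
    refine Tendsto.neg ?_
    have h0 : Tendsto (fun r : ℝ => rexp (-(C * r))) atTop (𝓝 0) :=
      tendsto_exp_neg_atTop_nhds_zero.comp (tendsto_id.const_mul_atTop hC)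
    exact h0.zero_mul_isBoundedUnder_le (isBoundedUnder_of ⟨M, fun r => Gam_le hb t⟩)

/-- One-sided exponential average. -/
noncomputable def expAvg (k : ℝ) (f : ℝ → ℝ) (t : ℝ) : ℝ :=
  rexp (-(k * t)) * ∫ y in Iic t, rexp (k * y) * f y

lemma integrableOn_expAvg {k : ℝ} (hk : 0 < k) {f : ℝ → ℝ} {M : ℝ} (hf : Continuous f)
    (hb : ∀ t, |f t| ≤ M) (t : ℝ) : IntegrableOn (fun y => rexp (k * y) * f y) (Iic t) :=
  (integrableOn_exp_mul_Iic hk t).mul_bdd (c := M) hf.aestronglyMeasurable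
    (ae_of_all _ fun y => hb y)

lemma expAvg_le {k : ℝ} (hk : 0 < k) {f : ℝ → ℝ} {M : ℝ} (hb : ∀ t, |f t| ≤ M) (t : ℝ) :
    |expAvg k f t| ≤ M / k := by
  have h : |∫ y in Iic t, rexp (k * y) * f y| ≤ rexp (k * t) / k * M := by
    rw [← integral_exp_mul_Iic hk, ← integral_mul_const]
    refine (norm_integral_le_integral_norm (G := ℝ) _).trans ?_
    refine integral_mono_of_nonneg (ae_of_all _ fun _ => norm_nonneg _)
      ((integrableOn_exp_mul_Iic hk t).mul_const _) (ae_of_all _ fun x => ?_)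
    simp only [norm_mul, norm_eq_abs, abs_exp]
    gcongr; exact hb _
  unfold expAvg
  rw [abs_mul, abs_exp]
  calc _ ≤ rexp (-(k * t)) * (rexp (k * t) / k * M) := by gcongr
    _ = (rexp (-(k * t)) * rexp (k * t)) * M / k := by ring
    _ = M / k := by rw [← exp_add]; simp

lemma hasDerivAt_expAvg {k : ℝ} (hk : 0 < k) {f : ℝ → ℝ} {M : ℝ} (hf : Continuous f)
    (hb : ∀ t, |f t| ≤ M) (t : ℝ) : HasDerivAt (expAvg k f) (f t - k * expAvg k f t) t := by
  have hi := integrableOn_expAvg hk hf hb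
  have h1 : HasDerivAt (fun t => ∫ y in Iic t, rexp (k * y) * f y) (rexp (k * t) * f t) t := by
    have h2 : (fun t => ∫ y in Iic t, rexp (k * y) * f y) = fun t =>
        (∫ y in Iic 0, rexp (k * y) * f y) + ∫ y in (0:ℝ)..t, rexp (k * y) * f y := by
      ext t; rw [← intervalIntegral.integral_Iic_sub_Iic (hi 0) (hi t)]; ring
    rw [h2]
    exact ((Continuous.integral_hasStrictDerivAt (by fun_prop) 0 t).hasDerivAt).const_add _
  have h3 : HasDerivAt (expAvg k f) _ t := (((hasDerivAt_id' t).const_mul k).fun_neg.exp).fun_mul h1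
  refine h3.congr_deriv ?_
  have : rexp (-(k * t)) * rexp (k * t) = 1 := by rw [← exp_add]; simp
  unfold expAvg
  linear_combination f t * this

/-- The derivative of `Res C f`. -/
noncomputable def Res' (C : ℝ) (f : ℝ → ℝ) (t : ℝ) : ℝ :=
  (expAvg (√C) (fun s => f (-s)) (-t) - expAvg (√C) f t) / 2

lemma Res'_le {C : ℝ} (hC : 0 < C) {f : ℝ → ℝ} {M : ℝ} (hb : ∀ t, |f t| ≤ M) (t : ℝ) :
    |Res' C f t| ≤ M / √C := by
  have hk : 0 < √C := sqrt_pos.2 hC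
  have h1 := expAvg_le hk hb t
  have h2 := expAvg_le hk (f := fun s => f (-s)) (fun s => hb _) (-t)
  unfold Res'
  rw [abs_le] at *
  constructor <;> linarith

lemma hasDerivAt_Res {C : ℝ} (hC : 0 < C) {f : ℝ → ℝ} {M : ℝ} (hf : Continuous f)
    (hb : ∀ t, |f t| ≤ M) (t : ℝ) : HasDerivAt (Res C f) (Res' C f t) t ∧
      HasDerivAt (Res' C f) (C * Res C f t - f t) t := by
  have hk : 0 < √C := sqrt_pos.2 hC
  have hkk : √C * √C = C := mul_self_sqrt hC.le
  set k := √C with hkd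
  have dL := hasDerivAt_expAvg hk hf hb
  have dR : ∀ t, HasDerivAt (fun t => expAvg k (fun s => f (-s)) (-t))
      (-(f t - k * expAvg k (fun s => f (-s)) (-t))) t := by
    intro t
    have := (hasDerivAt_expAvg hk (f := fun s => f (-s)) (by fun_prop) (fun s => hb _) (-t)).scomp t
      (hasDerivAt_neg t)
    refine this.congr_deriv ?_
    simp
  have cL : Continuous (expAvg k f) := continuous_iff_continuousAt.2 fun t => (dL t).continuousAt
  have cR : Continuous (fun t => expAvg k (fun s => f (-s)) (-t)) :=
    continuous_iff_continuousAt.2 fun t => (dR t).continuousAt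
  set g : ℝ → ℝ := fun t => (expAvg k (fun s => f (-s)) (-t) + expAvg k f t) / (2 * k) with hg
  have d1 : ∀ t, HasDerivAt g (Res' C f t) t := fun t => by
    refine (((dR t).fun_add (dL t)).div_const (2 * k)).congr_deriv ?_
    simp only [Res', ← hkd]; field_simp; ring
  have d2 : ∀ t, HasDerivAt (Res' C f) (C * g t - f t) t := fun t => by
    refine (((dR t).fun_sub (dL t)).div_const 2).congr_deriv ?_
    rw [← hkk, hg]; field_simp; ring
  have bg : ∀ t, |g t| ≤ M / k / k := fun t => by
    have h1 := expAvg_le hk hb t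
    have h2 := expAvg_le hk (f := fun s => f (-s)) (fun s => hb _) (-t)
    rw [hg]; simp only
    rw [abs_div, abs_of_pos (by positivity : 0 < 2 * k), div_le_iff₀ (by positivity)]
    have := abs_add_le (expAvg k (fun s => f (-s)) (-t)) (expAvg k f t)
    have e : M / k / k * (2 * k) = 2 * (M / k) := by field_simp
    linarith
  have cg : Continuous g := (cR.add cL).div_const _
  have e : Res C f = g := by
    ext t
    have := Res_eq_of_ode hC cg bg ((cR.sub cL).div_const 2 : Continuous (Res' C f))
      (Res'_le hC hb) (g'' := fun t => C * g t - f t) (by fun_prop) (M'' := C * (M / k / k) + M)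
      (fun t => by
        refine (abs_sub _ _).trans ?_
        rw [abs_mul, abs_of_pos hC]
        have := bg t; have := hb t; gcongr) d1 d2 t
    simpa using this
  rw [e]; exact ⟨d1 t, d2 t⟩

/-- Continuous potentials pinched between two positive constants. -/
structure Pot (l Λ : ℝ) where
  V : ℝ → ℝ
  cont : Continuous V
  l_pos : 0 < l
  lb : ∀ t, 2 * l ≤ V t
  ub : ∀ t, V t ≤ Λ

namespace Pot
variable {l Λ : ℝ} (P : Pot l Λ)

/-- The nonnegative perturbation `Λ + l - V`. -/
def W (t : ℝ) : ℝ := Λ + l - P.V t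

lemma W_cont : Continuous P.W := continuous_const.sub P.cont

lemma Lam_pos {l Λ : ℝ} (P : Pot l Λ) : 0 < Λ := by have := P.lb 0; have := P.ub 0; have := P.l_pos; linarith

lemma W_le (t : ℝ) : |P.W t| ≤ Λ - l := by
  have h1 := P.lb t; have h2 := P.ub t; have := P.l_pos
  unfold W; rw [abs_le]; constructor <;> linarith

lemma l_le {l Λ : ℝ} (P : Pot l Λ) : l ≤ Λ := by have := P.lb 0; have := P.ub 0; have := P.l_pos; linarith

lemma Wz_le {z : ℝ → ℝ} {M : ℝ} (hz : ∀ t, |z t| ≤ M) (t : ℝ) : |P.W t * z t| ≤ (Λ - l) * M := by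
  rw [abs_mul]
  exact mul_le_mul (P.W_le t) (hz t) (abs_nonneg _) (sub_nonneg.2 P.l_le)

lemma integral_exp_le (τ : ℝ) (hΛ : 0 < Λ) : ∫ r in (0:ℝ)..τ, rexp (-(Λ * r)) ≤ 1 / Λ := by
  have h : ∀ r ∈ uIcc 0 τ, HasDerivAt (fun r => -(rexp (-(Λ * r)) / Λ)) (rexp (-(Λ * r))) r := by
    intro r _
    have h1 : HasDerivAt (fun r => -(rexp (-(Λ * r)) / Λ)) _ r :=
      (((((hasDerivAt_id' r).const_mul Λ).fun_neg).exp).div_const Λ).fun_neg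
    exact h1.congr_deriv (by field_simp)
  rw [integral_eq_sub_of_hasDerivAt h
    (Continuous.intervalIntegrable (by fun_prop) _ _)]
  have : 0 ≤ rexp (-(Λ * τ)) / Λ := by positivity
  simp only [mul_zero, neg_zero, exp_zero]
  linarith

lemma abs_integral_exp_le {τ M : ℝ} (hτ : 0 ≤ τ) {g : ℝ → ℝ} (hΛ : 0 < Λ)
    (hg : ∀ r, |g r| ≤ M) : |∫ r in (0:ℝ)..τ, rexp (-(Λ * r)) * g r| ≤ M / Λ := by
  have hM : 0 ≤ M := (abs_nonneg _).trans (hg 0)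
  have h := intervalIntegral.norm_integral_le_of_norm_le (μ := volume)
    (f := fun r => rexp (-(Λ * r)) * g r)
    (g := fun r => rexp (-(Λ * r)) * M) hτ (ae_of_all _ fun r _ => by
      rw [norm_mul, norm_eq_abs, abs_exp]; gcongr; exact hg r)
    (Continuous.intervalIntegrable (by fun_prop) _ _)
  rw [intervalIntegral.integral_mul_const] at h
  refine h.trans ?_
  have := mul_le_mul_of_nonneg_right (integral_exp_le τ hΛ) hM
  calc _ ≤ 1 / Λ * M := this
    _ = M / Λ := by ring

/-- The integrand of the Duhamel term. -/
noncomputable def duh (z : ℝ → ℝ → ℝ) (τ r t : ℝ) : ℝ :=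
  rexp (-(Λ * r)) * Gam r (fun x => P.W x * z (τ - r) x) t

lemma duh_continuous {X : Type*} [TopologicalSpace X] [FirstCountableTopology X]
    {z : ℝ → ℝ → ℝ} {M : ℝ} (hz : Continuous fun p : ℝ² => z p.1 p.2)
    (hb : ∀ τ t, |z τ t| ≤ M) {τ r t : X → ℝ} (hτ : Continuous τ) (hr : Continuous r)
    (ht : Continuous t) : Continuous fun x => P.duh z (τ x) (r x) (t x) := by
  unfold duh
  refine Continuous.mul (by fun_prop) (continuous_Gam (h := fun x ξ => P.W ξ * z (τ x - r x) ξ)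
    hr ht ?_ (M := (Λ - l) * M) fun x ξ => P.Wz_le (hb _) ξ)
  exact (P.W_cont.comp continuous_snd).mul
    (hz.comp (f := fun p : X × ℝ => (τ p.1 - r p.1, p.2)) (by fun_prop))

lemma abs_duh_int_le {z : ℝ → ℝ → ℝ} {M τ : ℝ} (hτ : 0 ≤ τ) (hb : ∀ τ t, |z τ t| ≤ M) (t : ℝ) :
    |∫ r in (0:ℝ)..τ, P.duh z τ r t| ≤ (Λ - l) / Λ * M := by
  refine (abs_integral_exp_le hτ P.Lam_pos fun r => Gam_le (P.Wz_le (hb _)) t).trans (le_of_eq ?_)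
  ring

/-- The affine Duhamel map. -/
noncomputable def duhMap (f : Cb) (z : ℝ² →ᵇ ℝ) : ℝ² →ᵇ ℝ :=
  ofNormedAddCommGroup
    (fun p => rexp (-(Λ * max p.1 0)) * Gam (max p.1 0) f p.2 +
      ∫ r in (0:ℝ)..max p.1 0, P.duh (fun τ t => z (τ, t)) (max p.1 0) r p.2)
    (by
      have hz : Continuous fun p : ℝ² => z (p.1, p.2) := z.continuous
      refine Continuous.add (Continuous.mul (by fun_prop) (continuous_Gam
        (h := fun _ : ℝ² => f) (r := fun p : ℝ² => max p.1 0) (t := fun p : ℝ² => p.2)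
        (by fun_prop) (by fun_prop) (by fun_prop) fun _ => f.norm_coe_le_norm)) ?_
      exact continuous_parametric_intervalIntegral_of_continuous
        (f := fun (p : ℝ²) r => P.duh (fun τ t => z (τ, t)) (max p.1 0) r p.2)
        (P.duh_continuous (X := ℝ² × ℝ) (τ := fun x => max x.1.1 0) (r := fun x => x.2)
          (t := fun x => x.1.2) (M := ‖z‖) hz (fun _ _ => z.norm_coe_le_norm _)
          (by fun_prop) (by fun_prop) (by fun_prop)) (by fun_prop))
    (‖f‖ + (Λ - l) / Λ * ‖z‖) (by
      intro p
      refine (norm_add_le _ _).trans (add_le_add ?_ ?_)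
      · rw [norm_mul, norm_eq_abs, abs_exp]
        have h1 : rexp (-(Λ * max p.1 0)) ≤ 1 := by
          rw [exp_le_one_iff]
          have := mul_nonneg P.Lam_pos.le (le_max_right p.1 0); linarith
        have h2 := Gam_le (r := max p.1 0) (f := f) (fun t => f.norm_coe_le_norm t) p.2
        calc _ ≤ 1 * ‖f‖ := mul_le_mul h1 h2 (abs_nonneg _) zero_le_one
          _ = ‖f‖ := one_mul _
      · exact P.abs_duh_int_le (le_max_right _ _) (fun _ _ => z.norm_coe_le_norm _) _)

lemma Gam_sub {r : ℝ} {f g : ℝ → ℝ} {M K : ℝ} (hf : Continuous f) (hg : Continuous g)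
    (hbf : ∀ t, |f t| ≤ M) (hbg : ∀ t, |g t| ≤ K) (t : ℝ) :
    Gam r (fun x => f x - g x) t = Gam r f t - Gam r g t := by
  unfold Gam
  exact integral_sub (integrable_gauss_of_bdd (by fun_prop) fun _ => hbf _)
    (integrable_gauss_of_bdd (by fun_prop) fun _ => hbg _)

lemma duhMap_sub_le (f : Cb) (z z' : ℝ² →ᵇ ℝ) :
    dist (P.duhMap f z) (P.duhMap f z') ≤ (Λ - l) / Λ * dist z z' := by
  have hθ : 0 ≤ (Λ - l) / Λ := div_nonneg (sub_nonneg.2 P.l_le) P.Lam_pos.le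
  rw [dist_le (by positivity)]
  intro p
  have hz : ∀ z : ℝ² →ᵇ ℝ, Continuous fun p : ℝ² => z (p.1, p.2) := fun z => z.continuous
  have hc : ∀ z : ℝ² →ᵇ ℝ, Continuous fun r => P.duh (fun τ t => z (τ, t)) (max p.1 0) r p.2 :=
    fun z => P.duh_continuous (M := ‖z‖) (hz z) (fun _ _ => z.norm_coe_le_norm _)
      (by fun_prop) (by fun_prop) (by fun_prop)
  have e : P.duhMap f z p - P.duhMap f z' p =
      ∫ r in (0:ℝ)..max p.1 0, P.duh (fun τ t => z (τ, t) - z' (τ, t)) (max p.1 0) r p.2 := by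
    simp only [duhMap, coe_ofNormedAddCommGroup]
    rw [add_sub_add_left_eq_sub, ← intervalIntegral.integral_sub ((hc z).intervalIntegrable _ _)
      ((hc z').intervalIntegrable _ _)]
    refine integral_congr fun r _ => ?_
    simp only [duh]
    rw [← mul_sub, ← Gam_sub (M := (Λ - l) * ‖z‖) (K := (Λ - l) * ‖z'‖)]
    · simp only [mul_sub]
    · exact P.W_cont.mul ((hz z).comp (Continuous.prodMk_right _))
    · exact P.W_cont.mul ((hz z').comp (Continuous.prodMk_right _))
    · exact P.Wz_le fun t => z.norm_coe_le_norm _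
    · exact P.Wz_le fun t => z'.norm_coe_le_norm _
  rw [Real.dist_eq, e]
  exact P.abs_duh_int_le (le_max_right _ _) (fun τ t => by
    rw [← Real.dist_eq]; exact dist_coe_le_dist _) _

lemma contracting (f : Cb) :
    ContractingWith ((Λ - l) / Λ).toNNReal (P.duhMap f) := by
  have hθ : 0 ≤ (Λ - l) / Λ := div_nonneg (sub_nonneg.2 P.l_le) P.Lam_pos.le
  refine ⟨?_, LipschitzWith.of_dist_le_mul fun z w => ?_⟩
  · rw [toNNReal_lt_one, div_lt_one P.Lam_pos]; linarith [P.l_pos]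
  · rw [coe_toNNReal _ hθ]; exact P.duhMap_sub_le f z w

/-- The solution of Duhamel's equation. -/
noncomputable def Z (f : Cb) : ℝ² →ᵇ ℝ := ContractingWith.fixedPoint _ (P.contracting f)

lemma duhMap_Z (f : Cb) : P.duhMap f (P.Z f) = P.Z f := (P.contracting f).fixedPoint_isFixedPt

lemma Z_unique {f : Cb} {z : ℝ² →ᵇ ℝ} (h : P.duhMap f z = z) : z = P.Z f :=
  (P.contracting f).fixedPoint_unique h

lemma Z_eq (f : Cb) {τ : ℝ} (hτ : 0 ≤ τ) (t : ℝ) : P.Z f (τ, t) =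
    rexp (-(Λ * τ)) * Gam τ f t + ∫ r in (0:ℝ)..τ, P.duh (fun τ t => P.Z f (τ, t)) τ r t := by
  conv_lhs => rw [← P.duhMap_Z f]
  simp only [duhMap, coe_ofNormedAddCommGroup, max_eq_left hτ]

lemma Z_norm_le (f : Cb) : ‖P.Z f‖ ≤ Λ / l * ‖f‖ := by
  have hΛ := P.Lam_pos
  have hl := P.l_pos
  have h1 : ‖P.Z f‖ ≤ ‖f‖ + (Λ - l) / Λ * ‖P.Z f‖ := by
    conv_lhs => rw [← P.duhMap_Z f]
    exact norm_ofNormedAddCommGroup_le _ (by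
      have := div_nonneg (sub_nonneg.2 P.l_le) P.Lam_pos.le
      positivity) _
  rw [div_mul_eq_mul_div, le_div_iff₀ hl]
  have h2 := mul_le_mul_of_nonneg_left h1 hΛ.le
  have e : Λ * (‖f‖ + (Λ - l) / Λ * ‖P.Z f‖) = Λ * ‖f‖ + (Λ - l) * ‖P.Z f‖ := by field_simp
  linarith

lemma Z_le (f : Cb) (τ t : ℝ) : |P.Z f (τ, t)| ≤ Λ / l * ‖f‖ :=
  ((P.Z f).norm_coe_le_norm _).trans (P.Z_norm_le f)

lemma Z_zero (f : Cb) (t : ℝ) : P.Z f (0, t) = f t := by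
  rw [P.Z_eq f le_rfl]; simp [Gam_zero]

end Pot

lemma Gam_setIntegral {r : ℝ} {S : Set ℝ} {g : ℝ → ℝ → ℝ} {G : ℝ → ℝ}
    (hg : Continuous fun p : ℝ² => g p.1 p.2) (hS : MeasurableSet S) (hG : IntegrableOn G S)
    (hb : ∀ ρ ∈ S, ∀ x, |g ρ x| ≤ G ρ) (t : ℝ) :
    Gam r (fun x => ∫ ρ in S, g ρ x) t = ∫ ρ in S, Gam r (g ρ) t := by
  unfold Gam
  rw [integral_integral_swap]
  have h1 : Integrable (fun p : ℝ² => G p.2) ((γ).prod (volume.restrict S)) :=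
    hG.comp_snd _
  refine h1.mono' ?_ ?_
  · exact (hg.comp (f := fun p : ℝ² => (p.2, t + √(2 * r) * p.1))
      (by fun_prop)).aestronglyMeasurable
  · rw [← Measure.restrict_univ (μ := γ), Measure.prod_restrict]
    filter_upwards [ae_restrict_mem (MeasurableSet.univ.prod hS)] with p hp
    exact hb _ hp.2 _

lemma Gam_const_mul (r c : ℝ) (f : ℝ → ℝ) (t : ℝ) : Gam r (fun x => c * f x) t = c * Gam r f t := by
  unfold Gam; exact integral_const_mul _ _

lemma Gam_add {r : ℝ} {f g : ℝ → ℝ} {M K : ℝ} (hf : Continuous f) (hg : Continuous g)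
    (hbf : ∀ t, |f t| ≤ M) (hbg : ∀ t, |g t| ≤ K) (t : ℝ) :
    Gam r (fun x => f x + g x) t = Gam r f t + Gam r g t := by
  unfold Gam
  exact integral_add (integrable_gauss_of_bdd (by fun_prop) fun _ => hbf _)
    (integrable_gauss_of_bdd (by fun_prop) fun _ => hbg _)

/-- Shear change of variables for double integrals over the first quadrant. -/
lemma integral_shear {g : ℝ → ℝ → ℝ} {K c : ℝ} (hc : 0 < c)
    (hg : Continuous fun p : ℝ² => g p.1 p.2)
    (hb : ∀ σ r, 0 ≤ σ → 0 ≤ r → |g σ r| ≤ K * rexp (-(c * σ)) * rexp (-(c * r))) :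
    IntegrableOn (fun T => ∫ r in (0:ℝ)..T, g (T - r) r) (Ioi 0) ∧
    ∫ T in Ioi (0:ℝ), ∫ r in (0:ℝ)..T, g (T - r) r = ∫ r in Ioi (0:ℝ), ∫ σ in Ioi (0:ℝ), g σ r := by
  set G : ℝ² → ℝ := (Ioi (0:ℝ) ×ˢ Ioi (0:ℝ)).indicator fun p => g p.1 p.2 with hGdef
  have hG1 : ∀ σ r, 0 < σ → 0 < r → G (σ, r) = g σ r := fun σ r h1 h2 =>
    indicator_of_mem (show (σ, r) ∈ Ioi (0:ℝ) ×ˢ Ioi (0:ℝ) from ⟨h1, h2⟩) _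
  have hG0 : ∀ σ r, ¬(0 < σ ∧ 0 < r) → G (σ, r) = 0 := fun σ r h =>
    indicator_of_notMem (show (σ, r) ∉ Ioi (0:ℝ) ×ˢ Ioi (0:ℝ) from h) _
  have hint : Integrable G (volume.prod volume) := by
    rw [hGdef, integrable_indicator_iff (measurableSet_Ioi.prod measurableSet_Ioi)]
    have h1 : Integrable (fun p : ℝ² => K * rexp (-(c * p.1)) * rexp (-(c * p.2)))
        ((volume.restrict (Ioi 0)).prod (volume.restrict (Ioi 0))) := by
      have e := integrableOn_exp_mul_Ioi (a := -c) (by linarith) 0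
      simp only [neg_mul] at e
      exact (Integrable.const_mul e K).mul_prod e
    rw [Measure.prod_restrict] at h1
    refine Integrable.mono' h1 hg.aestronglyMeasurable ?_
    filter_upwards [ae_restrict_mem (measurableSet_Ioi.prod measurableSet_Ioi)] with p hp
    exact hb _ _ (le_of_lt hp.1) (le_of_lt hp.2)
  have hsh : MeasurePreserving (fun p : ℝ² => (p.1 - p.2, p.2)) (volume.prod volume)
      (volume.prod volume) := measurePreserving_sub_prod volume volume
  have hint2 : Integrable (fun p : ℝ² => G (p.1 - p.2, p.2)) (volume.prod volume) :=
    hsh.integrable_comp_of_integrable hint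
  have e1 : ∫ p, G (p.1 - p.2, p.2) ∂(volume.prod volume) = ∫ p, G p ∂(volume.prod volume) := by
    rw [← integral_map (f := G) hsh.measurable.aemeasurable (by rw [hsh.map_eq]; exact hint.1),
      hsh.map_eq]
  have e2 : ∀ T, ∫ r, G (T - r, r) = (Ioi (0:ℝ)).indicator
      (fun T => ∫ r in (0:ℝ)..T, g (T - r) r) T := by
    intro T
    have h : (fun r => G (T - r, r)) = (Ioo 0 T).indicator fun r => g (T - r) r := by
      funext r
      by_cases h : r ∈ Ioo 0 T
      · rw [indicator_of_mem h, hG1 _ _ (sub_pos.2 h.2) h.1]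
      · rw [indicator_of_notMem h, hG0 _ _ fun h' => h ⟨h'.2, sub_pos.1 h'.1⟩]
    rw [h, integral_indicator measurableSet_Ioo]
    by_cases hT : 0 < T
    · rw [indicator_of_mem (mem_Ioi.2 hT), integral_of_le hT.le,
        integral_Ioc_eq_integral_Ioo]
    · rw [indicator_of_notMem (by simpa using hT), Ioo_eq_empty (by simpa using hT)]; simp
  have e3 : ∀ r, ∫ σ, G (σ, r) = (Ioi (0:ℝ)).indicator (fun r => ∫ σ in Ioi (0:ℝ), g σ r) r := by
    intro r
    by_cases hr : r ∈ Ioi (0:ℝ)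
    · rw [indicator_of_mem hr, ← integral_indicator measurableSet_Ioi]
      refine integral_congr_ae (ae_of_all _ fun σ => ?_)
      beta_reduce
      by_cases h : σ ∈ Ioi (0:ℝ)
      · rw [indicator_of_mem h, hG1 _ _ h hr]
      · rw [indicator_of_notMem h, hG0 _ _ fun h' => h h'.1]
    · rw [indicator_of_notMem hr]
      simp only [hG0 _ r fun h' => hr h'.2, integral_zero]
  constructor
  · rw [← integrable_indicator_iff measurableSet_Ioi]
    exact hint2.integral_prod_left.congr (ae_of_all _ e2)
  · rw [← integral_indicator measurableSet_Ioi, ← integral_indicator measurableSet_Ioi,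
      ← integral_congr_ae (ae_of_all _ e2), ← integral_congr_ae (ae_of_all _ e3)]
    rw [← integral_prod _ hint2, e1, integral_prod_symm _ hint]

namespace Pot
variable {l Λ : ℝ} (P : Pot l Λ)

lemma Z_cont2 (f : Cb) : Continuous fun p : ℝ² => P.Z f (p.1, p.2) := (P.Z f).continuous

lemma duh_Z_continuous {X : Type*} [TopologicalSpace X] [FirstCountableTopology X] (f : Cb)
    {τ r t : X → ℝ} (hτ : Continuous τ) (hr : Continuous r) (ht : Continuous t) :
    Continuous fun x => P.duh (fun τ t => P.Z f (τ, t)) (τ x) (r x) (t x) :=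
  P.duh_continuous (P.Z_cont2 f) (P.Z_le f) hτ hr ht

lemma abs_duh_Z_le (f : Cb) (τ r t : ℝ) :
    |P.duh (fun τ t => P.Z f (τ, t)) τ r t| ≤ rexp (-(Λ * r)) * ((Λ - l) * (Λ / l * ‖f‖)) := by
  unfold duh
  rw [abs_mul, abs_exp]
  exact mul_le_mul_of_nonneg_left (Gam_le (P.Wz_le (P.Z_le f _)) t) (exp_pos _).le

lemma Z_level (f : Cb) {r T : ℝ} (hr : 0 ≤ r) (hT : r ≤ T) (t : ℝ) :
    P.Z f (T, t) = rexp (-(Λ * r)) * Gam r (fun x => P.Z f (T - r, x)) t +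
      ∫ ρ in (0:ℝ)..r, P.duh (fun τ t => P.Z f (τ, t)) T ρ t := by
  have hTr : 0 ≤ T - r := sub_nonneg.2 hT
  have hf := f.continuous
  have hfb : ∀ t, |f t| ≤ ‖f‖ := f.norm_coe_le_norm
  have e1 : Gam r (fun x => P.Z f (T - r, x)) t = rexp (-(Λ * (T - r))) * Gam T f t +
      ∫ ρ in (0:ℝ)..(T - r), Gam r (P.duh (fun τ t => P.Z f (τ, t)) (T - r) ρ) t := by
    rw [show (fun x => P.Z f (T - r, x)) = fun x => rexp (-(Λ * (T - r))) * Gam (T - r) f x +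
        ∫ ρ in (0:ℝ)..(T - r), P.duh (fun τ t => P.Z f (τ, t)) (T - r) ρ x from
        funext fun x => P.Z_eq f hTr x]
    rw [Gam_add (M := ‖f‖) (K := (Λ - l) / Λ * (Λ / l * ‖f‖)), Gam_const_mul,
      Gam_Gam hr hTr hf hfb, add_sub_cancel]
    · congr 1
      simp only [integral_of_le hTr]
      exact Gam_setIntegral (P.duh_Z_continuous f continuous_const continuous_fst continuous_snd)
        measurableSet_Ioc (G := fun r => rexp (-(Λ * r)) * ((Λ - l) * (Λ / l * ‖f‖)))
        ((Continuous.intervalIntegrable (by fun_prop) _ _).1)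
        (fun ρ _ x => P.abs_duh_Z_le f _ _ _) t
    · exact continuous_const.mul (continuous_Gam (h := fun _ : ℝ => f) continuous_const
        continuous_id (by fun_prop) fun _ => hfb)
    · exact continuous_parametric_intervalIntegral_of_continuous
        (f := fun (x : ℝ) ρ => P.duh (fun τ t => P.Z f (τ, t)) (T - r) ρ x)
        (P.duh_Z_continuous f (X := ℝ²) continuous_const continuous_snd continuous_fst)
        continuous_const
    · intro x
      rw [abs_mul, abs_exp]
      have h1 : rexp (-(Λ * (T - r))) ≤ 1 := by
        rw [exp_le_one_iff]; have := mul_nonneg P.Lam_pos.le hTr; linarith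
      calc _ ≤ 1 * ‖f‖ := mul_le_mul h1 (Gam_le hfb x) (abs_nonneg _) zero_le_one
        _ = ‖f‖ := one_mul _
    · exact P.abs_duh_int_le hTr (P.Z_le f)
  have e2 : rexp (-(Λ * r)) *
      ∫ ρ in (0:ℝ)..(T - r), Gam r (P.duh (fun τ t => P.Z f (τ, t)) (T - r) ρ) t =
      ∫ ρ in r..T, P.duh (fun τ t => P.Z f (τ, t)) T ρ t := by
    have hs := intervalIntegral.integral_comp_add_right (a := 0) (b := T - r)
      (fun ρ => P.duh (fun τ t => P.Z f (τ, t)) T ρ t) r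
    rw [zero_add, sub_add_cancel] at hs
    rw [← hs, ← intervalIntegral.integral_const_mul]
    refine integral_congr fun ρ hρ => ?_
    rw [uIcc_of_le hTr] at hρ
    simp only [duh]
    have hc : Continuous fun x => P.W x * P.Z f (T - r - ρ, x) :=
      P.W_cont.mul ((P.Z_cont2 f).comp (Continuous.prodMk_right _))
    rw [show P.duh (fun τ t => P.Z f (τ, t)) (T - r) ρ =
      fun t => rexp (-(Λ * ρ)) * (Gam ρ (fun x => P.W x * P.Z f (T - r - ρ, x))) t from rfl,
      Gam_const_mul, Gam_Gam hr hρ.1 hc (P.Wz_le (P.Z_le f _)), ← mul_assoc, ← exp_add,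
      add_comm ρ r, ← sub_sub]
    congr 2; ring
  rw [P.Z_eq f (hr.trans hT), e1, mul_add, e2, ← mul_assoc, ← exp_add]
  have hi : Continuous fun ρ => P.duh (fun τ t => P.Z f (τ, t)) T ρ t :=
    P.duh_Z_continuous f continuous_const continuous_id continuous_const
  rw [← intervalIntegral.integral_add_adjacent_intervals (hi.intervalIntegrable 0 r)
    (hi.intervalIntegrable r T), show -(Λ * r) + -(Λ * (T - r)) = -(Λ * T) by ring]
  ring

end Pot

/-- Bounded `C¹` weights on the half-line. -/
structure Wt (m m' : ℝ → ℝ) (M : ℝ) : Prop where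
  cont : Continuous m
  cont' : Continuous m'
  deriv : ∀ τ, 0 < τ → HasDerivAt m (m' τ) τ
  le : ∀ τ, |m τ| ≤ M
  le' : ∀ τ, |m' τ| ≤ M

lemma Wt.nonneg {m m' : ℝ → ℝ} {M : ℝ} (h : Wt m m' M) : 0 ≤ M := (abs_nonneg _).trans (h.le 0)

lemma integrableOn_exp_neg {c : ℝ} (hc : 0 < c) : IntegrableOn (fun τ => rexp (-(c * τ))) (Ioi 0) := by
  have e := integrableOn_exp_mul_Ioi (a := -c) (by linarith) 0
  simpa only [neg_mul] using e

lemma integral_exp_neg {c : ℝ} (hc : 0 < c) : ∫ τ in Ioi (0:ℝ), rexp (-(c * τ)) = 1 / c := by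
  have e := integral_exp_mul_Ioi (a := -c) (by linarith) 0
  simp only [neg_mul] at e
  rw [e]; simp

namespace Pot
variable {l Λ : ℝ} (P : Pot l Λ)

/-- The exponentially decaying flow. -/
noncomputable def Q (f : Cb) (τ t : ℝ) : ℝ := rexp (-(l * max τ 0)) * P.Z f (τ, t)

lemma Q_of_nonneg (f : Cb) {τ : ℝ} (hτ : 0 ≤ τ) (t : ℝ) :
    P.Q f τ t = rexp (-(l * τ)) * P.Z f (τ, t) := by simp only [Q, max_eq_left hτ]

lemma Q_cont (f : Cb) : Continuous fun p : ℝ² => P.Q f p.1 p.2 := by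
  unfold Q; exact Continuous.mul (by fun_prop) (P.Z_cont2 f)

lemma Q_cont_right (f : Cb) (τ : ℝ) : Continuous (P.Q f τ) :=
  (P.Q_cont f).comp (Continuous.prodMk_right τ)

lemma Q_cont_left (f : Cb) (t : ℝ) : Continuous fun τ => P.Q f τ t :=
  (P.Q_cont f).comp (Continuous.prodMk_left t)

/-- The constant controlling the flow. -/
noncomputable def KK (_P : Pot l Λ) : ℝ := Λ / l

lemma KK_nonneg : 0 ≤ P.KK := div_nonneg P.Lam_pos.le P.l_pos.le

lemma Q_le (f : Cb) {τ : ℝ} (hτ : 0 ≤ τ) (t : ℝ) :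
    |P.Q f τ t| ≤ rexp (-(l * τ)) * (P.KK * ‖f‖) := by
  rw [P.Q_of_nonneg f hτ, abs_mul, abs_exp]
  exact mul_le_mul_of_nonneg_left (P.Z_le f τ t) (exp_pos _).le

lemma Q_le' (f : Cb) (τ t : ℝ) : |P.Q f τ t| ≤ P.KK * ‖f‖ := by
  unfold Q
  rw [abs_mul, abs_exp]
  have h1 : rexp (-(l * max τ 0)) ≤ 1 := by
    rw [exp_le_one_iff]
    have := mul_nonneg P.l_pos.le (le_max_right τ 0); linarith
  calc _ ≤ 1 * (P.KK * ‖f‖) := mul_le_mul h1 (P.Z_le f τ t) (abs_nonneg _) zero_le_one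
    _ = _ := one_mul _

/-- Weighted time integrals of the flow. -/
noncomputable def Phi (m : ℝ → ℝ) (f : Cb) (t : ℝ) : ℝ := ∫ τ in Ioi (0:ℝ), m τ * P.Q f τ t

lemma mQ_le {m : ℝ → ℝ} {M : ℝ} (hb : ∀ τ, |m τ| ≤ M) (f : Cb) {τ : ℝ}
    (hτ : 0 ≤ τ) (t : ℝ) : |m τ * P.Q f τ t| ≤ rexp (-(l * τ)) * (M * (P.KK * ‖f‖)) := by
  rw [abs_mul]
  calc _ ≤ M * (rexp (-(l * τ)) * (P.KK * ‖f‖)) := mul_le_mul (hb τ) (P.Q_le f hτ t) (abs_nonneg _)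
        ((abs_nonneg _).trans (hb 0))
    _ = _ := by ring

lemma integrableOn_mQ {m : ℝ → ℝ} {M : ℝ} (hm : Continuous m) (hb : ∀ τ, |m τ| ≤ M) (f : Cb)
    (t : ℝ) : IntegrableOn (fun τ => m τ * P.Q f τ t) (Ioi 0) := by
  refine Integrable.mono' ((integrableOn_exp_neg P.l_pos).mul_const (M * (P.KK * ‖f‖)))
    (hm.mul (P.Q_cont_left f t)).aestronglyMeasurable ?_
  filter_upwards [ae_restrict_mem measurableSet_Ioi] with τ hτ
  exact P.mQ_le hb f (le_of_lt hτ) t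

lemma Phi_le {m : ℝ → ℝ} {M : ℝ} (hb : ∀ τ, |m τ| ≤ M) (f : Cb)
    (t : ℝ) : |P.Phi m f t| ≤ M * P.KK / l * ‖f‖ := by
  have h := norm_integral_le_of_norm_le ((integrableOn_exp_neg P.l_pos).mul_const (M * (P.KK * ‖f‖)))
    (f := fun τ => m τ * P.Q f τ t) (by
      filter_upwards [ae_restrict_mem measurableSet_Ioi] with τ hτ
      exact P.mQ_le hb f (le_of_lt hτ) t)
  rw [integral_mul_const, integral_exp_neg P.l_pos] at h
  refine h.trans (le_of_eq ?_); ring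

lemma Phi_cont {m : ℝ → ℝ} {M : ℝ} (hm : Continuous m) (hb : ∀ τ, |m τ| ≤ M) (f : Cb) :
    Continuous (P.Phi m f) := by
  refine continuous_of_dominated (bound := fun τ => rexp (-(l * τ)) * (M * (P.KK * ‖f‖))) ?_ ?_
    ((integrableOn_exp_neg P.l_pos).mul_const _) ?_
  · exact fun t => (hm.mul (P.Q_cont_left f t)).aestronglyMeasurable
  · intro t
    filter_upwards [ae_restrict_mem measurableSet_Ioi] with τ hτ
    exact P.mQ_le hb f (le_of_lt hτ) t
  · exact ae_of_all _ fun τ => continuous_const.mul (P.Q_cont_right f τ)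

/-- The shear kernel of the Duhamel expansion. -/
noncomputable def shk (m m' : ℝ → ℝ) (f : Cb) (t σ r : ℝ) : ℝ :=
  rexp (-((Λ + l) * r)) * Gam r (fun x => m' σ * P.Q f σ x + P.W x * (m σ * P.Q f σ x)) t

lemma shk_fun_le {m m' : ℝ → ℝ} {M : ℝ} (h : Wt m m' M) (f : Cb) (σ x : ℝ) :
    |m' σ * P.Q f σ x + P.W x * (m σ * P.Q f σ x)| ≤ (1 + (Λ - l)) * (M * (P.KK * ‖f‖)) := by
  have hM := h.nonneg
  have h1 : |m' σ * P.Q f σ x| ≤ M * (P.KK * ‖f‖) := by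
    rw [abs_mul]; exact mul_le_mul (h.le' σ) (P.Q_le' f σ x) (abs_nonneg _) hM
  have h2 : |m σ * P.Q f σ x| ≤ M * (P.KK * ‖f‖) := by
    rw [abs_mul]; exact mul_le_mul (h.le σ) (P.Q_le' f σ x) (abs_nonneg _) hM
  have h3 : |P.W x * (m σ * P.Q f σ x)| ≤ (Λ - l) * (M * (P.KK * ‖f‖)) := by
    rw [abs_mul]; exact mul_le_mul (P.W_le x) h2 (abs_nonneg _) (sub_nonneg.2 P.l_le)
  calc _ ≤ _ := abs_add_le _ _
    _ ≤ M * (P.KK * ‖f‖) + (Λ - l) * (M * (P.KK * ‖f‖)) := add_le_add h1 h3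
    _ = _ := by ring

lemma shk_fun_le' {m m' : ℝ → ℝ} {M : ℝ} (h : Wt m m' M) (f : Cb) {σ : ℝ} (hσ : 0 ≤ σ) (x : ℝ) :
    |m' σ * P.Q f σ x + P.W x * (m σ * P.Q f σ x)| ≤
      rexp (-(l * σ)) * ((1 + (Λ - l)) * (M * (P.KK * ‖f‖))) := by
  have h3 : |P.W x * (m σ * P.Q f σ x)| ≤ (Λ - l) * (rexp (-(l * σ)) * (M * (P.KK * ‖f‖))) := by
    rw [abs_mul]; exact mul_le_mul (P.W_le x) (P.mQ_le h.le f hσ x) (abs_nonneg _)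
      (sub_nonneg.2 P.l_le)
  calc _ ≤ _ := abs_add_le _ _
    _ ≤ _ := add_le_add (P.mQ_le h.le' f hσ x) h3
    _ = _ := by ring

lemma shk_fun_cont {m m' : ℝ → ℝ} {M : ℝ} (h : Wt m m' M) (f : Cb) :
    Continuous fun p : ℝ² => m' p.1 * P.Q f p.1 p.2 + P.W p.2 * (m p.1 * P.Q f p.1 p.2) :=
  ((h.cont'.comp continuous_fst).mul (P.Q_cont f)).add
    ((P.W_cont.comp continuous_snd).mul ((h.cont.comp continuous_fst).mul (P.Q_cont f)))

lemma shk_cont {m m' : ℝ → ℝ} {M : ℝ} (h : Wt m m' M) (f : Cb) (t : ℝ) :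
    Continuous fun p : ℝ² => P.shk m m' f t p.1 p.2 := by
  unfold shk
  refine Continuous.mul (by fun_prop) (continuous_Gam (r := fun p : ℝ² => p.2)
    (t := fun _ : ℝ² => t)
    (h := fun (p : ℝ²) x => m' p.1 * P.Q f p.1 x + P.W x * (m p.1 * P.Q f p.1 x))
    continuous_snd continuous_const ?_ fun p x => P.shk_fun_le h f p.1 x)
  exact (P.shk_fun_cont h f).comp (f := fun q : ℝ² × ℝ => (q.1.1, q.2)) (by fun_prop)

lemma Q_expand {m m' : ℝ → ℝ} {M : ℝ} (h : Wt m m' M) (f : Cb) {T : ℝ} (hT : 0 ≤ T) (t : ℝ) :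
    m T * P.Q f T t = m 0 * (rexp (-((Λ + l) * T)) * Gam T f t) +
      ∫ r in (0:ℝ)..T, P.shk m m' f t (T - r) r := by
  set k : ℝ → ℝ := fun ρ => rexp (-(l * T)) * P.duh (fun τ t => P.Z f (τ, t)) T ρ t with hk
  have kc : Continuous k := continuous_const.mul
    (P.duh_Z_continuous f continuous_const continuous_id continuous_const)
  set G : ℝ → ℝ := fun r => P.Q f T t - ∫ ρ in (0:ℝ)..r, k ρ with hG
  have hGd : ∀ r, HasDerivAt G (-k r) r := fun r =>
    (integral_hasDerivAt_right (kc.intervalIntegrable _ _)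
      (kc.stronglyMeasurableAtFilter _ _) kc.continuousAt).const_sub _
  have hGe : ∀ r ∈ Icc 0 T, G r = rexp (-(l * T)) * (rexp (-(Λ * r)) *
      Gam r (fun x => P.Z f (T - r, x)) t) := by
    intro r hr
    simp only [hG, hk]
    rw [P.Q_of_nonneg f hT, intervalIntegral.integral_const_mul, P.Z_level f hr.1 hr.2 t]
    ring
  have hd : ∀ r ∈ Ioo 0 T, HasDerivAt (fun r => m (T - r) * G r)
      (-(m' (T - r)) * G r + m (T - r) * -k r) r := by
    intro r hr
    have h1 : HasDerivAt (fun r => m (T - r)) (m' (T - r) * -1) r :=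
      (h.deriv (T - r) (sub_pos.2 hr.2)).comp r ((hasDerivAt_id' r).const_sub T)
    exact (h1.fun_mul (hGd r)).congr_deriv (by ring)
  have hGc : Continuous G := continuous_iff_continuousAt.2 fun r => (hGd r).continuousAt
  have hmc : Continuous fun r => m (T - r) := h.cont.comp (by fun_prop)
  have hmc' : Continuous fun r => m' (T - r) := h.cont'.comp (by fun_prop)
  have key := intervalIntegral.integral_eq_sub_of_hasDerivAt_of_le hT
    (f := fun r => m (T - r) * G r) (hmc.mul hGc).continuousOn hd
    ((hmc'.neg.mul hGc).add (hmc.mul kc.neg) |>.intervalIntegrable _ _)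
  have e : ∫ r in (0:ℝ)..T, P.shk m m' f t (T - r) r =
      -∫ r in (0:ℝ)..T, (-(m' (T - r)) * G r + m (T - r) * -k r) := by
    rw [← intervalIntegral.integral_neg]
    refine integral_congr fun r hr => ?_
    rw [uIcc_of_le hT] at hr
    have hTr : 0 ≤ T - r := sub_nonneg.2 hr.2
    have hZ : Continuous fun x => P.Z f (T - r, x) := (P.Z_cont2 f).comp (Continuous.prodMk_right _)
    have hf1 : (fun x => m' (T - r) * P.Q f (T - r) x + P.W x * (m (T - r) * P.Q f (T - r) x)) =
        fun x => (m' (T - r) * rexp (-(l * (T - r)))) * P.Z f (T - r, x) +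
          (m (T - r) * rexp (-(l * (T - r)))) * (P.W x * P.Z f (T - r, x)) := by
      funext x; rw [P.Q_of_nonneg f hTr]; ring
    have hb1 := P.Z_le f (T - r)
    have hb2 := P.Wz_le hb1
    have hexp : rexp (-(l * T)) * rexp (-(Λ * r)) =
        rexp (-((Λ + l) * r)) * rexp (-(l * (T - r))) := by
      rw [← exp_add, ← exp_add]; congr 1; ring
    simp only [shk, hf1]
    rw [Gam_add (f := fun x => m' (T - r) * rexp (-(l * (T - r))) * P.Z f (T - r, x))
      (g := fun x => m (T - r) * rexp (-(l * (T - r))) * (P.W x * P.Z f (T - r, x)))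
      (continuous_const.mul hZ) (continuous_const.mul (P.W_cont.mul hZ))
      (M := |m' (T - r) * rexp (-(l * (T - r)))| * (Λ / l * ‖f‖))
      (K := |m (T - r) * rexp (-(l * (T - r)))| * ((Λ - l) * (Λ / l * ‖f‖)))
      (fun x => by rw [abs_mul _ (P.Z f _)]; exact mul_le_mul_of_nonneg_left (hb1 x) (abs_nonneg _))
      (fun x => by
        rw [abs_mul _ (P.W x * _)]; exact mul_le_mul_of_nonneg_left (hb2 x) (abs_nonneg _)),
      Gam_const_mul, Gam_const_mul, hGe r hr]
    simp only [hk, duh]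
    rw [← mul_assoc (rexp (-(l * T))) (rexp (-(Λ * r))), ← mul_assoc (rexp (-(l * T))) (rexp (-(Λ * r))),
      hexp]
    ring
  rw [e, key]
  simp only [sub_self, sub_zero]
  rw [hGe T ⟨hT, le_rfl⟩, hGe 0 ⟨le_rfl, hT⟩, P.Q_of_nonneg f hT]
  simp only [sub_self, sub_zero, Gam_zero, P.Z_zero]
  have hexp : rexp (-((Λ + l) * T)) = rexp (-(l * T)) * rexp (-(Λ * T)) := by
    rw [← exp_add]; congr 1; ring
  rw [hexp]
  simp only [mul_zero, neg_zero, exp_zero]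
  rw [show Gam T (fun x => f x) t = Gam T f t from rfl]
  ring

/-- The source of the resolvent equation satisfied by `Phi`. -/
noncomputable def src (m m' : ℝ → ℝ) (f : Cb) (x : ℝ) : ℝ :=
  m 0 * f x + (P.Phi m' f x + P.W x * P.Phi m f x)

lemma src_cont {m m' : ℝ → ℝ} {M : ℝ} (h : Wt m m' M) (f : Cb) : Continuous (P.src m m' f) :=
  (continuous_const.mul f.continuous).add ((P.Phi_cont h.cont' h.le' f).add
    (P.W_cont.mul (P.Phi_cont h.cont h.le f)))

lemma src_le' {m m' : ℝ → ℝ} {M : ℝ} (h : Wt m m' M) (f : Cb) (x : ℝ) :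
    |P.Phi m' f x + P.W x * P.Phi m f x| ≤ (1 + (Λ - l)) * (M * P.KK / l * ‖f‖) := by
  have h3 : |P.W x * P.Phi m f x| ≤ (Λ - l) * (M * P.KK / l * ‖f‖) :=
    P.Wz_le (P.Phi_le h.le f) x
  calc _ ≤ _ := abs_add_le _ _
    _ ≤ _ := add_le_add (P.Phi_le h.le' f x) h3
    _ = _ := by ring

lemma src_le {m m' : ℝ → ℝ} {M : ℝ} (h : Wt m m' M) (f : Cb) (x : ℝ) :
    |P.src m m' f x| ≤ M * ‖f‖ + (1 + (Λ - l)) * (M * P.KK / l * ‖f‖) := by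
  refine (abs_add_le _ _).trans (add_le_add ?_ (P.src_le' h f x))
  rw [abs_mul]
  exact mul_le_mul (h.le 0) (f.norm_coe_le_norm x) (abs_nonneg _) h.nonneg

lemma Phi_eq_Res {m m' : ℝ → ℝ} {M : ℝ} (h : Wt m m' M) (f : Cb) (t : ℝ) :
    P.Phi m f t = Res (Λ + l) (P.src m m' f) t := by
  have hC : 0 < Λ + l := add_pos P.Lam_pos P.l_pos
  set B := (1 + (Λ - l)) * (M * (P.KK * ‖f‖)) with hB
  have hB0 : 0 ≤ B := (abs_nonneg _).trans (P.shk_fun_le h f 0 0)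
  have hsh := integral_shear (c := l) (K := B) P.l_pos (P.shk_cont h f t) (by
    intro σ r hσ hr
    unfold shk
    rw [abs_mul, abs_exp]
    have h1 : rexp (-((Λ + l) * r)) ≤ rexp (-(l * r)) := by
      have := mul_nonneg P.Lam_pos.le hr
      exact exp_le_exp.2 (by linarith)
    calc _ ≤ rexp (-(l * r)) * (rexp (-(l * σ)) * B) := mul_le_mul h1
          (Gam_le (P.shk_fun_le' h f hσ) t) (abs_nonneg _) (exp_pos _).le
      _ = _ := by ring)
  have hi1 : IntegrableOn (fun T => m 0 * (rexp (-((Λ + l) * T)) * Gam T f t)) (Ioi 0) := by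
    refine Integrable.const_mul ?_ _
    refine Integrable.mul_bdd (c := ‖f‖) (integrableOn_exp_neg hC) ?_
      (ae_of_all _ fun T => Gam_le f.norm_coe_le_norm t)
    exact (continuous_Gam (h := fun _ : ℝ => f) continuous_id continuous_const
      (by fun_prop) fun _ => f.norm_coe_le_norm).aestronglyMeasurable
  have e1 : P.Phi m f t = ∫ T in Ioi (0:ℝ), (m 0 * (rexp (-((Λ + l) * T)) * Gam T f t) +
      ∫ r in (0:ℝ)..T, P.shk m m' f t (T - r) r) :=
    setIntegral_congr_fun measurableSet_Ioi fun T hT => P.Q_expand h f (le_of_lt hT) t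
  rw [e1, integral_add hi1 hsh.1, hsh.2]
  have e2 : ∀ r, ∫ σ in Ioi (0:ℝ), P.shk m m' f t σ r = rexp (-((Λ + l) * r)) *
      Gam r (fun x => P.Phi m' f x + P.W x * P.Phi m f x) t := by
    intro r
    simp only [shk]
    rw [integral_const_mul]
    congr 1
    rw [← Gam_setIntegral (P.shk_fun_cont h f) measurableSet_Ioi
      ((integrableOn_exp_neg P.l_pos).mul_const B) (fun ρ hρ x => P.shk_fun_le' h f (le_of_lt hρ) x)]
    congr 1
    funext x
    rw [integral_add (P.integrableOn_mQ h.cont' h.le' f x)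
      ((P.integrableOn_mQ h.cont h.le f x).const_mul _), integral_const_mul]
    rfl
  have hc : Continuous fun x => P.Phi m' f x + P.W x * P.Phi m f x :=
    (P.Phi_cont h.cont' h.le' f).add (P.W_cont.mul (P.Phi_cont h.cont h.le f))
  have hi2 : IntegrableOn (fun r => rexp (-((Λ + l) * r)) *
      Gam r (fun x => P.Phi m' f x + P.W x * P.Phi m f x) t) (Ioi 0) := by
    refine Integrable.mul_bdd (c := (1 + (Λ - l)) * (M * P.KK / l * ‖f‖)) (integrableOn_exp_neg hC) ?_
      (ae_of_all _ fun T => Gam_le (P.src_le' h f) t)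
    exact (continuous_Gam (h := fun (_ : ℝ) x => P.Phi m' f x + P.W x * P.Phi m f x) continuous_id
      continuous_const (hc.comp continuous_snd) fun _ => P.src_le' h f).aestronglyMeasurable
  simp only [e2]
  rw [← integral_add hi1 hi2]
  unfold Res
  refine integral_congr_ae (ae_of_all _ fun r => ?_)
  unfold src
  beta_reduce
  rw [Gam_add (f := fun x => m 0 * f x) (M := |m 0| * ‖f‖) (continuous_const.mul f.continuous) hc (fun x => by
    rw [abs_mul]; exact mul_le_mul_of_nonneg_left (f.norm_coe_le_norm x) (abs_nonneg _))
    (P.src_le' h f), Gam_const_mul]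
  rw [show Gam r (fun x => f x) t = Gam r f t from rfl]
  ring

/-- The derivative of `Phi`. -/
noncomputable def Phi' (m m' : ℝ → ℝ) (f : Cb) : ℝ → ℝ := Res' (Λ + l) (P.src m m' f)

lemma hasDerivAt_Phi {m m' : ℝ → ℝ} {M : ℝ} (h : Wt m m' M) (f : Cb) (t : ℝ) :
    HasDerivAt (P.Phi m f) (P.Phi' m m' f t) t ∧
    HasDerivAt (P.Phi' m m' f) (P.V t * P.Phi m f t - m 0 * f t - P.Phi m' f t) t := by
  have hC : 0 < Λ + l := add_pos P.Lam_pos P.l_pos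
  have hR := hasDerivAt_Res hC (P.src_cont h f) (P.src_le h f) t
  have e : P.Phi m f = Res (Λ + l) (P.src m m' f) := funext fun t => P.Phi_eq_Res h f t
  refine ⟨by rw [e]; exact hR.1, hR.2.congr_deriv ?_⟩
  rw [← e]; unfold src W; ring

end Pot

lemma Gam_reflect (r c : ℝ) (f : ℝ → ℝ) (t : ℝ) : Gam r (fun x => f (c - x)) t = Gam r f (c - t) := by
  unfold Gam
  have h := gaussianReal_map_neg (μ := 0) (v := 1)
  rw [neg_zero] at h
  have e := (Homeomorph.neg ℝ).measurableEmbedding.integral_map (μ := γ)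
    (fun x => f (c - (t + √(2 * r) * x)))
  have h' : Measure.map (⇑(Homeomorph.neg ℝ)) γ = γ := h
  rw [h'] at e
  rw [e]
  refine integral_congr_ae (ae_of_all _ fun x => ?_)
  simp only [Homeomorph.coe_neg]
  congr 1; ring

namespace Pot
variable {l Λ : ℝ} (P : Pot l Λ)

lemma duhMap_apply (f : Cb) (z : ℝ² →ᵇ ℝ) (p : ℝ²) : P.duhMap f z p =
    rexp (-(Λ * max p.1 0)) * Gam (max p.1 0) f p.2 +
      ∫ r in (0:ℝ)..max p.1 0, P.duh (fun τ t => z (τ, t)) (max p.1 0) r p.2 := rfl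

lemma duh_z_continuous {X : Type*} [TopologicalSpace X] [FirstCountableTopology X]
    (z : ℝ² →ᵇ ℝ)
    {τ r t : X → ℝ} (hτ : Continuous τ) (hr : Continuous r) (ht : Continuous t) :
    Continuous fun x => P.duh (fun τ t => z (τ, t)) (τ x) (r x) (t x) :=
  P.duh_continuous (M := ‖z‖) z.continuous (fun _ _ => z.norm_coe_le_norm _) hτ hr ht

lemma duh_lin (c : ℝ) (z w : ℝ² →ᵇ ℝ) (τ r t : ℝ) :
    P.duh (fun τ t => (c • z + w) (τ, t)) τ r t =
      c * P.duh (fun τ t => z (τ, t)) τ r t + P.duh (fun τ t => w (τ, t)) τ r t := by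
  have hz : ∀ z : ℝ² →ᵇ ℝ, Continuous fun x => P.W x * z (τ - r, x) := fun z =>
    P.W_cont.mul (z.continuous.comp (Continuous.prodMk_right _))
  have hb : ∀ (z : ℝ² →ᵇ ℝ) x, |P.W x * z (τ - r, x)| ≤ (Λ - l) * ‖z‖ := fun z =>
    P.Wz_le fun t => z.norm_coe_le_norm _
  simp only [duh]
  rw [show (fun x => P.W x * (c • z + w) (τ - r, x)) =
      fun x => c * (P.W x * z (τ - r, x)) + P.W x * w (τ - r, x) by
        funext x
        simp only [coe_add, coe_smul,
          Pi.add_apply, smul_eq_mul]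
        ring]
  rw [Gam_add (f := fun x => c * (P.W x * z (τ - r, x))) (M := |c| * ((Λ - l) * ‖z‖))
    (continuous_const.mul (hz z)) (hz w) (fun x => by
      rw [abs_mul]; exact mul_le_mul_of_nonneg_left (hb z x) (abs_nonneg _)) (hb w), Gam_const_mul]
  ring

lemma Z_lin (c : ℝ) (f g : Cb) : P.Z (c • f + g) = c • P.Z f + P.Z g := by
  refine (P.Z_unique ?_).symm
  ext p
  rw [duhMap_apply]
  simp only [P.duh_lin]
  have hi : ∀ z : ℝ² →ᵇ ℝ, IntervalIntegrable
      (fun r => P.duh (fun τ t => z (τ, t)) (max p.1 0) r p.2) volume 0 (max p.1 0) := fun z =>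
    (P.duh_z_continuous z continuous_const continuous_id continuous_const).intervalIntegrable _ _
  rw [intervalIntegral.integral_add ((hi _).const_mul c) (hi _),
    intervalIntegral.integral_const_mul]
  have h1 := congrArg (fun z : ℝ² →ᵇ ℝ => z p) (P.duhMap_Z f)
  have h2 := congrArg (fun z : ℝ² →ᵇ ℝ => z p) (P.duhMap_Z g)
  simp only [duhMap_apply] at h1 h2
  have e : Gam (max p.1 0) (⇑(c • f + g)) p.2 = c * Gam (max p.1 0) f p.2 + Gam (max p.1 0) g p.2 := by
    rw [← Gam_const_mul, ← Gam_add (f := fun x => c * f x) (M := |c| * ‖f‖)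
      (continuous_const.mul f.continuous) g.continuous (fun x => by
      rw [abs_mul]; exact mul_le_mul_of_nonneg_left (f.norm_coe_le_norm x) (abs_nonneg _))
      g.norm_coe_le_norm]
    rfl
  rw [e]
  simp only [coe_add, coe_smul,
          Pi.add_apply, smul_eq_mul]
  linear_combination c * h1 + h2

lemma Z_odd {c : ℝ} (hV : ∀ t, P.V (c - t) = P.V t) {f : Cb} (hf : ∀ t, f (c - t) = -f t)
    (τ t : ℝ) : P.Z f (τ, c - t) = -P.Z f (τ, t) := by
  set w : ℝ² →ᵇ ℝ := ofNormedAddCommGroup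
    (fun p => -P.Z f (p.1, c - p.2)) ((P.Z f).continuous.comp (f := fun p : ℝ² => (p.1, c - p.2))
      (by fun_prop)).neg ‖P.Z f‖ (fun p => by rw [norm_neg]; exact (P.Z f).norm_coe_le_norm _) with hw
  have hwe : ∀ τ t, w (τ, t) = -P.Z f (τ, c - t) := fun _ _ => rfl
  have h : w = P.Z f := by
    refine P.Z_unique ?_
    ext p
    have h1 := congrArg (fun z : ℝ² →ᵇ ℝ => z (p.1, c - p.2)) (P.duhMap_Z f)
    simp only [duhMap_apply] at h1
    rw [show w p = w (p.1, p.2) from rfl, hwe, ← h1, duhMap_apply, ← Gam_reflect]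
    have e1 : Gam (max p.1 0) (fun x => f (c - x)) p.2 = -Gam (max p.1 0) f p.2 := by
      rw [show (fun x => f (c - x)) = fun x => (-1) * f x by funext x; rw [hf]; ring, Gam_const_mul]
      rw [show Gam (max p.1 0) (fun x => f x) p.2 = Gam (max p.1 0) f p.2 from rfl]; ring
    have e2 : ∀ r, P.duh (fun τ t => P.Z f (τ, t)) (max p.1 0) r (c - p.2) =
        -P.duh (fun τ t => w (τ, t)) (max p.1 0) r p.2 := by
      intro r
      simp only [duh, hwe]
      rw [← Gam_reflect, show (fun x => P.W x * -P.Z f (max p.1 0 - r, c - x)) =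
        fun x => (-1) * (P.W (c - x) * P.Z f (max p.1 0 - r, c - x)) by
          funext x; simp only [W, hV]; ring, Gam_const_mul]
      ring
    simp only [e1, e2, intervalIntegral.integral_neg]
    ring
  have := hwe τ t
  rw [h] at this
  linarith

end Pot

lemma tendsto_Gam {r : ℝ} {g : ℕ → ℝ → ℝ} {g₀ : ℝ → ℝ} {M : ℝ} (hg : ∀ k, Continuous (g k))
    (hb : ∀ k t, |g k t| ≤ M) (hl : ∀ t, Tendsto (fun k => g k t) atTop (𝓝 (g₀ t))) (t : ℝ) :
    Tendsto (fun k => Gam r (g k) t) atTop (𝓝 (Gam r g₀ t)) :=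
  tendsto_integral_of_dominated_convergence (fun _ => M)
    (fun k => ((hg k).comp (by fun_prop)).aestronglyMeasurable) (integrable_const _)
    (fun k => ae_of_all _ fun x => hb k _) (ae_of_all _ fun x => hl _)

namespace Pot
variable {l Λ : ℝ} (P : Pot l Λ)

lemma theta_nonneg {l Λ : ℝ} (P : Pot l Λ) : 0 ≤ (Λ - l) / Λ :=
  div_nonneg (sub_nonneg.2 P.l_le) P.Lam_pos.le

lemma theta_lt_one {l Λ : ℝ} (P : Pot l Λ) : (Λ - l) / Λ < 1 := by
  rw [div_lt_one P.Lam_pos]; linarith [P.l_pos]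

lemma dist_iterate_Z (f : Cb) (j : ℕ) :
    dist ((P.duhMap f)^[j] 0) (P.Z f) ≤ ((Λ - l) / Λ) ^ j * (P.KK * ‖f‖) := by
  induction j with
  | zero => simpa [KK] using P.Z_norm_le f
  | succ j ih =>
    rw [Function.iterate_succ_apply']
    conv_lhs => rw [← P.duhMap_Z f]
    calc _ ≤ _ := P.duhMap_sub_le f _ _
      _ ≤ (Λ - l) / Λ * (((Λ - l) / Λ) ^ j * (P.KK * ‖f‖)) :=
        mul_le_mul_of_nonneg_left ih P.theta_nonneg
      _ = _ := by ring

lemma tendsto_duhMap {Pk : ℕ → Pot l Λ} {fk : ℕ → Cb} {f : Cb} {M M' : ℝ}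
    (hV : ∀ t, Tendsto (fun k => (Pk k).V t) atTop (𝓝 (P.V t)))
    (hf : ∀ t, Tendsto (fun k => fk k t) atTop (𝓝 (f t))) (hM : ∀ k, ‖fk k‖ ≤ M)
    {zk : ℕ → ℝ² →ᵇ ℝ} {z : ℝ² →ᵇ ℝ} (hz : ∀ p, Tendsto (fun k => zk k p) atTop (𝓝 (z p)))
    (hM' : ∀ k, ‖zk k‖ ≤ M') (p : ℝ²) :
    Tendsto (fun k => (Pk k).duhMap (fk k) (zk k) p) atTop (𝓝 (P.duhMap f z p)) := by
  simp only [duhMap_apply]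
  refine Tendsto.add (Tendsto.const_mul _ (tendsto_Gam (fun k => (fk k).continuous)
    (fun k t => ((fk k).norm_coe_le_norm t).trans (hM k)) hf _)) ?_
  have hW : ∀ k r x, |(Pk k).W x * zk k (r, x)| ≤ (Λ - l) * M' := fun k r =>
    (Pk k).Wz_le fun t => ((zk k).norm_coe_le_norm _).trans (hM' k)
  refine intervalIntegral.tendsto_integral_filter_of_dominated_convergence
    (fun _ => (Λ - l) * M') (Eventually.of_forall fun k =>
      ((Pk k).duh_z_continuous (zk k) continuous_const continuous_id
        continuous_const).aestronglyMeasurable)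
    (Eventually.of_forall fun k => ae_of_all _ fun r hr => ?_) intervalIntegrable_const
    (ae_of_all _ fun r hr => ?_)
  · rw [uIoc_of_le (le_max_right _ _)] at hr
    rw [duh, norm_mul, norm_eq_abs, abs_exp]
    have h1 : rexp (-(Λ * r)) ≤ 1 := by
      rw [exp_le_one_iff]
      have := mul_nonneg P.Lam_pos.le hr.1.le; linarith
    calc _ ≤ 1 * ((Λ - l) * M') := mul_le_mul h1 (Gam_le (hW k _) _) (abs_nonneg _) zero_le_one
      _ = _ := one_mul _
  · refine Tendsto.const_mul _ (tendsto_Gam (fun k => (Pk k).W_cont.mul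
      ((zk k).continuous.comp (Continuous.prodMk_right _))) (fun k => hW k _) (fun x => ?_) _)
    exact ((hV x).const_sub _).mul (hz _)

/-- The flow depends continuously, pointwise, on potential and data. -/
lemma tendsto_Z {Pk : ℕ → Pot l Λ} {fk : ℕ → Cb} {f : Cb} {M : ℝ}
    (hV : ∀ t, Tendsto (fun k => (Pk k).V t) atTop (𝓝 (P.V t)))
    (hf : ∀ t, Tendsto (fun k => fk k t) atTop (𝓝 (f t))) (hM : ∀ k, ‖fk k‖ ≤ M) (p : ℝ²) :
    Tendsto (fun k => (Pk k).Z (fk k) p) atTop (𝓝 (P.Z f p)) := by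
  have hK := P.KK_nonneg
  have hM0 : 0 ≤ M := (norm_nonneg _).trans (hM 0)
  have hfM : ‖f‖ ≤ M := by
    rw [norm_le hM0]
    exact fun t => le_of_tendsto (hf t).norm (Eventually.of_forall fun k =>
      ((fk k).norm_coe_le_norm t).trans (hM k))
  have hd : ∀ (P : Pot l Λ) (f : Cb), ‖f‖ ≤ M → ∀ j,
      dist ((P.duhMap f)^[j] 0) (P.Z f) ≤ ((Λ - l) / Λ) ^ j * (P.KK * M) := fun P f hf j =>
    (P.dist_iterate_Z f j).trans (by
      have := P.theta_nonneg; have := P.KK_nonneg; gcongr)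
  have hit : ∀ j p, Tendsto (fun k => ((Pk k).duhMap (fk k))^[j] 0 p) atTop
      (𝓝 ((P.duhMap f)^[j] 0 p)) := by
    intro j
    induction j with
    | zero => intro p; simp
    | succ j ih =>
      intro p
      simp only [Function.iterate_succ_apply']
      refine P.tendsto_duhMap hV hf hM ih (M' := 2 * (P.KK * M)) (fun k => ?_) p
      have h1 := hd (Pk k) (fk k) (hM k) j
      rw [dist_eq_norm] at h1
      have h2 := ((Pk k).Z_norm_le (fk k)).trans (mul_le_mul_of_nonneg_left (hM k) hK)
      have h3 : ((Λ - l) / Λ) ^ j * (P.KK * M) ≤ P.KK * M :=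
        mul_le_of_le_one_left (by positivity) (pow_le_one₀ P.theta_nonneg P.theta_lt_one.le)
      calc _ = ‖(((Pk k).duhMap (fk k))^[j] 0 - (Pk k).Z (fk k)) + (Pk k).Z (fk k)‖ := by
            rw [sub_add_cancel]
        _ ≤ _ := norm_add_le _ _
        _ ≤ 2 * (P.KK * M) := by
          have h2' : ‖(Pk k).Z (fk k)‖ ≤ P.KK * M := h2
          have h1' : ‖((Pk k).duhMap (fk k))^[j] 0 - (Pk k).Z (fk k)‖ ≤ P.KK * M := h1.trans h3
          linarith
  rw [Metric.tendsto_atTop]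
  intro ε hε
  have h0 : Tendsto (fun j => ((Λ - l) / Λ) ^ j * (P.KK * M)) atTop (𝓝 0) := by
    simpa using (tendsto_pow_atTop_nhds_zero_of_lt_one P.theta_nonneg P.theta_lt_one).mul_const
      (P.KK * M)
  obtain ⟨j, hj⟩ := (h0.eventually (gt_mem_nhds (show (0:ℝ) < ε / 3 by positivity))).exists
  obtain ⟨N, hN⟩ := Metric.tendsto_atTop.1 (hit j p) (ε / 3) (by positivity)
  refine ⟨N, fun k hk => ?_⟩
  have a1 := (dist_coe_le_dist p).trans (hd (Pk k) (fk k) (hM k) j)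
  have a2 := (dist_coe_le_dist p).trans (hd P f hfM j)
  have a3 := hN k hk
  have hj' : ((Λ - l) / Λ) ^ j * ((Pk k).KK * M) < ε / 3 := hj
  rw [dist_comm] at a1
  calc _ ≤ _ := dist_triangle4 _ _ _ _
    _ < ε := by linarith

/-- The `t`-derivative of the Duhamel term. -/
noncomputable def D' (f : Cb) (τ t : ℝ) : ℝ :=
  ∫ r in (0:ℝ)..τ, rexp (-(Λ * r)) * Gam' r (fun x => P.W x * P.Z f (τ - r, x)) t

/-- The constant bounding `D'`. -/
noncomputable def CD (P : Pot l Λ) : ℝ :=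
  2 * mom * ((Λ - l) * P.KK) * ∫ r in Ioi (0:ℝ), rexp (-(Λ * r)) * r ^ (-(1 / 2) : ℝ)

lemma integrableOn_exp_rpow {c p : ℝ} (hc : 0 < c) (hp : -1 < p) :
    IntegrableOn (fun r => rexp (-(c * r)) * r ^ p) (Ioi 0) := by
  have := integrableOn_rpow_mul_exp_neg_mul_rpow (s := p) (p := 1) hp one_pos hc
  refine this.congr_fun (fun x hx => ?_) measurableSet_Ioi
  simp only [rpow_one]; rw [mul_comm]; congr 2; ring

lemma CD_nonneg : 0 ≤ P.CD := by
  unfold CD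
  have h1 := mom_nonneg
  have h2 := P.KK_nonneg
  have h3 := sub_nonneg.2 P.l_le
  have : 0 ≤ ∫ r in Ioi (0:ℝ), rexp (-(Λ * r)) * r ^ (-(1 / 2) : ℝ) :=
    setIntegral_nonneg measurableSet_Ioi fun r (hr : 0 < r) => by positivity
  positivity

lemma WZ_cont (f : Cb) (τ : ℝ) : Continuous fun p : ℝ² => P.W p.2 * P.Z f (τ - p.1, p.2) :=
  (P.W_cont.comp continuous_snd).mul
    ((P.Z f).continuous.comp (f := fun p : ℝ² => (τ - p.1, p.2)) (by fun_prop))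

lemma WZ_cont_right (f : Cb) (τ : ℝ) : Continuous fun x => P.W x * P.Z f (τ, x) :=
  P.W_cont.mul ((P.Z f).continuous.comp (Continuous.prodMk_right τ))

lemma WZ_le (f : Cb) (τ x : ℝ) : |P.W x * P.Z f (τ, x)| ≤ (Λ - l) * (P.KK * ‖f‖) :=
  P.Wz_le (fun t => P.Z_le f τ t) x

lemma duh'_le (f : Cb) (τ : ℝ) {r : ℝ} (hr : 0 < r) (t : ℝ) :
    |rexp (-(Λ * r)) * Gam' r (fun x => P.W x * P.Z f (τ - r, x)) t| ≤
      2 * mom * ((Λ - l) * (P.KK * ‖f‖)) * (rexp (-(Λ * r)) * r ^ (-(1 / 2) : ℝ)) := by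
  rw [abs_mul, abs_exp]
  calc _ ≤ rexp (-(Λ * r)) * (2 * mom * ((Λ - l) * (P.KK * ‖f‖)) * r ^ (-(1 / 2) : ℝ)) := by
        gcongr
        exact Gam'_le_bdd hr (P.WZ_cont_right f _) (P.WZ_le f _) t
    _ = _ := by ring

lemma duh'_meas (f : Cb) (τ t : ℝ) : AEStronglyMeasurable
    (fun r => rexp (-(Λ * r)) * Gam' r (fun x => P.W x * P.Z f (τ - r, x)) t)
    (volume.restrict (Ioc 0 τ)) := by
  have h := continuousOn_Gam' (X := ℝ) (r := fun r => r) (t := fun _ => t)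
    (h := fun r x => P.W x * P.Z f (τ - r, x)) continuous_id continuous_const (P.WZ_cont f τ)
    (fun r => P.WZ_le f _)
  refine ContinuousOn.aestronglyMeasurable (ContinuousOn.mul (by fun_prop) (h.mono ?_))
    measurableSet_Ioc
  exact fun r hr => hr.1

lemma duh'_int (f : Cb) {τ : ℝ} (hτ : 0 ≤ τ) : IntervalIntegrable
    (fun r => 2 * mom * ((Λ - l) * (P.KK * ‖f‖)) * (rexp (-(Λ * r)) * r ^ (-(1 / 2) : ℝ)))
    volume 0 τ := by
  rw [intervalIntegrable_iff_integrableOn_Ioc_of_le hτ]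
  exact (((integrableOn_exp_rpow P.Lam_pos (by norm_num)).mono_set
    Ioc_subset_Ioi_self).const_mul _)

lemma D'_le (f : Cb) {τ : ℝ} (hτ : 0 ≤ τ) (t : ℝ) : |P.D' f τ t| ≤ P.CD * ‖f‖ := by
  have h3 := sub_nonneg.2 P.l_le
  have h1 := mom_nonneg
  have h2 := P.KK_nonneg
  have h := intervalIntegral.norm_integral_le_of_norm_le (μ := volume) hτ
    (f := fun r => rexp (-(Λ * r)) * Gam' r (fun x => P.W x * P.Z f (τ - r, x)) t)
    (ae_of_all _ fun r hr => P.duh'_le f τ hr.1 t) (P.duh'_int f hτ)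
  refine h.trans ?_
  rw [intervalIntegral.integral_const_mul, integral_of_le hτ]
  have : ∫ r in Ioc (0:ℝ) τ, rexp (-(Λ * r)) * r ^ (-(1 / 2) : ℝ) ≤
      ∫ r in Ioi (0:ℝ), rexp (-(Λ * r)) * r ^ (-(1 / 2) : ℝ) :=
    setIntegral_mono_set (integrableOn_exp_rpow P.Lam_pos (by norm_num))
      (ae_Ioi (fun r (hr : 0 < r) => by
        simp only [Pi.zero_apply]; positivity)) Ioc_subset_Ioi_self.eventuallyLE
  calc _ ≤ 2 * mom * ((Λ - l) * (P.KK * ‖f‖)) *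
        ∫ r in Ioi (0:ℝ), rexp (-(Λ * r)) * r ^ (-(1 / 2) : ℝ) :=
        mul_le_mul_of_nonneg_left this (by positivity)
    _ = _ := by unfold CD; ring

lemma D'_cont (f : Cb) {τ : ℝ} (hτ : 0 ≤ τ) : Continuous (P.D' f τ) := by
  refine continuous_of_dominated_interval (fun t => ?_)
    (fun t => ae_of_all _ fun r hr => P.duh'_le f τ ?_ t) (P.duh'_int f hτ)
    (ae_of_all _ fun r hr => ?_)
  · rw [uIoc_of_le hτ]; exact P.duh'_meas f τ t
  · rw [uIoc_of_le hτ] at hr; exact hr.1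
  · rw [uIoc_of_le hτ] at hr
    refine continuous_const.mul ?_
    have h := continuousOn_Gam' (X := ℝ) (r := fun _ => r) (t := fun t => t)
      (h := fun _ x => P.W x * P.Z f (τ - r, x)) continuous_const continuous_id
      ((P.WZ_cont_right f _).comp continuous_snd) (fun _ => P.WZ_le f _)
    rw [← continuousOn_univ]
    convert h using 1
    exact (eq_univ_of_forall fun _ => hr.1).symm

lemma hasDerivAt_duhInt (f : Cb) {τ : ℝ} (hτ : 0 ≤ τ) (t : ℝ) :
    HasDerivAt (fun t => ∫ r in (0:ℝ)..τ, P.duh (fun τ t => P.Z f (τ, t)) τ r t)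
      (P.D' f τ t) t := by
  refine (intervalIntegral.hasDerivAt_integral_of_dominated_loc_of_deriv_le (s := univ) univ_mem
    (bound := fun r => 2 * mom * ((Λ - l) * (P.KK * ‖f‖)) * (rexp (-(Λ * r)) * r ^ (-(1 / 2) : ℝ)))
    (F' := fun t r => rexp (-(Λ * r)) * Gam' r (fun x => P.W x * P.Z f (τ - r, x)) t)
    (F := fun t r => P.duh (fun τ t => P.Z f (τ, t)) τ r t)
    (Eventually.of_forall fun t => ?_) ?_ ?_ (ae_of_all _ fun r hr t _ => P.duh'_le f τ ?_ t)
    (P.duh'_int f hτ) (ae_of_all _ fun r hr t _ => ?_)).2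
  · exact (P.duh_z_continuous (P.Z f) continuous_const continuous_id
      continuous_const).aestronglyMeasurable
  · exact (P.duh_z_continuous (P.Z f) continuous_const continuous_id
      continuous_const).intervalIntegrable _ _
  · rw [uIoc_of_le hτ]; exact P.duh'_meas f τ t
  · rw [uIoc_of_le hτ] at hr; exact hr.1
  · rw [uIoc_of_le hτ] at hr
    exact (hasDerivAt_Gam hr.1 (P.WZ_cont_right f _) (P.WZ_le f _) t).const_mul _

/-- The `t`-derivative of the decaying flow. -/
noncomputable def Q' (f : Cb) (τ t : ℝ) : ℝ :=
  rexp (-(l * τ)) * (rexp (-(Λ * τ)) * Gam' τ f t + P.D' f τ t)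

lemma hasDerivAt_Q (f : Cb) {τ : ℝ} (hτ : 0 < τ) (t : ℝ) :
    HasDerivAt (P.Q f τ) (P.Q' f τ t) t := by
  have e : P.Q f τ = fun t => rexp (-(l * τ)) * (rexp (-(Λ * τ)) * Gam τ f t +
      ∫ r in (0:ℝ)..τ, P.duh (fun τ t => P.Z f (τ, t)) τ r t) := by
    funext t; rw [P.Q_of_nonneg f hτ.le, P.Z_eq f hτ.le]
  rw [e]
  exact (((hasDerivAt_Gam hτ f.continuous f.norm_coe_le_norm t).const_mul _).add
    (P.hasDerivAt_duhInt f hτ.le t)).const_mul _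

lemma Q'_cont (f : Cb) {τ : ℝ} (hτ : 0 < τ) : Continuous (P.Q' f τ) := by
  refine continuous_const.mul ((continuous_const.mul ?_).add (P.D'_cont f hτ.le))
  have h := continuousOn_Gam' (X := ℝ) (r := fun _ => τ) (t := fun t => t)
    (h := fun _ x => f x) continuous_const continuous_id
    (f.continuous.comp continuous_snd) (fun _ => f.norm_coe_le_norm)
  rw [← continuousOn_univ]
  convert h using 1
  exact (eq_univ_of_forall fun _ => hτ).symm

lemma exp_le_one_aux {l τ : ℝ} (hl : 0 ≤ l) (hτ : 0 ≤ τ) : rexp (-(l * τ)) ≤ 1 := by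
  rw [exp_le_one_iff]
  have := mul_nonneg hl hτ; linarith

lemma Q'_le (f : Cb) {H α : ℝ} (hα : α ∈ Icc (0:ℝ) 1)
    (hH : ∀ t t', |f t - f t'| ≤ H * |t - t'| ^ α) {τ : ℝ} (hτ : 0 < τ) (t : ℝ) :
    |P.Q' f τ t| ≤ rexp (-(l * τ)) * (mom * H * τ ^ ((α - 1) / 2) + P.CD * ‖f‖) := by
  unfold Q'
  rw [abs_mul, abs_exp]
  gcongr
  refine (abs_add_le _ _).trans (add_le_add ?_ (P.D'_le f hτ.le t))
  rw [abs_mul, abs_exp]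
  have h := Gam'_le hτ hα f.continuous f.norm_coe_le_norm hH t
  calc _ ≤ 1 * (mom * H * τ ^ ((α - 1) / 2)) :=
        mul_le_mul (exp_le_one_aux P.Lam_pos.le hτ.le) h (abs_nonneg _) zero_le_one
    _ = _ := one_mul _

lemma Q_sub_le (f : Cb) {H α : ℝ} (hH : ∀ t t', |f t - f t'| ≤ H * |t - t'| ^ α)
    {τ : ℝ} (hτ : 0 ≤ τ) (t t' : ℝ) :
    |P.Q f τ t - P.Q f τ t'| ≤ rexp (-(l * τ)) * (H * |t - t'| ^ α + P.CD * ‖f‖ * |t - t'|) := by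
  rw [P.Q_of_nonneg f hτ, P.Q_of_nonneg f hτ, ← mul_sub, abs_mul, abs_exp]
  gcongr
  rw [P.Z_eq f hτ, P.Z_eq f hτ, add_sub_add_comm, ← mul_sub]
  refine (abs_add_le _ _).trans (add_le_add ?_ ?_)
  · rw [abs_mul, abs_exp]
    have h : |Gam τ f t - Gam τ f t'| ≤ H * |t - t'| ^ α := by
      unfold Gam
      rw [← integral_sub]
      · refine abs_integral_gauss_le (f := fun x => f (t + √(2 * τ) * x) - f (t' + √(2 * τ) * x))
          fun x => ?_
        have := hH (t + √(2 * τ) * x) (t' + √(2 * τ) * x)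
        rwa [add_sub_add_right_eq_sub] at this
      · exact integrable_gauss_of_bdd (M := ‖f‖) (f.continuous.comp (by fun_prop))
          fun _ => f.norm_coe_le_norm _
      · exact integrable_gauss_of_bdd (M := ‖f‖) (f.continuous.comp (by fun_prop))
          fun _ => f.norm_coe_le_norm _
    calc _ ≤ 1 * (H * |t - t'| ^ α) :=
          mul_le_mul (exp_le_one_aux P.Lam_pos.le hτ) h (abs_nonneg _) zero_le_one
      _ = _ := one_mul _
  · have := Convex.norm_image_sub_le_of_norm_hasDerivWithin_le (s := univ) (C := P.CD * ‖f‖)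
      (f := fun t => ∫ r in (0:ℝ)..τ, P.duh (fun τ t => P.Z f (τ, t)) τ r t) (f' := P.D' f τ)
      (fun x _ => (P.hasDerivAt_duhInt f hτ x).hasDerivWithinAt) (fun x _ => P.D'_le f hτ x)
      convex_univ (mem_univ t') (mem_univ t)
    simpa using this

lemma measurable_Q' (f : Cb) (t : ℝ) :
    AEStronglyMeasurable (fun τ => P.Q' f τ t) (volume.restrict (Ioi 0)) := by
  have h := measurable_deriv_with_param (f := fun τ t => P.Q f τ t) (P.Q_cont f)
  have h1 : Measurable fun τ => deriv (P.Q f τ) t := h.comp (measurable_id.prodMk measurable_const)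
  refine h1.aestronglyMeasurable.congr ?_
  refine ae_Ioi (fun τ hτ => ?_)
  exact (P.hasDerivAt_Q f hτ t).deriv

end Pot

/-- The time weights of the extension kernel. -/
noncomputable def wk (k y τ : ℝ) : ℝ := τ ^ (-k) * rexp (-(y ^ 2 / (4 * τ)))

lemma rpow_mul_exp_le {k x : ℝ} (hk : 0 < k) (hx : 0 ≤ x) : x ^ k * rexp (-x) ≤ k ^ k := by
  have h1 : x / k ≤ rexp (x / k) := by linarith [add_one_le_exp (x / k)]
  have h2 := rpow_le_rpow (by positivity) h1 hk.le
  rw [Real.div_rpow hx hk.le, ← exp_mul, div_mul_cancel₀ _ hk.ne',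
    div_le_iff₀ (by positivity)] at h2
  calc _ ≤ rexp x * k ^ k * rexp (-x) := by gcongr
    _ = k ^ k * (rexp x * rexp (-x)) := by ring
    _ = _ := by rw [← exp_add]; simp

lemma wk_nonneg {k y τ : ℝ} (hτ : 0 < τ) : 0 ≤ wk k y τ := by unfold wk; positivity

lemma wk_le_rpow {k y τ : ℝ} (hτ : 0 < τ) : wk k y τ ≤ τ ^ (-k) := by
  have : rexp (-(y ^ 2 / (4 * τ))) ≤ 1 := by
    rw [exp_le_one_iff]; have : 0 ≤ y ^ 2 / (4 * τ) := by positivity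
    linarith
  exact mul_le_of_le_one_right (by positivity) this

lemma wk_le {k y τ : ℝ} (hk : 0 < k) (hy : 0 < y) (hτ : 0 < τ) :
    wk k y τ ≤ (4 / y ^ 2) ^ k * k ^ k := by
  have h := rpow_mul_exp_le hk (show 0 ≤ y ^ 2 / (4 * τ) by positivity)
  have e : τ ^ (-k) = (4 / y ^ 2) ^ k * (y ^ 2 / (4 * τ)) ^ k := by
    rw [← mul_rpow (by positivity) (by positivity), rpow_neg hτ.le,
      ← inv_rpow hτ.le]
    congr 1; field_simp
  rw [wk, e, mul_assoc]
  gcongr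

lemma wk_anti {k y y₀ τ : ℝ} (hy₀ : 0 ≤ y₀) (hy : y₀ ≤ y) (hτ : 0 < τ) :
    wk k y τ ≤ wk k y₀ τ := by unfold wk; gcongr

lemma wk_succ {k y τ : ℝ} (hτ : 0 < τ) : wk (k + 1) y τ * τ = wk k y τ := by
  unfold wk
  rw [neg_add, rpow_add hτ, rpow_neg_one]
  field_simp

lemma hasDerivAt_wk_left (k y : ℝ) {τ : ℝ} (hτ : 0 < τ) :
    HasDerivAt (fun y => wk k y τ) (-(y / 2) * wk (k + 1) y τ) y := by
  have h : HasDerivAt (fun y => wk k y τ) _ y :=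
    ((((hasDerivAt_id' y).fun_pow 2).div_const (4 * τ)).fun_neg.exp).const_mul (τ ^ (-k))
  refine h.congr_deriv ?_
  rw [wk, neg_add, rpow_add hτ, rpow_neg_one]
  push_cast
  field_simp
  ring

lemma hasDerivAt_wk_right (k y : ℝ) {τ : ℝ} (hτ : 0 < τ) :
    HasDerivAt (fun τ => wk k y τ) (-k * wk (k + 1) y τ + y ^ 2 / 4 * wk (k + 2) y τ) τ := by
  have h0 : HasDerivAt (fun τ : ℝ => 4 * τ) 4 τ := by simpa using (hasDerivAt_id τ).const_mul 4
  have h : HasDerivAt (fun τ => wk k y τ) _ τ :=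
    (hasDerivAt_rpow_const (p := -k) (Or.inl hτ.ne')).fun_mul
      (((hasDerivAt_const τ (y ^ 2)).fun_div h0 (by positivity)).fun_neg.exp)
  refine h.congr_deriv ?_
  have e2 : τ ^ (-(k + 2)) = τ ^ (-k) * τ⁻¹ ^ 2 := by
    rw [neg_add, rpow_add hτ, rpow_neg hτ.le 2]; norm_num
  rw [wk, wk, e2, neg_add, rpow_add hτ, rpow_neg_one, rpow_sub_one hτ.ne']
  field_simp
  ring

/-- The weight extended by zero. -/
noncomputable def wz (k y τ : ℝ) : ℝ := if 0 < τ then wk k y τ else 0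

lemma wz_le {k y : ℝ} (hk : 0 < k) (hy : 0 < y) (τ : ℝ) :
    |wz k y τ| ≤ (4 / y ^ 2) ^ k * k ^ k := by
  unfold wz
  split_ifs with h
  · rw [abs_of_nonneg (wk_nonneg h)]; exact wk_le hk hy h
  · rw [abs_zero]; positivity

lemma wz_cont {k y : ℝ} (hk : 0 < k) (hy : 0 < y) : Continuous (wz k y) := by
  rw [continuous_iff_continuousAt]
  intro τ
  rcases lt_trichotomy τ 0 with h | h | h
  · refine (continuousAt_const (y := (0:ℝ))).congr ?_
    filter_upwards [gt_mem_nhds h] with x hx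
    simp [wz, not_lt.2 (le_of_lt hx)]
  · subst h
    have h0 : wz k y 0 = 0 := by simp [wz]
    rw [ContinuousAt, h0]
    refine squeeze_zero_norm (a := fun τ => |τ| * ((4 / y ^ 2) ^ (k + 1) * (k + 1) ^ (k + 1)))
      (fun τ => ?_) ?_
    · by_cases hτ : 0 < τ
      · rw [norm_eq_abs, wz, if_pos hτ, abs_of_nonneg (wk_nonneg hτ), ← wk_succ hτ,
          abs_of_pos hτ, mul_comm]
        exact mul_le_mul_of_nonneg_left (wk_le (by linarith) hy hτ) hτ.le
      · rw [wz, if_neg hτ, norm_zero]; positivity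
    · have : Tendsto (fun τ : ℝ => |τ| * ((4 / y ^ 2) ^ (k + 1) * (k + 1) ^ (k + 1))) (𝓝 0)
          (𝓝 (|0| * ((4 / y ^ 2) ^ (k + 1) * (k + 1) ^ (k + 1)))) :=
        Continuous.tendsto (by fun_prop) 0
      simpa using this
  · refine (hasDerivAt_wk_right k y h).continuousAt.congr ?_
    filter_upwards [lt_mem_nhds h] with x hx
    simp [wz, hx]

lemma wz_Wt {k y : ℝ} (hk : 0 < k) (hy : 0 < y) :
    ∃ M, Wt (wz k y) (fun τ => -k * wz (k + 1) y τ + y ^ 2 / 4 * wz (k + 2) y τ) M := by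
  have c1 := wz_cont (k := k + 1) (by linarith) hy
  have c2 := wz_cont (k := k + 2) (by linarith) hy
  have b0 := wz_le hk hy
  have b1 := wz_le (k := k + 1) (by linarith) hy
  have b2 := wz_le (k := k + 2) (by linarith) hy
  set B0 := (4 / y ^ 2) ^ k * k ^ k
  set B1 := (4 / y ^ 2) ^ (k + 1) * (k + 1) ^ (k + 1)
  set B2 := (4 / y ^ 2) ^ (k + 2) * (k + 2) ^ (k + 2)
  refine ⟨max B0 (k * B1 + y ^ 2 / 4 * B2), wz_cont hk hy, by fun_prop, fun τ hτ => ?_,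
    fun τ => (b0 τ).trans (le_max_left _ _), fun τ => le_trans ?_ (le_max_right _ _)⟩
  · have h := hasDerivAt_wk_right k y hτ
    simp only [wz, hτ, if_true]
    refine h.congr_of_eventuallyEq ?_
    filter_upwards [lt_mem_nhds hτ] with x hx
    simp [wz, hx]
  · refine (abs_add_le _ _).trans (add_le_add ?_ ?_)
    · rw [abs_mul, abs_neg, abs_of_pos hk]; exact mul_le_mul_of_nonneg_left (b1 τ) hk.le
    · rw [abs_mul, abs_of_nonneg (by positivity : 0 ≤ y ^ 2 / 4)]
      exact mul_le_mul_of_nonneg_left (b2 τ) (by positivity)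

namespace Pot
variable {l Λ : ℝ} (P : Pot l Λ)

/-- The weighted integrals of the flow and of its derivative. -/
noncomputable def J (k : ℝ) (f : Cb) (t y : ℝ) : ℝ := ∫ τ in Ioi (0:ℝ), wk k y τ * P.Q f τ t

noncomputable def J' (k : ℝ) (f : Cb) (t y : ℝ) : ℝ := ∫ τ in Ioi (0:ℝ), wk k y τ * P.Q' f τ t

lemma J_eq_Phi (k : ℝ) (f : Cb) (y : ℝ) : (fun t => P.J k f t y) = P.Phi (wz k y) f := by
  funext t
  refine setIntegral_congr_fun measurableSet_Ioi fun τ hτ => ?_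
  simp only [wz, if_pos (show 0 < τ from hτ)]

lemma wk_contOn (k y : ℝ) : ContinuousOn (wk k y) (Ioi 0) := fun _ hτ =>
  (hasDerivAt_wk_right k y hτ).continuousAt.continuousWithinAt

lemma wk_cont_left (k τ : ℝ) : Continuous fun y => wk k y τ := by unfold wk; fun_prop

lemma wkQ_meas (k : ℝ) (f : Cb) (t y : ℝ) : AEStronglyMeasurable
    (fun τ => wk k y τ * P.Q f τ t) (volume.restrict (Ioi 0)) :=
  ((wk_contOn k y).aestronglyMeasurable measurableSet_Ioi).mul
    (P.Q_cont_left f t).aestronglyMeasurable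

lemma wkQ'_meas (k : ℝ) (f : Cb) (t y : ℝ) : AEStronglyMeasurable
    (fun τ => wk k y τ * P.Q' f τ t) (volume.restrict (Ioi 0)) :=
  ((wk_contOn k y).aestronglyMeasurable measurableSet_Ioi).mul (P.measurable_Q' f t)

lemma J_contOn {k : ℝ} {f : Cb} {Y : Set ℝ} {b : ℝ → ℝ} (hb : IntegrableOn b (Ioi 0))
    (h : ∀ y ∈ Y, ∀ τ, 0 < τ → ∀ t, |wk k y τ * P.Q f τ t| ≤ b τ) :
    ContinuousOn (fun p : ℝ² => P.J k f p.1 p.2) (univ ×ˢ Y) := by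
  intro p hp
  refine tendsto_integral_filter_of_dominated_convergence b
    (Eventually.of_forall fun q => P.wkQ_meas k f _ _) ?_ hb ?_
  · filter_upwards [self_mem_nhdsWithin] with q hq
    exact ae_Ioi (fun τ hτ => h _ hq.2 τ hτ _)
  · refine ae_of_all _ fun τ => ?_
    exact (((wk_cont_left k τ).comp continuous_snd).mul
      ((P.Q_cont_right f τ).comp continuous_fst)).continuousAt.continuousWithinAt

lemma J'_contOn {k : ℝ} {f : Cb} {Y : Set ℝ} {b : ℝ → ℝ} (hb : IntegrableOn b (Ioi 0))
    (h : ∀ y ∈ Y, ∀ τ, 0 < τ → ∀ t, |wk k y τ * P.Q' f τ t| ≤ b τ) :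
    ContinuousOn (fun p : ℝ² => P.J' k f p.1 p.2) (univ ×ˢ Y) := by
  intro p hp
  refine tendsto_integral_filter_of_dominated_convergence b
    (Eventually.of_forall fun q => P.wkQ'_meas k f _ _) ?_ hb ?_
  · filter_upwards [self_mem_nhdsWithin] with q hq
    exact ae_Ioi (fun τ hτ => h _ hq.2 τ hτ _)
  · refine ae_Ioi (fun τ hτ => ?_)
    exact (((wk_cont_left k τ).comp continuous_snd).mul
      ((P.Q'_cont f hτ).comp continuous_fst)).continuousAt.continuousWithinAt

lemma hasDerivAt_J {k y : ℝ} {f : Cb} {b : ℝ → ℝ} (hb : IntegrableOn b (Ioi 0))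
    (h : ∀ τ, 0 < τ → ∀ t, |wk k y τ * P.Q' f τ t| ≤ b τ) (t : ℝ)
    (hi : IntegrableOn (fun τ => wk k y τ * P.Q f τ t) (Ioi 0)) :
    HasDerivAt (fun t => P.J k f t y) (P.J' k f t y) t := by
  refine (hasDerivAt_integral_of_dominated_loc_of_deriv_le (s := univ) univ_mem (bound := b)
    (F := fun t τ => wk k y τ * P.Q f τ t) (F' := fun t τ => wk k y τ * P.Q' f τ t)
    (Eventually.of_forall fun t => P.wkQ_meas k f _ _) hi (P.wkQ'_meas k f _ _)
    (ae_Ioi (fun τ hτ t _ => h τ hτ t)) hb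
    (ae_Ioi (fun τ hτ t _ => ?_))).2
  exact (P.hasDerivAt_Q f hτ t).const_mul _

lemma holder_zero (f : Cb) (t t' : ℝ) : |f t - f t'| ≤ 2 * ‖f‖ * |t - t'| ^ (0:ℝ) := by
  rw [rpow_zero, mul_one]
  have := abs_sub (f t) (f t')
  have h1 := f.norm_coe_le_norm t
  have h2 := f.norm_coe_le_norm t'
  rw [norm_eq_abs] at h1 h2
  linarith

/-- The bound for the derivative of the flow. -/
noncomputable def bQ (P : Pot l Λ) (H α : ℝ) (f : Cb) (τ : ℝ) : ℝ :=
  rexp (-(l * τ)) * (mom * H * τ ^ ((α - 1) / 2) + P.CD * ‖f‖)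

lemma integrableOn_bQ {p H α : ℝ} (hp : 0 < p + (α - 1) / 2) (hp0 : 0 < p) (f : Cb) :
    IntegrableOn (fun τ => τ ^ (p - 1) * P.bQ H α f τ) (Ioi 0) := by
  have h1 := (integrableOn_exp_rpow (p := p - 1 + (α - 1) / 2) P.l_pos (by linarith)).const_mul (mom * H)
  have h2 := (integrableOn_exp_rpow (p := p - 1) P.l_pos (by linarith)).const_mul (P.CD * ‖f‖)
  refine (IntegrableOn.add h1 h2).congr_fun (fun τ (hτ : 0 < τ) => ?_) measurableSet_Ioi
  simp only [Pi.add_apply, bQ]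
  rw [rpow_add hτ]; ring

lemma wkQ_le {k y₀ y : ℝ} (hk : 0 < k) (hy₀ : 0 < y₀) (hy : y₀ ≤ y) (f : Cb) (τ : ℝ)
    (hτ : 0 < τ) (t : ℝ) :
    |wk k y τ * P.Q f τ t| ≤ rexp (-(l * τ)) * ((4 / y₀ ^ 2) ^ k * k ^ k * (P.KK * ‖f‖)) := by
  rw [abs_mul, abs_of_nonneg (wk_nonneg hτ)]
  calc _ ≤ (4 / y₀ ^ 2) ^ k * k ^ k * (rexp (-(l * τ)) * (P.KK * ‖f‖)) :=
        mul_le_mul ((wk_anti hy₀.le hy hτ).trans (wk_le hk hy₀ hτ)) (P.Q_le f hτ.le t)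
          (abs_nonneg _) (by positivity)
    _ = _ := by ring

lemma wkQ'_le {k y₀ y : ℝ} (hk : 0 < k) (hy₀ : 0 < y₀) (hy : y₀ ≤ y) (f : Cb) (τ : ℝ)
    (hτ : 0 < τ) (t : ℝ) :
    |wk k y τ * P.Q' f τ t| ≤
      (4 / y₀ ^ 2) ^ k * k ^ k * (τ ^ ((1:ℝ) - 1) * P.bQ (2 * ‖f‖) 0 f τ) := by
  rw [abs_mul, abs_of_nonneg (wk_nonneg hτ), sub_self, rpow_zero, one_mul]
  exact mul_le_mul ((wk_anti hy₀.le hy hτ).trans (wk_le hk hy₀ hτ))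
    (P.Q'_le f (by norm_num) (holder_zero f) hτ t) (abs_nonneg _) (by positivity)

lemma wkQ_int {k y : ℝ} (hk : 0 < k) (hy : 0 < y) (f : Cb) (t : ℝ) :
    IntegrableOn (fun τ => wk k y τ * P.Q f τ t) (Ioi 0) :=
  Integrable.mono' ((integrableOn_exp_neg P.l_pos).mul_const _) (P.wkQ_meas k f t y)
    (ae_Ioi (fun τ hτ =>
      P.wkQ_le hk hy le_rfl f τ hτ t))

lemma J_cont {k : ℝ} (hk : 0 < k) (f : Cb) :
    ContinuousOn (fun p : ℝ² => P.J k f p.1 p.2) ℍ := by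
  intro p (hp : 0 < p.2)
  have h := P.J_contOn ((integrableOn_exp_neg P.l_pos).mul_const _)
    (fun y (hy : y ∈ Ici (p.2 / 2)) τ hτ t => P.wkQ_le hk (half_pos hp) hy f τ hτ t)
  refine (h.continuousAt ?_).continuousWithinAt
  rw [univ_prod]
  exact continuous_snd.continuousAt.preimage_mem_nhds (Ici_mem_nhds (half_lt_self hp))

lemma J'_cont {k : ℝ} (hk : 0 < k) (f : Cb) :
    ContinuousOn (fun p : ℝ² => P.J' k f p.1 p.2) ℍ := by
  intro p (hp : 0 < p.2)
  have h := P.J'_contOn ((P.integrableOn_bQ (p := 1) (by norm_num) one_pos f).const_mul _)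
    (fun y (hy : y ∈ Ici (p.2 / 2)) τ hτ t => P.wkQ'_le hk (half_pos hp) hy f τ hτ t)
  refine (h.continuousAt ?_).continuousWithinAt
  rw [univ_prod]
  exact continuous_snd.continuousAt.preimage_mem_nhds (Ici_mem_nhds (half_lt_self hp))

lemma hasDerivAt_J_t {k y : ℝ} (hk : 0 < k) (hy : 0 < y) (f : Cb) (t : ℝ) :
    HasDerivAt (fun t => P.J k f t y) (P.J' k f t y) t :=
  P.hasDerivAt_J ((P.integrableOn_bQ (p := 1) (by norm_num) one_pos f).const_mul _)
    (fun τ hτ t => P.wkQ'_le hk hy le_rfl f τ hτ t) t (P.wkQ_int hk hy f t)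

lemma hasDerivAt_J'_t {k y : ℝ} (hk : 0 < k) (hy : 0 < y) (f : Cb) (t : ℝ) :
    HasDerivAt (fun t => P.J' k f t y)
      (P.V t * P.J k f t y + k * P.J (k + 1) f t y - y ^ 2 / 4 * P.J (k + 2) f t y) t := by
  obtain ⟨M, hM⟩ := wz_Wt hk hy
  have h := P.hasDerivAt_Phi hM f
  have e : (fun t => P.J' k f t y) = P.Phi' (wz k y) (fun τ => -k * wz (k + 1) y τ + y ^ 2 / 4 * wz (k + 2) y τ) f := by
    funext t
    have h1 := P.hasDerivAt_J_t hk hy f t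
    rw [P.J_eq_Phi] at h1
    exact h1.unique (h t).1
  rw [e]
  refine (h t).2.congr_deriv ?_
  have e0 : wz k y 0 = 0 := by simp [wz]
  have e1 : P.Phi (fun τ => -k * wz (k + 1) y τ + y ^ 2 / 4 * wz (k + 2) y τ) f t =
      -k * P.J (k + 1) f t y + y ^ 2 / 4 * P.J (k + 2) f t y := by
    unfold J
    rw [← integral_const_mul, ← integral_const_mul, ← integral_add
      ((P.wkQ_int (by linarith) hy f t).const_mul _) ((P.wkQ_int (by linarith) hy f t).const_mul _)]
    refine setIntegral_congr_fun measurableSet_Ioi fun τ hτ => ?_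
    simp only [wz, if_pos (show 0 < τ from hτ)]; ring
  rw [e0, e1, ← congrFun (P.J_eq_Phi k f y) t]
  ring

lemma hasDerivAt_J_y {k y : ℝ} (hk : 0 < k) (hy : 0 < y) (f : Cb) (t : ℝ) :
    HasDerivAt (P.J k f t) (-(y / 2) * P.J (k + 1) f t y) y := by
  have h := (hasDerivAt_integral_of_dominated_loc_of_deriv_le (s := Icc (y / 2) (2 * y))
    (μ := volume.restrict (Ioi 0)) (x₀ := y)
    (Icc_mem_nhds (by linarith) (by linarith))
    (bound := fun τ => y * (rexp (-(l * τ)) *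
      ((4 / (y / 2) ^ 2) ^ (k + 1) * (k + 1) ^ (k + 1) * (P.KK * ‖f‖))))
    (F := fun y τ => wk k y τ * P.Q f τ t)
    (F' := fun y τ => -(y / 2) * (wk (k + 1) y τ * P.Q f τ t))
    (Eventually.of_forall fun y => P.wkQ_meas k f _ _) (P.wkQ_int hk hy f t)
    ((P.wkQ_meas (k + 1) f t y).const_mul _)
    (ae_Ioi (fun τ hτ z hz => ?_))
    (((integrableOn_exp_neg P.l_pos).mul_const _).const_mul _)
    (ae_Ioi (fun τ hτ z _ => ?_))).2
  · rw [integral_const_mul] at h; exact h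
  · rw [norm_mul]
    refine mul_le_mul ?_ (P.wkQ_le (by linarith) (half_pos hy) hz.1 f τ hτ t) (abs_nonneg _) hy.le
    rw [norm_eq_abs, abs_neg, abs_of_nonneg (by linarith [hz.1])]
    linarith [hz.2]
  · have := (hasDerivAt_wk_left k z hτ).mul_const (P.Q f τ t)
    exact this.congr_deriv (by ring)

end Pot

lemma integrableOn_wk_one {s : ℝ} (hs : s ∈ Ioo (0:ℝ) 1) : IntegrableOn (wk (2 - s) 1) (Ioi 0) := by
  rw [← Ioc_union_Ioi_eq_Ioi zero_le_one]
  refine IntegrableOn.union ?_ ?_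
  · refine Integrable.mono' (g := fun _ => (4 / 1 ^ 2) ^ (2 - s) * (2 - s) ^ (2 - s))
      (integrableOn_const (by simp)) (((Pot.wk_contOn _ _).mono Ioc_subset_Ioi_self).aestronglyMeasurable
        measurableSet_Ioc) ((ae_restrict_iff' measurableSet_Ioc).2 (ae_of_all _ fun r hr => ?_))
    rw [norm_eq_abs, abs_of_nonneg (wk_nonneg hr.1)]
    exact wk_le (by linarith [hs.2]) one_pos hr.1
  · refine Integrable.mono' (integrableOn_Ioi_rpow_of_lt (a := -(2 - s)) (by linarith [hs.2]) one_pos)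
      (((Pot.wk_contOn _ _).mono (Ioi_subset_Ioi zero_le_one)).aestronglyMeasurable
        measurableSet_Ioi) (ae_Ioi (fun r hr => ?_))
    have hr0 : 0 < r := one_pos.trans hr
    rw [norm_eq_abs, abs_of_nonneg (wk_nonneg hr0)]
    exact wk_le_rpow hr0

lemma integral_wk_one_pos {s : ℝ} (hs : s ∈ Ioo (0:ℝ) 1) : 0 < ∫ r in Ioi (0:ℝ), wk (2 - s) 1 r := by
  refine (setIntegral_pos_iff_support_of_nonneg_ae ((ae_restrict_iff' measurableSet_Ioi).2
    (ae_of_all _ fun r hr => wk_nonneg hr)) (integrableOn_wk_one hs)).2 ?_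
  have : Function.support (wk (2 - s) 1) ∩ Ioi 0 = Ioi 0 := by
    rw [inter_eq_right]
    intro r (hr : 0 < r)
    simp only [Function.mem_support, wk]; positivity
  rw [this]; simp

/-- The normalising constant of the extension kernel. -/
noncomputable def cs (s : ℝ) : ℝ := 2 / ∫ r in Ioi (0:ℝ), wk (2 - s) 1 r

lemma cs_pos {s : ℝ} (hs : s ∈ Ioo (0:ℝ) 1) : 0 < cs s := div_pos two_pos (integral_wk_one_pos hs)

lemma exp_sq_lip (a b : ℝ) : |rexp (-(a ^ 2 / 4)) - rexp (-(b ^ 2 / 4))| ≤ |a - b| := by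
  have h := Convex.norm_image_sub_le_of_norm_hasDerivWithin_le (s := univ) (C := 1)
    (f := fun x : ℝ => rexp (-(x ^ 2 / 4))) (f' := fun x => rexp (-(x ^ 2 / 4)) * -(x / 2))
    (fun x _ => HasDerivAt.hasDerivWithinAt ?_) (fun x _ => ?_)
      convex_univ (mem_univ b) (mem_univ a)
  · simpa using h
  · have h : HasDerivAt (fun x : ℝ => rexp (-(x ^ 2 / 4))) _ x :=
      (((hasDerivAt_id' x).fun_pow 2).div_const 4).fun_neg.exp
    exact h.congr_deriv (by push_cast; ring)
  · rw [norm_mul, norm_eq_abs, norm_eq_abs, abs_exp, abs_neg, abs_div, abs_two]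
    have h1 : |x| / 2 ≤ rexp (x ^ 2 / 4) := by
      have := add_one_le_exp (x ^ 2 / 4)
      nlinarith [sq_abs x, sq_nonneg (|x| / 2 - 1)]
    calc _ ≤ rexp (-(x ^ 2 / 4)) * rexp (x ^ 2 / 4) := by gcongr
      _ = 1 := by rw [← exp_add]; simp

lemma min_one_le_rpow {x z s : ℝ} (hx : 0 ≤ z) (h1 : x ≤ 1) (hz : x ≤ z) (hs : s ∈ Icc (0:ℝ) 1) :
    x ≤ z ^ s := by
  rcases le_total z 1 with h | h
  · exact hz.trans (self_le_rpow_of_le_one hx h hs.2)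
  · exact h1.trans (one_le_rpow h hs.1)

lemma exp_diff_le {s y y' τ : ℝ} (hs : s ∈ Ioo (0:ℝ) 1) (hτ : 0 < τ) :
    |rexp (-(y ^ 2 / (4 * τ))) - rexp (-(y' ^ 2 / (4 * τ)))| ≤ |y - y'| ^ s * τ ^ (-(s / 2)) := by
  have h := exp_sq_lip (y / √τ) (y' / √τ)
  have e : ∀ y : ℝ, (y / √τ) ^ 2 / 4 = y ^ 2 / (4 * τ) := fun y => by
    rw [div_pow, sq_sqrt hτ.le]; field_simp
  rw [e, e, ← sub_div, abs_div, abs_of_nonneg (sqrt_nonneg τ)] at h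
  have hE : ∀ y : ℝ, rexp (-(y ^ 2 / (4 * τ))) ≤ 1 := fun y => by
    rw [exp_le_one_iff]; have : 0 ≤ y ^ 2 / (4 * τ) := by positivity
    linarith
  refine (min_one_le_rpow (s := s) (by positivity) ?_ h ⟨hs.1.le, hs.2.le⟩).trans (le_of_eq ?_)
  · rw [abs_le]; constructor <;> linarith [hE y, hE y', exp_pos (-(y ^ 2 / (4 * τ))),
      exp_pos (-(y' ^ 2 / (4 * τ)))]
  · rw [Real.div_rpow (abs_nonneg _) (sqrt_nonneg _), sqrt_eq_rpow, ← rpow_mul hτ.le,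
      rpow_neg hτ.le, div_eq_mul_inv]
    congr 3; ring

lemma interp_le {x A B θ : ℝ} (hx : 0 ≤ x) (hA : x ≤ A) (hB : x ≤ B) (hθ : θ ∈ Icc (0:ℝ) 1) :
    x ≤ A ^ (1 - θ) * B ^ θ := by
  have h0 : (0:ℝ) ≤ 1 - θ := by linarith [hθ.2]
  have hA0 := hx.trans hA
  have hB0 := hx.trans hB
  calc x = x ^ (1 - θ) * x ^ θ := by
        rw [← rpow_add_of_nonneg hx h0 hθ.1]; simp
    _ ≤ _ := by
      have := hθ.1
      gcongr

namespace Pot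
variable {l Λ : ℝ} (P : Pot l Λ)

/-- The extension of Neumann data `f`. -/
noncomputable def N (s : ℝ) (f : Cb) (t y : ℝ) : ℝ := cs s * P.J (1 - s) f t y
noncomputable def Nt (s : ℝ) (f : Cb) (t y : ℝ) : ℝ := cs s * P.J' (1 - s) f t y
noncomputable def Ny (s : ℝ) (f : Cb) (t y : ℝ) : ℝ := -(cs s * (y / 2)) * P.J (2 - s) f t y
noncomputable def Nty (s : ℝ) (f : Cb) (t y : ℝ) : ℝ := -(cs s * (y / 2)) * P.J' (2 - s) f t y
noncomputable def Ntt (s : ℝ) (f : Cb) (t y : ℝ) : ℝ :=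
  cs s * (P.V t * P.J (1 - s) f t y + (1 - s) * P.J (2 - s) f t y - y ^ 2 / 4 * P.J (3 - s) f t y)
noncomputable def Nyy (s : ℝ) (f : Cb) (t y : ℝ) : ℝ :=
  -(cs s / 2) * P.J (2 - s) f t y + cs s * y ^ 2 / 4 * P.J (3 - s) f t y

variable {s : ℝ} (f : Cb)

lemma N_eqn {t y : ℝ} (hy : 0 < y) :
    P.Nyy s f t y + (1 - 2 * s) / y * P.Ny s f t y + P.Ntt s f t y = P.V t * P.N s f t y := by
  unfold Nyy Ny Ntt N; field_simp; ring

section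
variable (hs : s ∈ Ioo (0:ℝ) 1)
include hs

lemma hasDerivAt_N_t {y : ℝ} (hy : 0 < y) (t : ℝ) :
    HasDerivAt (fun t => P.N s f t y) (P.Nt s f t y) t :=
  (P.hasDerivAt_J_t (by linarith [hs.2]) hy f t).const_mul _

lemma hasDerivAt_Nt_t {y : ℝ} (hy : 0 < y) (t : ℝ) :
    HasDerivAt (fun t => P.Nt s f t y) (P.Ntt s f t y) t := by
  refine ((P.hasDerivAt_J'_t (k := 1 - s) (by linarith [hs.2]) hy f t).const_mul (cs s)).congr_deriv ?_
  rw [Ntt, show 1 - s + 1 = 2 - s by ring, show 1 - s + 2 = 3 - s by ring]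

lemma hasDerivAt_N_y {y : ℝ} (hy : 0 < y) (t : ℝ) : HasDerivAt (P.N s f t) (P.Ny s f t y) y := by
  refine ((P.hasDerivAt_J_y (k := 1 - s) (by linarith [hs.2]) hy f t).const_mul (cs s)).congr_deriv ?_
  rw [Ny, show 1 - s + 1 = 2 - s by ring]; ring

lemma hasDerivAt_Ny_y {y : ℝ} (hy : 0 < y) (t : ℝ) : HasDerivAt (P.Ny s f t) (P.Nyy s f t y) y := by
  have h : HasDerivAt (P.Ny s f t) _ y :=
    ((((hasDerivAt_id' y).div_const 2).const_mul (cs s)).fun_neg).fun_mul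
      (P.hasDerivAt_J_y (k := 2 - s) (by linarith [hs.2]) hy f t)
  refine h.congr_deriv ?_
  rw [Nyy, show 2 - s + 1 = 3 - s by ring]; ring

lemma hasDerivAt_Ny_t {y : ℝ} (hy : 0 < y) (t : ℝ) :
    HasDerivAt (fun t => P.Ny s f t y) (P.Nty s f t y) t :=
  (P.hasDerivAt_J_t (by linarith [hs.2]) hy f t).const_mul _

omit hs in
lemma wkQ_le_rpow {k : ℝ} (y : ℝ) {τ : ℝ} (hτ : 0 < τ) (t : ℝ) :
    |wk k y τ * P.Q f τ t| ≤ P.KK * ‖f‖ * (rexp (-(l * τ)) * τ ^ (-k)) := by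
  rw [abs_mul, abs_of_nonneg (wk_nonneg hτ)]
  calc _ ≤ τ ^ (-k) * (rexp (-(l * τ)) * (P.KK * ‖f‖)) :=
        mul_le_mul (wk_le_rpow hτ) (P.Q_le f hτ.le t) (abs_nonneg _) (by positivity)
    _ = _ := by ring

omit P in
lemma int_exp_rpow (P : Pot l Λ) : IntegrableOn (fun r => rexp (-(l * r)) * r ^ (-(1 - s))) (Ioi 0) :=
  integrableOn_exp_rpow P.l_pos (by linarith [hs.1])

lemma N_cont : Continuous fun p : ℝ² => P.N s f p.1 p.2 := by
  refine continuous_const.mul ?_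
  rw [← continuousOn_univ, ← univ_prod_univ]
  exact P.J_contOn ((P.int_exp_rpow hs).const_mul _)
    (fun y _ τ hτ t => P.wkQ_le_rpow f y hτ t)

lemma wkQ_int_one (t y : ℝ) : IntegrableOn (fun τ => wk (1 - s) y τ * P.Q f τ t) (Ioi 0) :=
  Integrable.mono' ((P.int_exp_rpow hs).const_mul _) (P.wkQ_meas _ f t y)
    (ae_Ioi (fun _ hτ => P.wkQ_le_rpow f y hτ t))

omit P hs in
/-- The constant bounding `N`. -/
noncomputable def CN (P : Pot l Λ) (s : ℝ) : ℝ :=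
  cs s * (P.KK * ∫ r in Ioi (0:ℝ), rexp (-(l * r)) * r ^ (-(1 - s)))

lemma N_le (t y : ℝ) : |P.N s f t y| ≤ P.CN s * ‖f‖ := by
  have h := norm_integral_le_of_norm_le (f := fun τ => wk (1 - s) y τ * P.Q f τ t)
    ((P.int_exp_rpow hs).const_mul (P.KK * ‖f‖))
    (ae_Ioi (fun τ hτ => P.wkQ_le_rpow f y hτ t))
  rw [integral_const_mul] at h
  rw [N, abs_mul, abs_of_pos (cs_pos hs)]
  calc _ ≤ _ := mul_le_mul_of_nonneg_left h (cs_pos hs).le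
    _ = _ := by unfold CN; ring

lemma CN_nonneg : 0 ≤ P.CN s := by
  have := P.N_le (const ℝ 1) hs 0 0
  rw [norm_const_eq] at this
  simpa using (abs_nonneg _).trans this

lemma N_holder_y (t y y' : ℝ) : |P.N s f t y - P.N s f t y'| ≤
    (cs s * (P.KK * ∫ r in Ioi (0:ℝ), rexp (-(l * r)) * r ^ (s / 2 - 1))) * ‖f‖ * |y - y'| ^ s := by
  have hi : IntegrableOn (fun r => rexp (-(l * r)) * r ^ (s / 2 - 1)) (Ioi 0) :=
    integrableOn_exp_rpow P.l_pos (by linarith [hs.1])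
  have h := norm_integral_le_of_norm_le (hi.const_mul (P.KK * ‖f‖ * |y - y'| ^ s))
    (f := fun τ => wk (1 - s) y τ * P.Q f τ t - wk (1 - s) y' τ * P.Q f τ t)
    (ae_Ioi (fun τ (hτ : 0 < τ) => ?_))
  · rw [integral_sub (P.wkQ_int_one f hs t y) (P.wkQ_int_one f hs t y'), integral_const_mul] at h
    rw [N, N, ← mul_sub, abs_mul, abs_of_pos (cs_pos hs)]
    calc _ ≤ _ := mul_le_mul_of_nonneg_left h (cs_pos hs).le
      _ = _ := by ring
  · rw [← sub_mul, norm_mul, wk, wk, ← mul_sub, norm_mul, norm_eq_abs, norm_eq_abs,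
      norm_eq_abs, abs_of_nonneg (by positivity : 0 ≤ τ ^ (-(1 - s)))]
    calc _ ≤ τ ^ (-(1 - s)) * (|y - y'| ^ s * τ ^ (-(s / 2))) * (rexp (-(l * τ)) * (P.KK * ‖f‖)) :=
          mul_le_mul (mul_le_mul_of_nonneg_left (exp_diff_le hs hτ) (by positivity))
            (P.Q_le f hτ.le t) (abs_nonneg _) (by positivity)
      _ = _ := by
        rw [show s / 2 - 1 = -(1 - s) + -(s / 2) by ring, rpow_add hτ]; ring

/-- Gain of `s` Hölder derivatives. -/
lemma Q_interp {H α : ℝ} (hα : 0 ≤ α) (hαs : α ≤ 1 - s)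
    (hH : ∀ t t', |f t - f t'| ≤ H * |t - t'| ^ α) {τ : ℝ} (hτ : 0 < τ) (t t' : ℝ) :
    |P.Q f τ t - P.Q f τ t'| ≤ rexp (-(l * τ)) *
      ((1 + mom) * H * |t - t'| ^ (α + s) * τ ^ (-(s / 2)) + P.CD * ‖f‖ * |t - t'|) := by
  have hH0 : 0 ≤ H := by simpa using (abs_nonneg _).trans (hH 0 1)
  have hm := mom_nonneg
  have h1 := P.Q_sub_le f hH hτ.le t t'
  have hα1 : α ∈ Icc (0:ℝ) 1 := ⟨hα, by linarith [hs.1]⟩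
  have h2 := Convex.norm_image_sub_le_of_norm_hasDerivWithin_le (s := univ)
      (C := rexp (-(l * τ)) * (mom * H * τ ^ ((α - 1) / 2) + P.CD * ‖f‖))
      (f := P.Q f τ) (f' := P.Q' f τ)
      (fun x _ => (P.hasDerivAt_Q f hτ x).hasDerivWithinAt) (fun x _ => P.Q'_le f hα1 hH hτ x)
      convex_univ (mem_univ t') (mem_univ t)
  rw [norm_eq_abs, norm_eq_abs] at h2
  set δ := |t - t'| with hδ
  have hδ0 : 0 ≤ δ := abs_nonneg _
  set E := rexp (-(l * τ)) with hE
  have hE0 : 0 < E := exp_pos _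
  set x := |P.Q f τ t - P.Q f τ t'| / E - P.CD * ‖f‖ * δ with hx
  have hxA : x ≤ H * δ ^ α := by
    rw [hx, sub_le_iff_le_add, div_le_iff₀ hE0]; linarith
  have hxB : x ≤ mom * H * τ ^ ((α - 1) / 2) * δ := by
    rw [hx, sub_le_iff_le_add, div_le_iff₀ hE0]; linarith
  have key : x ≤ (1 + mom) * H * δ ^ (α + s) * τ ^ (-(s / 2)) := by
    rcases le_total x 0 with h0 | h0
    · exact h0.trans (by positivity)
    have h1α : 0 < 1 - α := by linarith [hs.1]
    have hθ : s / (1 - α) ∈ Icc (0:ℝ) 1 :=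
      ⟨div_nonneg hs.1.le h1α.le, (div_le_one h1α).2 (by linarith)⟩
    set θ := s / (1 - α) with hθd
    have hθs : θ * (1 - α) = s := div_mul_cancel₀ _ h1α.ne'
    have h1θ : 0 ≤ 1 - θ := by linarith [hθ.2]
    have hxB' : x ≤ (1 + mom) * (H * (τ ^ ((α - 1) / 2) * δ)) := hxB.trans (by
      have : 0 ≤ H * (τ ^ ((α - 1) / 2) * δ) := by positivity
      nlinarith)
    refine (interp_le h0 hxA hxB' hθ).trans ?_
    have e1 : (H * δ ^ α) ^ (1 - θ) = H ^ (1 - θ) * δ ^ (α * (1 - θ)) := by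
      rw [mul_rpow hH0 (by positivity), ← rpow_mul hδ0]
    have e2 : ((1 + mom) * (H * (τ ^ ((α - 1) / 2) * δ))) ^ θ =
        (1 + mom) ^ θ * (H ^ θ * (τ ^ (-(s / 2)) * δ ^ θ)) := by
      rw [mul_rpow (by positivity) (by positivity), mul_rpow hH0 (by positivity),
        mul_rpow (by positivity) hδ0, ← rpow_mul hτ.le]
      congr 4
      rw [← hθs]; ring
    have e3 : (1 + mom) ^ θ ≤ 1 + mom := by
      simpa using rpow_le_rpow_of_exponent_le (x := 1 + mom) (by linarith) hθ.2
    rw [e1, e2]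
    have e4 : H ^ (1 - θ) * H ^ θ = H := by
      rw [← rpow_add_of_nonneg hH0 h1θ hθ.1]; simp
    have e5 : δ ^ (α * (1 - θ)) * δ ^ θ = δ ^ (α + s) := by
      rw [← rpow_add_of_nonneg hδ0 (mul_nonneg hα h1θ) hθ.1]; congr 1; rw [← hθs]; ring
    calc _ = (1 + mom) ^ θ * (H ^ (1 - θ) * H ^ θ) * (δ ^ (α * (1 - θ)) * δ ^ θ) * τ ^ (-(s / 2)) := by
          ring
      _ ≤ _ := by rw [e4, e5]; gcongr
  rw [hx, sub_le_iff_le_add, div_le_iff₀ hE0] at key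
  linarith

omit P in
/-- The constant of the Hölder gain. -/
lemma N_holder_t {l Λ : ℝ} : ∃ C, 0 ≤ C ∧ ∀ (P : Pot l Λ) (f : Cb) (H α : ℝ), 0 ≤ α → α ≤ 1 - s →
    (∀ t t', |f t - f t'| ≤ H * |t - t'| ^ α) → ∀ t t' y,
    |P.N s f t y - P.N s f t' y| ≤ C * (H + ‖f‖) * |t - t'| ^ (α + s) := by
  by_cases hP : Nonempty (Pot l Λ)
  swap
  · exact ⟨0, le_rfl, fun P => (hP ⟨P⟩).elim⟩
  obtain ⟨P₀⟩ := hP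
  set Γ1 := ∫ r in Ioi (0:ℝ), rexp (-(l * r)) * r ^ (s / 2 - 1) with hΓ1
  set Γ2 := ∫ r in Ioi (0:ℝ), rexp (-(l * r)) * r ^ (-(1 - s)) with hΓ2
  have hm := mom_nonneg
  have hc := cs_pos hs
  have hCD := P₀.CD_nonneg
  have hCN := P₀.CN_nonneg hs
  have g1 : 0 ≤ Γ1 := setIntegral_nonneg measurableSet_Ioi fun r (hr : 0 < r) => by positivity
  have g2 : 0 ≤ Γ2 := setIntegral_nonneg measurableSet_Ioi fun r (hr : 0 < r) => by positivity
  refine ⟨cs s * ((1 + mom) * Γ1 + P₀.CD * Γ2) + 2 * P₀.CN s, by positivity,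
    fun P f H α hα hαs hH t t' y => ?_⟩
  have hH0 : 0 ≤ H := by simpa using (abs_nonneg _).trans (hH 0 1)
  have hCN' : P.CN s = P₀.CN s := rfl
  have hCD' : P.CD = P₀.CD := rfl
  set δ := |t - t'| with hδ
  have hδ0 : 0 ≤ δ := abs_nonneg _
  have hf0 := norm_nonneg f
  rcases le_total 1 δ with h1 | h1
  · have b1 := P.N_le f hs t y
    have b2 := P.N_le f hs t' y
    rw [hCN'] at b1 b2
    have b3 := abs_sub (P.N s f t y) (P.N s f t' y)
    have b4 : 1 ≤ δ ^ (α + s) := one_le_rpow h1 (by linarith [hs.1])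
    calc _ ≤ 2 * P₀.CN s * (0 + ‖f‖) * 1 := by linarith
      _ ≤ _ := by
        gcongr
        have : 0 ≤ cs s * ((1 + mom) * Γ1 + P₀.CD * Γ2) := by positivity
        linarith
  · have i1 : IntegrableOn (fun r => rexp (-(l * r)) * r ^ (s / 2 - 1)) (Ioi 0) :=
      integrableOn_exp_rpow P.l_pos (by linarith [hs.1])
    have h := norm_integral_le_of_norm_le ((i1.const_mul ((1 + mom) * H * δ ^ (α + s))).add
        ((P.int_exp_rpow hs).const_mul (P.CD * ‖f‖ * δ)))
      (f := fun τ => wk (1 - s) y τ * P.Q f τ t - wk (1 - s) y τ * P.Q f τ t')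
      (ae_Ioi (fun τ (hτ : 0 < τ) => ?_))
    · rw [integral_sub (P.wkQ_int_one f hs t y) (P.wkQ_int_one f hs t' y)] at h
      simp only [Pi.add_apply] at h
      rw [integral_add (i1.const_mul _) ((P.int_exp_rpow hs).const_mul _), integral_const_mul,
        integral_const_mul, ← hΓ1, ← hΓ2, hCD'] at h
      rw [N, N, ← mul_sub, abs_mul, abs_of_pos hc]
      have h3 : δ ≤ δ ^ (α + s) := self_le_rpow_of_le_one hδ0 h1 (by linarith)
      have h4 : (1 + mom) * H * δ ^ (α + s) * Γ1 + P₀.CD * ‖f‖ * δ * Γ2 ≤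
          ((1 + mom) * Γ1 + P₀.CD * Γ2) * (H + ‖f‖) * δ ^ (α + s) := by
        have h5 : P₀.CD * ‖f‖ * δ * Γ2 ≤ P₀.CD * ‖f‖ * δ ^ (α + s) * Γ2 := by gcongr
        have h6 : 0 ≤ (1 + mom) * Γ1 * ‖f‖ * δ ^ (α + s) := by positivity
        have h7 : 0 ≤ P₀.CD * Γ2 * H * δ ^ (α + s) := by positivity
        linarith
      calc _ ≤ cs s * (((1 + mom) * Γ1 + P₀.CD * Γ2) * (H + ‖f‖) * δ ^ (α + s)) :=
            mul_le_mul_of_nonneg_left (h.trans h4) hc.le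
        _ = cs s * ((1 + mom) * Γ1 + P₀.CD * Γ2) * (H + ‖f‖) * δ ^ (α + s) := by ring
        _ ≤ _ := by gcongr; linarith
    · rw [← mul_sub, norm_mul, norm_eq_abs, norm_eq_abs, abs_of_nonneg (wk_nonneg hτ)]
      calc _ ≤ τ ^ (-(1 - s)) * (rexp (-(l * τ)) *
            ((1 + mom) * H * δ ^ (α + s) * τ ^ (-(s / 2)) + P.CD * ‖f‖ * δ)) :=
            mul_le_mul (wk_le_rpow hτ) (P.Q_interp f hs hα hαs hH hτ t t') (abs_nonneg _)
              (by positivity)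
        _ = _ := by
          simp only [Pi.add_apply]
          rw [show s / 2 - 1 = -(1 - s) + -(s / 2) by ring, rpow_add hτ]; ring

end

end Pot

section Partial

variable {g gx gy : ℝ → ℝ → ℝ} {Ω : Set ℝ²}

lemma hasFDerivAt_of_partial (hΩ : IsOpen Ω)
    (h1 : ∀ p ∈ Ω, HasDerivAt (fun t => g t p.2) (gx p.1 p.2) p.1)
    (h2 : ∀ p ∈ Ω, HasDerivAt (g p.1) (gy p.1 p.2) p.2)
    (c1 : ContinuousOn (fun p : ℝ² => gx p.1 p.2) Ω)
    (c2 : ContinuousOn (fun p : ℝ² => gy p.1 p.2) Ω) {p : ℝ²} (hp : p ∈ Ω) :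
    HasFDerivAt (fun p : ℝ² => g p.1 p.2)
      (gx p.1 p.2 • ContinuousLinearMap.fst ℝ ℝ ℝ + gy p.1 p.2 • ContinuousLinearMap.snd ℝ ℝ ℝ) p := by
  have hn : ∀ᶠ q in 𝓝 p, q ∈ Ω := hΩ.mem_nhds hp
  have := (hasStrictFDerivAt_uncurry_coprod (𝕜 := ℝ) (u := p) (f := g)
    (f₁ := fun t y => ContinuousLinearMap.toSpanSingleton ℝ (gx t y))
    (f₂ := fun t y => ContinuousLinearMap.toSpanSingleton ℝ (gy t y))
    (hn.mono fun q hq => (h1 q hq).hasFDerivAt) (hn.mono fun q hq => (h2 q hq).hasFDerivAt)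
    ((ContinuousLinearMap.toSpanSingletonCLE (𝕜 := ℝ) (E := ℝ)).continuous.continuousAt.comp
      (c1.continuousAt (hΩ.mem_nhds hp)))
    ((ContinuousLinearMap.toSpanSingletonCLE (𝕜 := ℝ) (E := ℝ)).continuous.continuousAt.comp
      (c2.continuousAt (hΩ.mem_nhds hp)))).hasFDerivAt
  refine this.congr_fderiv ?_
  ext <;> simp [Function.HasUncurry.uncurry]

lemma contDiffOn_succ_of_partial {m : ℕ} (hΩ : IsOpen Ω)
    (h1 : ∀ p ∈ Ω, HasDerivAt (fun t => g t p.2) (gx p.1 p.2) p.1)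
    (h2 : ∀ p ∈ Ω, HasDerivAt (g p.1) (gy p.1 p.2) p.2)
    (c1 : ContDiffOn ℝ m (fun p : ℝ² => gx p.1 p.2) Ω)
    (c2 : ContDiffOn ℝ m (fun p : ℝ² => gy p.1 p.2) Ω) :
    ContDiffOn ℝ (m + 1) (fun p : ℝ² => g p.1 p.2) Ω := by
  have hd : ∀ p ∈ Ω, _ := fun p hp =>
    hasFDerivAt_of_partial hΩ h1 h2 c1.continuousOn c2.continuousOn hp
  rw [contDiffOn_succ_iff_fderiv_of_isOpen hΩ]
  refine ⟨fun p hp => (hd p hp).differentiableAt.differentiableWithinAt, by simp, ?_⟩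
  exact ((c1.smul contDiffOn_const).add (c2.smul contDiffOn_const)).congr
    fun p hp => (hd p hp).fderiv

end Partial

lemma isOpen_upper : IsOpen ℍ := isOpen_lt continuous_const continuous_snd

namespace Pot
variable {l Λ : ℝ} (P : Pot l Λ) {s : ℝ} (f : Cb) (hs : s ∈ Ioo (0:ℝ) 1)
include hs

lemma Nt_contOn : ContinuousOn (fun p : ℝ² => P.Nt s f p.1 p.2) ℍ :=
  continuousOn_const.mul (P.J'_cont (by linarith [hs.2]) f)

lemma Ny_contOn : ContinuousOn (fun p : ℝ² => P.Ny s f p.1 p.2) ℍ :=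
  ContinuousOn.mul (by fun_prop) (P.J_cont (by linarith [hs.2]) f)

lemma Nty_contOn : ContinuousOn (fun p : ℝ² => P.Nty s f p.1 p.2) ℍ :=
  ContinuousOn.mul (by fun_prop) (P.J'_cont (by linarith [hs.2]) f)

lemma Nyy_contOn : ContinuousOn (fun p : ℝ² => P.Nyy s f p.1 p.2) ℍ :=
  (ContinuousOn.mul (by fun_prop) (P.J_cont (by linarith [hs.2]) f)).add
    (ContinuousOn.mul (by fun_prop) (P.J_cont (by linarith [hs.2]) f))

lemma Ntt_contOn : ContinuousOn (fun p : ℝ² => P.Ntt s f p.1 p.2) ℍ := by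
  have hV : Continuous fun p : ℝ² => P.V p.1 := P.cont.comp continuous_fst
  have h1 := P.J_cont (k := 1 - s) (by linarith [hs.2]) f
  have h2 := P.J_cont (k := 2 - s) (by linarith [hs.2]) f
  have h3 := P.J_cont (k := 3 - s) (by linarith [hs.2]) f
  exact continuousOn_const.mul (((hV.continuousOn.mul h1).add (continuousOn_const.mul h2)).sub
    (ContinuousOn.mul (by fun_prop) h3))

lemma hasDerivAt_Nt_y {y : ℝ} (hy : 0 < y) (t : ℝ) :
    HasDerivAt (P.Nt s f t) (P.Nty s f t y) y := by
  have hk : 0 < 1 - s := by linarith [hs.2]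
  have hk2 : 0 < 2 - s := by linarith [hs.2]
  set b : ℝ → ℝ := fun τ => (4 / (y / 2) ^ 2) ^ (2 - s) * (2 - s) ^ (2 - s) *
    (τ ^ ((1:ℝ) - 1) * P.bQ (2 * ‖f‖) 0 f τ) * y
  have hb : IntegrableOn b (Ioi 0) :=
    ((P.integrableOn_bQ (p := 1) (H := 2 * ‖f‖) (α := 0) (by norm_num) one_pos f).const_mul _).mul_const _
  have h := (hasDerivAt_integral_of_dominated_loc_of_deriv_le (μ := volume.restrict (Ioi 0))
    (F := fun y τ => wk (1 - s) y τ * P.Q' f τ t)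
    (F' := fun y τ => -(y / 2) * (wk (2 - s) y τ * P.Q' f τ t)) (x₀ := y) (bound := b)
    (s := Ioo (y / 2) (2 * y)) (Ioo_mem_nhds (by linarith) (by linarith))
    (Eventually.of_forall fun y => P.wkQ'_meas _ f t y)
    (Integrable.mono' ((P.integrableOn_bQ (p := 1) (H := 2 * ‖f‖) (α := 0)
      (by norm_num) one_pos f).const_mul _) (P.wkQ'_meas _ f t y)
      (ae_Ioi (fun τ hτ =>
        P.wkQ'_le hk hy le_rfl f τ hτ t)))
    ((P.wkQ'_meas _ f t y).const_mul _)
    (ae_Ioi (fun τ hτ z hz => ?_)) hb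
    (ae_Ioi (fun τ hτ z hz => ?_))).2
  · refine (h.const_mul (cs s)).congr_deriv ?_
    rw [integral_const_mul, Nty, J']; ring
  · have hz0 : 0 < z := by linarith [hz.1]
    rw [norm_mul, norm_neg, norm_eq_abs, norm_eq_abs, abs_of_pos (by linarith : 0 < z / 2),
      mul_comm]
    refine mul_le_mul (P.wkQ'_le hk2 (by linarith) hz.1.le f τ hτ t) (by linarith [hz.2])
      (by linarith) ?_
    exact (abs_nonneg _).trans (P.wkQ'_le hk2 (by linarith) hz.1.le f τ hτ t)
  · refine ((hasDerivAt_wk_left (1 - s) z hτ).mul_const (P.Q' f τ t)).congr_deriv ?_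
    rw [show 1 - s + 1 = 2 - s by ring]; ring

lemma N_smooth : ContDiffOn ℝ 2 (fun p : ℝ² => P.N s f p.1 p.2) ℍ := by
  have e1 : ContDiffOn ℝ 1 (fun p : ℝ² => P.Nt s f p.1 p.2) ℍ := by
    refine contDiffOn_succ_of_partial (m := 0) isOpen_upper
      (fun p hp => P.hasDerivAt_Nt_t f hs hp p.1) (fun p hp => P.hasDerivAt_Nt_y f hs hp p.1) ?_ ?_
    · exact contDiffOn_zero.2 (P.Ntt_contOn f hs)
    · exact contDiffOn_zero.2 (P.Nty_contOn f hs)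
  have e2 : ContDiffOn ℝ 1 (fun p : ℝ² => P.Ny s f p.1 p.2) ℍ := by
    refine contDiffOn_succ_of_partial (m := 0) isOpen_upper
      (fun p hp => P.hasDerivAt_Ny_t f hs hp p.1) (fun p hp => P.hasDerivAt_Ny_y f hs hp p.1) ?_ ?_
    · exact contDiffOn_zero.2 (P.Nty_contOn f hs)
    · exact contDiffOn_zero.2 (P.Nyy_contOn f hs)
  exact contDiffOn_succ_of_partial (m := 1) isOpen_upper
      (fun p hp => P.hasDerivAt_N_t f hs hp p.1) (fun p hp => P.hasDerivAt_N_y f hs hp p.1) e1 e2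

omit hs in
lemma Ny_scale {y : ℝ} (hy : 0 < y) (t : ℝ) : y ^ (1 - 2 * s) * P.Ny s f t y =
    -(cs s / 2) * ∫ r in Ioi (0:ℝ), wk (2 - s) 1 r * P.Q f (y ^ 2 * r) t := by
  have hy2 : 0 < y ^ 2 := by positivity
  have h := integral_comp_mul_left_Ioi (fun τ => wk (2 - s) y τ * P.Q f τ t) 0 hy2
  rw [mul_zero, smul_eq_mul, inv_mul_eq_div, eq_div_iff hy2.ne'] at h
  rw [Ny, J, ← h]
  have e : ∀ r ∈ Ioi (0:ℝ), wk (2 - s) y (y ^ 2 * r) * P.Q f (y ^ 2 * r) t =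
      y ^ (2 * s - 4) * (wk (2 - s) 1 r * P.Q f (y ^ 2 * r) t) := by
    intro r (hr : 0 < r)
    rw [wk, wk, mul_rpow hy2.le hr.le, ← rpow_natCast y 2, ← rpow_mul hy.le,
      show ((2:ℕ):ℝ) * -(2 - s) = 2 * s - 4 by push_cast; ring, rpow_natCast,
      show y ^ 2 / (4 * (y ^ 2 * r)) = 1 ^ 2 / (4 * r) by field_simp]
    ring
  rw [setIntegral_congr_fun measurableSet_Ioi e, integral_const_mul]
  have e2 : y ^ (1 - 2 * s) * y * y ^ (2 * s - 4) * y ^ 2 = 1 := by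
    rw [← rpow_natCast y 2]
    nth_rewrite 2 [← rpow_one y]
    rw [← rpow_add hy, ← rpow_add hy, ← rpow_add hy]
    convert rpow_zero y using 2
    push_cast; ring
  linear_combination (-(cs s / 2) * ∫ r in Ioi (0:ℝ), wk (2 - s) 1 r * P.Q f (y ^ 2 * r) t) * e2

omit hs in
lemma wkQ_scale_le {y : ℝ} (t : ℝ) {r : ℝ} (hr : r ∈ Ioi (0:ℝ)) :
    ‖wk (2 - s) 1 r * P.Q f (y ^ 2 * r) t‖ ≤ wk (2 - s) 1 r * (P.KK * ‖f‖) := by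
  have hr0 : 0 < r := hr
  rw [norm_mul, norm_eq_abs, norm_eq_abs, abs_of_nonneg (wk_nonneg hr)]
  refine mul_le_mul_of_nonneg_left ((P.Q_le f (by positivity) t).trans ?_) (wk_nonneg hr)
  have := mul_nonneg P.KK_nonneg (norm_nonneg f)
  refine mul_le_of_le_one_left this ?_
  rw [exp_le_one_iff]
  have := mul_nonneg P.l_pos.le (mul_nonneg (sq_nonneg y) hr0.le)
  linarith

lemma yNy_le {y : ℝ} (hy : 0 < y) (t : ℝ) : |y ^ (1 - 2 * s) * P.Ny s f t y| ≤ P.KK * ‖f‖ := by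
  have h := norm_integral_le_of_norm_le ((integrableOn_wk_one hs).mul_const (P.KK * ‖f‖))
    (f := fun r => wk (2 - s) 1 r * P.Q f (y ^ 2 * r) t)
    (ae_Ioi (fun r hr => P.wkQ_scale_le f t hr))
  rw [P.Ny_scale f hy, abs_mul, abs_neg, abs_of_pos (half_pos (cs_pos hs))]
  rw [integral_mul_const] at h
  refine (mul_le_mul_of_nonneg_left h (half_pos (cs_pos hs)).le).trans (le_of_eq ?_)
  rw [cs]
  have := integral_wk_one_pos hs
  field_simp

lemma tendsto_yNy (t : ℝ) :
    Tendsto (fun y => y ^ (1 - 2 * s) * P.Ny s f t y) (𝓝[>] 0) (𝓝 (-f t)) := by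
  have h : Tendsto (fun y => ∫ r in Ioi (0:ℝ), wk (2 - s) 1 r * P.Q f (y ^ 2 * r) t) (𝓝[>] 0)
      (𝓝 (∫ r in Ioi (0:ℝ), wk (2 - s) 1 r * f t)) := by
    refine tendsto_integral_filter_of_dominated_convergence
      (fun r => wk (2 - s) 1 r * (P.KK * ‖f‖)) (Eventually.of_forall fun y => ?_)
      (Eventually.of_forall fun y =>
        ae_Ioi (fun r hr => P.wkQ_scale_le f t hr))
      ((integrableOn_wk_one hs).mul_const _) (ae_of_all _ fun r => ?_)
    · refine ((wk_contOn _ _).mul ?_).aestronglyMeasurable measurableSet_Ioi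
      exact ((P.Q_cont_left f t).comp (continuous_const.mul continuous_id)).continuousOn
    · have h1 : Continuous fun y : ℝ => P.Q f (y ^ 2 * r) t :=
        (P.Q_cont_left f t).comp (f := fun y : ℝ => y ^ 2 * r) (by fun_prop)
      have h2 := (h1.tendsto 0).mono_left (nhdsWithin_le_nhds (s := Ioi 0))
      rw [zero_pow two_ne_zero, zero_mul, P.Q_of_nonneg f le_rfl, P.Z_zero, mul_zero, neg_zero,
        exp_zero, one_mul] at h2
      exact h2.const_mul _
  have h2 := h.const_mul (-(cs s / 2))
  have e : -(cs s / 2) * ∫ r in Ioi (0:ℝ), wk (2 - s) 1 r * f t = -f t := by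
    rw [integral_mul_const, cs]
    have := integral_wk_one_pos hs
    field_simp
  rw [e] at h2
  exact h2.congr' (eventually_mem_nhdsWithin.mono fun y hy => (P.Ny_scale f hy t).symm)

lemma N_decay {ε : ℝ} (hε : 0 < ε) :
    ∃ Y > 0, ∀ t y, Y ≤ y → |P.N s f t y| ≤ ε ∧ |P.Nt s f t y| ≤ ε := by
  have hk : 0 < 1 - s := by linarith [hs.2]
  have hc := cs_pos hs
  set I1 := ∫ τ in Ioi (0:ℝ), rexp (-(l * τ)) * (P.KK * ‖f‖) with hI1
  set I2 := ∫ τ in Ioi (0:ℝ), τ ^ ((1:ℝ) - 1) * P.bQ (2 * ‖f‖) 0 f τ with hI2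
  have i1 : IntegrableOn (fun τ => rexp (-(l * τ)) * (P.KK * ‖f‖)) (Ioi 0) :=
    (integrableOn_exp_neg P.l_pos).mul_const _
  have i2 := P.integrableOn_bQ (p := 1) (H := 2 * ‖f‖) (α := 0) (by norm_num) one_pos f
  have key : ∀ t y, 0 < y →
      |P.N s f t y| ≤ (4 / y ^ 2) ^ (1 - s) * (cs s * ((1 - s) ^ (1 - s) * I1)) ∧
      |P.Nt s f t y| ≤ (4 / y ^ 2) ^ (1 - s) * (cs s * ((1 - s) ^ (1 - s) * I2)) := by
    intro t y hy
    have h1 := norm_integral_le_of_norm_le (f := fun τ => wk (1 - s) y τ * P.Q f τ t)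
      (i1.const_mul ((4 / y ^ 2) ^ (1 - s) * (1 - s) ^ (1 - s)))
      (ae_Ioi (fun τ hτ =>
        (P.wkQ_le hk hy le_rfl f τ hτ t).trans (le_of_eq (by ring))))
    have h2 := norm_integral_le_of_norm_le (f := fun τ => wk (1 - s) y τ * P.Q' f τ t)
      (i2.const_mul ((4 / y ^ 2) ^ (1 - s) * (1 - s) ^ (1 - s)))
      (ae_Ioi (fun τ hτ =>
        P.wkQ'_le hk hy le_rfl f τ hτ t))
    rw [integral_const_mul] at h1 h2
    constructor
    · rw [N, abs_mul, abs_of_pos hc]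
      exact (mul_le_mul_of_nonneg_left h1 hc.le).trans (le_of_eq (by ring))
    · rw [Nt, abs_mul, abs_of_pos hc]
      exact (mul_le_mul_of_nonneg_left h2 hc.le).trans (le_of_eq (by ring))
  have lim : ∀ C : ℝ, Tendsto (fun y : ℝ => (4 / y ^ 2) ^ (1 - s) * C) atTop (𝓝 0) := by
    intro C
    have h0 : Tendsto (fun y : ℝ => 4 / y ^ 2) atTop (𝓝 0) :=
      tendsto_const_nhds.div_atTop (tendsto_pow_atTop two_ne_zero)
    have h1 := (h0.rpow_const (p := 1 - s) (Or.inr hk.le)).mul_const C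
    rwa [zero_rpow hk.ne', zero_mul] at h1
  obtain ⟨Y, hY⟩ := eventually_atTop.1 (((lim (cs s * ((1 - s) ^ (1 - s) * I1))).eventually_lt_const hε).and
    ((lim (cs s * ((1 - s) ^ (1 - s) * I2))).eventually_lt_const hε))
  refine ⟨max Y 1, by positivity, fun t y hy => ?_⟩
  have hy0 : 0 < y := one_pos.trans_le ((le_max_right _ _).trans hy)
  have := hY y ((le_max_left _ _).trans hy)
  exact ⟨((key t y hy0).1).trans this.1.le, ((key t y hy0).2).trans this.2.le⟩

section Holder
variable {f} {H α : ℝ} (hα : α ∈ Icc (0:ℝ) 1) (hαs : 1 - 2 * s < α)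
  (hH : ∀ t t', |f t - f t'| ≤ H * |t - t'| ^ α)
include hα hH

omit hs in
lemma wkQ'_le_rpow (y : ℝ) {τ : ℝ} (hτ : 0 < τ) (t : ℝ) :
    |wk (1 - s) y τ * P.Q' f τ t| ≤ τ ^ (s - 1) * P.bQ H α f τ := by
  rw [abs_mul, abs_of_nonneg (wk_nonneg hτ), show s - 1 = -(1 - s) by ring]
  exact mul_le_mul (wk_le_rpow hτ) (P.Q'_le f hα hH hτ t) (abs_nonneg _) (by positivity)

include hαs

lemma Nt_cont : Continuous fun p : ℝ² => P.Nt s f p.1 p.2 := by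
  refine continuous_const.mul ?_
  rw [← continuousOn_univ, ← univ_prod_univ]
  exact P.J'_contOn (P.integrableOn_bQ (p := s) (by linarith) hs.1 f)
    (fun y _ τ hτ t => P.wkQ'_le_rpow hα hH y hτ t)

lemma hasDerivAt_N_t_all (t y : ℝ) : HasDerivAt (fun t => P.N s f t y) (P.Nt s f t y) t :=
  (P.hasDerivAt_J (P.integrableOn_bQ (p := s) (by linarith) hs.1 f)
    (fun τ hτ t => P.wkQ'_le_rpow hα hH y hτ t) t (P.wkQ_int_one f hs t y)).const_mul _

lemma Nt_le : ∃ C, ∀ t y, |P.Nt s f t y| ≤ C := by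
  refine ⟨cs s * ∫ τ in Ioi (0:ℝ), τ ^ (s - 1) * P.bQ H α f τ, fun t y => ?_⟩
  have h2 := norm_integral_le_of_norm_le (f := fun τ => wk (1 - s) y τ * P.Q' f τ t)
      (P.integrableOn_bQ (p := s) (by linarith) hs.1 f)
      (ae_Ioi (fun τ hτ =>
        P.wkQ'_le_rpow hα hH y hτ t))
  rw [Nt, abs_mul, abs_of_pos (cs_pos hs)]
  exact mul_le_mul_of_nonneg_left h2 (cs_pos hs).le

end Holder

lemma N_lin (c : ℝ) (f g : Cb) (t y : ℝ) :
    P.N s (c • f + g) t y = c * P.N s f t y + P.N s g t y := by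
  have e : ∀ τ, P.Q (c • f + g) τ t = c * P.Q f τ t + P.Q g τ t := fun τ => by
    simp only [Q, P.Z_lin, coe_add, coe_smul,
      Pi.add_apply, smul_eq_mul]; ring
  simp only [N, J, e]
  have h := integral_add ((P.wkQ_int_one f hs t y).const_mul c) (P.wkQ_int_one g hs t y)
  rw [integral_const_mul] at h
  rw [mul_left_comm, ← mul_add, ← h]
  congr 2; ext τ; ring

omit hs in
lemma N_odd {c : ℝ} (hV : ∀ t, P.V (c - t) = P.V t) {f : Cb} (hf : ∀ t, f (c - t) = -f t)
    (t y : ℝ) : P.N s f (c - t) y = -P.N s f t y := by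
  have e : ∀ τ, P.Q f τ (c - t) = -P.Q f τ t := fun τ => by
    simp only [Q, P.Z_odd hV hf]; ring
  simp only [N, J, e, mul_neg, integral_neg]

omit f in
lemma tendsto_N {Pk : ℕ → Pot l Λ} {fk : ℕ → Cb} {f : Cb} {M : ℝ}
    (hV : ∀ t, Tendsto (fun k => (Pk k).V t) atTop (𝓝 (P.V t)))
    (hf : ∀ t, Tendsto (fun k => fk k t) atTop (𝓝 (f t))) (hM : ∀ k, ‖fk k‖ ≤ M) (t y : ℝ) :
    Tendsto (fun k => (Pk k).N s (fk k) t y) atTop (𝓝 (P.N s f t y)) := by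
  refine Tendsto.const_mul _ (tendsto_integral_of_dominated_convergence
    (fun r => P.KK * M * (rexp (-(l * r)) * r ^ (-(1 - s))))
    (fun k => (Pk k).wkQ_meas _ _ t y) ((P.int_exp_rpow hs).const_mul _)
    (fun k => ae_Ioi (fun r (hr : 0 < r) => ?_))
    (ae_of_all _ fun r => ?_))
  · refine ((Pk k).wkQ_le_rpow (fk k) y hr t).trans ?_
    have := P.KK_nonneg
    have := hM k
    change P.KK * ‖fk k‖ * _ ≤ _
    gcongr
  · simp only [Q]
    exact ((P.tendsto_Z hV hf hM (r, t)).const_mul _).const_mul _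

end Pot

/-- Antisymmetry under reflection in the end points of `[-L, L]`. -/
def Refl (L : ℝ) (f : ℝ → ℝ) : Prop := ∀ t, f (2 * L - t) = -f t ∧ f (-(2 * L) - t) = -f t

/-- Symmetry under reflection in the end points of `[-L, L]`. -/
def ReflE (L : ℝ) (f : ℝ → ℝ) : Prop := ∀ t, f (2 * L - t) = f t ∧ f (-(2 * L) - t) = f t

lemma Refl.right {L : ℝ} {f : ℝ → ℝ} (h : Refl L f) : f L = 0 := by
  have := (h L).1; rw [show 2 * L - L = L by ring] at this; linarith

lemma Refl.left {L : ℝ} {f : ℝ → ℝ} (h : Refl L f) : f (-L) = 0 := by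
  have := (h (-L)).2; rw [show -(2 * L) - -L = -L by ring] at this; linarith

/-- The exponential weights. -/
noncomputable def ew (z τ : ℝ) : ℝ := rexp (-(z * max τ 0))

lemma ew_le {z : ℝ} (hz : 0 ≤ z) (τ : ℝ) : |ew z τ| ≤ 1 := by
  rw [ew, abs_exp, exp_le_one_iff]
  have := mul_nonneg hz (le_max_right τ 0)
  linarith

lemma ew_Wt {z : ℝ} (hz : 0 ≤ z) : Wt (ew z) (fun τ => -z * ew z τ) (1 + z) where
  cont := by unfold ew; fun_prop
  cont' := by unfold ew; fun_prop
  deriv τ hτ := by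
    have h : HasDerivAt (fun τ => rexp (-(z * τ))) _ τ :=
      ((hasDerivAt_id' τ).const_mul z).fun_neg.exp
    have h2 : HasDerivAt (ew z) _ τ := h.congr_of_eventuallyEq
      ((eventually_gt_nhds hτ).mono fun r (hr : 0 < r) => by rw [ew, max_eq_left hr.le])
    refine h2.congr_deriv ?_
    rw [ew, max_eq_left hτ.le]; ring
  le τ := (ew_le hz τ).trans (by linarith)
  le' τ := by
    rw [abs_mul, abs_neg, abs_of_nonneg hz]
    have := mul_le_mul_of_nonneg_left (ew_le hz τ) hz
    linarith

lemma integrableOn_rpow_div {s l : ℝ} (hs : s ∈ Ioo (0:ℝ) 1) (hl : 0 < l) :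
    IntegrableOn (fun z : ℝ => z ^ (-s) * (z + l)⁻¹) (Ioi 0) := by
  have hc : ContinuousOn (fun z : ℝ => z ^ (-s) * (z + l)⁻¹) (Ioi 0) :=
    ContinuousOn.mul (fun z (hz : 0 < z) => (continuousAt_rpow_const _ _ (Or.inl hz.ne')).continuousWithinAt)
      (ContinuousOn.inv₀ (by fun_prop) fun z (hz : 0 < z) => by positivity)
  rw [← Ioc_union_Ioi_eq_Ioi zero_le_one]
  refine IntegrableOn.union ?_ ?_
  · have h0 : IntegrableOn (fun z : ℝ => z ^ (-s)) (Ioc 0 1) :=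
      (intervalIntegrable_iff_integrableOn_Ioc_of_le zero_le_one).1
        (intervalIntegrable_rpow' (by linarith [hs.2]))
    refine Integrable.mono' (h0.mul_const l⁻¹)
      ((hc.mono Ioc_subset_Ioi_self).aestronglyMeasurable measurableSet_Ioc)
      ((ae_restrict_iff' measurableSet_Ioc).2 (ae_of_all _ fun z hz => ?_))
    have hz0 : 0 < z := hz.1
    rw [norm_eq_abs, abs_of_nonneg (by positivity)]
    gcongr; linarith
  · refine Integrable.mono' (integrableOn_Ioi_rpow_of_lt (a := -s - 1) (by linarith [hs.1]) one_pos)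
      ((hc.mono (Ioi_subset_Ioi zero_le_one)).aestronglyMeasurable
        measurableSet_Ioi) (ae_Ioi (fun z hz => ?_))
    have hz0 : 0 < z := one_pos.trans hz
    rw [norm_eq_abs, abs_of_nonneg (by positivity), rpow_sub_one hz0.ne', div_eq_mul_inv]
    gcongr; linarith

namespace Pot
variable {l Λ : ℝ} (P : Pot l Λ) {s : ℝ} (f : Cb)

/-- The resolvent of the one dimensional Schrödinger operator. -/
noncomputable def G (z : ℝ) (f : Cb) (t : ℝ) : ℝ := P.Phi (ew z) f t
noncomputable def G' (z : ℝ) (f : Cb) (t : ℝ) : ℝ := P.Phi' (ew z) (fun τ => -z * ew z τ) f t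

lemma hasDerivAt_G {z : ℝ} (hz : 0 ≤ z) (t : ℝ) : HasDerivAt (P.G z f) (P.G' z f t) t :=
  (P.hasDerivAt_Phi (ew_Wt hz) f t).1

lemma hasDerivAt_G' {z : ℝ} (hz : 0 ≤ z) (t : ℝ) :
    HasDerivAt (P.G' z f) ((P.V t + z) * P.G z f t - f t) t := by
  refine (P.hasDerivAt_Phi (ew_Wt hz) f t).2.congr_deriv ?_
  have : P.Phi (fun τ => -z * ew z τ) f t = -z * P.G z f t := by
    rw [G, Phi, Phi, ← integral_const_mul]; simp only [mul_assoc]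
  rw [this, G]
  simp [ew]; ring

lemma G_Refl {L z : ℝ} (hV : ReflE L P.V) {f : Cb} (hf : Refl L f) : Refl L (P.G z f) := by
  intro t
  have e1 : ∀ τ, P.Q f τ (2 * L - t) = -P.Q f τ t := fun τ => by
    simp only [Q, P.Z_odd (fun t => (hV t).1) (fun t => (hf t).1)]; ring
  have e2 : ∀ τ, P.Q f τ (-(2 * L) - t) = -P.Q f τ t := fun τ => by
    simp only [Q, P.Z_odd (fun t => (hV t).2) (fun t => (hf t).2)]; ring
  simp only [G, Phi, e1, e2, mul_neg, integral_neg, and_self]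

lemma ewQ_le {z : ℝ} (t : ℝ) {τ : ℝ} (hτ : 0 < τ) :
    ‖ew z τ * P.Q f τ t‖ ≤ rexp (-((z + l) * τ)) * (P.KK * ‖f‖) := by
  rw [norm_mul, norm_eq_abs, norm_eq_abs, ew, abs_exp, max_eq_left hτ.le]
  refine (mul_le_mul_of_nonneg_left (P.Q_le f hτ.le t) (exp_pos _).le).trans (le_of_eq ?_)
  rw [← mul_assoc, ← exp_add]; congr 2; ring

lemma G_le {z : ℝ} (hz : 0 < z) (t : ℝ) : |P.G z f t| ≤ (z + l)⁻¹ * (P.KK * ‖f‖) := by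
  have hzl : 0 < z + l := add_pos hz P.l_pos
  have h := norm_integral_le_of_norm_le ((integrableOn_exp_neg hzl).mul_const (P.KK * ‖f‖))
    (f := fun τ => ew z τ * P.Q f τ t)
    (ae_Ioi (fun τ hτ => P.ewQ_le f t hτ))
  rw [integral_mul_const, integral_exp_neg hzl] at h
  simpa [G, Phi] using h

lemma G_cont : ContinuousOn (fun p : ℝ² => P.G p.1 f p.2) (Ioi 0 ×ˢ univ) := by
  refine continuousOn_of_dominated (bound := fun τ => rexp (-(l * τ)) * (P.KK * ‖f‖))
    (fun p _ => ?_) (fun p hp => (ae_restrict_iff' measurableSet_Ioi).2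
      (ae_of_all _ fun τ (hτ : 0 < τ) => ?_))
    ((integrableOn_exp_neg P.l_pos).mul_const _) (ae_of_all _ fun τ => ?_)
  · have : Continuous (ew p.1) := by unfold ew; fun_prop
    exact (this.mul (P.Q_cont_left f p.2)).aestronglyMeasurable
  · refine (P.ewQ_le f _ hτ).trans ?_
    have := P.KK_nonneg
    have hp0 : 0 < p.1 := hp.1
    gcongr; linarith
  · have : Continuous fun p : ℝ² => ew p.1 τ := by unfold ew; fun_prop
    exact (this.mul ((P.Q_cont_right f τ).comp continuous_snd)).continuousOn

lemma G_ibp {L z : ℝ} (hz : 0 ≤ z) (hV : ReflE L P.V) {g : Cb} (hg : Refl L g) :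
    ∫ t in -L..L, f t * P.G z g t =
      ∫ t in -L..L, ((P.V t + z) * (P.G z f t * P.G z g t) + P.G' z f t * P.G' z g t) := by
  have c1 : ∀ f, Continuous (P.G z f) := fun f =>
    continuous_iff_continuousAt.2 fun t => (P.hasDerivAt_G f hz t).continuousAt
  have c2 : ∀ f, Continuous (P.G' z f) := fun f =>
    continuous_iff_continuousAt.2 fun t => (P.hasDerivAt_G' f hz t).continuousAt
  have hc := P.cont
  have cf := f.continuous
  have c1f := c1 f
  have c1g := c1 g
  have c2f := c2 f
  have c2g := c2 g
  have h := integral_eq_sub_of_hasDerivAt (a := -L) (b := L)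
    (f := fun t => P.G' z f t * P.G z g t)
    (f' := fun t => ((P.V t + z) * (P.G z f t * P.G z g t) + P.G' z f t * P.G' z g t) - f t * P.G z g t)
    (fun t _ => ((P.hasDerivAt_G' f hz t).fun_mul (P.hasDerivAt_G g hz t)).congr_deriv (by ring))
    (Continuous.intervalIntegrable (by fun_prop) _ _)
  rw [intervalIntegral.integral_sub (Continuous.intervalIntegrable (by fun_prop) _ _)
    (Continuous.intervalIntegrable (by fun_prop) _ _), (P.G_Refl hV hg).right,
    (P.G_Refl hV hg).left] at h
  linarith

lemma G_symm {L z : ℝ} (hz : 0 ≤ z) (hV : ReflE L P.V) {f g : Cb} (hf : Refl L f)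
    (hg : Refl L g) : ∫ t in -L..L, f t * P.G z g t = ∫ t in -L..L, g t * P.G z f t := by
  rw [P.G_ibp f hz hV hg, P.G_ibp g hz hV hf]
  congr 1; ext t; ring

lemma G_coer {L z : ℝ} (hL : 0 ≤ L) (hz : 0 ≤ z) (hV : ReflE L P.V) {f : Cb} (hf : Refl L f) :
    (z + l) * ∫ t in -L..L, P.G z f t ^ 2 ≤ ∫ t in -L..L, f t * P.G z f t := by
  rw [P.G_ibp f hz hV hf, ← intervalIntegral.integral_const_mul]
  have c1 : Continuous (P.G z f) :=
    continuous_iff_continuousAt.2 fun t => (P.hasDerivAt_G f hz t).continuousAt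
  have c2 : Continuous (P.G' z f) :=
    continuous_iff_continuousAt.2 fun t => (P.hasDerivAt_G' f hz t).continuousAt
  have hc := P.cont
  refine integral_mono_on (by linarith) (Continuous.intervalIntegrable (by fun_prop) _ _)
    (Continuous.intervalIntegrable (by fun_prop) _ _) fun t _ => ?_
  have h1 := P.lb t
  have h2 := P.l_pos
  nlinarith [sq_nonneg (P.G' z f t), mul_nonneg (by linarith : 0 ≤ P.V t - l) (sq_nonneg (P.G z f t))]

variable (hs : s ∈ Ioo (0:ℝ) 1)
include hs

lemma N_eq_G (t : ℝ) : P.N s f t 0 =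
    cs s / Gamma (1 - s) * ∫ z in Ioi (0:ℝ), z ^ (-s) * P.G z f t := by
  have h1s : 0 < 1 - s := by linarith [hs.2]
  have hΓ := Gamma_pos_of_pos h1s
  have hmeas : AEStronglyMeasurable (fun p : ℝ² => p.1 ^ (-s) * (ew p.1 p.2 * P.Q f p.2 t))
      ((volume.restrict (Ioi 0)).prod (volume.restrict (Ioi 0))) := by
    have m1 : Measurable fun p : ℝ² => p.1 ^ (-s) := measurable_fst.pow_const _
    have m2 : Continuous fun p : ℝ² => ew p.1 p.2 * P.Q f p.2 t := by
      have := P.Q_cont_left f t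
      have : Continuous fun p : ℝ² => P.Q f p.2 t := this.comp continuous_snd
      unfold ew; fun_prop
    exact (m1.mul m2.measurable).aestronglyMeasurable
  have i0 : ∀ τ : ℝ, 0 < τ → IntegrableOn (fun z : ℝ => z ^ (-s) * ew z τ) (Ioi 0) := by
    intro τ hτ
    refine (integrableOn_exp_rpow (c := τ) (p := -s) hτ (by linarith)).congr_fun
      (fun z _ => ?_) measurableSet_Ioi
    simp only [ew, max_eq_left hτ.le, mul_comm z τ]; ring
  have e0 : ∀ τ : ℝ, 0 < τ → ∫ z in Ioi (0:ℝ), z ^ (-s) * ew z τ = τ ^ (s - 1) * Gamma (1 - s) := by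
    intro τ hτ
    have := integral_rpow_mul_exp_neg_mul_Ioi h1s hτ
    rw [one_div, inv_rpow hτ.le, ← rpow_neg hτ.le, neg_sub] at this
    rw [← this]
    refine setIntegral_congr_fun measurableSet_Ioi fun z _ => ?_
    simp only [ew, max_eq_left hτ.le, mul_comm z τ]; congr 2; ring
  have hint : Integrable (fun p : ℝ² => p.1 ^ (-s) * (ew p.1 p.2 * P.Q f p.2 t))
      ((volume.restrict (Ioi 0)).prod (volume.restrict (Ioi 0))) := by
    rw [integrable_prod_iff' hmeas]
    refine ⟨ae_Ioi (fun τ hτ => ?_), ?_⟩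
    · simpa only [mul_assoc] using (i0 τ hτ).mul_const (P.Q f τ t)
    · have hi : IntegrableOn (fun τ => Gamma (1 - s) * ‖wk (1 - s) 0 τ * P.Q f τ t‖) (Ioi 0) :=
        (P.wkQ_int_one f hs t 0).norm.const_mul _
      refine hi.congr_fun
        (fun τ (hτ : 0 < τ) => ?_) measurableSet_Ioi
      simp only [wk]
      rw [show -(1 - s) = s - 1 by ring]
      simp only [← mul_assoc, norm_mul]
      rw [integral_mul_const]
      have : ∫ z in Ioi (0:ℝ), ‖z ^ (-s)‖ * ‖ew z τ‖ = ∫ z in Ioi (0:ℝ), z ^ (-s) * ew z τ := by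
        refine setIntegral_congr_fun measurableSet_Ioi fun z (hz : 0 < z) => ?_
        simp only [norm_eq_abs]
        rw [abs_of_nonneg (by positivity), abs_of_nonneg (show 0 ≤ ew z τ from (exp_pos _).le)]
      rw [this, e0 τ hτ, norm_eq_abs (τ ^ (s - 1)), abs_of_nonneg (by positivity)]
      simp only [neg_zero, ne_eq, OfNat.ofNat_ne_zero, not_false_eq_true, zero_pow, zero_div,
        exp_zero, norm_one]
      ring
  have sw := integral_integral_swap (f := fun z τ : ℝ => z ^ (-s) * (ew z τ * P.Q f τ t)) hint
  simp only [integral_const_mul] at sw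
  simp only [G, Phi, sw]
  have : ∫ τ in Ioi (0:ℝ), ∫ z in Ioi (0:ℝ), z ^ (-s) * (ew z τ * P.Q f τ t) =
      Gamma (1 - s) * P.J (1 - s) f t 0 := by
    rw [J, ← integral_const_mul]
    refine setIntegral_congr_fun measurableSet_Ioi fun τ (hτ : 0 < τ) => ?_
    simp only [← mul_assoc]
    rw [integral_mul_const, e0 τ hτ, wk, show -(1 - s) = s - 1 by ring]
    simp only [ne_eq, OfNat.ofNat_ne_zero, not_false_eq_true, zero_pow, zero_div, neg_zero,
      exp_zero]
    ring
  rw [this, N]; field_simp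

lemma integral_mul_N {L : ℝ} (hL : 0 ≤ L) (m : Cb) :
    IntegrableOn (fun z => z ^ (-s) * ∫ t in -L..L, m t * P.G z f t) (Ioi 0) ∧
    ∫ t in -L..L, m t * P.N s f t 0 =
    cs s / Gamma (1 - s) * ∫ z in Ioi (0:ℝ), z ^ (-s) * ∫ t in -L..L, m t * P.G z f t := by
  have hLL : -L ≤ L := by linarith
  have hmeas : AEStronglyMeasurable (fun p : ℝ² => m p.2 * (p.1 ^ (-s) * P.G p.1 f p.2))
      ((volume.restrict (Ioi 0)).prod (volume.restrict (Ioc (-L) L))) := by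
    rw [Measure.prod_restrict]
    have m1 : Measurable fun p : ℝ² => p.1 ^ (-s) := measurable_fst.pow_const _
    have m3 : Continuous fun p : ℝ² => m p.2 := m.continuous.comp continuous_snd
    refine m3.aestronglyMeasurable.mul (m1.aestronglyMeasurable.mul ?_)
    exact ((P.G_cont f).mono (prod_mono_right (subset_univ _))).aestronglyMeasurable
      (measurableSet_Ioi.prod measurableSet_Ioc)
  have hint : Integrable (fun p : ℝ² => m p.2 * (p.1 ^ (-s) * P.G p.1 f p.2))
      ((volume.restrict (Ioi 0)).prod (volume.restrict (Ioc (-L) L))) := by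
    have hb := ((integrableOn_rpow_div hs P.l_pos).mul_prod
      (integrableOn_const (s := Ioc (-L) L) (μ := volume) (C := ‖m‖ * (P.KK * ‖f‖)) (by simp)))
    refine Integrable.mono' hb hmeas ?_
    rw [Measure.prod_restrict]
    refine (ae_restrict_iff' (measurableSet_Ioi.prod measurableSet_Ioc)).2 (ae_of_all _ fun p hp => ?_)
    have hp0 : 0 < p.1 := hp.1
    rw [norm_mul, norm_mul, norm_eq_abs (p.1 ^ (-s)), abs_of_nonneg (by positivity)]
    calc _ ≤ ‖m‖ * (p.1 ^ (-s) * ((p.1 + l)⁻¹ * (P.KK * ‖f‖))) := by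
          gcongr
          · exact m.norm_coe_le_norm _
          · exact P.G_le f hp0 _
      _ = _ := by ring
  have e : ∀ z, z ^ (-s) * ∫ t in -L..L, m t * P.G z f t =
      ∫ t in Ioc (-L) L, m t * (z ^ (-s) * P.G z f t) := fun z => by
    rw [integral_of_le hLL, ← integral_const_mul]
    congr 1; ext t; ring
  simp only [e]
  refine ⟨hint.integral_prod_left, ?_⟩
  rw [integral_integral_swap (f := fun z t => m t * (z ^ (-s) * P.G z f t)) hint,
    integral_of_le hLL, ← integral_const_mul]
  congr 1; ext t
  rw [integral_const_mul, P.N_eq_G f hs]; ring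

/-- The trace of `N` as a bounded continuous function. -/
noncomputable def A (f : Cb) : Cb :=
  ofNormedAddCommGroup (fun t => P.N s f t 0)
    ((P.N_cont f hs).comp (f := fun t : ℝ => (t, (0:ℝ))) (by fun_prop)) (P.CN s * ‖f‖)
    fun t => P.N_le f hs t 0

lemma A_apply (t : ℝ) : P.A hs f t = P.N s f t 0 := rfl

lemma A_symm {L : ℝ} (hL : 0 ≤ L) (hV : ReflE L P.V) {f g : Cb} (hf : Refl L f)
    (hg : Refl L g) : ∫ t in -L..L, f t * P.A hs g t = ∫ t in -L..L, g t * P.A hs f t := by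
  simp only [A_apply]
  rw [(P.integral_mul_N g hs hL f).2, (P.integral_mul_N f hs hL g).2]
  congr 1
  refine setIntegral_congr_fun measurableSet_Ioi fun z (hz : 0 < z) => ?_
  simp only [P.G_symm hz.le hV hf hg]

omit P hs f in
/-- The constant in the coercivity inequality. -/
noncomputable def CA (l s : ℝ) : ℝ :=
  cs s / Gamma (1 - s) * ∫ z in Ioi (0:ℝ), z ^ (-s) * (z + l)⁻¹

omit P f in
lemma CA_pos (hl : 0 < l) : 0 < CA l s := by
  refine mul_pos (div_pos (cs_pos hs) (Gamma_pos_of_pos (by linarith [hs.2]))) ?_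
  refine (setIntegral_pos_iff_support_of_nonneg_ae ((ae_restrict_iff' measurableSet_Ioi).2
    (ae_of_all _ fun z (hz : 0 < z) => ?_)) (integrableOn_rpow_div hs hl)).2 ?_
  · simp only [Pi.zero_apply]; positivity
  · have : Function.support (fun z : ℝ => z ^ (-s) * (z + l)⁻¹) ∩ Ioi 0 = Ioi 0 := by
      rw [inter_eq_right]
      intro r (hr : 0 < r)
      simp only [Function.mem_support]; positivity
    rw [this]; simp

lemma A_coer {L : ℝ} (hL : 0 ≤ L) (hV : ReflE L P.V) {f : Cb} (hf : Refl L f) :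
    ∫ t in -L..L, P.A hs f t ^ 2 ≤ CA l s * ∫ t in -L..L, f t * P.A hs f t := by
  have hLL : -L ≤ L := by linarith
  have hC := CA_pos hs P.l_pos
  have hc' : 0 < cs s / Gamma (1 - s) :=
    div_pos (cs_pos hs) (Gamma_pos_of_pos (by linarith [hs.2]))
  set C := CA l s with hCdef
  set c' := cs s / Gamma (1 - s) with hc'def
  set m : Cb := C⁻¹ • P.A hs f with hm
  have cm : Continuous m := m.continuous
  have key : ∀ z > 0, 2 * (∫ t in -L..L, m t * P.G z f t) - (z + l)⁻¹ * ∫ t in -L..L, m t ^ 2 ≤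
      ∫ t in -L..L, f t * P.G z f t := by
    intro z hz
    refine le_trans ?_ (P.G_coer hL hz.le hV hf)
    have hzl : 0 < z + l := add_pos hz P.l_pos
    have c1 : Continuous (P.G z f) :=
      continuous_iff_continuousAt.2 fun t => (P.hasDerivAt_G f hz.le t).continuousAt
    have h : 0 ≤ ∫ t in -L..L, (z + l)⁻¹ * ((z + l) * P.G z f t - m t) ^ 2 :=
      intervalIntegral.integral_nonneg hLL fun t _ => by positivity
    have e : ∫ t in -L..L, (z + l)⁻¹ * ((z + l) * P.G z f t - m t) ^ 2 =
        ∫ t in -L..L, ((z + l) * P.G z f t ^ 2 - (2 * (m t * P.G z f t) - (z + l)⁻¹ * m t ^ 2)) := by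
      congr 1; ext t; field_simp; ring
    rw [e, intervalIntegral.integral_sub (Continuous.intervalIntegrable (by fun_prop) _ _)
      (Continuous.intervalIntegrable (by fun_prop) _ _),
      intervalIntegral.integral_sub (Continuous.intervalIntegrable (by fun_prop) _ _)
      (Continuous.intervalIntegrable (by fun_prop) _ _), intervalIntegral.integral_const_mul,
      intervalIntegral.integral_const_mul, intervalIntegral.integral_const_mul] at h
    linarith
  obtain ⟨i1, e1⟩ := P.integral_mul_N f hs hL m
  obtain ⟨i2, e2⟩ := P.integral_mul_N f hs hL f
  have i3 := (integrableOn_rpow_div hs P.l_pos).mul_const (∫ t in -L..L, m t ^ 2)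
  have h := setIntegral_mono_on ((i1.const_mul 2).sub i3) i2 measurableSet_Ioi
    fun z (hz : 0 < z) => by
      have := mul_le_mul_of_nonneg_left (key z hz) (by positivity : 0 ≤ z ^ (-s))
      refine le_trans (le_of_eq ?_) this
      simp only [Pi.sub_apply]; ring
  simp only [Pi.sub_apply] at h
  rw [integral_sub (i1.const_mul 2) i3, integral_const_mul, integral_mul_const] at h
  have h2 := mul_le_mul_of_nonneg_left h hc'.le
  have e3 : c' * ∫ z in Ioi (0:ℝ), z ^ (-s) * (z + l)⁻¹ = C := rfl
  have h3 : 2 * (∫ t in -L..L, m t * P.N s f t 0) - C * ∫ t in -L..L, m t ^ 2 ≤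
      ∫ t in -L..L, f t * P.N s f t 0 := by
    rw [e1, e2, ← e3]; linarith
  have e4 : ∫ t in -L..L, m t * P.N s f t 0 = C⁻¹ * ∫ t in -L..L, P.A hs f t ^ 2 := by
    rw [← intervalIntegral.integral_const_mul]
    congr 1; ext t
    simp [hm, A_apply]; ring
  have e5 : ∫ t in -L..L, m t ^ 2 = C⁻¹ ^ 2 * ∫ t in -L..L, P.A hs f t ^ 2 := by
    rw [← intervalIntegral.integral_const_mul]
    congr 1; ext t
    simp [hm, A_apply]; ring
  rw [e4, e5] at h3
  have h4 := mul_le_mul_of_nonneg_left h3 hC.le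
  simp only [A_apply] at h4 ⊢
  refine le_trans (le_of_eq ?_) h4
  field_simp; ring

end Pot

/-! ### Hyperbolic weights -/

lemma hasDerivAt_tanh (t : ℝ) : HasDerivAt tanh (1 / cosh t ^ 2) t := by
  have hc := (cosh_pos t).ne'
  have h : HasDerivAt (fun x => sinh x / cosh x) _ t :=
    (hasDerivAt_sinh t).fun_div (hasDerivAt_cosh t) hc
  have e : tanh = fun x => sinh x / cosh x := funext tanh_eq_sinh_div_cosh
  rw [e]
  refine h.congr_deriv ?_
  have := cosh_sq t
  field_simp
  linarith

lemma continuous_tanh : Continuous tanh :=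
  continuous_iff_continuousAt.2 fun t => (hasDerivAt_tanh t).continuousAt

lemma tanh_sq (t : ℝ) : tanh t ^ 2 = 1 - 1 / cosh t ^ 2 := by
  have hc := (cosh_pos t).ne'
  rw [tanh_eq_sinh_div_cosh, div_pow, sinh_sq]
  field_simp

lemma inv_cosh_sq_mem (t : ℝ) : 1 / cosh t ^ 2 ∈ Icc (0:ℝ) 1 := by
  have := one_le_cosh t
  refine ⟨by positivity, (div_le_one (by positivity)).2 (one_le_pow₀ this)⟩

lemma abs_tanh_le (t : ℝ) : |tanh t| ≤ 1 := by
  rw [← sq_le_one_iff_abs_le_one, tanh_sq]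
  linarith [(inv_cosh_sq_mem t).1]

/-- The weight `cosh^μ`. -/
noncomputable def qf (μ t : ℝ) : ℝ := cosh t ^ μ

/-- The potential `q''/q` for `q = cosh^μ`. -/
noncomputable def Vf (μ t : ℝ) : ℝ := μ ^ 2 * tanh t ^ 2 + μ / cosh t ^ 2

lemma qf_pos (μ t : ℝ) : 0 < qf μ t := rpow_pos_of_pos (cosh_pos t) _

lemma hasDerivAt_qf (μ t : ℝ) : HasDerivAt (qf μ) (μ * tanh t * qf μ t) t := by
  have h := (hasDerivAt_cosh t).rpow_const (p := μ) (Or.inl (cosh_pos t).ne')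
  refine h.congr_deriv ?_
  rw [qf, tanh_eq_sinh_div_cosh, rpow_sub (cosh_pos t), rpow_one]
  field_simp [(cosh_pos t).ne']

lemma hasDerivAt_qf' (μ t : ℝ) :
    HasDerivAt (fun x => μ * tanh x * qf μ x) (Vf μ t * qf μ t) t := by
  have h : HasDerivAt (fun x => μ * tanh x * qf μ x) _ t :=
    ((hasDerivAt_tanh t).const_mul μ).fun_mul (hasDerivAt_qf μ t)
  refine h.congr_deriv ?_
  rw [Vf]; ring

lemma continuous_qf (μ : ℝ) : Continuous (qf μ) :=
  continuous_iff_continuousAt.2 fun t => (hasDerivAt_qf μ t).continuousAt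

lemma qf_neg (μ t : ℝ) : qf μ (-t) = qf μ t := by simp [qf]

lemma one_le_qf {μ : ℝ} (hμ : 0 ≤ μ) (t : ℝ) : 1 ≤ qf μ t := one_le_rpow (one_le_cosh t) hμ

lemma qf_neg_le_one {m : ℝ} (hm : 0 ≤ m) (t : ℝ) : qf (-m) t ≤ 1 :=
  rpow_le_one_of_one_le_of_nonpos (one_le_cosh t) (by linarith)

lemma qf_mul (μ ν t : ℝ) : qf μ t * qf ν t = qf (μ + ν) t := (rpow_add (cosh_pos t) _ _).symm

lemma qf_zero (t : ℝ) : qf 0 t = 1 := rpow_zero _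

lemma qf_mul_neg (μ t : ℝ) : qf μ t * qf (-μ) t = 1 := by rw [qf_mul, add_neg_cancel, qf_zero]

lemma qf_neg_mul (μ t : ℝ) : qf (-μ) t * qf μ t = 1 := by rw [qf_mul, neg_add_cancel, qf_zero]

lemma qf_inv (μ t : ℝ) : qf (-μ) t = (qf μ t)⁻¹ := rpow_neg (cosh_pos t).le _

lemma qf_le_of_abs_le {μ : ℝ} (hμ : 0 ≤ μ) {t t' : ℝ} (h : |t| ≤ |t'|) : qf μ t ≤ qf μ t' :=
  rpow_le_rpow (cosh_pos t).le (cosh_le_cosh.2 h) hμ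

lemma qf_le_exp {μ : ℝ} (hμ : 0 ≤ μ) (t x : ℝ) : qf μ x ≤ rexp (μ * |x - t|) * qf μ t := by
  have : cosh x ≤ rexp |x - t| * cosh t := by
    rw [cosh_eq, cosh_eq]
    have h1 : rexp x ≤ rexp |x - t| * rexp t := by
      rw [← exp_add]; exact exp_le_exp.2 (by linarith [le_abs_self (x - t)])
    have h2 : rexp (-x) ≤ rexp |x - t| * rexp (-t) := by
      rw [← exp_add]; exact exp_le_exp.2 (by linarith [neg_abs_le (x - t)])
    linarith
  have h := rpow_le_rpow (cosh_pos x).le this hμ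
  rw [mul_rpow (exp_pos _).le (cosh_pos t).le, ← exp_mul] at h
  rwa [mul_comm μ]

lemma tendsto_qf {μ : ℝ} (hμ : 0 < μ) : Tendsto (qf μ) atTop atTop := by
  have h : Tendsto cosh atTop atTop := by
    refine tendsto_atTop_mono (fun t => ?_) (tendsto_exp_atTop.atTop_div_const (by norm_num : (0:ℝ) < 2))
    rw [cosh_eq]; linarith [exp_pos (-t)]
  exact (tendsto_rpow_atTop hμ).comp h

lemma Vf_eq (μ t : ℝ) : Vf μ t = μ ^ 2 + (μ - μ ^ 2) * (1 / cosh t ^ 2) := by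
  rw [Vf, tanh_sq]; ring

lemma continuous_Vf (μ : ℝ) : Continuous (Vf μ) := by
  unfold Vf
  have := continuous_tanh
  refine Continuous.add (by fun_prop) (Continuous.div (by fun_prop) (by fun_prop) fun t => ?_)
  have := cosh_pos t
  positivity

lemma Vf_lb (μ t : ℝ) : min μ (μ ^ 2) ≤ Vf μ t := by
  have h := inv_cosh_sq_mem t
  rw [Vf_eq]
  rcases le_total μ (μ ^ 2) with h' | h'
  · rw [min_eq_left h']; nlinarith [h.2]
  · rw [min_eq_right h']; nlinarith [h.1]

lemma Vf_ub (μ t : ℝ) : Vf μ t ≤ max μ (μ ^ 2) := by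
  have h := inv_cosh_sq_mem t
  rw [Vf_eq]
  rcases le_total μ (μ ^ 2) with h' | h'
  · rw [max_eq_right h']; nlinarith [h.1]
  · rw [max_eq_left h']; nlinarith [h.2]

/-- The odd primitive of `cosh^{-2μ}`. -/
noncomputable def Hf (μ t : ℝ) : ℝ := ∫ x in (0:ℝ)..t, qf (-(2 * μ)) x

lemma hasDerivAt_Hf (μ t : ℝ) : HasDerivAt (Hf μ) (qf (-(2 * μ)) t) t :=
  integral_hasDerivAt_right ((continuous_qf _).intervalIntegrable _ _)
    ((continuous_qf _).stronglyMeasurableAtFilter _ _) (continuous_qf _).continuousAt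

lemma continuous_Hf (μ : ℝ) : Continuous (Hf μ) :=
  continuous_iff_continuousAt.2 fun t => (hasDerivAt_Hf μ t).continuousAt

lemma Hf_zero (μ : ℝ) : Hf μ 0 = 0 := by simp [Hf]

lemma Hf_neg (μ t : ℝ) : Hf μ (-t) = -Hf μ t := by
  have := integral_comp_neg (a := 0) (b := t) (qf (-(2 * μ)))
  simp only [qf_neg, neg_zero] at this
  rw [Hf, Hf, this, integral_symm]

lemma Hf_strictMono (μ : ℝ) : StrictMono (Hf μ) :=
  strictMono_of_deriv_pos fun t => by rw [(hasDerivAt_Hf μ t).deriv]; exact qf_pos _ _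

lemma Hf_pos (μ : ℝ) {t : ℝ} (ht : 0 < t) : 0 < Hf μ t := by
  have := Hf_strictMono μ ht
  rwa [Hf_zero] at this

/-- A constant in the tail estimate of `Hf`. -/
noncomputable def K0 (μ : ℝ) : ℝ := 2 ^ (2 * μ) / (2 * μ)

lemma K0_pos {μ : ℝ} (hμ : 0 < μ) : 0 < K0 μ := by unfold K0; positivity

lemma Hf_tail_exp {μ : ℝ} (hμ : 0 < μ) {t x : ℝ} (htx : t ≤ x) :
    Hf μ x - Hf μ t ≤ K0 μ * (rexp (-(2 * μ * t)) - rexp (-(2 * μ * x))) := by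
  have hd : ∀ t, HasDerivAt (fun t => Hf μ t + K0 μ * rexp (-(2 * μ * t)))
      (qf (-(2 * μ)) t - 2 ^ (2 * μ) * rexp (-(2 * μ * t))) t := fun t => by
    have h1 : HasDerivAt (fun t => -(2 * μ * t)) (-(2 * μ)) t := by
      simpa using ((hasDerivAt_id t).const_mul (2 * μ)).fun_neg
    have h : HasDerivAt (fun t => Hf μ t + K0 μ * rexp (-(2 * μ * t))) _ t :=
      (hasDerivAt_Hf μ t).fun_add (h1.exp.const_mul (K0 μ))
    refine h.congr_deriv ?_
    rw [K0]; field_simp; ring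
  have h := (antitone_of_deriv_nonpos (fun t => (hd t).differentiableAt) fun t => by
    rw [(hd t).deriv, sub_nonpos]
    have h1 : rexp t / 2 ≤ cosh t := by rw [cosh_eq]; linarith [exp_pos (-t)]
    have h2 := rpow_le_rpow_of_nonpos (z := -(2 * μ)) (by positivity) h1 (by linarith)
    refine h2.trans (le_of_eq ?_)
    rw [div_rpow (exp_pos t).le (by norm_num), ← exp_mul, rpow_neg (by norm_num : (0:ℝ) ≤ 2)]
    rw [div_inv_eq_mul, mul_comm]; congr 2; ring) htx
  simp only at h
  linarith

lemma Hf_tail {μ : ℝ} (hμ : 0 < μ) {t x : ℝ} (ht : 0 ≤ t) (htx : t ≤ x) :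
    Hf μ x - Hf μ t ≤ K0 μ * qf (-(2 * μ)) t := by
  refine (Hf_tail_exp hμ htx).trans (mul_le_mul_of_nonneg_left ?_ (K0_pos hμ).le)
  have h1 : cosh t ≤ rexp t := by
    rw [cosh_eq]; linarith [exp_le_exp.2 (by linarith : -t ≤ t)]
  have h2 := rpow_le_rpow_of_nonpos (z := -(2 * μ)) (cosh_pos t) h1 (by linarith)
  rw [← exp_mul] at h2
  rw [qf]
  refine le_trans ?_ h2
  have : t * -(2 * μ) = -(2 * μ * t) := by ring
  rw [this]
  linarith [exp_pos (-(2 * μ * x))]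

lemma Hf_le {μ : ℝ} (hμ : 0 < μ) (t : ℝ) : Hf μ t ≤ K0 μ := by
  rcases le_total 0 t with h | h
  · have := Hf_tail_exp hμ h
    simp only [Hf_zero, mul_zero, neg_zero, exp_zero] at this
    nlinarith [K0_pos hμ, exp_pos (-(2 * μ * t))]
  · have := (Hf_strictMono μ).monotone h
    rw [Hf_zero] at this
    linarith [K0_pos hμ]

/-- The limit of `Hf` at infinity. -/
noncomputable def Hinf (μ : ℝ) : ℝ := ⨆ t, Hf μ t

lemma tendsto_Hf {μ : ℝ} (hμ : 0 < μ) : Tendsto (Hf μ) atTop (𝓝 (Hinf μ)) :=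
  tendsto_atTop_ciSup (Hf_strictMono μ).monotone
    ⟨K0 μ, by rintro _ ⟨t, rfl⟩; exact Hf_le hμ t⟩

lemma Hf_le_Hinf {μ : ℝ} (hμ : 0 < μ) (t : ℝ) : Hf μ t ≤ Hinf μ :=
  le_ciSup (f := Hf μ) ⟨K0 μ, by rintro _ ⟨t, rfl⟩; exact Hf_le hμ t⟩ t

lemma Hinf_pos {μ : ℝ} (hμ : 0 < μ) : 0 < Hinf μ := (Hf_pos μ one_pos).trans_le (Hf_le_Hinf hμ 1)

/-! ### Folding onto a strip -/

/-- The folding map of `ℝ` onto `[-L, L]`. -/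
noncomputable def fold (L t : ℝ) : ℝ := 2 * L / π * arcsin (sin (π * t / (2 * L)))

/-- The odd extension of a function on `[-L, L]` by reflections. -/
noncomputable def ext (L : ℝ) (g : ℝ → ℝ) (t : ℝ) : ℝ :=
  if 0 ≤ cos (π * t / (2 * L)) then g (fold L t) else -g (fold L t)

section
variable {L : ℝ} (hL : 0 < L)
include hL

lemma fold_eq {t : ℝ} (ht : |t| ≤ L) : fold L t = t := by
  have h := abs_le.1 ht
  have hp := pi_pos
  rw [fold, arcsin_sin]
  · field_simp
  · rw [le_div_iff₀ (by positivity)]; nlinarith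
  · rw [div_le_iff₀ (by positivity)]; nlinarith

lemma abs_fold_le (t : ℝ) : |fold L t| ≤ L := by
  have hp := pi_pos
  rw [fold, abs_mul, abs_of_pos (by positivity)]
  have := abs_le.2 ⟨(arcsin_mem_Icc (sin (π * t / (2 * L)))).1 |> fun h => by linarith,
    (arcsin_mem_Icc (sin (π * t / (2 * L)))).2⟩
  calc 2 * L / π * |arcsin (sin (π * t / (2 * L)))| ≤ 2 * L / π * (π / 2) := by gcongr
    _ = L := by field_simp

omit hL in
lemma continuous_fold : Continuous (fold L) := by
  unfold fold
  exact (continuous_arcsin.comp (by fun_prop)).const_mul _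

lemma arg_sub (t : ℝ) : π * (2 * L - t) / (2 * L) = π - π * t / (2 * L) := by field_simp

lemma arg_sub' (t : ℝ) : π * (-(2 * L) - t) / (2 * L) = -(π * t / (2 * L) + π) := by
  field_simp; ring

lemma reflE_fold : ReflE L (fold L) := fun t => by
  constructor
  · rw [fold, fold, arg_sub hL, sin_pi_sub]
  · rw [fold, fold, arg_sub' hL, sin_neg, sin_add_pi, neg_neg]

omit hL in
lemma abs_arcsin_sin_sub_le (x y : ℝ) : |arcsin (sin x) - arcsin (sin y)| ≤ |x - y| := by
  have h1 := arcsin_mem_Icc (sin x)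
  have h2 := arcsin_mem_Icc (sin y)
  rcases le_total π |x - y| with h | h
  · rw [abs_le]; constructor <;> linarith [h1.1, h1.2, h2.1, h2.2]
  · by_contra! hc
    have h3 : |arcsin (sin x) - arcsin (sin y)| ≤ π := by
      rw [abs_le]; constructor <;> linarith [h1.1, h1.2, h2.1, h2.2]
    have h4 := strictAntiOn_cos ⟨abs_nonneg _, h⟩ ⟨abs_nonneg _, h3⟩ hc
    rw [cos_abs, cos_abs, cos_sub, cos_sub, sin_arcsin (neg_one_le_sin _) (sin_le_one _),
      sin_arcsin (neg_one_le_sin _) (sin_le_one _), cos_arcsin, cos_arcsin,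
      ← abs_cos_eq_sqrt_one_sub_sin_sq, ← abs_cos_eq_sqrt_one_sub_sin_sq, ← abs_mul] at h4
    linarith [le_abs_self (cos x * cos y)]

lemma abs_fold_sub_le (t t' : ℝ) : |fold L t - fold L t'| ≤ |t - t'| := by
  have hp := pi_pos
  rw [fold, fold, ← mul_sub, abs_mul, abs_of_pos (by positivity)]
  calc _ ≤ 2 * L / π * |π * t / (2 * L) - π * t' / (2 * L)| := by
        exact mul_le_mul_of_nonneg_left (abs_arcsin_sin_sub_le _ _) (by positivity)
    _ = 2 * L / π * |π / (2 * L) * (t - t')| := by congr 2; field_simp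
    _ = |t - t'| := by
      rw [abs_mul, abs_of_pos (by positivity : 0 < π / (2 * L))]; field_simp

lemma fold_of_cos {t : ℝ} (h : cos (π * t / (2 * L)) = 0) : fold L t = L ∨ fold L t = -L := by
  have hp := pi_pos
  have h2 := sin_sq_add_cos_sq (π * t / (2 * L))
  rw [h] at h2
  rcases mul_self_eq_one_iff.1 (by linarith : sin (π * t / (2 * L)) * sin (π * t / (2 * L)) = 1) with h3 | h3
  · left; rw [fold, h3, arcsin_one]; field_simp
  · right; rw [fold, h3, arcsin_neg, arcsin_one]; field_simp

omit hL in
lemma abs_ext (g : ℝ → ℝ) (t : ℝ) : |ext L g t| = |g (fold L t)| := by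
  unfold ext; split_ifs <;> simp

lemma ext_of_cos {g : ℝ → ℝ} (h1 : g L = 0) (h2 : g (-L) = 0) {t : ℝ}
    (h : cos (π * t / (2 * L)) = 0) : ext L g t = 0 := by
  rw [← abs_eq_zero, abs_ext]
  rcases fold_of_cos hL h with h | h <;> simp [h, h1, h2]

lemma ext_eq (g : ℝ → ℝ) {t : ℝ} (ht : |t| ≤ L) : ext L g t = g t := by
  have h := abs_le.1 ht
  have hp := pi_pos
  rw [ext, if_pos, fold_eq hL ht]
  apply cos_nonneg_of_neg_pi_div_two_le_of_le
  · rw [le_div_iff₀ (by positivity)]; nlinarith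
  · rw [div_le_iff₀ (by positivity)]; nlinarith

lemma refl_ext {g : ℝ → ℝ} (h1 : g L = 0) (h2 : g (-L) = 0) : Refl L (ext L g) := by
  have key : ∀ t t' : ℝ, cos (π * t' / (2 * L)) = -cos (π * t / (2 * L)) → fold L t' = fold L t →
      ext L g t' = -ext L g t := by
    intro t t' hc hf
    rcases lt_trichotomy (cos (π * t / (2 * L))) 0 with h | h | h
    · rw [ext, ext, if_pos (by linarith), if_neg (by linarith), hf, neg_neg]
    · rw [ext_of_cos hL h1 h2 h, ext_of_cos hL h1 h2 (by rw [hc, h, neg_zero]), neg_zero]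
    · rw [ext, ext, if_neg (by linarith), if_pos h.le, hf]
  refine fun t => ⟨key _ _ ?_ (reflE_fold hL t).1, key _ _ ?_ (reflE_fold hL t).2⟩
  · rw [arg_sub hL, cos_pi_sub]
  · rw [arg_sub' hL, cos_neg, cos_add_pi]

lemma continuous_ext {g : ℝ → ℝ} (hg : Continuous g) (h1 : g L = 0) (h2 : g (-L) = 0) :
    Continuous (ext L g) := by
  have hc := hg.comp (continuous_fold (L := L))
  refine Continuous.if_le hc hc.neg continuous_const (by fun_prop) fun t ht => ?_
  rcases fold_of_cos hL ht.symm with h | h <;> simp [h, h1, h2]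

lemma exists_ext {g : ℝ → ℝ} (hg : Continuous g) (h1 : g L = 0) (h2 : g (-L) = 0) :
    ∃ f : Cb, ∀ t, f t = ext L g t := by
  obtain ⟨C, hC⟩ := isCompact_Icc.exists_bound_of_continuousOn (s := Icc (-L) L) hg.continuousOn
  exact ⟨ofNormedAddCommGroup (ext L g) (continuous_ext hL hg h1 h2) C
    fun t => by
      rw [norm_eq_abs, abs_ext]; exact hC _ (abs_le.1 (abs_fold_le hL t)), fun t => rfl⟩

lemma ext_holder {g : ℝ → ℝ} (h1 : g L = 0) (h2 : g (-L) = 0)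
    {H α : ℝ} (hH : 0 ≤ H) (hα : 0 ≤ α)
    (hg : ∀ t ∈ Icc (-L) L, ∀ t' ∈ Icc (-L) L, |g t - g t'| ≤ H * |t - t'| ^ α) (t t' : ℝ) :
    |ext L g t - ext L g t'| ≤ 2 * H * |t - t'| ^ α := by
  have hm := fun t => abs_le.1 (abs_fold_le hL t)
  have hb : ∀ t t', |g (fold L t) - g (fold L t')| ≤ H * |t - t'| ^ α := fun t t' =>
    (hg _ (hm t) _ (hm t')).trans (mul_le_mul_of_nonneg_left
      (rpow_le_rpow (abs_nonneg _) (abs_fold_sub_le hL t t') hα) hH)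
  have hn : 0 ≤ H * |t - t'| ^ α := by positivity
  have hop : cos (π * t / (2 * L)) * cos (π * t' / (2 * L)) ≤ 0 →
      |ext L g t - ext L g t'| ≤ 2 * H * |t - t'| ^ α := by
    intro h
    have hcc : Continuous fun t : ℝ => cos (π * t / (2 * L)) := by fun_prop
    obtain ⟨z, hz, hz0⟩ : ∃ z ∈ uIcc t t', cos (π * z / (2 * L)) = 0 := by
      refine intermediate_value_uIcc hcc.continuousOn ?_
      rw [mem_uIcc]
      rcases le_total 0 (cos (π * t / (2 * L))) with h0 | h0 <;>
      rcases le_total 0 (cos (π * t' / (2 * L))) with h0' | h0'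
      · rcases (mul_nonneg h0 h0').antisymm h |>.symm |> mul_eq_zero.1 with h3 | h3
        · left; constructor <;> linarith
        · right; constructor <;> linarith
      · right; exact ⟨h0', h0⟩
      · left; exact ⟨h0, h0'⟩
      · rcases (mul_nonneg_of_nonpos_of_nonpos h0 h0').antisymm h |>.symm |> mul_eq_zero.1
          with h3 | h3
        · right; constructor <;> linarith
        · left; constructor <;> linarith
    have hgz : g (fold L z) = 0 := by rcases fold_of_cos hL hz0 with h | h <;> simp [h, h1, h2]
    have e1 : |ext L g t| ≤ H * |t - t'| ^ α := by
      have := hb t z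
      rw [hgz, sub_zero] at this
      rw [abs_ext]
      refine this.trans (mul_le_mul_of_nonneg_left (rpow_le_rpow (abs_nonneg _) ?_ hα) hH)
      rw [abs_sub_comm, abs_sub_comm t]; exact abs_sub_left_of_mem_uIcc hz
    have e2 : |ext L g t'| ≤ H * |t - t'| ^ α := by
      have := hb t' z
      rw [hgz, sub_zero] at this
      rw [abs_ext]
      refine this.trans (mul_le_mul_of_nonneg_left (rpow_le_rpow (abs_nonneg _) ?_ hα) hH)
      rw [abs_sub_comm t]; exact abs_sub_right_of_mem_uIcc hz
    linarith [abs_sub (ext L g t) (ext L g t')]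
  rcases le_or_gt 0 (cos (π * t / (2 * L))) with h0 | h0 <;>
  rcases le_or_gt 0 (cos (π * t' / (2 * L))) with h0' | h0'
  · rw [ext, ext, if_pos h0, if_pos h0']; linarith [hb t t']
  · exact hop (mul_nonpos_of_nonneg_of_nonpos h0 h0'.le)
  · exact hop (mul_nonpos_of_nonpos_of_nonneg h0.le h0')
  · rw [ext, ext, if_neg (not_le.2 h0), if_neg (not_le.2 h0'), ← neg_sub', abs_neg]
    linarith [hb t t']

end

/-- The lower constant for the potentials `Vf μ`. -/
noncomputable def lf (μ : ℝ) : ℝ := min μ (μ ^ 2) / 2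

/-- The upper constant for the potentials `Vf μ`. -/
noncomputable def Lf (μ : ℝ) : ℝ := max μ (μ ^ 2)

lemma lf_pos {μ : ℝ} (hμ : 0 < μ) : 0 < lf μ := by
  have : 0 < min μ (μ ^ 2) := lt_min hμ (by positivity)
  unfold lf; positivity

/-- The potential `Vf μ` composed with a continuous map, as an admissible potential. -/
noncomputable def potOf (μ : ℝ) (hμ : 0 < μ) (θ : ℝ → ℝ) (hθ : Continuous θ) :
    Pot (lf μ) (Lf μ) where
  V := fun t => Vf μ (θ t)
  cont := (continuous_Vf μ).comp hθ
  l_pos := lf_pos hμ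
  lb := fun t => by have := Vf_lb μ (θ t); unfold lf; linarith
  ub := fun t => Vf_ub μ _

/-! ### Maximum principles -/

lemma deriv_of_isLocalMin {f f' : ℝ → ℝ} {f'' x : ℝ} (hf : ∀ᶠ z in 𝓝 x, HasDerivAt f (f' z) z)
    (hf' : HasDerivAt f' f'' x) (hm : IsLocalMin f x) : f' x = 0 ∧ 0 ≤ f'' := by
  have h0 : f' x = 0 := hm.hasDerivAt_eq_zero hf.self_of_nhds
  refine ⟨h0, ?_⟩
  by_contra! h
  have e : deriv f =ᶠ[𝓝 x] f' := hf.mono fun z hz => hz.deriv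
  have e2 : deriv (deriv f) x = f'' := by rw [e.deriv_eq, hf'.deriv]
  have hM := isLocalMax_of_deriv_deriv_neg (by rwa [e2]) (by rw [hf.self_of_nhds.deriv, h0])
    hf.self_of_nhds.continuousAt
  have hc : f =ᶠ[𝓝 x] fun _ => f x := by
    filter_upwards [hM, hm] with z h1 h2 using le_antisymm h1 h2
  have : deriv f =ᶠ[𝓝 x] fun _ => 0 := by
    filter_upwards [hc.eventuallyEq_nhds] with z hz
    rw [hz.deriv_eq, deriv_const]
  rw [this.deriv_eq, deriv_const] at e2
  exact h.ne e2.symm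

lemma boundary_min {f f' : ℝ → ℝ} {a g Y : ℝ} (hY : 0 < Y) (hc : ContinuousOn f (Ici 0))
    (hf : ∀ y > 0, HasDerivAt f (f' y) y) (hm : ∀ y ≥ 0, y ≤ Y → f 0 ≤ f y)
    (hg : Tendsto (fun y => y ^ a * f' y) (𝓝[>] 0) (𝓝 g)) : 0 ≤ g := by
  by_contra! h
  have h1 := hg.eventually (gt_mem_nhds h)
  obtain ⟨δ, hδ, hd⟩ := mem_nhdsGT_iff_exists_Ioo_subset.1 h1
  have hδ' : 0 < δ := hδ
  have hm' : 0 < min (δ / 2) Y := by positivity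
  have h2 : StrictAntiOn f (Icc 0 (min (δ / 2) Y)) := by
    refine strictAntiOn_of_deriv_neg (convex_Icc _ _) (hc.mono fun y hy => hy.1) fun y hy => ?_
    rw [interior_Icc] at hy
    have h3 : y ^ a * f' y < 0 := hd ⟨hy.1, by linarith [hy.2, min_le_left (δ / 2) Y]⟩
    rw [(hf y hy.1).deriv]
    exact (pos_iff_neg_of_mul_neg h3).1 (rpow_pos_of_pos hy.1 _)
  have h3 := h2 (left_mem_Icc.2 hm'.le) (right_mem_Icc.2 hm'.le) hm'
  linarith [hm _ hm'.le (min_le_right _ _)]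

lemma exists_neg_min {E : Type*} [TopologicalSpace E] {K : Set E} (hK : IsCompact K)
    {M : E × ℝ → ℝ} (hM : ContinuousOn M (K ×ˢ Ici 0))
    (hinf : ∀ ε > 0, ∃ Y, ∀ x ∈ K, ∀ y ≥ Y, -ε ≤ M (x, y)) {x₀ : E} (hx : x₀ ∈ K) {y₀ : ℝ}
    (hy : 0 ≤ y₀) (hneg : M (x₀, y₀) < 0) :
    ∃ x ∈ K, ∃ y ≥ 0, M (x, y) < 0 ∧ ∀ x' ∈ K, ∀ y' ≥ 0, M (x, y) ≤ M (x', y') := by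
  obtain ⟨Y, hY⟩ := hinf (-M (x₀, y₀) / 2) (by linarith)
  have hc := hK.prod (isCompact_Icc (a := (0:ℝ)) (b := max Y y₀))
  have hmem : (x₀, y₀) ∈ K ×ˢ Icc (0:ℝ) (max Y y₀) := ⟨hx, hy, le_max_right _ _⟩
  obtain ⟨⟨x, y⟩, ⟨hx1, hy1⟩, hmin⟩ := hc.exists_isMinOn ⟨_, hmem⟩
    (hM.mono (prod_mono_right Icc_subset_Ici_self))
  have h0 : M (x, y) ≤ M (x₀, y₀) := hmin hmem
  refine ⟨x, hx1, y, hy1.1, by linarith, fun x' hx' y' hy' => ?_⟩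
  rcases le_total y' (max Y y₀) with h | h
  · exact hmin (show (x', y') ∈ K ×ˢ Icc (0:ℝ) (max Y y₀) from ⟨hx', hy', h⟩)
  · linarith [hY x' hx' y' ((le_max_left _ _).trans h)]

namespace Pot
variable {l Λ : ℝ} (P : Pot l Λ) {s : ℝ} (hs : s ∈ Ioo (0:ℝ) 1) {L : ℝ}
include hs

omit hs in
lemma V_pos (t : ℝ) : 0 < P.V t := by linarith [P.lb t, P.l_pos]

omit hs in
lemma N_right (hV : ReflE L P.V) {f : Cb} (hf : Refl L f) (y : ℝ) : P.N s f L y = 0 := by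
  have := P.N_odd (s := s) (fun t => (hV t).1) (fun t => (hf t).1) L y
  rw [show 2 * L - L = L by ring] at this
  linarith

omit hs in
lemma N_left (hV : ReflE L P.V) {f : Cb} (hf : Refl L f) (y : ℝ) : P.N s f (-L) y = 0 := by
  have := P.N_odd (s := s) (fun t => (hV t).2) (fun t => (hf t).2) (-L) y
  rw [show -(2 * L) - -L = -L by ring] at this
  linarith

/-- Comparison on a strip: a supersolution `p` depending on `t` only dominates `N f`. -/
lemma N_le_of_super (hV : ReflE L P.V) {f : Cb} (hf : Refl L f) {p p' p'' : ℝ → ℝ}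
    (hp : ∀ t, HasDerivAt p (p' t) t) (hp' : ∀ t, HasDerivAt p' (p'' t) t)
    (hpos : ∀ t, |t| ≤ L → 0 ≤ p t) (hsup : ∀ t, |t| ≤ L → p'' t ≤ P.V t * p t)
    (hb : ∀ t, |t| < L → p t < P.N s f t 0 → f t < 0) {t y : ℝ} (ht : |t| ≤ L) (hy : 0 ≤ y) :
    P.N s f t y ≤ p t := by
  by_contra! hcon
  have cp : Continuous p := continuous_iff_continuousAt.2 fun t => (hp t).continuousAt
  have cN := P.N_cont f hs
  have cM : Continuous fun x : ℝ² => p x.1 - P.N s f x.1 x.2 := by fun_prop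
  obtain ⟨t₀, ht₀, y₀, hy₀, hneg, hmin⟩ := exists_neg_min (isCompact_Icc (a := -L) (b := L))
    (M := fun x => p x.1 - P.N s f x.1 x.2) cM.continuousOn
    (fun ε hε => by
      obtain ⟨Y, -, hY⟩ := P.N_decay f hs hε
      refine ⟨Y, fun x hx y hy => ?_⟩
      have := (abs_le.1 (hY x y hy).1).2
      have := hpos x (abs_le.2 hx)
      simp only; linarith) (x₀ := t) (abs_le.1 ht) hy (by simp only; linarith)
  simp only at hneg hmin
  have hin : |t₀| < L := by
    refine lt_of_le_of_ne (abs_le.2 ht₀) fun h => ?_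
    have := hpos t₀ h.le
    rcases eq_or_eq_neg_of_abs_eq h with rfl | rfl
    · rw [P.N_right hV hf] at hneg; linarith
    · rw [P.N_left hV hf] at hneg; linarith
  have hIcc : Icc (-L) L ∈ 𝓝 t₀ := Icc_mem_nhds (abs_lt.1 hin).1 (abs_lt.1 hin).2
  rcases eq_or_lt_of_le hy₀ with rfl | hy0
  · have h := boundary_min one_pos (f := fun y => p t₀ - P.N s f t₀ y) (f' := fun y => -P.Ny s f t₀ y)
      (a := 1 - 2 * s) (g := f t₀)
      (Continuous.continuousOn (Continuous.comp (f := fun y : ℝ => (t₀, y)) cM (by fun_prop)))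
      (fun y hy => (P.hasDerivAt_N_y f hs hy t₀).const_sub _)
      (fun y hy _ => hmin t₀ ht₀ y hy) (by
        have := (P.tendsto_yNy f hs t₀).neg
        rw [neg_neg] at this
        refine this.congr fun y => by ring)
    linarith [hb t₀ hin (by linarith)]
  · have h1 := deriv_of_isLocalMin (f := fun t => p t - P.N s f t y₀) (x := t₀)
      (Eventually.of_forall fun z => (hp z).sub (P.hasDerivAt_N_t f hs hy0 z))
      ((hp' t₀).sub (P.hasDerivAt_Nt_t f hs hy0 t₀))
      (by filter_upwards [hIcc] with z hz using hmin z hz y₀ hy₀)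
    have h2 := deriv_of_isLocalMin (f := fun y => p t₀ - P.N s f t₀ y)
      (f' := fun y => -P.Ny s f t₀ y) (x := y₀)
      (by filter_upwards [lt_mem_nhds hy0] with z hz using
        (P.hasDerivAt_N_y f hs hz t₀).const_sub _)
      ((P.hasDerivAt_Ny_y f hs hy0 t₀).fun_neg)
      (by filter_upwards [lt_mem_nhds hy0] with z hz using hmin t₀ ht₀ z hz.le)
    have h3 := P.N_eqn (s := s) f (t := t₀) hy0
    have h4 := hsup t₀ hin.le
    have h5 : P.Ny s f t₀ y₀ = 0 := by linarith [h2.1]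
    rw [h5] at h3
    have := h1.2
    have := h2.2
    nlinarith [P.V_pos t₀]

lemma N_neg (f : Cb) (t y : ℝ) : P.N s (-f) t y = -P.N s f t y := by
  have h0 := P.N_lin hs 1 0 0 t y
  have := P.N_lin hs (-1) f 0 t y
  rw [show (-1:ℝ) • f = -f by ext; simp] at this
  simp only [smul_zero, add_zero, one_mul] at h0 this
  linarith

end Pot

namespace Pot
variable {l Λ : ℝ}

/-! ### The Robin problem -/

section robin
variable (P : Pot l Λ) {s : ℝ} (hs : s ∈ Ioo (0:ℝ) 1) {L : ℝ}
include hs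

lemma N_const_smul (c : ℝ) (f : Cb) (t y : ℝ) : P.N s (c • f) t y = c * P.N s f t y := by
  have h0 := P.N_lin hs 1 0 0 t y
  have := P.N_lin hs c f 0 t y
  simp only [smul_zero, add_zero, one_mul] at h0 this
  linarith

lemma N_sub (f g : Cb) (t y : ℝ) : P.N s (f - g) t y = P.N s f t y - P.N s g t y := by
  have := P.N_lin hs 1 f (-g) t y
  rw [P.N_neg hs, one_smul, ← sub_eq_add_neg] at this
  linarith

lemma refl_A (hV : ReflE L P.V) {f : Cb} (hf : Refl L f) : Refl L (P.A hs f) := fun t =>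
  ⟨P.N_odd (fun t => (hV t).1) (fun t => (hf t).1) t 0,
    P.N_odd (fun t => (hV t).2) (fun t => (hf t).2) t 0⟩

lemma robin_le (hV : ReflE L P.V) {f : Cb} (hf : Refl L f) {κ G : ℝ} (hκ : 0 < κ)
    (hG : 0 ≤ G) (h : ∀ t, |t| ≤ L → |f t + κ * P.N s f t 0| ≤ G) {t : ℝ} (ht : |t| ≤ L) :
    |P.N s f t 0| ≤ G / κ := by
  have key : ∀ f : Cb, Refl L f → (∀ t, |t| ≤ L → |f t + κ * P.N s f t 0| ≤ G) →
      P.N s f t 0 ≤ G / κ := fun f hf h => by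
    refine P.N_le_of_super hs hV hf (p := fun _ => G / κ) (p' := fun _ => 0) (p'' := fun _ => 0)
      (fun t => hasDerivAt_const _ _) (fun t => hasDerivAt_const _ _)
      (fun t _ => by positivity) (fun t _ => ?_) (fun t ht hlt => ?_) ht le_rfl
    · have := P.V_pos t; positivity
    · have h1 := (abs_le.1 (h t ht.le)).2
      rw [div_lt_iff₀ hκ] at hlt
      linarith
  rw [abs_le]
  refine ⟨?_, key f hf h⟩
  have := key (-f) (fun t => by
    have := hf t
    simp only [coe_neg, Pi.neg_apply]
    constructor <;> linarith) (fun t ht => by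
      rw [P.N_neg hs, coe_neg, Pi.neg_apply,
        show -f t + κ * -P.N s f t 0 = -(f t + κ * P.N s f t 0) by ring, abs_neg]
      exact h t ht)
  rw [P.N_neg hs] at this
  linarith

omit hs in
lemma abs_fold_apply (hL : 0 < L) {f : Cb} (hf : Refl L f) {C : ℝ}
    (h : ∀ t, |t| ≤ L → |f t| ≤ C) (t : ℝ) : |f t| ≤ C := by
  have step : ∀ n : ℕ, ∀ t, |t| ≤ L + n * L → |f t| ≤ C := by
    intro n
    induction n with
    | zero => intro t ht; exact h t (by simpa using ht)
    | succ n ih =>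
      intro t ht
      push_cast at ht
      have hn : 0 ≤ (n:ℝ) * L := by positivity
      have := abs_le.1 ht
      rcases le_total t (-L) with h1 | h1
      · rw [← abs_neg, ← (hf t).2]
        refine ih _ (abs_le.2 ⟨?_, ?_⟩) <;> linarith
      · rcases le_total t L with h2 | h2
        · exact h t (abs_le.2 ⟨h1, h2⟩)
        · rw [← abs_neg, ← (hf t).1]
          refine ih _ (abs_le.2 ⟨?_, ?_⟩) <;> linarith
  obtain ⟨n, hn⟩ := exists_nat_ge (|t| / L)
  refine step n t ?_
  rw [div_le_iff₀ hL] at hn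
  linarith

omit hs in
lemma exists_add_eq {T : (Cb) → (Cb)} (hT : ∀ f : Cb, Refl L f → Refl L (T f))
    (hc : ∀ f g : Cb, Refl L f → Refl L g → ‖T f - T g‖ ≤ 1 / 2 * ‖f - g‖) {g : Cb}
    (hg : Refl L g) : ∃ f : Cb, Refl L f ∧ f + T f = g := by
  let S : Set (Cb) := {f | Refl L f}
  have hS : IsClosed S := by
    have ev : ∀ t : ℝ, Continuous fun f : Cb => f t :=
      fun t => (lipschitz_eval_const t).continuous
    have : S = ⋂ t : ℝ, {f : Cb | f (2 * L - t) = -f t} ∩ {f | f (-(2 * L) - t) = -f t} := by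
      ext f; simp [S, Refl]
    rw [this]
    exact isClosed_iInter fun t => (isClosed_eq (ev _) (ev t).neg).inter
      (isClosed_eq (ev _) (ev t).neg)
  have hm : MapsTo (fun f => g - T f) S S := fun f hf t => by
    have h1 := hg t
    have h2 := hT f hf t
    simp only [coe_sub, Pi.sub_apply]
    constructor <;> linarith
  have hcw : ContractingWith (1 / 2) (hm.restrict (fun f => g - T f) S S) := by
    refine ⟨by rw [← NNReal.coe_lt_coe]; norm_num, LipschitzWith.of_dist_le_mul fun x y => ?_⟩
    rw [Subtype.dist_eq, Subtype.dist_eq, dist_eq_norm, dist_eq_norm]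
    have := hc y x y.2 x.2
    rw [norm_sub_rev (y : Cb)] at this
    refine le_trans (le_of_eq ?_) (this.trans (le_of_eq ?_))
    · simp only [MapsTo.val_restrict_apply]; congr 1; abel
    · push_cast; rfl
  obtain ⟨f, hf, hfix, -⟩ := hcw.exists_fixedPoint' hS.isComplete hm (x := g) hg (edist_ne_top _ _)
  refine ⟨f, hf, ?_⟩
  have : g - T f = f := hfix
  rw [eq_comm, ← sub_eq_iff_eq_add, this]

lemma exists_robin_small (hV : ReflE L P.V) {κ : ℝ} (hκ : 0 ≤ κ) (hκs : κ * P.CN s ≤ 1 / 2)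
    {g : Cb} (hg : Refl L g) :
    ∃ f : Cb, Refl L f ∧ ∀ t, f t + κ * P.N s f t 0 = g t := by
  obtain ⟨f, hf, he⟩ := exists_add_eq (L := L) (T := fun f => κ • P.A hs f) (fun f hf t => by
      have := P.refl_A hs hV hf t
      simp only [coe_smul, smul_eq_mul, this.1, this.2]
      constructor <;> ring) (fun f g hf hg => by
      refine (norm_le (by positivity)).2 fun t => ?_
      have h := P.N_le (f - g) hs t 0
      rw [P.N_sub hs] at h
      simp only [coe_sub, coe_smul,
        Pi.sub_apply, smul_eq_mul, A_apply, ← mul_sub, norm_eq_abs, abs_mul, abs_of_nonneg hκ]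
      calc _ ≤ κ * (P.CN s * ‖f - g‖) := by gcongr
        _ = κ * P.CN s * ‖f - g‖ := by ring
        _ ≤ _ := by gcongr) hg
  exact ⟨f, hf, fun t => by rw [← he]; rfl⟩

lemma exists_robin_step (hL : 0 < L) (hV : ReflE L P.V) {κ : ℝ} (hκ : 0 < κ)
    (h : ∀ g : Cb, Refl L g → ∃ f : Cb, Refl L f ∧ ∀ t, f t + κ * P.N s f t 0 = g t)
    (g : Cb) (hg : Refl L g) :
    ∃ f : Cb, Refl L f ∧ ∀ t, f t + 3 / 2 * κ * P.N s f t 0 = g t := by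
  choose! R hR1 hR2 using h
  obtain ⟨f, hf, he⟩ := exists_add_eq (L := L) (T := fun f => (κ / 2) • P.A hs (R f))
    (fun f hf t => by
      have := P.refl_A hs hV (hR1 f hf) t
      simp only [coe_smul, smul_eq_mul, this.1, this.2]
      constructor <;> ring) (fun f g hf hg => by
      refine (norm_le (by positivity)).2 fun t => ?_
      have hr : Refl L (R f - R g : Cb) := fun t => by
        have h1 := hR1 f hf t
        have h2 := hR1 g hg t
        simp only [coe_sub, Pi.sub_apply]
        constructor <;> linarith
      have hb : ∀ t, |t| ≤ L → |P.A hs (R f - R g) t| ≤ ‖f - g‖ / κ := fun t ht =>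
        P.robin_le hs hV hr hκ (norm_nonneg _) (fun t _ => by
          have e : (R f - R g) t + κ * P.N s (R f - R g) t 0 = (f - g) t := by
            rw [P.N_sub hs]
            simp only [coe_sub, Pi.sub_apply]
            linarith [hR2 f hf t, hR2 g hg t]
          rw [e]
          exact (f - g).norm_coe_le_norm t) ht
      have h := abs_fold_apply hL (P.refl_A hs hV hr) hb t
      rw [A_apply, P.N_sub hs] at h
      simp only [coe_sub, coe_smul,
        Pi.sub_apply, smul_eq_mul, A_apply, ← mul_sub, norm_eq_abs, abs_mul,
        abs_of_pos (half_pos hκ)]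
      calc _ ≤ κ / 2 * (‖f - g‖ / κ) := by gcongr
        _ = _ := by field_simp) hg
  refine ⟨R f, hR1 f hf, fun t => ?_⟩
  have h1 := hR2 f hf t
  have h2 : f t + κ / 2 * P.N s (R f) t 0 = g t := by rw [← he]; rfl
  linarith

lemma exists_robin (hL : 0 < L) (hV : ReflE L P.V) {κ : ℝ} (hκ : 0 < κ)
    {g : Cb} (hg : Refl L g) :
    ∃ f : Cb, Refl L f ∧ ∀ t, f t + κ * P.N s f t 0 = g t := by
  have hC := P.CN_nonneg hs
  obtain ⟨n, hn⟩ : ∃ n : ℕ, κ * P.CN s * 2 < (3 / 2 : ℝ) ^ n :=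
    pow_unbounded_of_one_lt _ (by norm_num)
  have hp : (0:ℝ) < (3 / 2) ^ n := by positivity
  have base : ∀ g : Cb, Refl L g → ∃ f : Cb, Refl L f ∧
      ∀ t, f t + κ / (3 / 2) ^ n * P.N s f t 0 = g t := fun g hg =>
    P.exists_robin_small hs hV (by positivity) (by
      rw [div_mul_eq_mul_div, div_le_iff₀ hp]; linarith) hg
  have all : ∀ m : ℕ, ∀ g : Cb, Refl L g → ∃ f : Cb, Refl L f ∧
      ∀ t, f t + (3 / 2) ^ m * (κ / (3 / 2) ^ n) * P.N s f t 0 = g t := by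
    intro m
    induction m with
    | zero => simpa using base
    | succ m ih =>
      intro g hg
      obtain ⟨f, hf, he⟩ := P.exists_robin_step hs hL hV (by positivity) ih g hg
      exact ⟨f, hf, fun t => by rw [← he t]; ring⟩
  obtain ⟨f, hf, he⟩ := all n g hg
  refine ⟨f, hf, fun t => ?_⟩
  rw [← he t, mul_div_cancel₀ _ hp.ne']

end robin
/-! ### Functions of the form `c H + q⁻¹ N f` -/

/-- The function `c H + q⁻¹ N f`, where `q = cosh^μ`, and its partial derivatives. -/
noncomputable def U (P : Pot l Λ) (μ s c : ℝ) (f : Cb) (t y : ℝ) : ℝ :=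
  c * Hf μ t + qf (-μ) t * P.N s f t y
noncomputable def Ut (P : Pot l Λ) (μ s c : ℝ) (f : Cb) (t y : ℝ) : ℝ :=
  c * qf (-(2 * μ)) t + qf (-μ) t * (P.Nt s f t y - μ * tanh t * P.N s f t y)
noncomputable def Uy (P : Pot l Λ) (μ s : ℝ) (f : Cb) (t y : ℝ) : ℝ :=
  qf (-μ) t * P.Ny s f t y
noncomputable def Utt (P : Pot l Λ) (μ s c : ℝ) (f : Cb) (t y : ℝ) : ℝ :=
  -(2 * μ * tanh t) * P.Ut μ s c f t y + qf (-μ) t * (P.Ntt s f t y - Vf μ t * P.N s f t y)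
noncomputable def Uty (P : Pot l Λ) (μ s : ℝ) (f : Cb) (t y : ℝ) : ℝ :=
  qf (-μ) t * (P.Nty s f t y - μ * tanh t * P.Ny s f t y)
noncomputable def Uyy (P : Pot l Λ) (μ s : ℝ) (f : Cb) (t y : ℝ) : ℝ :=
  qf (-μ) t * P.Nyy s f t y

section
variable (P : Pot l Λ) (μ c : ℝ) {s : ℝ} (f : Cb) (hs : s ∈ Ioo (0:ℝ) 1)
include hs

omit hs in
lemma hasDerivAt_U_of {t y : ℝ} (h : HasDerivAt (fun t => P.N s f t y) (P.Nt s f t y) t) :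
    HasDerivAt (fun t => P.U μ s c f t y) (P.Ut μ s c f t y) t := by
  have h1 : HasDerivAt (fun t => P.U μ s c f t y) _ t :=
    ((hasDerivAt_Hf μ t).const_mul c).fun_add ((hasDerivAt_qf (-μ) t).fun_mul h)
  refine h1.congr_deriv ?_
  rw [Ut]; ring

lemma hasDerivAt_U_t {y : ℝ} (hy : 0 < y) (t : ℝ) :
    HasDerivAt (fun t => P.U μ s c f t y) (P.Ut μ s c f t y) t :=
  P.hasDerivAt_U_of μ c f (P.hasDerivAt_N_t f hs hy t)

lemma hasDerivAt_Ut_t {y : ℝ} (hy : 0 < y) (t : ℝ) :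
    HasDerivAt (fun t => P.Ut μ s c f t y) (P.Utt μ s c f t y) t := by
  have h1 : HasDerivAt (fun t => P.Ut μ s c f t y) _ t :=
    ((hasDerivAt_qf (-(2 * μ)) t).const_mul c).fun_add ((hasDerivAt_qf (-μ) t).fun_mul
      ((P.hasDerivAt_Nt_t f hs hy t).fun_sub
        (((hasDerivAt_tanh t).const_mul μ).fun_mul (P.hasDerivAt_N_t f hs hy t))))
  refine h1.congr_deriv ?_
  rw [Utt, Ut, Vf]; ring

lemma hasDerivAt_U_y {y : ℝ} (hy : 0 < y) (t : ℝ) :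
    HasDerivAt (fun y => P.U μ s c f t y) (P.Uy μ s f t y) y :=
  ((P.hasDerivAt_N_y f hs hy t).const_mul _).const_add _

lemma hasDerivAt_Uy_y {y : ℝ} (hy : 0 < y) (t : ℝ) :
    HasDerivAt (fun y => P.Uy μ s f t y) (P.Uyy μ s f t y) y :=
  (P.hasDerivAt_Ny_y f hs hy t).const_mul _

lemma hasDerivAt_Uy_t {y : ℝ} (hy : 0 < y) (t : ℝ) :
    HasDerivAt (fun t => P.Uy μ s f t y) (P.Uty μ s f t y) t := by
  have h1 : HasDerivAt (fun t => P.Uy μ s f t y) _ t :=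
    (hasDerivAt_qf (-μ) t).fun_mul (P.hasDerivAt_Ny_t f hs hy t)
  refine h1.congr_deriv ?_
  rw [Uty]; ring

lemma hasDerivAt_Ut_y {y : ℝ} (hy : 0 < y) (t : ℝ) :
    HasDerivAt (fun y => P.Ut μ s c f t y) (P.Uty μ s f t y) y :=
  (((P.hasDerivAt_Nt_y f hs hy t).sub ((P.hasDerivAt_N_y f hs hy t).const_mul _)).const_mul
    _).const_add _

omit hs in
lemma U_eqn {t y : ℝ} (hV : P.V t = Vf μ t) (hy : 0 < y) :
    P.Uyy μ s f t y + (1 - 2 * s) / y * P.Uy μ s f t y + P.Utt μ s c f t y +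
      2 * μ * tanh t * P.Ut μ s c f t y = 0 := by
  have h := P.N_eqn (s := s) f (t := t) hy
  rw [hV] at h
  rw [Uyy, Uy, Utt]
  linear_combination qf (-μ) t * h

lemma continuous_U : Continuous fun p : ℝ² => P.U μ s c f p.1 p.2 := by
  have h1 := P.N_cont f hs
  have h2 := continuous_Hf μ
  have h3 := continuous_qf (-μ)
  unfold U
  fun_prop

lemma continuousOn_Ut : ContinuousOn (fun p : ℝ² => P.Ut μ s c f p.1 p.2) ℍ := by
  have h1 := (P.N_cont f hs).continuousOn (s := ℍ)
  have h2 := P.Nt_contOn f hs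
  have h3 := (continuous_qf (-μ)).comp continuous_fst |>.continuousOn (s := ℍ)
  have h4 := (continuous_qf (-(2 * μ))).comp continuous_fst
    |>.continuousOn (s := ℍ)
  have h5 := continuous_tanh.comp continuous_fst |>.continuousOn (s := ℍ)
  exact (continuousOn_const.mul h4).add
    (h3.mul (h2.sub ((continuousOn_const.mul h5).mul h1)))

lemma continuousOn_Uy : ContinuousOn (fun p : ℝ² => P.Uy μ s f p.1 p.2) ℍ :=
  ((continuous_qf (-μ)).comp continuous_fst).continuousOn.mul (P.Ny_contOn f hs)

lemma tendsto_yUy (t : ℝ) : Tendsto (fun y => y ^ (1 - 2 * s) * P.Uy μ s f t y) (𝓝[>] 0)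
    (𝓝 (-(qf (-μ) t * f t))) := by
  have := (P.tendsto_yNy f hs t).const_mul (qf (-μ) t)
  rw [mul_neg] at this
  refine this.congr fun y => ?_
  rw [Uy]; ring

end

section strip
variable (P : Pot l Λ) {μ c : ℝ} (hμ : 0 < μ) {s : ℝ} (hs : s ∈ Ioo (0:ℝ) 1) {L : ℝ}
  (hL : 0 < L) (hV : ReflE L P.V) (hVf : ∀ t, |t| ≤ L → P.V t = Vf μ t) (hc : c * Hf μ L = 1)
  {f : Cb} (hf : Refl L f)

include hV hf hc in
lemma U_right (y : ℝ) : P.U μ s c f L y = 1 := by rw [U, P.N_right hV hf, hc]; ring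

include hV hf hc in
lemma U_left (y : ℝ) : P.U μ s c f (-L) y = -1 := by
  rw [U, P.N_left hV hf, Hf_neg, mul_neg, hc]; ring

include hL hc in
lemma c_pos : 0 < c := by
  have := Hf_pos μ hL
  by_contra! h
  nlinarith

include hL hc in
lemma cHf_le {t : ℝ} (ht : |t| ≤ L) : |c * Hf μ t| ≤ 1 := by
  have h := abs_le.1 ht
  have hc0 := c_pos hL hc
  have h1 := (Hf_strictMono μ).monotone h.1
  have h2 := (Hf_strictMono μ).monotone h.2
  rw [Hf_neg] at h1
  rw [abs_le]
  constructor <;> nlinarith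

variable {κ : ℝ} {g : ℝ → ℝ} (hκ : 0 < κ)
  (hfg : ∀ t, |t| ≤ L → qf (-μ) t * f t = g t - κ * P.U μ s c f t 0)

include hs hL hV hVf hc hf hfg hκ

lemma U_le_one (hg : ∀ t, |t| ≤ L → g t ≤ κ) {t y : ℝ} (ht : |t| ≤ L) (hy : 0 ≤ y) :
    P.U μ s c f t y ≤ 1 := by
  have hd : ∀ t, HasDerivAt (fun t => qf μ t * (1 - c * Hf μ t))
      (μ * tanh t * qf μ t * (1 - c * Hf μ t) - c * qf (-μ) t) t := fun t => by
    have h : HasDerivAt (fun t => qf μ t * (1 - c * Hf μ t)) _ t :=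
      (hasDerivAt_qf μ t).fun_mul (((hasDerivAt_Hf μ t).const_mul c).const_sub 1)
    refine h.congr_deriv ?_
    rw [show -μ = μ + -(2 * μ) by ring, ← qf_mul]; ring
  have hd' : ∀ t, HasDerivAt (fun t => μ * tanh t * qf μ t * (1 - c * Hf μ t) - c * qf (-μ) t)
      (Vf μ t * (qf μ t * (1 - c * Hf μ t))) t := fun t => by
    have h : HasDerivAt
      (fun t => μ * tanh t * qf μ t * (1 - c * Hf μ t) - c * qf (-μ) t) _ t :=
      ((hasDerivAt_qf' μ t).fun_mul (((hasDerivAt_Hf μ t).const_mul c).const_sub 1)).fun_sub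
        ((hasDerivAt_qf (-μ) t).const_mul c)
    refine h.congr_deriv ?_
    rw [show qf (-μ) t = qf μ t * qf (-(2 * μ)) t by rw [qf_mul]; congr 1; ring]
    ring
  have hq := fun t => qf_pos μ t
  have h := P.N_le_of_super hs hV hf hd hd'
    (fun t ht => mul_nonneg (hq t).le (by linarith [(abs_le.1 (cHf_le hL hc ht)).2]))
    (fun t ht => by rw [hVf t ht]) (fun t ht hlt => by
      have h1 := mul_lt_mul_of_pos_left hlt (qf_pos (-μ) t)
      rw [← mul_assoc, qf_neg_mul, one_mul] at h1
      have h2 : 1 < P.U μ s c f t 0 := by rw [U]; linarith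
      have h3 : qf (-μ) t * f t < 0 := by
        rw [hfg t ht.le]; nlinarith [hg t ht.le]
      exact (pos_iff_neg_of_mul_neg h3).1 (qf_pos _ _)) ht hy
  have h1 := mul_le_mul_of_nonneg_left h (qf_pos (-μ) t).le
  rw [← mul_assoc, qf_neg_mul, one_mul] at h1
  rw [U]; linarith

lemma neg_one_le_U (hg : ∀ t, |t| ≤ L → -κ ≤ g t) {t y : ℝ} (ht : |t| ≤ L) (hy : 0 ≤ y) :
    -1 ≤ P.U μ s c f t y := by
  have hd : ∀ t, HasDerivAt (fun t => qf μ t * (1 + c * Hf μ t))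
      (μ * tanh t * qf μ t * (1 + c * Hf μ t) + c * qf (-μ) t) t := fun t => by
    have h : HasDerivAt (fun t => qf μ t * (1 + c * Hf μ t)) _ t :=
      (hasDerivAt_qf μ t).fun_mul (((hasDerivAt_Hf μ t).const_mul c).const_add 1)
    refine h.congr_deriv ?_
    rw [show -μ = μ + -(2 * μ) by ring, ← qf_mul]; ring
  have hd' : ∀ t, HasDerivAt (fun t => μ * tanh t * qf μ t * (1 + c * Hf μ t) + c * qf (-μ) t)
      (Vf μ t * (qf μ t * (1 + c * Hf μ t))) t := fun t => by
    have h : HasDerivAt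
      (fun t => μ * tanh t * qf μ t * (1 + c * Hf μ t) + c * qf (-μ) t) _ t :=
      ((hasDerivAt_qf' μ t).fun_mul (((hasDerivAt_Hf μ t).const_mul c).const_add 1)).fun_add
        ((hasDerivAt_qf (-μ) t).const_mul c)
    refine h.congr_deriv ?_
    rw [show qf (-μ) t = qf μ t * qf (-(2 * μ)) t by rw [qf_mul]; congr 1; ring]
    ring
  have hq := fun t => qf_pos μ t
  have hf' : Refl L (-f : Cb) := fun t => by
    have := hf t
    simp only [coe_neg, Pi.neg_apply]
    constructor <;> linarith
  have h := P.N_le_of_super hs hV hf' hd hd'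
    (fun t ht => mul_nonneg (hq t).le (by linarith [(abs_le.1 (cHf_le hL hc ht)).1]))
    (fun t ht => by rw [hVf t ht]) (fun t ht hlt => by
      rw [P.N_neg hs] at hlt
      have h1 := mul_lt_mul_of_pos_left hlt (qf_pos (-μ) t)
      rw [← mul_assoc, qf_neg_mul, one_mul] at h1
      have h2 : P.U μ s c f t 0 < -1 := by rw [U]; linarith
      have h3 : 0 < qf (-μ) t * f t := by
        rw [hfg t ht.le]; nlinarith [hg t ht.le]
      have := (pos_iff_pos_of_mul_pos h3).1 (qf_pos _ _)
      simpa using this) ht hy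
  rw [P.N_neg hs] at h
  have h1 := mul_le_mul_of_nonneg_left h (qf_pos (-μ) t).le
  rw [← mul_assoc, qf_neg_mul, one_mul] at h1
  rw [U]; linarith

end strip
end Pot

/-! ### Monotonicity in `t` -/

/-- A positive bounded strict supersolution of `Y'' + (a / y) Y' = 0`, with `a = 1 - 2s`. -/
noncomputable def bar (s ε y : ℝ) : ℝ := 1 + ε * (1 - (1 + y ^ (2 * s))⁻¹)
noncomputable def bar' (s ε y : ℝ) : ℝ := ε * (2 * s * y ^ (2 * s - 1)) / (1 + y ^ (2 * s)) ^ 2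
noncomputable def bar'' (s ε y : ℝ) : ℝ :=
  -(1 - 2 * s) / y * bar' s ε y - 2 * ε * (2 * s * y ^ (2 * s - 1)) ^ 2 / (1 + y ^ (2 * s)) ^ 3

lemma hasDerivAt_bar (s ε : ℝ) {y : ℝ} (hy : 0 < y) : HasDerivAt (bar s ε) (bar' s ε y) y := by
  have h0 : 0 < 1 + y ^ (2 * s) := by positivity
  have h1 : HasDerivAt (fun y => 1 + y ^ (2 * s)) _ y :=
    (hasDerivAt_rpow_const (p := 2 * s) (Or.inl hy.ne')).const_add 1
  have h : HasDerivAt (bar s ε) _ y := (((h1.fun_inv h0.ne').const_sub 1).const_mul ε).const_add 1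
  refine h.congr_deriv ?_
  rw [bar']; ring

lemma hasDerivAt_bar' (s ε : ℝ) {y : ℝ} (hy : 0 < y) : HasDerivAt (bar' s ε) (bar'' s ε y) y := by
  have h0 : 0 < 1 + y ^ (2 * s) := by positivity
  have h1 : HasDerivAt (fun y => 1 + y ^ (2 * s)) _ y :=
    (hasDerivAt_rpow_const (p := 2 * s) (Or.inl hy.ne')).const_add 1
  have h2 : HasDerivAt (fun y => ε * (2 * s * y ^ (2 * s - 1))) _ y :=
    ((hasDerivAt_rpow_const (p := 2 * s - 1) (Or.inl hy.ne')).const_mul (2 * s)).const_mul ε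
  have h : HasDerivAt (bar' s ε) _ y := h2.fun_div (h1.fun_pow 2) (by positivity)
  refine h.congr_deriv ?_
  rw [bar'', bar', rpow_sub_one hy.ne' (2 * s - 1)]
  push_cast
  field_simp
  ring

lemma bar_mem {s ε : ℝ} (hε : 0 ≤ ε) {y : ℝ} (hy : 0 ≤ y) : bar s ε y ∈ Icc 1 (1 + ε) := by
  have h0 : 1 ≤ 1 + y ^ (2 * s) := by linarith [rpow_nonneg hy (2 * s)]
  have h1 : (1 + y ^ (2 * s))⁻¹ ≤ 1 := inv_le_one_of_one_le₀ h0
  have h2 : 0 ≤ (1 + y ^ (2 * s))⁻¹ := by positivity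
  constructor <;> rw [bar] <;> nlinarith

lemma continuousOn_bar {s : ℝ} (hs : 0 < s) (ε : ℝ) : ContinuousOn (bar s ε) (Ici 0) := by
  have h1 : Continuous fun y : ℝ => y ^ (2 * s) := continuous_rpow_const (by positivity)
  unfold bar
  refine continuousOn_const.add (continuousOn_const.mul (continuousOn_const.sub
    (ContinuousOn.inv₀ (by fun_prop) fun y (hy : 0 ≤ y) => ?_)))
  have := rpow_nonneg hy (2 * s)
  positivity

lemma bar_zero {s : ℝ} (hs : 0 < s) (ε : ℝ) : bar s ε 0 = 1 := by
  rw [bar, zero_rpow (by positivity)]; norm_num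

lemma bar_eqn {s ε : ℝ} (hs : 0 < s) (hε : 0 < ε) {y : ℝ} (hy : 0 < y) :
    bar'' s ε y + (1 - 2 * s) / y * bar' s ε y < 0 := by
  rw [bar'']
  have : 0 < 2 * ε * (2 * s * y ^ (2 * s - 1)) ^ 2 / (1 + y ^ (2 * s)) ^ 3 := by positivity
  have e : -(1 - 2 * s) / y * bar' s ε y = -((1 - 2 * s) / y * bar' s ε y) := by ring
  rw [e]; linarith

lemma tendsto_bar' {s : ℝ} (hs : 0 < s) (ε : ℝ) :
    Tendsto (fun y => y ^ (1 - 2 * s) * bar' s ε y) (𝓝[>] 0) (𝓝 (2 * s * ε)) := by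
  have h1 : ContinuousAt (fun y : ℝ => 2 * s * ε / (1 + y ^ (2 * s)) ^ 2) 0 := by
    have h2 : Continuous fun y : ℝ => y ^ (2 * s) := continuous_rpow_const (by positivity)
    refine ContinuousAt.div continuousAt_const (by fun_prop) ?_
    rw [zero_rpow (by positivity)]; norm_num
  have h3 : Tendsto (fun y : ℝ => 2 * s * ε / (1 + y ^ (2 * s)) ^ 2) (𝓝[>] 0) (𝓝 (2 * s * ε)) := by
    have := h1.tendsto
    rw [zero_rpow (by positivity)] at this
    norm_num at this
    exact this.mono_left nhdsWithin_le_nhds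
  refine h3.congr' ?_
  filter_upwards [self_mem_nhdsWithin] with y (hy : 0 < y)
  have : y ^ (1 - 2 * s) * y ^ (2 * s - 1) = 1 := by
    rw [← rpow_add hy]; norm_num
  rw [bar', ← mul_div_assoc]
  congr 1
  linear_combination (-(2 * s * ε)) * this

namespace Pot
variable {l Λ : ℝ} (P : Pot l Λ) {μ c : ℝ} {s : ℝ} (hs : s ∈ Ioo (0:ℝ) 1) {L : ℝ}
  (hL : 0 < L) (hV : ReflE L P.V) (hVf : ∀ t, |t| ≤ L → P.V t = Vf μ t) (hc : c * Hf μ L = 1)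
  {f : Cb} (hf : Refl L f) {κ : ℝ} {g : ℝ → ℝ} (hκ : 0 < κ)
  (hfg : ∀ t, |t| ≤ L → qf (-μ) t * f t = g t - κ * P.U μ s c f t 0)

include hs hL hV hVf hc hf hfg hκ

lemma U_mono_aux (hμ : 0 < μ) (hg : MonotoneOn g (Icc (-L) L))
    (h1 : ∀ t y, |t| ≤ L → 0 ≤ y → |P.U μ s c f t y| ≤ 1) {ε : ℝ} (hε : 0 < ε) {t' t y : ℝ}
    (ht' : -L ≤ t') (htt : t' ≤ t) (ht : t ≤ L) (hy : 0 ≤ y) :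
    0 ≤ P.U μ s c f t y - P.U μ s c f t' y + ε * bar s (κ / (4 * s)) y := by
  have hs0 := hs.1
  set η := κ / (4 * s) with hη
  have hη0 : 0 < η := by positivity
  by_contra! hcon
  have cU := P.continuous_U μ c f hs
  let K : Set ℝ² := {x | x.1 ∈ Icc (-L) L ∧ x.2 ∈ Icc (-L) x.1}
  have hK : IsCompact K := by
    refine IsCompact.of_isClosed_subset ((isCompact_Icc (a := -L) (b := L)).prod
      (isCompact_Icc (a := -L) (b := L))) ?_ fun x hx => ⟨hx.1, hx.2.1, hx.2.2.trans hx.1.2⟩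
    simp only [K, mem_Icc]
    refine IsClosed.and ?_ ?_ <;> refine IsClosed.and ?_ ?_ <;>
      exact isClosed_le (by fun_prop) (by fun_prop)
  have hc0 := c_pos hL hc
  let M : ℝ² × ℝ → ℝ := fun x =>
    P.U μ s c f x.1.1 x.2 - P.U μ s c f x.1.2 x.2 + ε * bar s η x.2
  have hM : ContinuousOn M (K ×ˢ Ici 0) := by
    refine ContinuousOn.add (Continuous.continuousOn ?_) (continuousOn_const.mul
      ((continuousOn_bar hs0 η).comp continuousOn_snd fun x hx => hx.2))
    exact (cU.comp (g := fun p : ℝ² => P.U μ s c f p.1 p.2)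
      (f := fun x : ℝ² × ℝ => (x.1.1, x.2)) (by fun_prop)).sub
      (cU.comp (g := fun p : ℝ² => P.U μ s c f p.1 p.2)
      (f := fun x : ℝ² × ℝ => (x.1.2, x.2)) (by fun_prop))
  obtain ⟨⟨t₁, t₂⟩, ⟨ht₁, ht₂⟩, y₀, hy₀, hneg, hmin⟩ := exists_neg_min hK hM
    (fun δ hδ => by
      obtain ⟨Y, hY0, hY⟩ := P.N_decay f hs (half_pos hδ)
      refine ⟨Y, fun x hx y hy => ?_⟩
      have i1 := abs_le.1 (hY x.1 y hy).1
      have i2 := abs_le.1 (hY x.2 y hy).1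
      have i3 := (Hf_strictMono μ).monotone hx.2.2
      have i4 := (bar_mem (s := s) hη0.le (hY0.le.trans hy)).1
      have j : ∀ t, |qf (-μ) t * P.N s f t y| ≤ δ / 2 := fun t => by
        rw [abs_mul, abs_of_pos (qf_pos _ _)]
        calc _ ≤ 1 * (δ / 2) := mul_le_mul (qf_neg_le_one hμ.le t) (hY t y hy).1 (abs_nonneg _) zero_le_one
          _ = _ := one_mul _
      have j1 := abs_le.1 (j x.1)
      have j2 := abs_le.1 (j x.2)
      have i5 : 0 ≤ c * (Hf μ x.1 - Hf μ x.2) := mul_nonneg hc0.le (by linarith)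
      have i6 : 0 ≤ ε * bar s η y := by positivity
      simp only [M, U]
      linarith) (x₀ := (t, t')) (show (t, t') ∈ K from ⟨⟨by linarith, ht⟩, ht', htt⟩) hy
      (by simp only [M]; exact hcon)
  simp only [mem_Icc] at ht₁ ht₂
  simp only [M] at hneg hmin
  have hb1 := (bar_mem (s := s) hη0.le hy₀).1
  have hεb : ε ≤ ε * bar s η y₀ := le_mul_of_one_le_right hε.le hb1
  have a1 : |t₁| ≤ L := abs_le.2 ht₁
  have a2 : |t₂| ≤ L := abs_le.2 ⟨ht₂.1, ht₂.2.trans ht₁.2⟩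
  have b1 := abs_le.1 (h1 t₁ y₀ a1 hy₀)
  have b2 := abs_le.1 (h1 t₂ y₀ a2 hy₀)
  have l1 : t₁ < L := by
    refine lt_of_le_of_ne ht₁.2 fun h => ?_
    rw [h, P.U_right hV hc hf] at hneg; linarith
  have l2 : -L < t₂ := by
    refine lt_of_le_of_ne ht₂.1 fun h => ?_
    rw [← h, P.U_left hV hc hf] at hneg; linarith
  have l3 : t₂ < t₁ := by
    refine lt_of_le_of_ne ht₂.2 fun h => ?_
    rw [h] at hneg; linarith
  rcases eq_or_lt_of_le hy₀ with rfl | hy0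
  · have h := boundary_min one_pos
      (f := fun y => P.U μ s c f t₁ y - P.U μ s c f t₂ y + ε * bar s η y)
      (f' := fun y => P.Uy μ s f t₁ y - P.Uy μ s f t₂ y + ε * bar' s η y)
      (a := 1 - 2 * s) (g := -(qf (-μ) t₁ * f t₁) - -(qf (-μ) t₂ * f t₂) + ε * (2 * s * η))
      (by
        refine ContinuousOn.add (Continuous.continuousOn ?_)
          (continuousOn_const.mul (continuousOn_bar hs0 η))
        exact (cU.comp (f := fun y : ℝ => (t₁, y)) (by fun_prop)).sub
          (cU.comp (f := fun y : ℝ => (t₂, y)) (by fun_prop)))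
      (fun y hy => ((P.hasDerivAt_U_y μ c f hs hy t₁).sub (P.hasDerivAt_U_y μ c f hs hy t₂)).add
        ((hasDerivAt_bar s η hy).const_mul ε))
      (fun y hy _ => hmin (t₁, t₂) ⟨ht₁, ht₂⟩ y hy) (by
        refine (((P.tendsto_yUy μ f hs t₁).sub (P.tendsto_yUy μ f hs t₂)).add
          ((tendsto_bar' hs0 η).const_mul ε)).congr fun y => by ring)
    rw [hfg t₁ a1, hfg t₂ a2] at h
    have hgm := hg ⟨ht₂.1, ht₂.2.trans ht₁.2⟩ ht₁ ht₂.2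
    rw [bar_zero hs0] at hneg
    have e : 2 * s * η = κ / 2 := by rw [hη]; field_simp; norm_num
    rw [e] at h
    nlinarith
  · have n1 : Ioo (-L) L ∈ 𝓝 t₁ := Ioo_mem_nhds (by linarith) l1
    have d1 := deriv_of_isLocalMin (x := t₁)
      (f := fun t => P.U μ s c f t y₀ - P.U μ s c f t₂ y₀ + ε * bar s η y₀)
      (f' := fun t => P.Ut μ s c f t y₀) (f'' := P.Utt μ s c f t₁ y₀)
      (Eventually.of_forall fun z =>
        ((P.hasDerivAt_U_t μ c f hs hy0 z).sub_const _).add_const _)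
      (P.hasDerivAt_Ut_t μ c f hs hy0 t₁)
      (by
        filter_upwards [n1, lt_mem_nhds l3] with z hz hz'
        exact hmin (z, t₂) ⟨⟨hz.1.le, hz.2.le⟩, ht₂.1, hz'.le⟩ y₀ hy₀)
    have d2 := deriv_of_isLocalMin (x := t₂)
      (f := fun t => P.U μ s c f t₁ y₀ - P.U μ s c f t y₀ + ε * bar s η y₀)
      (f' := fun t => -P.Ut μ s c f t y₀) (f'' := -P.Utt μ s c f t₂ y₀)
      (Eventually.of_forall fun z =>
        ((P.hasDerivAt_U_t μ c f hs hy0 z).const_sub _).add_const _)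
      (P.hasDerivAt_Ut_t μ c f hs hy0 t₂).fun_neg
      (by
        filter_upwards [lt_mem_nhds l2, gt_mem_nhds l3] with z hz hz'
        exact hmin (t₁, z) ⟨ht₁, hz.le, hz'.le⟩ y₀ hy₀)
    have d3 := deriv_of_isLocalMin (x := y₀)
      (f := fun y => P.U μ s c f t₁ y - P.U μ s c f t₂ y + ε * bar s η y)
      (f' := fun y => P.Uy μ s f t₁ y - P.Uy μ s f t₂ y + ε * bar' s η y)
      (by
        filter_upwards [lt_mem_nhds hy0] with y hy
        exact ((P.hasDerivAt_U_y μ c f hs hy t₁).sub (P.hasDerivAt_U_y μ c f hs hy t₂)).add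
          ((hasDerivAt_bar s η hy).const_mul ε))
      (((P.hasDerivAt_Uy_y μ f hs hy0 t₁).fun_sub (P.hasDerivAt_Uy_y μ f hs hy0 t₂)).fun_add
          ((hasDerivAt_bar' s η hy0).const_mul ε))
      (by
        filter_upwards [lt_mem_nhds hy0] with y hy
        exact hmin (t₁, t₂) ⟨ht₁, ht₂⟩ y hy.le)
    have e1 := P.U_eqn μ c (s := s) f (hVf t₁ a1) hy0
    have e2 := P.U_eqn μ c (s := s) f (hVf t₂ a2) hy0
    have d1' := d1.1
    have d2' : P.Ut μ s c f t₂ y₀ = 0 := by linarith [d2.1]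
    rw [d1'] at e1
    rw [d2'] at e2
    have d11 := d1.2
    have d22 := d2.2
    have d31 := d3.1
    have d32 := d3.2
    have hb := mul_lt_mul_of_pos_left (bar_eqn hs0 hη0 hy0) hε
    have hk : (1 - 2 * s) / y₀ * (P.Uy μ s f t₁ y₀ - P.Uy μ s f t₂ y₀ + ε * bar' s η y₀) = 0 := by
      rw [d31, mul_zero]
    linarith

lemma U_mono (hμ : 0 < μ) (hg : MonotoneOn g (Icc (-L) L))
    (h1 : ∀ t y, |t| ≤ L → 0 ≤ y → |P.U μ s c f t y| ≤ 1) {t' t y : ℝ}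
    (ht' : -L ≤ t') (htt : t' ≤ t) (ht : t ≤ L) (hy : 0 ≤ y) :
    P.U μ s c f t' y ≤ P.U μ s c f t y := by
  have hs0 := hs.1
  have hη0 : 0 < κ / (4 * s) := by positivity
  have hb := bar_mem (s := s) hη0.le hy
  refine le_of_forall_pos_le_add fun δ hδ => ?_
  have hp : 0 < bar s (κ / (4 * s)) y := by linarith [hb.1]
  have := P.U_mono_aux hs hL hV hVf hc hf hκ hfg hμ hg h1 (div_pos hδ hp) ht' htt ht hy
  rw [div_mul_cancel₀ _ hp.ne'] at this
  linarith

end Pot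

/-! ### Double-well nonlinearities -/

/-- A double-well potential `F` with derivative `F'`, Lipschitz with constant `κ / 2`. -/
structure Well (F F' : ℝ → ℝ) (κ : ℝ) : Prop where
  κ_pos : 0 < κ
  hd : ∀ x, HasDerivAt F (F' x) x
  cont' : Continuous F'
  lip : ∀ x ∈ Icc (-1:ℝ) 1, ∀ y ∈ Icc (-1:ℝ) 1, |F' x - F' y| ≤ κ / 2 * |x - y|
  F_one : F 1 = 0
  F_neg_one : F (-1) = 0
  F'_one : F' 1 = 0
  F'_neg_one : F' (-1) = 0
  nonneg : ∀ x ∈ Icc (-1:ℝ) 1, 0 ≤ F x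

namespace Well
variable {F F' : ℝ → ℝ} {κ : ℝ} (W : Well F F' κ)
include W

lemma continuous : Continuous F := continuous_iff_continuousAt.2 fun x => (W.hd x).continuousAt

lemma taylor {x y : ℝ} (hx : x ∈ Icc (-1:ℝ) 1) (hy : y ∈ Icc (-1:ℝ) 1) :
    F y - F x ≤ F' x * (y - x) + κ / 2 * (y - x) ^ 2 := by
  have hκ := W.κ_pos
  have key : ∀ z ∈ Icc (-1:ℝ) 1, |z - x| ≤ |y - x| → F y - F x = F' z * (y - x) →
      F y - F x ≤ F' x * (y - x) + κ / 2 * (y - x) ^ 2 := by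
    intro z hz h1 h2
    have h3 : (F' z - F' x) * (y - x) ≤ κ / 2 * |y - x| * |y - x| := by
      refine (le_abs_self _).trans ?_
      rw [abs_mul]
      gcongr
      exact (W.lip z hz x hx).trans (by gcongr)
    rw [mul_assoc, ← sq, sq_abs] at h3
    linarith
  rcases lt_trichotomy x y with h | h | h
  · obtain ⟨z, hz, e⟩ := exists_hasDerivAt_eq_slope F F' h W.continuous.continuousOn
      fun t _ => W.hd t
    refine key z ⟨hx.1.trans hz.1.le, hz.2.le.trans hy.2⟩ ?_ ?_
    · rw [abs_of_pos (by linarith [hz.1]), abs_of_pos (by linarith)]; linarith [hz.2]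
    · rw [e]; field_simp [(sub_pos.2 h).ne']
  · subst h; simp
  · obtain ⟨z, hz, e⟩ := exists_hasDerivAt_eq_slope F F' h W.continuous.continuousOn
      fun t _ => W.hd t
    refine key z ⟨hy.1.trans hz.1.le, hz.2.le.trans hx.2⟩ ?_ ?_
    · rw [abs_of_neg (by linarith [hz.2]), abs_of_neg (by linarith)]; linarith [hz.1]
    · rw [e]; field_simp [(sub_pos.2 h).ne']; ring

lemma F_le_right {x : ℝ} (hx : x ∈ Icc (-1:ℝ) 1) : F x ≤ κ / 2 * (1 - x) ^ 2 := by
  have := W.taylor (x := 1) (by norm_num) hx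
  rw [W.F_one, W.F'_one] at this
  linarith

lemma F_le_left {x : ℝ} (hx : x ∈ Icc (-1:ℝ) 1) : F x ≤ κ / 2 * (1 + x) ^ 2 := by
  have := W.taylor (x := -1) (by norm_num) hx
  rw [W.F_neg_one, W.F'_neg_one] at this
  linarith

lemma F'_le_right {x : ℝ} (hx : x ∈ Icc (-1:ℝ) 1) : |F' x| ≤ κ / 2 * (1 - x) := by
  have := W.lip x hx 1 (by norm_num)
  rwa [W.F'_one, sub_zero, abs_sub_comm x, abs_of_nonneg (sub_nonneg.2 hx.2)] at this

lemma F'_le_left {x : ℝ} (hx : x ∈ Icc (-1:ℝ) 1) : |F' x| ≤ κ / 2 * (1 + x) := by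
  have := W.lip x hx (-1) (by norm_num)
  rwa [W.F'_neg_one, sub_zero, sub_neg_eq_add, add_comm x,
    abs_of_nonneg (a := 1 + x) (by linarith [hx.1])] at this

lemma g_mono : MonotoneOn (fun x => κ * x - F' x) (Icc (-1) 1) := by
  intro x hx y hy h
  have h1 := (abs_le.1 (W.lip y hy x hx)).2
  rw [abs_of_nonneg (sub_nonneg.2 h)] at h1
  have := mul_nonneg W.κ_pos.le (sub_nonneg.2 h)
  simp only
  linarith

lemma g_le {x : ℝ} (hx : x ∈ Icc (-1:ℝ) 1) : |κ * x - F' x| ≤ κ := by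
  have h1 := W.g_mono hx (right_mem_Icc.2 (by norm_num)) hx.2
  have h2 := W.g_mono (left_mem_Icc.2 (by norm_num)) hx hx.1
  simp only [W.F'_one, W.F'_neg_one] at h1 h2
  rw [abs_le]; constructor <;> linarith

end Well

lemma refl_eq_ext {L : ℝ} (hL : 0 < L) {f : Cb} (hf : Refl L f) (t : ℝ) :
    f t = ext L f t := by
  obtain ⟨e, he⟩ := exists_ext hL f.continuous hf.right hf.left
  have hre := refl_ext hL hf.right hf.left
  have h : Refl L (f - e : Cb) := fun t => by
    simp only [coe_sub, Pi.sub_apply, he, (hf t).1, (hf t).2,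
      (hre t).1, (hre t).2]
    constructor <;> ring
  have := Pot.abs_fold_apply hL h (C := 0) (fun t ht => by
    simp only [coe_sub, Pi.sub_apply, he, ext_eq hL f ht]; simp) t
  rw [← he]
  exact sub_eq_zero.1 (abs_eq_zero.1 (le_antisymm this (abs_nonneg _)))

/-- The assumptions on the strip `|t| ≤ L`. -/
structure Strip {l Λ : ℝ} (P : Pot l Λ) (μ s c L : ℝ) : Prop where
  hs : s ∈ Ioo (0:ℝ) 1
  hμ : 0 < μ
  hL : 0 < L
  hV : ReflE L P.V
  hVf : ∀ t, |t| ≤ L → P.V t = Vf μ t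
  hc : c * Hf μ L = 1

namespace Strip
variable {l Λ : ℝ} {P : Pot l Λ} {μ s c L : ℝ} (S : Strip P μ s c L)
  {F F' : ℝ → ℝ} {κ : ℝ} (W : Well F F' κ)

variable (P μ s c L) in
/-- Admissible Neumann data: the extension is bounded by one and monotone. -/
def Good (f : Cb) : Prop :=
  Refl L f ∧ (∀ t y, |t| ≤ L → 0 ≤ y → |P.U μ s c f t y| ≤ 1) ∧
    ∀ t' t y, -L ≤ t' → t' ≤ t → t ≤ L → 0 ≤ y → P.U μ s c f t' y ≤ P.U μ s c f t y

include S in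
lemma good_zero : Good P μ s c L 0 := by
  have hN : ∀ t y, P.N s 0 t y = 0 := fun t y => by
    have := P.N_const_smul S.hs 0 0 t y
    simpa using this
  refine ⟨fun t => by simp, fun t y ht _ => ?_, fun t' t y h1 h2 h3 _ => ?_⟩
  · rw [Pot.U, hN, mul_zero, add_zero]; exact Pot.cHf_le S.hL S.hc ht
  · rw [Pot.U, Pot.U, hN, hN]
    have := mul_le_mul_of_nonneg_left ((Hf_strictMono μ).monotone h2) (Pot.c_pos S.hL S.hc).le
    linarith

include S in
lemma continuous_U0 (f : Cb) : Continuous fun t => P.U μ s c f t 0 :=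
  Continuous.comp (f := fun t : ℝ => (t, (0:ℝ))) (P.continuous_U μ c f S.hs) (by fun_prop)

include S W in
lemma good_step {f : Cb} (hf : Good P μ s c L f) : ∃ f' : Cb, Good P μ s c L f' ∧
    ∀ t, |t| ≤ L → f' t = qf μ t *
      (κ * P.U μ s c f t 0 - F' (P.U μ s c f t 0) - κ * P.U μ s c f' t 0) := by
  have cU := S.continuous_U0 f
  have cg : Continuous fun t => κ * P.A S.hs f t - qf μ t * F' (P.U μ s c f t 0) :=
    (continuous_const.mul (P.A S.hs f).continuous).sub
      ((continuous_qf μ).mul (W.cont'.comp cU))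
  have hA := P.refl_A S.hs S.hV hf.1
  have h1 : κ * P.A S.hs f L - qf μ L * F' (P.U μ s c f L 0) = 0 := by
    rw [hA.right, P.U_right S.hV S.hc hf.1, W.F'_one]; simp
  have h2 : κ * P.A S.hs f (-L) - qf μ (-L) * F' (P.U μ s c f (-L) 0) = 0 := by
    rw [hA.left, P.U_left S.hV S.hc hf.1, W.F'_neg_one]; simp
  obtain ⟨g, hg⟩ := exists_ext S.hL cg h1 h2
  have hgr : Refl L g := by
    have := refl_ext S.hL (g := fun t => κ * P.A S.hs f t - qf μ t * F' (P.U μ s c f t 0)) h1 h2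
    exact (funext hg : ⇑g = _) ▸ this
  obtain ⟨f', hf', hN⟩ := P.exists_robin S.hs S.hL S.hV W.κ_pos hgr
  have hfg : ∀ t, |t| ≤ L → qf (-μ) t * f' t =
      (κ * P.U μ s c f t 0 - F' (P.U μ s c f t 0)) - κ * P.U μ s c f' t 0 := fun t ht => by
    have := hN t
    rw [hg, ext_eq S.hL _ ht, Pot.A_apply] at this
    rw [Pot.U, ← eq_sub_iff_add_eq] at *
    rw [this, Pot.U]
    linear_combination (-(F' (c * Hf μ t + qf (-μ) t * P.N s f t 0))) * qf_neg_mul μ t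
  have hU : ∀ t, |t| ≤ L → P.U μ s c f t 0 ∈ Icc (-1:ℝ) 1 := fun t ht =>
    abs_le.1 (hf.2.1 t 0 ht le_rfl)
  have hb : ∀ t y, |t| ≤ L → 0 ≤ y → |P.U μ s c f' t y| ≤ 1 := fun t y ht hy =>
    abs_le.2 ⟨P.neg_one_le_U S.hs S.hL S.hV S.hVf S.hc hf' W.κ_pos hfg
      (fun t ht => (abs_le.1 (W.g_le (hU t ht))).1) ht hy,
    P.U_le_one S.hs S.hL S.hV S.hVf S.hc hf' W.κ_pos hfg
      (fun t ht => (abs_le.1 (W.g_le (hU t ht))).2) ht hy⟩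
  refine ⟨f', ⟨hf', hb, fun t' t y h1 h2 h3 h4 =>
    P.U_mono S.hs S.hL S.hV S.hVf S.hc hf' W.κ_pos hfg S.hμ ?_ hb h1 h2 h3 h4⟩, fun t ht => ?_⟩
  · intro x hx y hy hxy
    exact W.g_mono (hU x (abs_le.2 hx)) (hU y (abs_le.2 hy)) (hf.2.2 x y 0 hx.1 hxy hy.2 le_rfl)
  · rw [← hfg t ht, ← mul_assoc, qf_mul_neg, one_mul]

/-- The energy of Neumann data. -/
noncomputable def JJ (F : ℝ → ℝ) (c L μ : ℝ) (P : Pot l Λ) (hs : s ∈ Ioo (0:ℝ) 1)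
    (f : Cb) : ℝ :=
  (∫ t in -L..L, f t * P.A hs f t) / 2 + ∫ t in -L..L, F (P.U μ s c f t 0) * qf μ t ^ 2

include W in
lemma JJ_step {f f' : Cb} (hf : Good P μ s c L f) (hf' : Good P μ s c L f')
    (h : ∀ t, |t| ≤ L → f' t = qf μ t *
      (κ * P.U μ s c f t 0 - F' (P.U μ s c f t 0) - κ * P.U μ s c f' t 0)) :
    JJ F c L μ P S.hs f' + κ / 2 * ∫ t in -L..L, (P.A S.hs f' t - P.A S.hs f t) ^ 2 ≤
      JJ F c L μ P S.hs f := by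
  have hLL : -L ≤ L := by linarith [S.hL]
  have c1 := (P.A S.hs f).continuous
  have c2 := (P.A S.hs f').continuous
  have c3 := f.continuous
  have c4 := f'.continuous
  have c5 := W.continuous.comp (S.continuous_U0 f)
  have c6 := W.continuous.comp (S.continuous_U0 f')
  have c7 := continuous_qf μ
  have c8 := c5.mul (c7.pow 2)
  have c9 := c6.mul (c7.pow 2)
  have c10 := continuous_const (y := κ / 2) |>.mul ((c2.sub c1).pow 2)
  have c11 := c4.mul (c2.sub c1)
  have hsub : Refl L (f' - f : Cb) := fun t => by
    simp only [coe_sub, Pi.sub_apply, (hf.1 t).1, (hf.1 t).2,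
      (hf'.1 t).1, (hf'.1 t).2]
    constructor <;> ring
  have h0 : 0 ≤ ∫ t in -L..L, (f' t - f t) * (P.A S.hs f' t - P.A S.hs f t) := by
    have h1 := P.A_coer S.hs S.hL.le S.hV hsub
    have h2 : 0 ≤ ∫ t in -L..L, P.A S.hs (f' - f) t ^ 2 :=
      intervalIntegral.integral_nonneg hLL fun t _ => sq_nonneg _
    have h3 := nonneg_of_mul_nonneg_right (h2.trans h1) (Pot.CA_pos S.hs P.l_pos)
    simpa only [Pot.A_apply, P.N_sub S.hs, coe_sub, Pi.sub_apply] using h3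
  have hsym := P.A_symm S.hs S.hL.le S.hV hf.1 hf'.1
  have hle : ∫ t in -L..L, (F (P.U μ s c f' t 0) * qf μ t ^ 2 +
      κ / 2 * (P.A S.hs f' t - P.A S.hs f t) ^ 2) ≤
      ∫ t in -L..L, (F (P.U μ s c f t 0) * qf μ t ^ 2 - f' t * (P.A S.hs f' t - P.A S.hs f t)) := by
    refine integral_mono_on hLL (c9.add c10 |>.intervalIntegrable _ _)
      (c8.sub c11 |>.intervalIntegrable _ _) fun t ht => ?_
    have ht := abs_le.2 ht
    have h1 := W.taylor (abs_le.1 (hf.2.1 t 0 ht le_rfl)) (abs_le.1 (hf'.2.1 t 0 ht le_rfl))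
    have hq := qf_mul_neg μ t
    have hU : qf μ t * (P.U μ s c f' t 0 - P.U μ s c f t 0) = P.A S.hs f' t - P.A S.hs f t := by
      rw [Pot.U, Pot.U, Pot.A_apply, Pot.A_apply]
      linear_combination (P.N s f' t 0 - P.N s f t 0) * hq
    rw [← hU, h t ht]
    have h2 := mul_le_mul_of_nonneg_right h1 (sq_nonneg (qf μ t))
    linarith
  have i1 : ∫ t in -L..L, (f' t - f t) * (P.A S.hs f' t - P.A S.hs f t) =
      (∫ t in -L..L, f' t * P.A S.hs f' t) - (∫ t in -L..L, f t * P.A S.hs f' t) -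
      (∫ t in -L..L, f' t * P.A S.hs f t) + ∫ t in -L..L, f t * P.A S.hs f t := by
    rw [← intervalIntegral.integral_sub, ← intervalIntegral.integral_sub,
      ← intervalIntegral.integral_add]
    · congr 1; ext t; ring
    all_goals exact Continuous.intervalIntegrable (by fun_prop) _ _
  have i2 : ∫ t in -L..L, (F (P.U μ s c f' t 0) * qf μ t ^ 2 +
      κ / 2 * (P.A S.hs f' t - P.A S.hs f t) ^ 2) = (∫ t in -L..L, F (P.U μ s c f' t 0) * qf μ t ^ 2)
      + κ / 2 * ∫ t in -L..L, (P.A S.hs f' t - P.A S.hs f t) ^ 2 := by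
    rw [intervalIntegral.integral_add, intervalIntegral.integral_const_mul]
    · exact c9.intervalIntegrable _ _
    · exact c10.intervalIntegrable _ _
  have i3 : ∫ t in -L..L, (F (P.U μ s c f t 0) * qf μ t ^ 2 -
      f' t * (P.A S.hs f' t - P.A S.hs f t)) = (∫ t in -L..L, F (P.U μ s c f t 0) * qf μ t ^ 2)
      - ((∫ t in -L..L, f' t * P.A S.hs f' t) - ∫ t in -L..L, f' t * P.A S.hs f t) := by
    rw [← intervalIntegral.integral_sub, ← intervalIntegral.integral_sub]
    · congr 1; ext t; ring
    · exact Continuous.intervalIntegrable c8 _ _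
    · exact Continuous.intervalIntegrable (by fun_prop) _ _
    · exact Continuous.intervalIntegrable (by fun_prop) _ _
    · exact Continuous.intervalIntegrable (by fun_prop) _ _
  rw [JJ, JJ]
  linarith

include W in
lemma JJ_lb {f : Cb} (hf : Good P μ s c L f) :
    ∫ t in -L..L, P.A S.hs f t ^ 2 ≤ 2 * Pot.CA l s * JJ F c L μ P S.hs f := by
  have hLL : -L ≤ L := by linarith [S.hL]
  have h1 := P.A_coer S.hs S.hL.le S.hV hf.1
  have h2 : 0 ≤ ∫ t in -L..L, F (P.U μ s c f t 0) * qf μ t ^ 2 :=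
    intervalIntegral.integral_nonneg hLL fun t ht => mul_nonneg
      (W.nonneg _ (abs_le.1 (hf.2.1 t 0 (abs_le.2 ht) le_rfl))) (sq_nonneg _)
  have := mul_nonneg (Pot.CA_pos S.hs P.l_pos).le h2
  rw [JJ]
  linarith

end Strip

/-! ### Existence on a strip by monotone descent -/

lemma exists_subseq_tendsto {v : ℕ → ℝ → ℝ} {M H α : ℝ} (hα : 0 < α)
    (hM : ∀ k t, |v k t| ≤ M) (hH : ∀ k t t', |v k t - v k t'| ≤ H * |t - t'| ^ α) :
    ∃ (w : ℝ → ℝ) (φ : ℕ → ℕ), StrictMono φ ∧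
      ∀ t, Tendsto (fun k => v (φ k) t) atTop (𝓝 (w t)) := by
  have hc : IsCompact (univ.pi fun _ : ℚ => Icc (-M) M) := isCompact_univ_pi fun _ => isCompact_Icc
  obtain ⟨z, -, φ, hφ, hz⟩ := hc.tendsto_subseq (x := fun k (q : ℚ) => v k q)
    fun k q _ => abs_le.1 (hM k q)
  have hq : ∀ q : ℚ, Tendsto (fun k => v (φ k) q) atTop (𝓝 (z q)) := fun q =>
    (tendsto_pi_nhds.1 hz) q
  have key : ∀ t, ∃ w, Tendsto (fun k => v (φ k) t) atTop (𝓝 w) := by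
    intro t
    refine cauchySeq_tendsto_of_complete (Metric.cauchySeq_iff.2 fun ε hε => ?_)
    have ht : Tendsto (fun x : ℝ => H * |t - x| ^ α) (𝓝 t) (𝓝 0) := by
      have : ContinuousAt (fun x : ℝ => H * |t - x| ^ α) t :=
        continuousAt_const.mul ((by fun_prop : ContinuousAt (fun x => |t - x|) t).rpow_const
          (Or.inr hα.le))
      simpa [ContinuousAt, zero_rpow hα.ne'] using this
    obtain ⟨δ, hδ, h⟩ := Metric.eventually_nhds_iff.1
      (ht.eventually (gt_mem_nhds (show (0:ℝ) < ε / 3 by positivity)))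
    obtain ⟨q, hq1, hq2⟩ := exists_rat_btwn (show t < t + δ by linarith)
    have hq' := h (y := (q:ℝ)) (by rw [Real.dist_eq, abs_of_pos] <;> linarith)
    obtain ⟨n, hn⟩ := Metric.cauchySeq_iff.1 (hq q).cauchySeq (ε / 3) (by positivity)
    refine ⟨n, fun i hi j hj => ?_⟩
    have h1 := hn i hi j hj
    rw [Real.dist_eq] at h1 ⊢
    have h2 := hH (φ i) t q
    have h3 := hH (φ j) t q
    calc |v (φ i) t - v (φ j) t| = |(v (φ i) t - v (φ i) q) + (v (φ i) q - v (φ j) q) -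
          (v (φ j) t - v (φ j) q)| := by ring_nf
      _ ≤ |v (φ i) t - v (φ i) q| + |v (φ i) q - v (φ j) q| + |v (φ j) t - v (φ j) q| :=
          (abs_sub _ _).trans (by gcongr; exact abs_add_le _ _)
      _ < ε := by linarith
  choose w hw using key
  exact ⟨w, φ, hφ, hw⟩

lemma continuous_of_holder {w : ℝ → ℝ} {H α : ℝ} (hα : 0 < α)
    (h : ∀ t t', |w t - w t'| ≤ H * |t - t'| ^ α) : Continuous w := by
  refine continuous_iff_continuousAt.2 fun t => ?_
  have ht : Tendsto (fun x : ℝ => H * |x - t| ^ α) (𝓝 t) (𝓝 0) := by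
    have : ContinuousAt (fun x : ℝ => H * |x - t| ^ α) t :=
      continuousAt_const.mul ((by fun_prop : ContinuousAt (fun x => |x - t|) t).rpow_const
        (Or.inr hα.le))
    simpa [ContinuousAt, zero_rpow hα.ne'] using this
  rw [ContinuousAt, tendsto_iff_dist_tendsto_zero]
  exact squeeze_zero (fun _ => dist_nonneg) (fun x => h x t) ht

lemma tendsto_ext {L : ℝ} (hL : 0 < L) {g : ℕ → ℝ → ℝ} {h : ℝ → ℝ}
    (H : ∀ t, |t| ≤ L → Tendsto (fun k => g k t) atTop (𝓝 (h t))) (t : ℝ) :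
    Tendsto (fun k => ext L (g k) t) atTop (𝓝 (ext L h t)) := by
  have := H _ (abs_fold_le hL t)
  unfold ext
  split_ifs
  exacts [this, this.neg]

namespace Strip
variable {l Λ : ℝ} {P : Pot l Λ} {μ s c L : ℝ} (S : Strip P μ s c L)
  {F F' : ℝ → ℝ} {κ : ℝ} (W : Well F F' κ)
include S W

lemma exists_solution : ∃ f : Cb, Good P μ s c L f ∧
    (∀ t, |t| ≤ L → f t = -(qf μ t * F' (P.U μ s c f t 0))) ∧
    ∫ t in -L..L, P.A S.hs f t ^ 2 ≤ 2 * Pot.CA l s * JJ F c L μ P S.hs 0 := by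
  have hL := S.hL
  have hs := S.hs
  have hLL : -L ≤ L := by linarith
  have hκ := W.κ_pos
  let step : {f // Good P μ s c L f} → {f // Good P μ s c L f} := fun f =>
    ⟨_, (S.good_step W f.2).choose_spec.1⟩
  have hstep : ∀ f : {f // Good P μ s c L f}, ∀ t, |t| ≤ L → (step f).1 t = qf μ t *
      (κ * P.U μ s c f.1 t 0 - F' (P.U μ s c f.1 t 0) - κ * P.U μ s c (step f).1 t 0) := fun f =>
    (S.good_step W f.2).choose_spec.2
  let f : ℕ → {f // Good P μ s c L f} := fun k => step^[k] ⟨0, S.good_zero⟩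
  have hf : ∀ k, f (k + 1) = step (f k) := fun k => Function.iterate_succ_apply' _ _ _
  clear_value step
  have hf0 : (f 0).1 = 0 := rfl
  clear_value f
  have hrel : ∀ k t, |t| ≤ L → (f (k + 1)).1 t = qf μ t * (κ * P.U μ s c (f k).1 t 0 -
      F' (P.U μ s c (f k).1 t 0) - κ * P.U μ s c (f (k + 1)).1 t 0) := fun k => by
    rw [hf k]; exact hstep _
  -- energies
  have hdec : ∀ k, JJ F c L μ P hs (f (k + 1)).1 +
      κ / 2 * ∫ t in -L..L, (P.A hs (f (k + 1)).1 t - P.A hs (f k).1 t) ^ 2 ≤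
      JJ F c L μ P hs (f k).1 := fun k => S.JJ_step W (f k).2 (f (k + 1)).2 (hrel k)
  have hd0 : ∀ k, 0 ≤ ∫ t in -L..L, (P.A hs (f (k + 1)).1 t - P.A hs (f k).1 t) ^ 2 := fun k =>
    intervalIntegral.integral_nonneg hLL fun t _ => sq_nonneg _
  have hlb := fun k => S.JJ_lb W (f k).2
  have hanti : Antitone fun k => JJ F c L μ P hs (f k).1 := antitone_nat_of_succ_le fun k => by
    have := mul_nonneg hκ.le (hd0 k)
    linarith [hdec k]
  have hbdd : BddBelow (range fun k => JJ F c L μ P hs (f k).1) := by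
    refine ⟨0, ?_⟩
    rintro _ ⟨k, rfl⟩
    have h1 : 0 ≤ ∫ t in -L..L, P.A hs (f k).1 t ^ 2 :=
      intervalIntegral.integral_nonneg hLL fun t _ => sq_nonneg _
    have h2 := h1.trans (hlb k)
    rw [mul_comm 2, mul_assoc] at h2
    have := nonneg_of_mul_nonneg_right h2 (Pot.CA_pos hs P.l_pos)
    show 0 ≤ JJ F c L μ P hs (f k).1
    linarith
  have hlim := tendsto_atTop_ciInf hanti hbdd
  have hd : Tendsto (fun k => ∫ t in -L..L, (P.A hs (f (k + 1)).1 t - P.A hs (f k).1 t) ^ 2) atTop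
      (𝓝 0) := by
    have h1 := ((hlim.sub (hlim.comp (tendsto_add_atTop_nat 1))).const_mul (2 / κ))
    rw [sub_self, mul_zero] at h1
    refine squeeze_zero hd0 (fun k => ?_) h1
    have := hdec k
    simp only [Function.comp_apply]
    rw [div_mul_eq_mul_div, le_div_iff₀ hκ]
    linarith
  -- bounds
  have hU : ∀ k t, |t| ≤ L → P.U μ s c (f k).1 t 0 ∈ Icc (-1:ℝ) 1 := fun k t ht =>
    abs_le.1 ((f k).2.2.1 t 0 ht le_rfl)
  set M := qf μ L * (2 * κ) with hM
  have hM0 : 0 ≤ M := by have := qf_pos μ L; positivity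
  have hfM : ∀ k, ‖(f k).1‖ ≤ M := by
    intro k
    cases k with
    | zero => rw [hf0, norm_zero]; exact hM0
    | succ k =>
      refine (norm_le hM0).2
        (Pot.abs_fold_apply hL (f (k + 1)).2.1 fun t ht => ?_)
      rw [hrel k t ht, abs_mul, abs_of_pos (qf_pos μ t)]
      refine mul_le_mul (qf_le_of_abs_le S.hμ.le (by rwa [abs_of_pos hL])) ?_ (abs_nonneg _)
        (qf_pos μ L).le
      have h1 := abs_le.1 (W.g_le (hU k t ht))
      have h2 := hU (k + 1) t ht
      rw [abs_le]
      constructor <;> nlinarith [h2.1, h2.2]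
  obtain ⟨C, hC, hN⟩ := Pot.N_holder_t hs (l := l) (Λ := Λ)
  have hH : ∀ k t t', |P.A hs (f k).1 t - P.A hs (f k).1 t'| ≤ C * (3 * M) * |t - t'| ^ s := by
    intro k t t'
    have := hN P (f k).1 (2 * M) 0 le_rfl (by linarith [hs.2]) (fun t t' => by
      have h1 := ((f k).1.norm_coe_le_norm t).trans (hfM k)
      have h2 := ((f k).1.norm_coe_le_norm t').trans (hfM k)
      rw [norm_eq_abs] at h1 h2
      rw [rpow_zero, mul_one]
      exact (abs_sub _ _).trans (by linarith)) t t' 0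
    rw [zero_add] at this
    refine this.trans ?_
    gcongr
    linarith [hfM k]
  have hA : ∀ k t, |P.A hs (f k).1 t| ≤ P.CN s * M := fun k t =>
    (P.N_le (f k).1 hs t 0).trans (mul_le_mul_of_nonneg_left (hfM k) (P.CN_nonneg hs))
  -- subsequences
  obtain ⟨w₁, φ₁, hφ₁, hw₁⟩ := exists_subseq_tendsto hs.1 hA hH
  obtain ⟨w, φ₂, hφ₂, hw₂⟩ := exists_subseq_tendsto hs.1 (fun k t => hA (φ₁ k + 1) t)
    (fun k => hH (φ₁ k + 1))
  have hw₁' : ∀ t, Tendsto (fun k => P.A hs (f (φ₁ (φ₂ k))).1 t) atTop (𝓝 (w₁ t)) := fun t =>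
    (hw₁ t).comp hφ₂.tendsto_atTop
  have hwc : Continuous w := continuous_of_holder hs.1 fun t t' =>
    le_of_tendsto ((hw₂ t).sub (hw₂ t')).abs (Eventually.of_forall fun k => hH _ t t')
  have hwc₁ : Continuous w₁ := continuous_of_holder hs.1 fun t t' =>
    le_of_tendsto ((hw₁ t).sub (hw₁ t')).abs (Eventually.of_forall fun k => hH _ t t')
  have heq : ∀ t, |t| ≤ L → w₁ t = w t := by
    have h1 : Tendsto (fun k => ∫ t in -L..L, (P.A hs (f (φ₁ (φ₂ k) + 1)).1 t -
        P.A hs (f (φ₁ (φ₂ k))).1 t) ^ 2) atTop (𝓝 (∫ t in -L..L, (w t - w₁ t) ^ 2)) := by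
      refine intervalIntegral.tendsto_integral_filter_of_dominated_convergence
        (fun _ => (2 * (P.CN s * M)) ^ 2) (Eventually.of_forall fun k => ?_)
        (Eventually.of_forall fun k => ae_of_all _ fun t _ => ?_) intervalIntegrable_const
        (ae_of_all _ fun t _ => ((hw₂ t).sub (hw₁' t)).pow 2)
      · exact (((P.A hs _).continuous.sub (P.A hs _).continuous).pow 2).aestronglyMeasurable
      · rw [norm_eq_abs, abs_pow]
        gcongr
        exact (abs_sub _ _).trans (by linarith [hA (φ₁ (φ₂ k)) t, hA (φ₁ (φ₂ k) + 1) t])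
    have h2 := tendsto_nhds_unique h1
      (hd.comp ((hφ₁.comp hφ₂).tendsto_atTop))
    by_contra! ⟨t, ht, hne⟩
    refine (intervalIntegral.integral_pos (by linarith) (by fun_prop) (fun _ _ => sq_nonneg _)
      ⟨t, abs_le.1 ht, ?_⟩).ne' h2
    have := sub_ne_zero.2 hne.symm
    positivity
  -- the limit
  set h : ℝ → ℝ := fun t => c * Hf μ t + qf (-μ) t * w t with hh
  have hhc : Continuous h := by
    have := continuous_Hf μ
    have := continuous_qf (-μ)
    fun_prop
  have hwL : w L = 0 := tendsto_nhds_unique (hw₂ L) (by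
    simp only [(P.refl_A hs S.hV (f _).2.1).right]; exact tendsto_const_nhds)
  have hwL' : w (-L) = 0 := tendsto_nhds_unique (hw₂ (-L)) (by
    simp only [(P.refl_A hs S.hV (f _).2.1).left]; exact tendsto_const_nhds)
  have h1 : -(qf μ L * F' (h L)) = 0 := by
    rw [hh]; simp only [hwL, S.hc, mul_zero, add_zero, W.F'_one, neg_zero]
  have h2 : -(qf μ (-L) * F' (h (-L))) = 0 := by
    rw [hh]; simp only [hwL', Hf_neg, mul_neg, S.hc, mul_zero, add_zero, W.F'_neg_one, neg_zero]
  obtain ⟨φ, hφ⟩ := exists_ext hL (g := fun t => -(qf μ t * F' (h t)))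
    ((continuous_qf μ).mul (W.cont'.comp hhc)).neg h1 h2
  have hφr : Refl L φ := by
    have := refl_ext hL (g := fun t => -(qf μ t * F' (h t))) h1 h2
    exact (funext hφ : ⇑φ = _) ▸ this
  have hU₂ : ∀ t, Tendsto (fun k => P.U μ s c (f (φ₁ (φ₂ k) + 1)).1 t 0) atTop (𝓝 (h t)) :=
    fun t => ((hw₂ t).const_mul _).const_add _
  have hU₁ : ∀ t, |t| ≤ L → Tendsto (fun k => P.U μ s c (f (φ₁ (φ₂ k))).1 t 0) atTop (𝓝 (h t)) :=
    fun t ht => by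
      rw [hh]; simp only [← heq t ht]
      exact ((hw₁' t).const_mul _).const_add _
  have hft : ∀ t, Tendsto (fun k => (f (φ₁ (φ₂ k) + 1)).1 t) atTop (𝓝 (φ t)) := by
    intro t
    simp only [hφ, refl_eq_ext hL (f _).2.1]
    refine tendsto_ext hL (fun t ht => ?_) t
    simp only [hrel _ t ht]
    have h3 := ((((hU₁ t ht).const_mul κ).sub ((W.cont'.tendsto _).comp (hU₁ t ht))).sub
      ((hU₂ t).const_mul κ)).const_mul (qf μ t)
    rw [show -(qf μ t * F' (h t)) = qf μ t * (κ * h t - F' (h t) - κ * h t) by ring]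
    exact h3
  have hNt : ∀ t y, Tendsto (fun k => P.N s (f (φ₁ (φ₂ k) + 1)).1 t y) atTop (𝓝 (P.N s φ t y)) :=
    P.tendsto_N hs (Pk := fun _ => P) (fun _ => tendsto_const_nhds) hft (fun k => hfM _)
  have hUt : ∀ t y, Tendsto (fun k => P.U μ s c (f (φ₁ (φ₂ k) + 1)).1 t y) atTop
      (𝓝 (P.U μ s c φ t y)) := fun t y => ((hNt t y).const_mul _).const_add _
  have hUh : ∀ t, P.U μ s c φ t 0 = h t := fun t => tendsto_nhds_unique (hUt t 0) (hU₂ t)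
  refine ⟨φ, ⟨hφr, fun t y ht hy => ?_, fun t' t y h3 h4 h5 hy => ?_⟩, fun t ht => ?_, ?_⟩
  · exact le_of_tendsto (hUt t y).abs (Eventually.of_forall fun k => (f _).2.2.1 t y ht hy)
  · exact le_of_tendsto_of_tendsto' (hUt t' y) (hUt t y) fun k => (f _).2.2.2 t' t y h3 h4 h5 hy
  · rw [hφ, ext_eq hL _ ht, hUh]
  · have h3 : Tendsto (fun k => ∫ t in -L..L, P.A hs (f (φ₁ (φ₂ k) + 1)).1 t ^ 2) atTop
        (𝓝 (∫ t in -L..L, P.A hs φ t ^ 2)) := by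
      refine intervalIntegral.tendsto_integral_filter_of_dominated_convergence
        (fun _ => (P.CN s * M) ^ 2) (Eventually.of_forall fun k => ?_)
        (Eventually.of_forall fun k => ae_of_all _ fun t _ => ?_) intervalIntegrable_const
        (ae_of_all _ fun t _ => (hNt t 0).pow 2)
      · exact ((P.A hs _).continuous.pow 2).aestronglyMeasurable
      · rw [norm_eq_abs, abs_pow]
        gcongr
        exact hA _ t
    refine le_of_tendsto h3 (Eventually.of_forall fun k => (hlb _).trans ?_)
    have := hanti (Nat.zero_le (φ₁ (φ₂ k) + 1))
    rw [← hf0]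
    have h4 := Pot.CA_pos hs P.l_pos
    exact mul_le_mul_of_nonneg_left this (by positivity)

end Strip

/-! ### Bounds which are uniform in the strip -/

lemma weighted_bound {μ : ℝ} (hμ : 0 < μ) {L K B : ℝ} {D v : ℝ → ℝ}
    (hD : AntitoneOn D (Icc 0 L)) (hD' : ∀ t ∈ Icc 0 L, D t ∈ Icc (0:ℝ) 2) (hv : Continuous v)
    (hK : 0 ≤ K) (h : ∀ t ∈ Icc 0 L, qf μ t * D t ≤ K + |v t|) (hB : ∫ t in (0:ℝ)..L, v t ^ 2 ≤ B)
    {t : ℝ} (ht : t ∈ Icc 0 L) : qf μ t * D t ≤ exp μ * (K + 2 + B) := by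
  have hL : 0 ≤ L := ht.1.trans ht.2
  have hB0 : 0 ≤ B := le_trans (intervalIntegral.integral_nonneg hL fun t _ => sq_nonneg _) hB
  have he := exp_pos μ
  have hq : ∀ x ∈ Icc (t - 1) t, qf μ t ≤ exp μ * qf μ x := fun x hx => by
    refine (qf_le_exp hμ.le x t).trans (mul_le_mul_of_nonneg_right (exp_le_exp.2 ?_) (qf_pos μ x).le)
    rw [abs_of_nonneg (by linarith [hx.2])]
    nlinarith [hx.1]
  rcases le_total t 1 with h1 | h1
  · have h2 := hq 0 ⟨by linarith, ht.1⟩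
    have h3 : qf μ 0 = 1 := by simp [qf]
    rw [h3, mul_one] at h2
    calc qf μ t * D t ≤ exp μ * 2 := mul_le_mul h2 (hD' t ht).2 (hD' t ht).1 he.le
      _ ≤ _ := by gcongr; linarith
  · have key : ∫ _ in (t - 1)..t, qf μ t * D t ≤ ∫ x in (t - 1)..t, exp μ * (K + 1 + v x ^ 2) := by
      refine integral_mono_on (by linarith) intervalIntegrable_const
        (Continuous.intervalIntegrable (by fun_prop) _ _) fun x hx => ?_
      have hx' : x ∈ Icc 0 L := ⟨by linarith [hx.1], hx.2.trans ht.2⟩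
      have h4 := hD hx' ht hx.2
      have h5 := h x hx'
      calc qf μ t * D t ≤ exp μ * qf μ x * D x :=
            mul_le_mul (hq x hx) h4 (hD' t ht).1 (by have := qf_pos μ x; positivity)
        _ = exp μ * (qf μ x * D x) := by ring
        _ ≤ exp μ * (K + 1 + v x ^ 2) := by
            gcongr
            rw [← sq_abs (v x)]
            nlinarith [sq_nonneg (|v x| - 1)]
    have h6 : ∫ x in (t - 1)..t, v x ^ 2 ≤ ∫ x in (0:ℝ)..L, v x ^ 2 :=
      integral_mono_interval (by linarith) (by linarith) ht.2
        (ae_of_all _ fun x => sq_nonneg _) (Continuous.intervalIntegrable (by fun_prop) _ _)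
    rw [intervalIntegral.integral_const, intervalIntegral.integral_const_mul,
      intervalIntegral.integral_add intervalIntegrable_const
        (Continuous.intervalIntegrable (by fun_prop) _ _), intervalIntegral.integral_const] at key
    simp only [sub_sub_cancel, one_smul] at key
    refine key.trans (mul_le_mul_of_nonneg_left ?_ he.le)
    linarith

namespace Strip
variable {l Λ : ℝ} {P : Pot l Λ} {μ s c L : ℝ} (S : Strip P μ s c L)
  {F F' : ℝ → ℝ} {κ : ℝ} (W : Well F F' κ)
include S

lemma one_sub_cHf_le {t : ℝ} (h0 : 0 ≤ t) (ht : t ≤ L) :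
    1 - c * Hf μ t ∈ Icc 0 (c * K0 μ * qf (-(2 * μ)) t) := by
  have hc := Pot.c_pos S.hL S.hc
  constructor
  · linarith [(abs_le.1 (Pot.cHf_le S.hL S.hc (abs_le.2 ⟨by linarith [S.hL], ht⟩))).2]
  · rw [← S.hc]
    have := mul_le_mul_of_nonneg_left (Hf_tail S.hμ h0 ht) hc.le
    linarith

include W in
lemma JJ_zero_le : JJ F c L μ P S.hs 0 ≤ κ * c * K0 μ ^ 2 := by
  have hL := S.hL
  have hc := Pot.c_pos S.hL S.hc
  have hK := K0_pos S.hμ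
  have hκ := W.κ_pos
  have hN : ∀ t y, P.N s 0 t y = 0 := fun t y => by
    have := P.N_const_smul S.hs 0 0 t y
    simpa using this
  have hH := continuous_Hf μ
  have hq := continuous_qf μ
  have hq' := continuous_qf (-(2 * μ))
  have hF := W.continuous.comp (continuous_const (y := c) |>.mul hH)
  have pt : ∀ t, 0 ≤ t → t ≤ L → κ / 2 * (1 - c * Hf μ t) ^ 2 * qf μ t ^ 2 ≤
      κ / 2 * (c * K0 μ) ^ 2 * qf (-(2 * μ)) t := fun t h0 ht => by
    have h1 := S.one_sub_cHf_le h0 ht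
    have h2 := pow_le_pow_left₀ h1.1 h1.2 2
    have h3 : qf (-(2 * μ)) t * (qf μ t * qf μ t) = 1 := by
      rw [qf_mul, qf_mul, show -(2 * μ) + (μ + μ) = 0 by ring, qf_zero]
    calc κ / 2 * (1 - c * Hf μ t) ^ 2 * qf μ t ^ 2
        ≤ κ / 2 * (c * K0 μ * qf (-(2 * μ)) t) ^ 2 * qf μ t ^ 2 := by gcongr
      _ = κ / 2 * (c * K0 μ) ^ 2 * qf (-(2 * μ)) t * (qf (-(2 * μ)) t * (qf μ t * qf μ t)) := by
          ring
      _ = _ := by rw [h3, mul_one]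
  have hle : ∀ t ∈ Icc (-L) L, F (c * Hf μ t) * qf μ t ^ 2 ≤
      κ / 2 * (c * K0 μ) ^ 2 * qf (-(2 * μ)) t := by
    intro t ht
    have h1 := abs_le.1 (Pot.cHf_le S.hL S.hc (abs_le.2 ht))
    rcases le_total 0 t with h0 | h0
    · exact (mul_le_mul_of_nonneg_right (W.F_le_right h1) (sq_nonneg _)).trans (pt t h0 ht.2)
    · have h2 := pt (-t) (by linarith) (by linarith [ht.1])
      rw [Hf_neg, qf_neg, qf_neg, mul_neg, sub_neg_eq_add] at h2
      exact (mul_le_mul_of_nonneg_right (W.F_le_left h1) (sq_nonneg _)).trans h2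
  have hint : ∫ t in -L..L, qf (-(2 * μ)) t = Hf μ L - Hf μ (-L) :=
    integral_eq_sub_of_hasDerivAt (fun t _ => hasDerivAt_Hf μ t)
      (hq'.intervalIntegrable _ _)
  have : ∫ t in -L..L, F (c * Hf μ t) * qf μ t ^ 2 ≤
      ∫ t in -L..L, κ / 2 * (c * K0 μ) ^ 2 * qf (-(2 * μ)) t :=
    integral_mono_on (by linarith) ((hF.mul (hq.pow 2)).intervalIntegrable _ _)
      ((continuous_const.mul hq').intervalIntegrable _ _) hle
  rw [intervalIntegral.integral_const_mul, hint, Hf_neg] at this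
  rw [JJ]
  simp only [coe_zero, Pi.zero_apply, zero_mul,
    intervalIntegral.integral_zero, zero_div, zero_add, Pot.U, hN, mul_zero, add_zero]
  refine this.trans (le_of_eq ?_)
  have := S.hc
  linear_combination κ * c * K0 μ ^ 2 * this

/-- The bound for `q (1 ∓ u)`. -/
noncomputable def bd (μ s l κ L₀ : ℝ) : ℝ :=
  exp μ * (K0 μ / Hf μ L₀ + 2 + 2 * Pot.CA l s * (κ * (Hf μ L₀)⁻¹ * K0 μ ^ 2))

include W in
lemma bound {L₀ : ℝ} (h0 : 0 < L₀) (hL₀ : L₀ ≤ L) {f : Cb} (hf : Good P μ s c L f)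
    (hfF : ∀ t, |t| ≤ L → f t = -(qf μ t * F' (P.U μ s c f t 0)))
    (hB : ∫ t in -L..L, P.A S.hs f t ^ 2 ≤ 2 * Pot.CA l s * JJ F c L μ P S.hs 0) :
    (∀ t, |P.N s f t 0| ≤ bd μ s l κ L₀ + K0 μ / Hf μ L₀) ∧ ‖f‖ ≤ κ / 2 * bd μ s l κ L₀ := by
  have hL := S.hL
  have hc := Pot.c_pos S.hL S.hc
  have hK := K0_pos S.hμ
  have hκ := W.κ_pos
  have hCA := Pot.CA_pos S.hs P.l_pos
  have hH0 := Hf_pos μ h0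
  have hcL : c ≤ (Hf μ L₀)⁻¹ := by
    rw [← one_div, le_div_iff₀ hH0, ← S.hc]
    exact mul_le_mul_of_nonneg_left ((Hf_strictMono μ).monotone hL₀) hc.le
  set K := K0 μ / Hf μ L₀ with hKdef
  have hK0 : 0 ≤ K := by positivity
  have hB' : ∫ t in -L..L, P.A S.hs f t ^ 2 ≤
      2 * Pot.CA l s * (κ * (Hf μ L₀)⁻¹ * K0 μ ^ 2) := by
    refine hB.trans ?_
    gcongr
    exact (S.JJ_zero_le W).trans (by gcongr)
  have cA := (P.A S.hs f).continuous
  have hpos : ∀ t, 0 ≤ t → t ≤ L → qf μ t * (1 - c * Hf μ t) ∈ Icc 0 K := fun t h1 h2 => by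
    have h3 := S.one_sub_cHf_le h1 h2
    have hq := qf_pos μ t
    refine ⟨mul_nonneg hq.le h3.1, (mul_le_mul_of_nonneg_left h3.2 hq.le).trans ?_⟩
    have h4 : qf μ t * qf (-(2 * μ)) t = qf (-μ) t := by rw [qf_mul]; congr 1; ring
    have h5 := qf_neg_mul μ t
    have h6 := qf_neg_le_one S.hμ.le t
    calc qf μ t * (c * K0 μ * qf (-(2 * μ)) t) = c * K0 μ * qf (-μ) t := by rw [← h4]; ring
      _ ≤ (Hf μ L₀)⁻¹ * K0 μ * 1 := by
          have := qf_pos (-μ) t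
          gcongr
      _ = K := by rw [hKdef]; ring
  have hUq : ∀ t, qf μ t * P.U μ s c f t 0 = qf μ t * (c * Hf μ t) + P.A S.hs f t := fun t => by
    rw [Pot.U, Pot.A_apply]; linear_combination P.N s f t 0 * qf_mul_neg μ t
  have hU : ∀ t, |t| ≤ L → P.U μ s c f t 0 ∈ Icc (-1:ℝ) 1 := fun t ht =>
    abs_le.1 (hf.2.1 t 0 ht le_rfl)
  have hR : ∀ t ∈ Icc 0 L, qf μ t * (1 - P.U μ s c f t 0) ≤ bd μ s l κ L₀ := by
    refine fun t ht => weighted_bound S.hμ (D := fun t => 1 - P.U μ s c f t 0)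
      (v := P.A S.hs f) (L := L) ?_ (fun t ht => ?_) cA hK0 (fun t ht => ?_) (le_trans ?_ hB') ht
    · intro x hx y hy hxy
      have := hf.2.2 x y 0 (by linarith [hx.1]) hxy hy.2 le_rfl
      simp only; linarith
    · have := hU t (abs_le.2 ⟨by linarith [ht.1], ht.2⟩)
      constructor <;> linarith [this.1, this.2]
    · have := (hpos t ht.1 ht.2).2
      have h2 := neg_abs_le (P.A S.hs f t)
      linarith [hUq t]
    · exact integral_mono_interval (by linarith) hL.le le_rfl
        (ae_of_all _ fun x => sq_nonneg _) (Continuous.intervalIntegrable (by fun_prop) _ _)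
  have hLf : ∀ t ∈ Icc 0 L, qf μ t * (1 + P.U μ s c f (-t) 0) ≤ bd μ s l κ L₀ := by
    refine fun t ht => weighted_bound S.hμ (D := fun t => 1 + P.U μ s c f (-t) 0)
      (v := fun t => P.A S.hs f (-t)) (L := L) ?_ (fun t ht => ?_) (by fun_prop) hK0
      (fun t ht => ?_) (le_trans ?_ hB') ht
    · intro x hx y hy hxy
      have := hf.2.2 (-y) (-x) 0 (by linarith [hy.2]) (by linarith) (by linarith [hx.1]) le_rfl
      simp only; linarith
    · have := hU (-t) (by rw [abs_neg]; exact abs_le.2 ⟨by linarith [ht.1], ht.2⟩)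
      constructor <;> linarith [this.1, this.2]
    · have := (hpos t ht.1 ht.2).2
      have h2 := le_abs_self (P.A S.hs f (-t))
      have h3 := hUq (-t)
      rw [qf_neg, Hf_neg] at h3
      linarith
    · rw [integral_comp_neg (fun t => P.A S.hs f t ^ 2), neg_zero]
      exact integral_mono_interval le_rfl (by linarith) hL.le
        (ae_of_all _ fun x => sq_nonneg _) (Continuous.intervalIntegrable (by fun_prop) _ _)
  have hbd : 0 ≤ bd μ s l κ L₀ := le_trans
    (mul_nonneg (qf_pos μ L).le (by linarith [(hU L (abs_of_pos hL).le).2]))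
    (hR L (right_mem_Icc.2 hL.le))
  constructor
  · refine Pot.abs_fold_apply hL (P.refl_A S.hs S.hV hf.1) fun t ht => ?_
    have h1 := hU t ht
    have hq := qf_pos μ t
    rcases le_total 0 t with h | h
    · have h2 := hR t ⟨h, (abs_le.1 ht).2⟩
      have h3 := hpos t h (abs_le.1 ht).2
      have h4 : 0 ≤ qf μ t * (1 - P.U μ s c f t 0) := mul_nonneg hq.le (by linarith [h1.2])
      rw [abs_le]
      constructor <;> linarith [hUq t, h3.1, h3.2]
    · have h2 := hLf (-t) ⟨by linarith, by linarith [(abs_le.1 ht).1]⟩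
      have h3 := hpos (-t) (by linarith) (by linarith [(abs_le.1 ht).1])
      have h4 : 0 ≤ qf μ t * (1 + P.U μ s c f t 0) := mul_nonneg hq.le (by linarith [h1.1])
      rw [neg_neg, qf_neg] at h2
      rw [qf_neg, Hf_neg] at h3
      rw [abs_le]
      constructor <;> linarith [hUq t, h3.1, h3.2]
  · refine (norm_le (by positivity)).2
      (Pot.abs_fold_apply hL hf.1 fun t ht => ?_)
    have h1 := hU t ht
    have hq := qf_pos μ t
    rw [hfF t ht, abs_neg, abs_mul, abs_of_pos hq]
    rcases le_total 0 t with h | h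
    · have h2 := hR t ⟨h, (abs_le.1 ht).2⟩
      have h3 := mul_le_mul_of_nonneg_left (W.F'_le_right h1) hq.le
      nlinarith
    · have h2 := hLf (-t) ⟨by linarith, by linarith [(abs_le.1 ht).1]⟩
      rw [neg_neg, qf_neg] at h2
      have h3 := mul_le_mul_of_nonneg_left (W.F'_le_left h1) hq.le
      nlinarith

end Strip

/-! ### Regularity -/

lemma abs_qf_sub_le {μ : ℝ} (hμ : 0 < μ) {t t' : ℝ} (h : |t - t'| ≤ 1) :
    |qf μ t - qf μ t'| ≤ μ * exp μ * |t - t'| * qf μ t' := by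
  have h1 := qf_le_exp hμ.le t' t
  have h2 := qf_le_exp hμ.le t t'
  rw [abs_sub_comm] at h2
  have hq := qf_pos μ t'
  have hq0 := qf_pos μ t
  set d := |t - t'|
  have hd : 0 ≤ d := abs_nonneg _
  have h3 : exp (μ * d) * exp (-(μ * d)) = 1 := by rw [← exp_add, add_neg_cancel, exp_zero]
  have h4 := add_one_le_exp (-(μ * d))
  have h5 := exp_pos (μ * d)
  have h6 : exp (μ * d) ≤ exp μ := exp_le_exp.2 (by nlinarith)
  have h7 : 1 ≤ exp μ := one_le_exp hμ.le
  have h8 : exp (μ * d) - 1 ≤ μ * exp μ * d := by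
    have : exp (μ * d) - 1 ≤ exp (μ * d) * (μ * d) := by nlinarith
    refine this.trans ?_
    rw [show μ * exp μ * d = exp μ * (μ * d) by ring]
    gcongr
  have h9 := mul_le_mul_of_nonneg_right h8 hq.le
  have h10 := mul_le_mul_of_nonneg_left h2 (exp_pos (-(μ * d))).le
  rw [← mul_assoc, mul_comm (exp (-(μ * d))) (exp (μ * d)), h3, one_mul] at h10
  have h11 : μ * d * qf μ t' ≤ μ * exp μ * d * qf μ t' := by
    gcongr
    nlinarith
  rw [abs_le]
  constructor <;> nlinarith

lemma qf_mul_Hf_sub_le {μ : ℝ} (hμ : 0 < μ) {t t' : ℝ} (h : |t - t'| ≤ 1) :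
    qf μ t * |Hf μ t - Hf μ t'| ≤ exp μ * |t - t'| := by
  have := (convex_uIcc t' t).norm_image_sub_le_of_norm_hasDerivWithin_le
    (f := fun x => qf μ t * Hf μ x) (f' := fun x => qf μ t * qf (-(2 * μ)) x) (C := exp μ)
    (fun x _ => ((hasDerivAt_Hf μ x).const_mul _).hasDerivWithinAt) (fun x hx => ?_)
    left_mem_uIcc right_mem_uIcc
  · rwa [← mul_sub, norm_eq_abs, norm_eq_abs, abs_mul, abs_of_pos (qf_pos μ t)] at this
  · have hq := qf_pos μ x
    have hq1 := one_le_qf hμ.le x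
    have h1 : |t - x| ≤ 1 := (abs_sub_right_of_mem_uIcc hx).trans h
    have h2 : qf μ t ≤ exp μ * qf μ x := (qf_le_exp hμ.le x t).trans
      (mul_le_mul_of_nonneg_right (exp_le_exp.2 (by nlinarith [abs_nonneg (t - x)])) hq.le)
    have h3 : qf (-(2 * μ)) x * (qf μ x * qf μ x) = 1 := by
      rw [qf_mul, qf_mul, show -(2 * μ) + (μ + μ) = 0 by ring, qf_zero]
    have h4 := qf_pos (-(2 * μ)) x
    have h5 : qf (-(2 * μ)) x * qf μ x ≤ 1 := by
      rw [← h3]; gcongr; nlinarith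
    rw [norm_of_nonneg (mul_pos (qf_pos μ t) h4).le]
    calc qf μ t * qf (-(2 * μ)) x ≤ exp μ * qf μ x * qf (-(2 * μ)) x := by gcongr
      _ = exp μ * (qf (-(2 * μ)) x * qf μ x) := by ring
      _ ≤ exp μ := mul_le_of_le_one_right (exp_pos μ).le h5

namespace Pot
variable {l Λ : ℝ} (P : Pot l Λ) {μ c s : ℝ} {f : Cb} {F F' : ℝ → ℝ} {κ : ℝ}
  (W : Well F F' κ) (hμ : 0 < μ) (hs : s ∈ Ioo (0:ℝ) 1) {S : Set ℝ}
  (hU : ∀ t ∈ S, P.U μ s c f t 0 ∈ Icc (-1:ℝ) 1)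
  (hf : ∀ t ∈ S, f t = -(qf μ t * F' (P.U μ s c f t 0)))

include W hμ hs hU hf

lemma reaction_lip {t t' : ℝ} (ht : t ∈ S) (ht' : t' ∈ S) (h : |t - t'| ≤ 1) :
    |f t - f t'| ≤ (μ * exp μ * ‖f‖ + κ / 2 * (|c| * exp μ + μ * exp μ * (P.CN s * ‖f‖))) *
      |t - t'| + κ / 2 * |P.N s f t 0 - P.N s f t' 0| := by
  have hκ := W.κ_pos
  have hq := qf_pos μ t
  have hq' := qf_pos μ t'
  have hqm' := qf_pos (-μ) t'
  have h1 : |(qf μ t - qf μ t') * F' (P.U μ s c f t' 0)| ≤ μ * exp μ * |t - t'| * ‖f‖ := by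
    have h2 := f.norm_coe_le_norm t'
    rw [hf t' ht', norm_neg, norm_mul, norm_eq_abs, norm_eq_abs, abs_of_pos hq'] at h2
    rw [abs_mul]
    refine (mul_le_mul_of_nonneg_right (abs_qf_sub_le hμ h) (abs_nonneg _)).trans ?_
    rw [mul_assoc]
    exact mul_le_mul_of_nonneg_left h2 (by positivity)
  have e1 := qf_mul_neg μ t
  have e2 := qf_mul_neg μ t'
  have h3 : |(qf μ t' - qf μ t) * qf (-μ) t'| ≤ μ * exp μ * |t - t'| := by
    rw [abs_mul, abs_of_pos hqm', abs_sub_comm]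
    refine (mul_le_mul_of_nonneg_right (abs_qf_sub_le hμ h) hqm'.le).trans (le_of_eq ?_)
    rw [mul_assoc, e2, mul_one]
  have h4 : qf μ t * |P.U μ s c f t 0 - P.U μ s c f t' 0| ≤ |c| * (exp μ * |t - t'|) +
      (|P.N s f t 0 - P.N s f t' 0| + μ * exp μ * |t - t'| * (P.CN s * ‖f‖)) := by
    have : qf μ t * (P.U μ s c f t 0 - P.U μ s c f t' 0) = c * (qf μ t * (Hf μ t - Hf μ t')) +
        ((P.N s f t 0 - P.N s f t' 0) + (qf μ t' - qf μ t) * qf (-μ) t' * P.N s f t' 0) := by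
      rw [U, U]
      linear_combination P.N s f t 0 * e1 - P.N s f t' 0 * e2
    rw [show ∀ x : ℝ, qf μ t * |x| = |qf μ t * x| from fun x => by rw [abs_mul, abs_of_pos hq],
      this]
    refine (abs_add_le _ _).trans (add_le_add ?_ ((abs_add_le _ _).trans
      (add_le_add le_rfl ?_)))
    · rw [abs_mul, abs_mul, abs_of_pos hq]
      exact mul_le_mul_of_nonneg_left (qf_mul_Hf_sub_le hμ h) (abs_nonneg c)
    · rw [abs_mul]
      exact mul_le_mul h3 (P.N_le f hs t' 0) (abs_nonneg _) (by positivity)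
  have h5 : |qf μ t * (F' (P.U μ s c f t 0) - F' (P.U μ s c f t' 0))| ≤
      κ / 2 * (qf μ t * |P.U μ s c f t 0 - P.U μ s c f t' 0|) := by
    rw [abs_mul, abs_of_pos hq]
    have := mul_le_mul_of_nonneg_left (W.lip _ (hU t ht) _ (hU t' ht')) hq.le
    linarith
  have e : f t - f t' = -(qf μ t * (F' (P.U μ s c f t 0) - F' (P.U μ s c f t' 0)) +
      (qf μ t - qf μ t') * F' (P.U μ s c f t' 0)) := by rw [hf t ht, hf t' ht']; ring
  rw [e, abs_neg]
  refine (abs_add_le _ _).trans ?_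
  have := mul_le_mul_of_nonneg_left h4 (by positivity : 0 ≤ κ / 2)
  linarith

lemma exists_holder (hS : ∀ H α : ℝ, 0 ≤ H → 0 ≤ α →
      (∀ t ∈ S, ∀ t' ∈ S, |f t - f t'| ≤ H * |t - t'| ^ α) →
      ∃ H', ∀ t t', |f t - f t'| ≤ H' * |t - t'| ^ α) :
    ∃ H α : ℝ, α ∈ Icc (0:ℝ) 1 ∧ 1 - 2 * s < α ∧ ∀ t t', |f t - f t'| ≤ H * |t - t'| ^ α := by
  have hκ := W.κ_pos
  obtain ⟨C, hC, hN⟩ := N_holder_t hs (l := l) (Λ := Λ)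
  have h0 : ∀ t t', |f t - f t'| ≤ 2 * ‖f‖ := fun t t' => by
    have h1 := f.norm_coe_le_norm t
    have h2 := f.norm_coe_le_norm t'
    rw [norm_eq_abs] at h1 h2
    exact (abs_sub _ _).trans (by linarith)
  have key : ∀ n : ℕ, (n:ℝ) * s ≤ 1 →
      ∃ H, ∀ t t', |f t - f t'| ≤ H * |t - t'| ^ ((n:ℝ) * s) := by
    intro n
    induction n with
    | zero => exact fun _ => ⟨2 * ‖f‖, fun t t' => by simpa using h0 t t'⟩
    | succ n ih =>
      intro hn
      push_cast at hn ⊢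
      have hns : 0 ≤ (n:ℝ) * s := mul_nonneg n.cast_nonneg hs.1.le
      obtain ⟨H, hH⟩ := ih (by linarith [hs.1])
      have hv := fun t t' => hN P f H _ hns (by linarith) hH t t' 0
      rw [← add_one_mul] at hv
      set A := μ * exp μ * ‖f‖ + κ / 2 * (|c| * exp μ + μ * exp μ * (P.CN s * ‖f‖))
      have hA : 0 ≤ A := by have := P.CN_nonneg hs; positivity
      have hH0 : 0 ≤ H := by
        have := (abs_nonneg _).trans (hH 1 0)
        simpa using this
      refine hS (A + κ / 2 * (C * (H + ‖f‖)) + 2 * ‖f‖) _ (by positivity)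
        (by linarith [hs.1]) fun t ht t' ht' => ?_
      have hd := abs_nonneg (t - t')
      rcases le_total |t - t'| 1 with h | h
      · have h7 := P.reaction_lip W hμ hs hU hf ht ht' h
        change _ ≤ A * _ + _ at h7
        have h2 : |t - t'| ≤ |t - t'| ^ (((n:ℝ) + 1) * s) := by
          rcases hd.eq_or_lt with h3 | h3
          · rw [← h3]; exact rpow_nonneg le_rfl _
          · simpa using rpow_le_rpow_of_exponent_ge h3 h (by linarith : ((n:ℝ) + 1) * s ≤ 1)
        have h4 := mul_le_mul_of_nonneg_left (hv t t') (by positivity : 0 ≤ κ / 2)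
        have h5 := mul_le_mul_of_nonneg_left h2 hA
        have h6 : 0 ≤ 2 * ‖f‖ * |t - t'| ^ (((n:ℝ) + 1) * s) := by positivity
        linarith
      · refine (h0 t t').trans ?_
        have h2 : 1 ≤ |t - t'| ^ (((n:ℝ) + 1) * s) := one_le_rpow h (by linarith [hs.1])
        have h3 : 0 ≤ A + κ / 2 * (C * (H + ‖f‖)) := by positivity
        nlinarith [norm_nonneg f]
  have hf1 := Nat.floor_le (a := 1 / s) (by have := hs.1; positivity)
  have hf2 := Nat.lt_floor_add_one (1 / s)
  rw [le_div_iff₀ hs.1] at hf1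
  rw [div_lt_iff₀ hs.1] at hf2
  obtain ⟨H, hH⟩ := key _ hf1
  exact ⟨H, _, ⟨mul_nonneg (Nat.cast_nonneg _) hs.1.le, hf1⟩, by linarith [hs.1], hH⟩

end Pot

lemma Strip.exists_holder {l Λ : ℝ} {P : Pot l Λ} {μ s c L : ℝ} (S : Strip P μ s c L)
    {F F' : ℝ → ℝ} {κ : ℝ} (W : Well F F' κ) {f : Cb} (hf : Good P μ s c L f)
    (hfF : ∀ t, |t| ≤ L → f t = -(qf μ t * F' (P.U μ s c f t 0))) :
    ∃ H α : ℝ, α ∈ Icc (0:ℝ) 1 ∧ 1 - 2 * s < α ∧ ∀ t t', |f t - f t'| ≤ H * |t - t'| ^ α := by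
  refine P.exists_holder W S.hμ S.hs (S := Icc (-L) L)
    (fun t ht => abs_le.1 (hf.2.1 t 0 (abs_le.2 ht) le_rfl)) (fun t ht => hfF t (abs_le.2 ht))
    fun H α hH hα h => ⟨2 * H, fun t x => ?_⟩
  rw [refl_eq_ext S.hL hf.1 t, refl_eq_ext S.hL hf.1 x]
  exact ext_holder S.hL hf.1.right hf.1.left hH hα h t x

/-! ### A Hopf-type lower barrier -/

/-- The profile `exp (K y²) (1 + m y^{2s})` and its derivatives. -/
noncomputable def prof (s K m y : ℝ) : ℝ := rexp (K * y ^ 2) * (1 + m * y ^ (2 * s))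
noncomputable def prof' (s K m y : ℝ) : ℝ :=
  2 * K * y * prof s K m y + rexp (K * y ^ 2) * (m * (2 * s * y ^ (2 * s - 1)))
noncomputable def prof'' (s K m y : ℝ) : ℝ :=
  2 * K * prof s K m y + 2 * K * y * prof' s K m y +
    2 * K * y * (rexp (K * y ^ 2) * (m * (2 * s * y ^ (2 * s - 1)))) +
    rexp (K * y ^ 2) * (m * (2 * s * ((2 * s - 1) * y ^ (2 * s - 2))))

lemma hasDerivAt_prof (s K m : ℝ) {y : ℝ} (hy : 0 < y) :
    HasDerivAt (prof s K m) (prof' s K m y) y := by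
  have h1 : HasDerivAt (fun y : ℝ => rexp (K * y ^ 2)) _ y :=
    ((hasDerivAt_pow 2 y).const_mul K).exp
  have h2 : HasDerivAt (fun y : ℝ => 1 + m * y ^ (2 * s)) _ y :=
    ((hasDerivAt_rpow_const (p := 2 * s) (Or.inl hy.ne')).const_mul m).const_add 1
  have h : HasDerivAt (prof s K m) _ y := h1.fun_mul h2
  refine h.congr_deriv ?_
  rw [prof', prof]
  push_cast
  ring

lemma hasDerivAt_prof' (s K m : ℝ) {y : ℝ} (hy : 0 < y) :
    HasDerivAt (prof' s K m) (prof'' s K m y) y := by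
  have h1 : HasDerivAt (fun y : ℝ => rexp (K * y ^ 2)) _ y :=
    ((hasDerivAt_pow 2 y).const_mul K).exp
  have h2 : HasDerivAt (fun y : ℝ => m * (2 * s * y ^ (2 * s - 1))) _ y :=
    ((hasDerivAt_rpow_const (p := 2 * s - 1) (Or.inl hy.ne')).const_mul (2 * s)).const_mul m
  have h3 : HasDerivAt (fun y : ℝ => 2 * K * y) _ y := (hasDerivAt_id y).const_mul (2 * K)
  have h : HasDerivAt (prof' s K m) _ y :=
    (h3.fun_mul (hasDerivAt_prof s K m hy)).fun_add (h1.fun_mul h2)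
  refine h.congr_deriv ?_
  rw [prof'', show 2 * s - 1 - 1 = 2 * s - 2 by ring]
  push_cast
  ring

lemma continuous_prof {s : ℝ} (hs : 0 < s) (K m : ℝ) : Continuous (prof s K m) := by
  have h1 : Continuous fun y : ℝ => y ^ (2 * s) := continuous_rpow_const (by positivity)
  unfold prof
  fun_prop

lemma prof_zero {s : ℝ} (hs : 0 < s) (K m : ℝ) : prof s K m 0 = 1 := by
  rw [prof, zero_rpow (by positivity)]; norm_num

lemma prof_mono {s K m : ℝ} (hs : 0 < s) (hK : 0 ≤ K) (hm : 0 ≤ m) {x y : ℝ} (hx : 0 ≤ x)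
    (hxy : x ≤ y) : prof s K m x ≤ prof s K m y := by
  unfold prof
  have := rpow_nonneg hx (2 * s)
  have h2 := rpow_le_rpow hx hxy (by positivity : 0 ≤ 2 * s)
  gcongr

lemma one_le_prof {s K m : ℝ} (hs : 0 < s) (hK : 0 ≤ K) (hm : 0 ≤ m) {y : ℝ} (hy : 0 ≤ y) :
    1 ≤ prof s K m y := by
  rw [← prof_zero hs K m]; exact prof_mono hs hK hm le_rfl hy

lemma prof_eqn {s K m : ℝ} (hs : s ∈ Ioo (0:ℝ) 1) (hK : 0 ≤ K) (hm : 0 ≤ m) {y : ℝ} (hy : 0 < y) :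
    4 * K * (1 - s) * prof s K m y ≤ prof'' s K m y + (1 - 2 * s) / y * prof' s K m y := by
  have h0 := hs.1
  have hp : 0 ≤ prof s K m y := zero_le_one.trans (one_le_prof hs.1 hK hm hy.le)
  have e1 : y ^ (2 * s - 1) = y * y ^ (2 * s - 2) := by
    rw [show 2 * s - 1 = 1 + (2 * s - 2) by ring, rpow_add hy, rpow_one]
  have hz : 0 ≤ rexp (K * y ^ 2) * (m * (2 * s * (y * y ^ (2 * s - 2)))) := by positivity
  rw [prof'', prof', e1]
  set z := rexp (K * y ^ 2) * (m * (2 * s * (y * y ^ (2 * s - 2)))) with hzd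
  have e2 : rexp (K * y ^ 2) * (m * (2 * s * ((2 * s - 1) * y ^ (2 * s - 2)))) =
      (2 * s - 1) / y * z := by rw [hzd]; field_simp
  have e3 : (1 - 2 * s) / y * (2 * K * y * prof s K m y + z) =
      (1 - 2 * s) * (2 * K * prof s K m y) - (2 * s - 1) / y * z := by field_simp; ring
  rw [e2, e3]
  have i1 : 0 ≤ 2 * K * y * (2 * K * y * prof s K m y + z) := by positivity
  have i2 : 0 ≤ 2 * K * y * z := by positivity
  nlinarith

lemma tendsto_prof' {s : ℝ} (hs : s ∈ Ioo (0:ℝ) 1) (K m : ℝ) :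
    Tendsto (fun y => y ^ (1 - 2 * s) * prof' s K m y) (𝓝[>] 0) (𝓝 (2 * s * m)) := by
  have h1 : Continuous fun y : ℝ => 2 * K * y ^ (2 - 2 * s) * prof s K m y +
      rexp (K * y ^ 2) * (2 * s * m) := by
    have h1 : Continuous fun y : ℝ => y ^ (2 - 2 * s) :=
      continuous_rpow_const (by linarith [hs.2])
    have h2 := continuous_prof hs.1 K m
    fun_prop
  have h3 := (h1.tendsto 0).mono_left (nhdsWithin_le_nhds (s := Ioi 0))
  rw [zero_rpow (by linarith [hs.2])] at h3
  norm_num at h3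
  refine h3.congr' ?_
  filter_upwards [self_mem_nhdsWithin] with y (hy : 0 < y)
  have e1 : y ^ (1 - 2 * s) * y ^ (2 * s - 1) = 1 := by
    rw [← rpow_add hy]; norm_num
  have e2 : y ^ (2 - 2 * s) = y * y ^ (1 - 2 * s) := by
    rw [show 2 - 2 * s = 1 + (1 - 2 * s) by ring, rpow_add hy, rpow_one]
  rw [prof', e2]
  linear_combination (-(rexp (K * y ^ 2) * (2 * s * m))) * e1

lemma bump_ineq {R B t b M : ℝ} (ht : |t| < R) (hb : |b| ≤ B)
    (hM : (12 + 4 * (B * R)) ^ 2 < 32 * M * R ^ 2) :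
    0 < (R ^ 2 - t ^ 2) ^ 2 * M + (8 * t ^ 2 - 4 * (R ^ 2 - t ^ 2)) -
      b * (4 * t * (R ^ 2 - t ^ 2)) := by
  have hr : 0 < R ^ 2 - t ^ 2 := by nlinarith [abs_lt.1 ht]
  set r := R ^ 2 - t ^ 2 with hrd
  have hbt : b * t ≤ B * R := by
    calc _ ≤ |b * t| := le_abs_self _
      _ = |b| * |t| := abs_mul _ _
      _ ≤ _ := mul_le_mul hb ht.le (abs_nonneg _) ((abs_nonneg _).trans hb)
  have e : 8 * t ^ 2 = 8 * R ^ 2 - 8 * r := by rw [hrd]; ring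
  have i1 : b * (4 * t * r) ≤ 4 * (B * R) * r := by nlinarith
  have hM0 : 0 < M := by
    by_contra! h
    nlinarith [sq_nonneg (12 + 4 * (B * R)), sq_nonneg R]
  have key : 0 < r ^ 2 * M - (12 + 4 * (B * R)) * r + 8 * R ^ 2 := by
    set A := 12 + 4 * (B * R)
    have : 0 < 4 * M * (r ^ 2 * M - A * r + 8 * R ^ 2) := by
      nlinarith [sq_nonneg (2 * M * r - A)]
    exact (pos_iff_pos_of_mul_pos this).1 (by positivity)
  nlinarith

lemma exists_barrier {s R Y κ B : ℝ} (hs : s ∈ Ioo (0:ℝ) 1) (hR : 0 < R) (hY : 0 < Y) (hκ : 0 ≤ κ)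
    (hB : 0 ≤ B) :
    ∃ η > 0, ∀ (Z Zt Zy Ztt Zyy : ℝ → ℝ → ℝ) (b g : ℝ → ℝ) (c₀ : ℝ), 0 < c₀ →
      (∀ t, |t| ≤ R → |b t| ≤ B) →
      Continuous (fun p : ℝ² => Z p.1 p.2) →
      (∀ t y, 0 < y → HasDerivAt (fun t => Z t y) (Zt t y) t) →
      (∀ t y, 0 < y → HasDerivAt (fun t => Zt t y) (Ztt t y) t) →
      (∀ t y, 0 < y → HasDerivAt (fun y => Z t y) (Zy t y) y) →
      (∀ t y, 0 < y → HasDerivAt (fun y => Zy t y) (Zyy t y) y) →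
      (∀ t, Tendsto (fun y => y ^ (1 - 2 * s) * Zy t y) (𝓝[>] 0) (𝓝 (g t))) →
      (∀ t, |t| ≤ R → g t ≤ κ * Z t 0) →
      (∀ t y, |t| ≤ R → 0 < y →
        Zyy t y + (1 - 2 * s) / y * Zy t y + Ztt t y + b t * Zt t y ≤ 0) →
      (∀ t y, |t| ≤ R → 0 ≤ y → 0 ≤ Z t y) →
      (∀ t y, |t| ≤ R → Y ≤ y → c₀ ≤ Z t y) →
      ∀ t y, |t| ≤ R → 0 ≤ y → y ≤ Y → c₀ * η * (R ^ 2 - t ^ 2) ^ 2 ≤ Z t y := by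
  have h1s : 0 < 1 - s := by linarith [hs.2]
  have hs0 := hs.1
  set m := (κ + 1) / (2 * s) with hm
  have hm0 : 0 < m := by positivity
  set K := ((12 + 4 * (B * R)) ^ 2 + 1) / (128 * R ^ 2 * (1 - s)) with hK
  have hK0 : 0 < K := by positivity
  have hKM : (12 + 4 * (B * R)) ^ 2 < 32 * (4 * K * (1 - s)) * R ^ 2 := by
    have : 32 * (4 * K * (1 - s)) * R ^ 2 = (12 + 4 * (B * R)) ^ 2 + 1 := by
      rw [hK]; field_simp; norm_num
    linarith
  have hpY := one_le_prof (s := s) hs0 hK0.le hm0.le hY.le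
  refine ⟨(R ^ 4 * prof s K m Y)⁻¹, by positivity, ?_⟩
  intro Z Zt Zy Ztt Zyy b g c₀ hc₀ hb hZ hZt hZtt hZy hZyy hbc hg heq hnn hZY t y ht hy hyY
  set ε := c₀ * (R ^ 4 * prof s K m Y)⁻¹ with hε
  have hε0 : 0 < ε := by positivity
  have hεY : ε * R ^ 4 * prof s K m Y = c₀ := by rw [hε]; field_simp
  have hp1 : ∀ t : ℝ, |t| ≤ R → 0 ≤ (R ^ 2 - t ^ 2) ∧ R ^ 2 - t ^ 2 ≤ R ^ 2 := fun t ht => by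
    have := abs_le.1 ht
    constructor <;> nlinarith
  have hp2 : ∀ t : ℝ, |t| ≤ R → (R ^ 2 - t ^ 2) ^ 2 ≤ R ^ 4 := fun t ht => by
    have := hp1 t ht
    calc _ ≤ (R ^ 2) ^ 2 := pow_le_pow_left₀ this.1 this.2 2
      _ = _ := by ring
  suffices h : 0 ≤ Z t y - ε * (R ^ 2 - t ^ 2) ^ 2 * prof s K m y by
    have h1 := one_le_prof (s := s) hs0 hK0.le hm0.le hy
    have h2 : ε * (R ^ 2 - t ^ 2) ^ 2 ≤ ε * (R ^ 2 - t ^ 2) ^ 2 * prof s K m y :=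
      le_mul_of_one_le_right (by positivity) h1
    linarith
  have cp := continuous_prof hs0 K m
  have hc := (isCompact_Icc (a := -R) (b := R)).prod (isCompact_Icc (a := (0:ℝ)) (b := Y))
  obtain ⟨⟨t₁, y₁⟩, ⟨ht₁, hy₁⟩, hmin⟩ := hc.exists_isMinOn ⟨(t, y), abs_le.1 ht, hy, hyY⟩
    (f := fun p : ℝ² => Z p.1 p.2 - ε * (R ^ 2 - p.1 ^ 2) ^ 2 * prof s K m p.2)
    (by refine (hZ.sub ?_).continuousOn; fun_prop)
  have hmin' : ∀ t y, |t| ≤ R → 0 ≤ y → y ≤ Y →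
      Z t₁ y₁ - ε * (R ^ 2 - t₁ ^ 2) ^ 2 * prof s K m y₁ ≤
      Z t y - ε * (R ^ 2 - t ^ 2) ^ 2 * prof s K m y :=
    fun t y ht hy hyY => hmin (show (t, y) ∈ Icc (-R) R ×ˢ Icc 0 Y from ⟨abs_le.1 ht, hy, hyY⟩)
  refine le_trans ?_ (hmin' t y ht hy hyY)
  by_contra! hneg
  change t₁ ∈ Icc (-R) R at ht₁
  change y₁ ∈ Icc 0 Y at hy₁
  have ht₁' : |t₁| ≤ R := abs_le.2 ht₁
  have hlt : |t₁| < R := by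
    refine lt_of_le_of_ne ht₁' fun h => ?_
    have : R ^ 2 - t₁ ^ 2 = 0 := by rw [← h, sq_abs, sub_self]
    rw [this] at hneg
    have := hnn t₁ y₁ ht₁' hy₁.1
    norm_num at hneg
    linarith
  have hr : 0 < R ^ 2 - t₁ ^ 2 := by nlinarith [abs_lt.1 hlt]
  have hyY : y₁ < Y := by
    refine lt_of_le_of_ne hy₁.2 fun h => ?_
    have h1 := hZY t₁ y₁ ht₁' h.ge
    rw [h] at hneg h1
    have : ε * (R ^ 2 - t₁ ^ 2) ^ 2 * prof s K m Y ≤ ε * R ^ 4 * prof s K m Y := by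
      have := hp2 t₁ ht₁'
      gcongr
    linarith
  rcases eq_or_lt_of_le hy₁.1 with h0 | hy0
  · subst h0
    have h2 : Tendsto (fun y => y ^ (1 - 2 * s) *
        (Zy t₁ y - ε * (R ^ 2 - t₁ ^ 2) ^ 2 * prof' s K m y)) (𝓝[>] 0)
        (𝓝 (g t₁ - ε * (R ^ 2 - t₁ ^ 2) ^ 2 * (2 * s * m))) := by
      refine ((hbc t₁).sub ((tendsto_prof' hs K m).const_mul
        (ε * (R ^ 2 - t₁ ^ 2) ^ 2))).congr fun y => by ring
    have h3 := boundary_min hY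
      (f := fun y => Z t₁ y - ε * (R ^ 2 - t₁ ^ 2) ^ 2 * prof s K m y)
      (by
        refine Continuous.continuousOn (Continuous.sub ?_ (by fun_prop))
        exact hZ.comp (f := fun y : ℝ => (t₁, y)) (by fun_prop))
      (fun y hy => (hZy t₁ y hy).sub ((hasDerivAt_prof s K m hy).const_mul _))
      (fun y hy hyY => hmin' t₁ y ht₁' hy hyY) h2
    rw [prof_zero hs0, mul_one] at hneg
    have e : 2 * s * m = κ + 1 := by rw [hm]; field_simp
    have h4 := hg t₁ ht₁'
    have h5 : 0 < ε * (R ^ 2 - t₁ ^ 2) ^ 2 := by positivity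
    rw [e] at h3
    nlinarith
  · have d1 := deriv_of_isLocalMin (x := t₁)
      (f := fun t => Z t y₁ - ε * (R ^ 2 - t ^ 2) ^ 2 * prof s K m y₁)
      (f' := fun t => Zt t y₁ + ε * prof s K m y₁ * (4 * t * (R ^ 2 - t ^ 2)))
      (f'' := Ztt t₁ y₁ + ε * prof s K m y₁ * (4 * (R ^ 2 - t₁ ^ 2) - 8 * t₁ ^ 2))
      (Eventually.of_forall fun z => by
        have h : HasDerivAt (fun t : ℝ => (R ^ 2 - t ^ 2) ^ 2) _ z :=
          ((hasDerivAt_pow 2 z).const_sub (R ^ 2)).fun_pow 2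
        refine ((hZt z y₁ hy0).sub ((h.const_mul ε).mul_const (prof s K m y₁))).congr_deriv ?_
        push_cast; ring)
      (by
        have h : HasDerivAt (fun t : ℝ => 4 * t * (R ^ 2 - t ^ 2)) _ t₁ :=
          ((hasDerivAt_id t₁).const_mul 4).fun_mul ((hasDerivAt_pow 2 t₁).const_sub (R ^ 2))
        refine ((hZtt t₁ y₁ hy0).add (h.const_mul (ε * prof s K m y₁))).congr_deriv ?_
        push_cast; simp only [id]; ring)
      (by
        filter_upwards [Ioo_mem_nhds (abs_lt.1 hlt).1 (abs_lt.1 hlt).2] with z hz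
        exact hmin' z y₁ (abs_le.2 ⟨hz.1.le, hz.2.le⟩) hy0.le hyY.le)
    have d2 := deriv_of_isLocalMin (x := y₁)
      (f := fun y => Z t₁ y - ε * (R ^ 2 - t₁ ^ 2) ^ 2 * prof s K m y)
      (f' := fun y => Zy t₁ y - ε * (R ^ 2 - t₁ ^ 2) ^ 2 * prof' s K m y)
      (by
        filter_upwards [lt_mem_nhds hy0] with y hy
        exact (hZy t₁ y hy).sub ((hasDerivAt_prof s K m hy).const_mul _))
      ((hZyy t₁ y₁ hy0).sub ((hasDerivAt_prof' s K m hy0).const_mul _))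
      (by
        filter_upwards [Ioo_mem_nhds hy0 hyY] with y hy
        exact hmin' t₁ y ht₁' hy.1.le hy.2.le)
    have h1 := heq t₁ y₁ ht₁' hy0
    have h2 := prof_eqn hs hK0.le hm0.le hy0 (m := m)
    have h3 := bump_ineq hlt (hb t₁ ht₁') hKM
    have hpp := one_le_prof (s := s) hs0 hK0.le hm0.le hy0.le (m := m)
    obtain ⟨d1, d1'⟩ := d1
    obtain ⟨d2, d2'⟩ := d2
    have e1 : Zt t₁ y₁ = -(ε * prof s K m y₁ * (4 * t₁ * (R ^ 2 - t₁ ^ 2))) := by linarith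
    have e2 : Zy t₁ y₁ = ε * (R ^ 2 - t₁ ^ 2) ^ 2 * prof' s K m y₁ := by linarith
    rw [e1, e2] at h1
    have h4 := mul_le_mul_of_nonneg_left h2 (by positivity : 0 ≤ ε * (R ^ 2 - t₁ ^ 2) ^ 2)
    have h5 : 0 < ε * prof s K m y₁ := by positivity
    have h6 := mul_pos h5 h3
    linarith

/-- A bounded monotone solution of the boundary reaction problem on the strip `|t| ≤ L`. -/
structure Layer {l Λ : ℝ} (P : Pot l Λ) (μ s c L : ℝ) (F' : ℝ → ℝ) (f : Cb) : Prop where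
  hs : s ∈ Ioo (0:ℝ) 1
  hμ : 0 < μ
  hc : 0 < c
  hVf : ∀ t, |t| ≤ L → P.V t = Vf μ t
  hfF : ∀ t, |t| ≤ L → f t = -(qf μ t * F' (P.U μ s c f t 0))
  bd : ∀ t y, |t| ≤ L → 0 ≤ y → |P.U μ s c f t y| ≤ 1
  mono : ∀ t' t y, -L ≤ t' → t' ≤ t → t ≤ L → 0 ≤ y → P.U μ s c f t' y ≤ P.U μ s c f t y
  holder : ∃ H α : ℝ, α ∈ Icc (0:ℝ) 1 ∧ 1 - 2 * s < α ∧ ∀ t t', |f t - f t'| ≤ H * |t - t'| ^ α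

namespace Layer
variable {l Λ : ℝ} {P : Pot l Λ} {μ s c L : ℝ} {F F' : ℝ → ℝ} {f : Cb}
  (E : Layer P μ s c L F' f)
include E

lemma hasDerivAt (t y : ℝ) : HasDerivAt (fun t => P.U μ s c f t y) (P.Ut μ s c f t y) t := by
  obtain ⟨H, α, hα, hαs, hH⟩ := E.holder
  exact P.hasDerivAt_U_of μ c f (P.hasDerivAt_N_t_all E.hs hα hαs hH t y)

lemma Ut_nonneg {t y : ℝ} (ht : |t| < L) (hy : 0 < y) : 0 ≤ P.Ut μ s c f t y := by
  have hd := P.hasDerivAt_U_t μ c f E.hs hy t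
  have hn : Icc (-L) L ∈ 𝓝 t := Icc_mem_nhds (abs_lt.1 ht).1 (abs_lt.1 ht).2
  rw [← hd.deriv, ← derivWithin_of_mem_nhds hn]
  refine MonotoneOn.derivWithin_nonneg fun a ha b hb hab => E.mono a b y ha.1 hab hb.2 hy.le

lemma bc {t : ℝ} (ht : |t| ≤ L) : -(qf (-μ) t * f t) = F' (P.U μ s c f t 0) := by
  rw [E.hfF t ht, mul_neg, neg_neg, ← mul_assoc, qf_neg_mul, one_mul]

lemma Ut_far : ∃ Y > 0, ∃ c₁ > 0, ∀ t y, |t| ≤ L → Y ≤ y → c₁ ≤ P.Ut μ s c f t y := by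
  have hμ := E.hμ
  have hc := E.hc
  have hm : 0 < qf (-(2 * μ)) L := qf_pos _ _
  set m := c * qf (-(2 * μ)) L with hmd
  have hm0 : 0 < m := by positivity
  obtain ⟨Y, hY, h⟩ := P.N_decay f E.hs (by positivity : 0 < m / (2 * (1 + μ)))
  refine ⟨Y, hY, m / 2, by positivity, fun t y ht hy => ?_⟩
  obtain ⟨h1, h2⟩ := h t y hy
  have i1 : m ≤ c * qf (-(2 * μ)) t := by
    refine mul_le_mul_of_nonneg_left ?_ hc.le
    rw [qf_inv, qf_inv]
    exact inv_anti₀ (qf_pos _ _)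
      (qf_le_of_abs_le (by positivity) (ht.trans (le_abs_self L)))
  have i2 : |qf (-μ) t * (P.Nt s f t y - μ * tanh t * P.N s f t y)| ≤ m / 2 := by
    rw [abs_mul, abs_of_pos (qf_pos _ _)]
    have hq := qf_neg_le_one hμ.le t
    have h3 : |μ * tanh t * P.N s f t y| ≤ μ * (m / (2 * (1 + μ))) := by
      rw [abs_mul, abs_mul, abs_of_pos hμ]
      have := abs_tanh_le t
      calc _ ≤ μ * 1 * (m / (2 * (1 + μ))) := by gcongr
        _ = _ := by ring
    calc _ ≤ 1 * |P.Nt s f t y - μ * tanh t * P.N s f t y| := by gcongr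
      _ ≤ m / (2 * (1 + μ)) + μ * (m / (2 * (1 + μ))) := by
        rw [one_mul]; exact (abs_sub _ _).trans (add_le_add h2 h3)
      _ = _ := by field_simp
  rw [Pot.Ut]
  linarith [neg_abs_le (qf (-μ) t * (P.Nt s f t y - μ * tanh t * P.N s f t y))]

lemma Ut_pos {κ : ℝ} (W : Well F F' κ) {t y : ℝ} (ht : |t| < L) (hy : 0 ≤ y) :
    0 < P.Ut μ s c f t y := by
  obtain ⟨R, htR, hRL⟩ := exists_between ht
  have hR : 0 < R := (abs_nonneg t).trans_lt htR
  have hs := E.hs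
  have hμ := E.hμ
  obtain ⟨Y, hY, c₁, hc₁, hfar⟩ := E.Ut_far
  rcases le_or_gt Y y with h | hyY
  · exact hc₁.trans_le (hfar t y ht.le h)
  obtain ⟨η, hη, hbar⟩ := exists_barrier hs hR hY W.κ_pos.le (by positivity : 0 ≤ 2 * μ)
  have hr : 0 < R ^ 2 - t ^ 2 := by nlinarith [abs_lt.1 htR]
  refine (by positivity : 0 < c₁ * η * (R ^ 2 - t ^ 2) ^ 2).trans_le ?_
  have hd := E.hasDerivAt t y
  refine ge_of_tendsto hd.tendsto_slope_zero_right ?_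
  filter_upwards [Ioo_mem_nhdsGT (show (0:ℝ) < L - R by linarith)] with δ hδ
  have hδ0 : 0 < δ := hδ.1
  have hL1 : ∀ t, |t| ≤ R → |t + δ| < L := fun t ht => by
    have := abs_le.1 ht
    rw [abs_lt]; constructor <;> linarith [hδ.2]
  have cU := P.continuous_U μ c f hs
  have key := hbar (fun t y => P.U μ s c f (t + δ) y - P.U μ s c f t y)
    (fun t y => P.Ut μ s c f (t + δ) y - P.Ut μ s c f t y)
    (fun t y => P.Uy μ s f (t + δ) y - P.Uy μ s f t y)
    (fun t y => P.Utt μ s c f (t + δ) y - P.Utt μ s c f t y)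
    (fun t y => P.Uyy μ s f (t + δ) y - P.Uyy μ s f t y)
    (fun t => 2 * μ * tanh t) (fun t => -(qf (-μ) (t + δ) * f (t + δ)) - -(qf (-μ) t * f t))
    (δ * c₁) (by positivity)
    (fun t _ => by
      rw [abs_mul, abs_of_pos (by positivity : 0 < 2 * μ)]
      exact mul_le_of_le_one_right (by positivity) (abs_tanh_le t))
    ((cU.comp (f := fun p : ℝ² => (p.1 + δ, p.2)) (by fun_prop)).sub cU)
    (fun t y hy => ((P.hasDerivAt_U_t μ c f hs hy (t + δ)).comp_add_const t δ).sub
      (P.hasDerivAt_U_t μ c f hs hy t))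
    (fun t y hy => ((P.hasDerivAt_Ut_t μ c f hs hy (t + δ)).comp_add_const t δ).sub
      (P.hasDerivAt_Ut_t μ c f hs hy t))
    (fun t y hy => (P.hasDerivAt_U_y μ c f hs hy (t + δ)).sub
      (P.hasDerivAt_U_y μ c f hs hy t))
    (fun t y hy => (P.hasDerivAt_Uy_y μ f hs hy (t + δ)).sub
      (P.hasDerivAt_Uy_y μ f hs hy t))
    (fun t => ((P.tendsto_yUy μ f hs (t + δ)).sub (P.tendsto_yUy μ f hs t)).congr
      fun y => by ring)
    (fun t ht => by
      have h1 := (hL1 t ht).le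
      have h2 : |t| ≤ L := ht.trans hRL.le
      rw [E.bc h1, E.bc h2]
      have h3 := W.lip _ (abs_le.1 (E.bd (t + δ) 0 h1 le_rfl)) _ (abs_le.1 (E.bd t 0 h2 le_rfl))
      have h4 := E.mono t (t + δ) 0 (abs_le.1 h2).1 (by linarith) (abs_le.1 h1).2 le_rfl
      rw [abs_of_nonneg (by linarith : 0 ≤ P.U μ s c f (t + δ) 0 - P.U μ s c f t 0)] at h3
      have := W.κ_pos
      nlinarith [le_abs_self (F' (P.U μ s c f (t + δ) 0) - F' (P.U μ s c f t 0))])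
    (fun t y ht hy => by
      have h1 := P.U_eqn (s := s) μ c f (E.hVf t (ht.trans hRL.le)) hy
      have h2 := P.U_eqn (s := s) μ c f (E.hVf (t + δ) (hL1 t ht).le) hy
      have h3 := E.Ut_nonneg (hL1 t ht) hy
      have h4 : tanh t ≤ tanh (t + δ) := by
        refine monotone_of_deriv_nonneg (fun x => (hasDerivAt_tanh x).differentiableAt)
          (fun x => ?_) (by linarith : t ≤ t + δ)
        rw [(hasDerivAt_tanh x).deriv]
        positivity
      have h5 : 0 ≤ 2 * μ * (tanh (t + δ) - tanh t) * P.Ut μ s c f (t + δ) y :=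
        mul_nonneg (mul_nonneg (by positivity) (by linarith)) h3
      linarith)
    (fun t y ht hy => by
      have := E.mono t (t + δ) y (abs_le.1 (ht.trans hRL.le)).1 (by linarith)
        (abs_lt.1 (hL1 t ht)).2.le hy
      linarith)
    (fun t y ht hy => by
      have hy0 : 0 < y := hY.trans_le hy
      have h := Convex.mul_sub_le_image_sub_of_le_deriv (convex_Icc (-L) L)
        (f := fun t => P.U μ s c f t y) (C := c₁)
        (fun z _ => (P.hasDerivAt_U_t μ c f hs hy0 z).continuousAt.continuousWithinAt)
        (fun z _ => (P.hasDerivAt_U_t μ c f hs hy0 z).differentiableAt.differentiableWithinAt)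
        (fun z hz => by
          rw [(P.hasDerivAt_U_t μ c f hs hy0 z).deriv]
          exact hfar z y (abs_le.2 (interior_subset hz : z ∈ Icc (-L) L)) hy)
        t (abs_le.1 (ht.trans hRL.le)) (t + δ) (abs_le.1 (hL1 t ht).le) (by linarith)
      rw [show t + δ - t = δ by ring] at h
      linarith)
    t y htR.le hy hyY.le
  rw [smul_eq_mul, inv_mul_eq_div, le_div_iff₀ hδ0]
  linarith

lemma strictMono {κ : ℝ} (W : Well F F' κ) {y : ℝ} (hy : 0 ≤ y) :
    StrictMonoOn (fun t => P.U μ s c f t y) (Icc (-L) L) := by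
  have hd := fun t => E.hasDerivAt t y
  refine strictMonoOn_of_deriv_pos (convex_Icc _ _)
    (fun t _ => (hd t).continuousAt.continuousWithinAt) fun t ht => ?_
  rw [interior_Icc] at ht
  rw [(hd t).deriv]
  exact E.Ut_pos W (abs_lt.2 ht) hy

/-- Strict bounds in the interior of the strip. -/
lemma U_abs_lt {κ : ℝ} (W : Well F F' κ) {t y : ℝ} (ht : |t| < L) (hy : 0 ≤ y) :
    |P.U μ s c f t y| < 1 := by
  have hm := E.strictMono W hy
  have h1 := abs_lt.1 ht
  have hL : 0 < L := (abs_nonneg t).trans_lt ht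
  have b1 := abs_le.1 (E.bd L y (abs_of_pos hL).le hy)
  have b2 := abs_le.1 (E.bd (-L) y (by rw [abs_neg, abs_of_pos hL]) hy)
  have i1 := hm ⟨h1.1.le, h1.2.le⟩ (right_mem_Icc.2 (by linarith)) h1.2
  have i2 := hm (left_mem_Icc.2 (by linarith)) ⟨h1.1.le, h1.2.le⟩ h1.1
  simp only at i1 i2
  rw [abs_lt]; constructor <;> linarith

end Layer

/-! ### Primitives depending on a parameter -/

section Primitive
variable {g g' : ℝ → ℝ → ℝ} (hg : ContinuousOn (fun p : ℝ² => g p.1 p.2) ℍ)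
include hg

lemma continuous_slice {y : ℝ} (hy : 0 < y) : Continuous fun x => g x y :=
  continuousOn_univ.1 (hg.comp (f := fun x : ℝ => (x, y)) (by fun_prop) fun _ _ => hy)

lemma continuousOn_primitive :
    ContinuousOn (fun p : ℝ² => ∫ x in (0:ℝ)..p.1, g x p.2) ℍ := by
  intro p hp
  have hp' : 0 < p.2 := hp
  have hp0 : 0 < p.2 / 2 := half_pos hp
  have h1 : Continuous fun q : ℝ² × ℝ => g q.2 (max q.1.2 (p.2 / 2)) :=
    continuousOn_univ.1 (hg.comp (f := fun q : ℝ² × ℝ => (q.2, max q.1.2 (p.2 / 2)))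
      (by fun_prop) fun _ _ => hp0.trans_le (le_max_right _ _))
  have hc : Continuous fun q : ℝ² => ∫ x in (0:ℝ)..q.1, g x (max q.2 (p.2 / 2)) :=
    continuous_parametric_intervalIntegral_of_continuous
    (μ := volume) (a₀ := 0) (f := fun (q : ℝ²) x => g x (max q.2 (p.2 / 2)))
    (s := fun q => q.1) h1 continuous_fst
  refine (hc.continuousAt.congr ?_).continuousWithinAt
  have : ∀ᶠ q : ℝ² in 𝓝 p, p.2 / 2 < q.2 :=
    continuous_snd.continuousAt.eventually (lt_mem_nhds (half_lt_self hp'))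
  filter_upwards [this] with q hq
  rw [max_eq_left hq.le]

lemma hasDerivAt_primitive (hd : ∀ x y, 0 < y → HasDerivAt (fun y => g x y) (g' x y) y)
    (hg' : ContinuousOn (fun p : ℝ² => g' p.1 p.2) ℍ) (x : ℝ) {y : ℝ}
    (hy : 0 < y) :
    HasDerivAt (fun y => ∫ t in (0:ℝ)..x, g t y) (∫ t in (0:ℝ)..x, g' t y) y := by
  have hK := (isCompact_uIcc (a := 0) (b := x)).prod (isCompact_Icc (a := y / 2) (b := 2 * y))
  obtain ⟨C, hC⟩ := hK.exists_bound_of_continuousOn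
    (hg'.mono fun p hp => (half_pos hy).trans_le hp.2.1)
  have hn : Icc (y / 2) (2 * y) ∈ 𝓝 y := Icc_mem_nhds (by linarith) (by linarith)
  refine (intervalIntegral.hasDerivAt_integral_of_dominated_loc_of_deriv_le (μ := volume)
    (F := fun y t => g t y) (F' := fun y t => g' t y) (bound := fun _ => C) hn ?_ ?_ ?_ ?_ ?_ ?_).2
  · filter_upwards [lt_mem_nhds hy] with z hz
    exact (continuous_slice hg hz).aestronglyMeasurable
  · exact (continuous_slice hg hy).intervalIntegrable _ _
  · exact (continuous_slice hg' hy).aestronglyMeasurable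
  · exact ae_of_all _ fun t ht z hz => hC (t, z) ⟨uIoc_subset_uIcc ht, hz⟩
  · exact intervalIntegrable_const
  · exact ae_of_all _ fun t _ z hz => hd t z ((half_pos hy).trans_le hz.1)

end Primitive

/-! ### The inverse of `u(·, y)` -/

namespace Layer
variable {l Λ : ℝ} {P : Pot l Λ} {μ s c L : ℝ} {F F' : ℝ → ℝ} {κ : ℝ} {f : Cb}

open Classical in
variable (P μ s c L f) in
/-- The inverse function of `x ↦ U x y` on `[-L, L]`. -/
noncomputable def X (z y : ℝ) : ℝ :=
  if h : ∃ x ∈ Ioo (-L) L, P.U μ s c f x y = z then h.choose else 0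

variable (E : Layer P μ s c L F' f) (W : Well F F' κ) (hL : 0 < L)
  (hr : ∀ y, P.U μ s c f L y = 1) (hl : ∀ y, P.U μ s c f (-L) y = -1)
include E W hL hr hl

omit W in
lemma X_spec {z y : ℝ} (hz : |z| < 1) :
    X P μ s c L f z y ∈ Ioo (-L) L ∧ P.U μ s c f (X P μ s c L f z y) y = z := by
  have h : ∃ x ∈ Ioo (-L) L, P.U μ s c f x y = z := by
    have hc : Continuous fun x => P.U μ s c f x y :=
      (P.continuous_U μ c f E.hs).comp (f := fun x : ℝ => (x, y)) (by fun_prop)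
    have := intermediate_value_Ioo (by linarith : -L ≤ L) hc.continuousOn
    rw [hr, hl] at this
    exact this (abs_lt.1 hz)
  rw [X, dif_pos h]
  exact h.choose_spec

lemma X_eq {x y : ℝ} (hx : |x| < L) (hy : 0 ≤ y) : X P μ s c L f (P.U μ s c f x y) y = x := by
  have h := E.X_spec hL hr hl (y := y) (E.U_abs_lt W hx hy)
  exact (E.strictMono W hy).injOn (Ioo_subset_Icc_self h.1) (abs_le.1 hx.le) h.2

lemma X_continuousOn :
    ContinuousOn (fun p : ℝ² => X P μ s c L f p.1 p.2) {p | |p.1| < 1 ∧ 0 ≤ p.2} := by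
  rintro ⟨z, y⟩ ⟨hz, hy⟩
  change |z| < 1 at hz
  change 0 ≤ y at hy
  have h := E.X_spec hL hr hl (y := y) hz
  rw [ContinuousWithinAt, tendsto_order]
  have cU := P.continuous_U μ c f E.hs
  constructor
  · intro b hb
    obtain ⟨b', hb1, hb2⟩ := exists_between (max_lt hb h.1.1)
    have hb3 : b' ∈ Icc (-L) L := ⟨((le_max_right _ _).trans_lt hb1).le, (hb2.trans h.1.2).le⟩
    have h1 : P.U μ s c f b' y < z := by
      conv_rhs => rw [← h.2]
      exact E.strictMono W hy hb3 (Ioo_subset_Icc_self h.1) hb2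
    have h2 : ∀ᶠ p : ℝ² in 𝓝 (z, y), P.U μ s c f b' p.2 < p.1 :=
      (cU.comp (f := fun p : ℝ² => (b', p.2)) (by fun_prop)).continuousAt.eventually_lt
        continuous_fst.continuousAt h1
    filter_upwards [nhdsWithin_le_nhds h2, self_mem_nhdsWithin] with p hp hp'
    have h3 := E.X_spec hL hr hl (y := p.2) hp'.1
    refine ((le_max_left _ _).trans_lt hb1).trans ?_
    by_contra! hcon
    have h4 := (E.strictMono W hp'.2).monotoneOn (Ioo_subset_Icc_self h3.1) hb3 hcon
    simp only [h3.2] at h4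
    linarith
  · intro b hb
    obtain ⟨b', hb1, hb2⟩ := exists_between (lt_min hb h.1.2)
    have hb3 : b' ∈ Icc (-L) L := ⟨(h.1.1.trans hb1).le, (hb2.trans_le (min_le_right _ _)).le⟩
    have h1 : z < P.U μ s c f b' y := by
      conv_lhs => rw [← h.2]
      exact E.strictMono W hy (Ioo_subset_Icc_self h.1) hb3 hb1
    have h2 : ∀ᶠ p : ℝ² in 𝓝 (z, y), p.1 < P.U μ s c f b' p.2 :=
      continuous_fst.continuousAt.eventually_lt
        (cU.comp (f := fun p : ℝ² => (b', p.2)) (by fun_prop)).continuousAt h1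
    filter_upwards [nhdsWithin_le_nhds h2, self_mem_nhdsWithin] with p hp hp'
    have h3 := E.X_spec hL hr hl (y := p.2) hp'.1
    refine lt_of_lt_of_le ?_ (hb2.trans_le (min_le_left _ _)).le
    by_contra! hcon
    have h4 := (E.strictMono W hp'.2).monotoneOn hb3 (Ioo_subset_Icc_self h3.1) hcon
    simp only [h3.2] at h4
    linarith

omit E W hL hr hl in
/-- The linear equivalence `(h, k) ↦ (α h + β k, k)`. -/
noncomputable def shear (α β : ℝ) (hα : α ≠ 0) : ℝ² ≃L[ℝ] ℝ² :=
  ContinuousLinearEquiv.equivOfInverse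
    ((α • ContinuousLinearMap.fst ℝ ℝ ℝ + β • ContinuousLinearMap.snd ℝ ℝ ℝ).prod
      (ContinuousLinearMap.snd ℝ ℝ ℝ))
    ((α⁻¹ • (ContinuousLinearMap.fst ℝ ℝ ℝ - β • ContinuousLinearMap.snd ℝ ℝ ℝ)).prod
      (ContinuousLinearMap.snd ℝ ℝ ℝ))
    (fun p => by ext <;> simp [hα]) (fun p => by ext <;> simp [hα])

lemma hasFDerivAt_X {z y : ℝ} (hz : |z| < 1) (hy : 0 < y) :
    HasFDerivAt (fun p : ℝ² => X P μ s c L f p.1 p.2)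
      ((P.Ut μ s c f (X P μ s c L f z y) y)⁻¹ • (ContinuousLinearMap.fst ℝ ℝ ℝ -
        P.Uy μ s f (X P μ s c L f z y) y • ContinuousLinearMap.snd ℝ ℝ ℝ)) (z, y) := by
  have hX := E.X_spec hL hr hl (y := y) hz
  set x := X P μ s c L f z y with hx
  have hpos := E.Ut_pos W (abs_lt.2 hX.1) hy.le
  have hU := hasFDerivAt_of_partial isOpen_upper (g := P.U μ s c f)
    (fun p hp => P.hasDerivAt_U_t μ c f E.hs hp p.1)
    (fun p hp => P.hasDerivAt_U_y μ c f E.hs hp p.1)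
    (P.continuousOn_Ut μ c f E.hs) (P.continuousOn_Uy μ f E.hs)
    (show (x, y) ∈ ℍ from hy)
  have hn : {p : ℝ² | |p.1| < 1 ∧ 0 < p.2} ∈ 𝓝 (z, y) :=
    ((isOpen_lt (by fun_prop) continuous_const).and isOpen_upper).mem_nhds ⟨hz, hy⟩
  have h := HasFDerivAt.of_local_left_inverse
    (f := fun p : ℝ² => (P.U μ s c f p.1 p.2, p.2))
    (g := fun p : ℝ² => (X P μ s c L f p.1 p.2, p.2)) (a := (z, y))
    (f' := shear (P.Ut μ s c f x y) (P.Uy μ s f x y) hpos.ne')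
    (((E.X_continuousOn W hL hr hl).continuousAt
      (mem_of_superset hn fun p hp => ⟨hp.1, hp.2.le⟩)).prodMk continuousAt_snd)
    (hU.prodMk hasFDerivAt_snd)
    (by
      filter_upwards [hn] with p hp
      exact Prod.ext (E.X_spec hL hr hl hp.1).2 rfl)
  exact h.fst

end Layer

/-! ### The calibration -/

namespace Pot
variable {l Λ : ℝ}

/-- Primitives in `x` of `u_x²`, `u_x u_y` and `2μ tanh x u_x²`. -/
noncomputable def GG (P : Pot l Λ) (μ s c : ℝ) (f : Cb) (x y : ℝ) : ℝ :=
  ∫ t in (0:ℝ)..x, P.Ut μ s c f t y ^ 2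
noncomputable def MM (P : Pot l Λ) (μ s c : ℝ) (f : Cb) (x y : ℝ) : ℝ :=
  ∫ t in (0:ℝ)..x, P.Ut μ s c f t y * P.Uy μ s f t y
noncomputable def BB (P : Pot l Λ) (μ s c : ℝ) (f : Cb) (x y : ℝ) : ℝ :=
  ∫ t in (0:ℝ)..x, 2 * μ * tanh t * P.Ut μ s c f t y ^ 2

variable (P : Pot l Λ) (μ c : ℝ) {s : ℝ} (f : Cb) (hs : s ∈ Ioo (0:ℝ) 1)

include hs

lemma continuousOn_Uty : ContinuousOn (fun p : ℝ² => P.Uty μ s f p.1 p.2) ℍ := by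
  have h1 := P.Ny_contOn f hs
  have h2 := P.Nty_contOn f hs
  have h3 := (continuous_qf (-μ)).comp continuous_fst |>.continuousOn (s := ℍ)
  have h5 := continuous_tanh.comp continuous_fst |>.continuousOn (s := ℍ)
  exact h3.mul (h2.sub ((continuousOn_const.mul h5).mul h1))

lemma continuousOn_Uyy : ContinuousOn (fun p : ℝ² => P.Uyy μ s f p.1 p.2) ℍ :=
  ((continuous_qf (-μ)).comp continuous_fst).continuousOn.mul (P.Nyy_contOn f hs)

lemma continuousOn_Utt :
    ContinuousOn (fun p : ℝ² => P.Utt μ s c f p.1 p.2) ℍ := by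
  have h1 := (P.N_cont f hs).continuousOn (s := ℍ)
  have h2 := P.Ntt_contOn f hs
  have h3 := (continuous_qf (-μ)).comp continuous_fst |>.continuousOn (s := ℍ)
  have h4 := (continuous_Vf μ).comp continuous_fst
    |>.continuousOn (s := ℍ)
  have h5 := continuous_tanh.comp continuous_fst |>.continuousOn (s := ℍ)
  exact ((continuousOn_const.mul h5).neg.mul (P.continuousOn_Ut μ c f hs)).add
    (h3.mul (h2.sub (h4.mul h1)))

lemma continuousOn_GG : ContinuousOn (fun p : ℝ² => P.GG μ s c f p.1 p.2) ℍ :=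
  continuousOn_primitive (g := fun t y => P.Ut μ s c f t y ^ 2) ((P.continuousOn_Ut μ c f hs).pow 2)

lemma continuousOn_BB_aux : ContinuousOn
    (fun p : ℝ² => 2 * μ * tanh p.1 * P.Ut μ s c f p.1 p.2 ^ 2) ℍ :=
  ((continuous_const.mul (continuous_tanh.comp continuous_fst)).continuousOn).mul
    ((P.continuousOn_Ut μ c f hs).pow 2)

lemma continuousOn_BB : ContinuousOn (fun p : ℝ² => P.BB μ s c f p.1 p.2) ℍ :=
  continuousOn_primitive (g := fun t y => 2 * μ * tanh t * P.Ut μ s c f t y ^ 2)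
    (P.continuousOn_BB_aux μ c f hs)

lemma hasDerivAt_GG {y : ℝ} (hy : 0 < y) (x : ℝ) :
    HasDerivAt (fun x => P.GG μ s c f x y) (P.Ut μ s c f x y ^ 2) x :=
  ((continuous_slice (P.continuousOn_Ut μ c f hs) hy).pow 2).integral_hasStrictDerivAt 0 x
    |>.hasDerivAt

lemma GG_le_BB (hμ : 0 < μ) {y : ℝ} (hy : 0 < y) (t x : ℝ) :
    2 * μ * tanh t * (P.GG μ s c f x y - P.GG μ s c f t y) ≤
      P.BB μ s c f x y - P.BB μ s c f t y := by
  have c1 : Continuous fun t => P.Ut μ s c f t y ^ 2 :=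
    (continuous_slice (P.continuousOn_Ut μ c f hs) hy).pow 2
  have c2 := continuous_slice (g := fun t y => 2 * μ * tanh t * P.Ut μ s c f t y ^ 2)
    (P.continuousOn_BB_aux μ c f hs) hy
  have hmono : Monotone tanh :=
    monotone_of_deriv_nonneg (fun x => (hasDerivAt_tanh x).differentiableAt) fun x => by
      rw [(hasDerivAt_tanh x).deriv]; positivity
  rw [GG, GG, BB, BB, integral_interval_sub_left (c1.intervalIntegrable _ _)
    (c1.intervalIntegrable _ _), integral_interval_sub_left
    (c2.intervalIntegrable _ _) (c2.intervalIntegrable _ _), ← intervalIntegral.integral_const_mul]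
  rcases le_total t x with h | h
  · refine integral_mono_on h ((c1.const_mul _).intervalIntegrable _ _)
      (c2.intervalIntegrable _ _) fun z hz => ?_
    have := hmono hz.1
    gcongr
  · rw [integral_symm x t, integral_symm x t, neg_le_neg_iff]
    refine integral_mono_on h (c2.intervalIntegrable _ _)
      ((c1.const_mul _).intervalIntegrable _ _) fun z hz => ?_
    have := hmono hz.2
    gcongr

lemma hasDerivAt_MM_x {y : ℝ} (hy : 0 < y) (x : ℝ) :
    HasDerivAt (fun x => P.MM μ s c f x y) (P.Ut μ s c f x y * P.Uy μ s f x y) x :=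
  ((continuous_slice (P.continuousOn_Ut μ c f hs) hy).mul
    (continuous_slice (P.continuousOn_Uy μ f hs) hy)).integral_hasStrictDerivAt 0 x
    |>.hasDerivAt

lemma hasDerivAt_MM_y {y : ℝ} (hy : 0 < y) (x : ℝ) :
    HasDerivAt (fun y => P.MM μ s c f x y) (∫ t in (0:ℝ)..x,
      (P.Uty μ s f t y * P.Uy μ s f t y + P.Ut μ s c f t y * P.Uyy μ s f t y)) y :=
  hasDerivAt_primitive (g := fun t y => P.Ut μ s c f t y * P.Uy μ s f t y)
    (g' := fun t y => P.Uty μ s f t y * P.Uy μ s f t y + P.Ut μ s c f t y * P.Uyy μ s f t y)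
    ((P.continuousOn_Ut μ c f hs).mul (P.continuousOn_Uy μ f hs))
    (fun x _ hy => (P.hasDerivAt_Ut_y μ c f hs hy x).mul (P.hasDerivAt_Uy_y μ f hs hy x))
    (((P.continuousOn_Uty μ f hs).mul (P.continuousOn_Uy μ f hs)).add
      ((P.continuousOn_Ut μ c f hs).mul (P.continuousOn_Uyy μ f hs))) x hy

lemma hasFDerivAt_MM {x y : ℝ} (hy : 0 < y) :
    HasFDerivAt (fun p : ℝ² => P.MM μ s c f p.1 p.2)
      ((P.Ut μ s c f x y * P.Uy μ s f x y) • ContinuousLinearMap.fst ℝ ℝ ℝ +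
        (∫ t in (0:ℝ)..x, (P.Uty μ s f t y * P.Uy μ s f t y +
          P.Ut μ s c f t y * P.Uyy μ s f t y)) • ContinuousLinearMap.snd ℝ ℝ ℝ) (x, y) :=
  hasFDerivAt_of_partial isOpen_upper (g := P.MM μ s c f) (p := (x, y))
    (gx := fun x y => P.Ut μ s c f x y * P.Uy μ s f x y)
    (gy := fun x y => ∫ t in (0:ℝ)..x, (P.Uty μ s f t y * P.Uy μ s f t y +
          P.Ut μ s c f t y * P.Uyy μ s f t y))
    (fun p hp => P.hasDerivAt_MM_x μ c f hs hp p.1) (fun p hp => P.hasDerivAt_MM_y μ c f hs hp p.1)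
    ((P.continuousOn_Ut μ c f hs).mul (P.continuousOn_Uy μ f hs))
    (continuousOn_primitive (g := fun t y => P.Uty μ s f t y * P.Uy μ s f t y +
          P.Ut μ s c f t y * P.Uyy μ s f t y)
      (((P.continuousOn_Uty μ f hs).mul (P.continuousOn_Uy μ f hs)).add
      ((P.continuousOn_Ut μ c f hs).mul (P.continuousOn_Uyy μ f hs)))) hy

lemma MM_y_eq {L : ℝ} (hVf : ∀ t, |t| ≤ L → P.V t = Vf μ t) {x y : ℝ} (hx : |x| ≤ L)
    (hy : 0 < y) :
    ∫ t in (0:ℝ)..x, (P.Uty μ s f t y * P.Uy μ s f t y + P.Ut μ s c f t y * P.Uyy μ s f t y) =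
      (P.Uy μ s f x y ^ 2 - P.Ut μ s c f x y ^ 2) / 2 -
        (P.Uy μ s f 0 y ^ 2 - P.Ut μ s c f 0 y ^ 2) / 2 -
        (1 - 2 * s) / y * P.MM μ s c f x y - P.BB μ s c f x y := by
  have c1 := continuous_slice (P.continuousOn_Ut μ c f hs) hy
  have c2 := continuous_slice (P.continuousOn_Uy μ f hs) hy
  have c3 := continuous_slice (P.continuousOn_Uty μ f hs) hy
  have c4 := continuous_slice (P.continuousOn_Utt μ c f hs) hy
  have c5 := continuous_slice (g := fun t y => 2 * μ * tanh t * P.Ut μ s c f t y ^ 2)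
    (P.continuousOn_BB_aux μ c f hs) hy
  have h1 : ∫ t in (0:ℝ)..x, (P.Uty μ s f t y * P.Uy μ s f t y - P.Utt μ s c f t y * P.Ut μ s c f t y)
      = (P.Uy μ s f x y ^ 2 - P.Ut μ s c f x y ^ 2) / 2 -
        (P.Uy μ s f 0 y ^ 2 - P.Ut μ s c f 0 y ^ 2) / 2 := by
    refine integral_eq_sub_of_hasDerivAt
      (f := fun x => (P.Uy μ s f x y ^ 2 - P.Ut μ s c f x y ^ 2) / 2) (fun z _ => ?_)
      (((c3.mul c2).sub (c4.mul c1)).intervalIntegrable _ _)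
    have h : HasDerivAt (fun x => (P.Uy μ s f x y ^ 2 - P.Ut μ s c f x y ^ 2) / 2) _ z :=
      (((P.hasDerivAt_Uy_t μ f hs hy z).fun_pow 2).fun_sub
        ((P.hasDerivAt_Ut_t μ c f hs hy z).fun_pow 2)).div_const 2
    refine h.congr_deriv ?_
    push_cast; ring
  have c6 : Continuous fun t => P.Uty μ s f t y * P.Uy μ s f t y -
    P.Utt μ s c f t y * P.Ut μ s c f t y := (c3.mul c2).sub (c4.mul c1)
  have c7 : Continuous fun t => (1 - 2 * s) / y * (P.Ut μ s c f t y * P.Uy μ s f t y) :=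
    (c1.mul c2).const_mul _
  rw [← h1, MM, BB, ← intervalIntegral.integral_const_mul, ← intervalIntegral.integral_sub
    (c6.intervalIntegrable _ _) (c7.intervalIntegrable _ _), ← intervalIntegral.integral_sub
    ((c6.fun_sub c7).intervalIntegrable _ _) (c5.intervalIntegrable _ _)]
  refine integral_congr fun z hz => ?_
  have hz' : |z| ≤ L := by
    have h := abs_le.1 hx
    have h0 : (0:ℝ) ∈ Icc (-L) L := by
      have := (abs_nonneg x).trans hx
      exact ⟨by linarith, this⟩
    exact abs_le.2 (uIcc_subset_Icc h0 h hz)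
  have := P.U_eqn (s := s) μ c f (hVf z hz') hy
  linear_combination (P.Ut μ s c f z y) * this

end Pot

lemma integral_div_rect {A A' B B' : ℝ → ℝ → ℝ} {T ε : ℝ} (hT : 0 ≤ T) (hε : ε ≤ T)
    (hA : ∀ t ∈ Icc (-T) T, ∀ y ∈ Icc ε T, HasDerivAt (fun t => A t y) (A' t y) t)
    (hB : ∀ t ∈ Icc (-T) T, ∀ y ∈ Icc ε T, HasDerivAt (fun y => B t y) (B' t y) y)
    (cA : ContinuousOn (fun p : ℝ² => A' p.1 p.2) (Icc (-T) T ×ˢ Icc ε T))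
    (cB : ContinuousOn (fun p : ℝ² => B' p.1 p.2) (Icc (-T) T ×ˢ Icc ε T))
    (hA1 : ∀ y ∈ Icc ε T, A T y = A (-T) y) (hB1 : ∀ t ∈ Icc (-T) T, B t T = 0) :
    ∫ p in Icc (-T) T ×ˢ Icc ε T, (A' p.1 p.2 + B' p.1 p.2) = -∫ t in Icc (-T) T, B t ε := by
  have hT' : -T ≤ T := by linarith
  have hc : IsCompact (Icc (-T) T ×ˢ Icc ε T) := isCompact_Icc.prod isCompact_Icc
  have iA := cA.integrableOn_compact (μ := volume) hc
  have iB := cB.integrableOn_compact (μ := volume) hc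
  rw [integral_add iA iB]
  have h1 : ∫ p in Icc (-T) T ×ˢ Icc ε T, A' p.1 p.2 = 0 := by
    have hsw := setIntegral_prod_swap (μ := volume) (ν := volume) (Icc (-T) T) (Icc ε T)
      (fun p : ℝ² => A' p.1 p.2)
    rw [← Measure.volume_eq_prod] at hsw
    rw [← hsw, Measure.volume_eq_prod, setIntegral_prod]
    · refine setIntegral_eq_zero_of_forall_eq_zero fun y hy => ?_
      have h2 : ContinuousOn (fun t => A' t y) (Icc (-T) T) :=
        cA.comp (f := fun t : ℝ => (t, y)) (by fun_prop) fun t ht => ⟨ht, hy⟩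
      change ∫ t in Icc (-T) T, A' t y = 0
      rw [integral_Icc_eq_integral_Ioc, ← integral_of_le hT',
        integral_eq_sub_of_hasDerivAt (f := fun t => A t y)
        (fun t ht => hA t (by rwa [uIcc_of_le hT'] at ht) y hy)
        (ContinuousOn.intervalIntegrable (by rwa [uIcc_of_le hT'])), hA1 y hy, sub_self]
    · rw [← Measure.volume_eq_prod]
      exact (ContinuousOn.comp cA continuous_swap.continuousOn fun p hp =>
        ⟨hp.2, hp.1⟩).integrableOn_compact (isCompact_Icc.prod isCompact_Icc)
  rw [h1, zero_add, Measure.volume_eq_prod, setIntegral_prod _ (by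
    rwa [← Measure.volume_eq_prod]), ← integral_neg]
  refine setIntegral_congr_fun measurableSet_Icc fun t ht => ?_
  have h2 : ContinuousOn (fun y => B' t y) (Icc ε T) :=
    cB.comp (f := fun y : ℝ => (t, y)) (by fun_prop) fun y hy => ⟨ht, hy⟩
  change ∫ y in Icc ε T, B' t y = _
  rw [integral_Icc_eq_integral_Ioc, ← integral_of_le hε,
    integral_eq_sub_of_hasDerivAt (f := fun y => B t y)
    (fun y hy => hB t ht y (by rwa [uIcc_of_le hε] at hy))
    (ContinuousOn.intervalIntegrable (by rwa [uIcc_of_le hε])), hB1 t ht, zero_sub]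

/-- Perturbations supported in `[-T, T] × [0, T]`, with their partial derivatives. -/
structure Pert (T : ℝ) (w wt wy : ℝ → ℝ → ℝ) : Prop where
  cont : ContinuousOn (fun p : ℝ² => w p.1 p.2) {p | 0 ≤ p.2}
  dt : ∀ t y, 0 < y → HasDerivAt (fun t => w t y) (wt t y) t
  dy : ∀ t y, 0 < y → HasDerivAt (fun y => w t y) (wy t y) y
  ct : ContinuousOn (fun p : ℝ² => wt p.1 p.2) ℍ
  cy : ContinuousOn (fun p : ℝ² => wy p.1 p.2) ℍ
  bdd : ∃ C, ∀ t y, 0 < y → |wt t y| ≤ C ∧ |wy t y| ≤ C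
  zero : ∀ t y, 0 ≤ y → (T ≤ |t| ∨ T ≤ y) → w t y = 0

lemma Pert.zero_pert (T : ℝ) : Pert T 0 0 0 where
  cont := continuousOn_const
  dt t _ _ := hasDerivAt_const t 0
  dy _ y _ := hasDerivAt_const y 0
  ct := continuousOn_const
  cy := continuousOn_const
  bdd := ⟨0, fun _ _ _ => by simp⟩
  zero _ _ _ _ := rfl

lemma integrableOn_rpow_snd {T r : ℝ} (hr : -1 < r) :
    IntegrableOn (fun p : ℝ² => p.2 ^ r) (Icc (-T) T ×ˢ Ioc 0 T) := by
  have h := (intervalIntegrable_rpow' (a := 0) (b := T) hr).1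
  have h1 : IntegrableOn (fun _ : ℝ => (1:ℝ)) (Icc (-T) T) :=
    integrableOn_const measure_Icc_lt_top.ne
  have := Integrable.mul_prod h1 h
  rw [Measure.prod_restrict, ← Measure.volume_eq_prod] at this
  simpa [IntegrableOn] using this

namespace Layer
/-- The leaf `x` of the foliation by translated layers passing through the graph of `u + w`. -/
noncomputable def leaf {l Λ : ℝ} (P : Pot l Λ) (μ s c L : ℝ) (f : Cb) (w : ℝ → ℝ → ℝ)
    (t y : ℝ) : ℝ :=
  X P μ s c L f (P.U μ s c f t y + w t y) y

/-- The weighted energy density of `u + w`. -/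
noncomputable def dens {l Λ : ℝ} (P : Pot l Λ) (μ s c : ℝ) (f : Cb) (wt wy : ℝ → ℝ → ℝ)
    (p : ℝ²) : ℝ :=
  p.2 ^ (1 - 2 * s) * (qf (2 * μ) p.1 * (((P.Ut μ s c f p.1 p.2 + wt p.1 p.2) ^ 2 +
    (P.Uy μ s f p.1 p.2 + wy p.1 p.2) ^ 2) / 2))

section
variable {l Λ : ℝ} {P : Pot l Λ} {μ s c L κ T : ℝ} {F F' : ℝ → ℝ} {f : Cb}
  {w wt wy : ℝ → ℝ → ℝ}
  (E : Layer P μ s c L F' f) (W : Well F F' κ)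
  (hL : 0 < L) (hr : ∀ y, P.U μ s c f L y = 1) (hl : ∀ y, P.U μ s c f (-L) y = -1)
  (w_ : Pert T w wt wy) (hv : ∀ t y, |t| < L → 0 ≤ y → |P.U μ s c f t y + w t y| < 1)

local notation "𝐔" => Pot.U P μ s c f
local notation "𝐔t" => Pot.Ut P μ s c f
local notation "𝐔y" => Pot.Uy P μ s f
local notation "𝛕" => leaf P μ s c L f w

include E W hL hr hl w_ hv

omit W w_ in
lemma leaf_spec {t y : ℝ} (ht : |t| < L) (hy : 0 ≤ y) :
    |𝛕 t y| < L ∧ 𝐔 (𝛕 t y) y = 𝐔 t y + w t y := by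
  have := E.X_spec hL hr hl (y := y) (hv t y ht hy)
  exact ⟨abs_lt.2 this.1, this.2⟩

omit hv in
lemma leaf_eq {t y : ℝ} (ht : |t| < L) (hy : 0 ≤ y) (h : T ≤ |t| ∨ T ≤ y) : 𝛕 t y = t := by
  rw [leaf, w_.zero t y hy h, add_zero, E.X_eq W hL hr hl ht hy]

lemma leaf_continuousOn :
    ContinuousOn (fun p : ℝ² => 𝛕 p.1 p.2) {p | |p.1| < L ∧ 0 ≤ p.2} := by
  refine (E.X_continuousOn W hL hr hl).comp
    (f := fun p : ℝ² => (𝐔 p.1 p.2 + w p.1 p.2, p.2)) ?_ fun p hp => ⟨hv _ _ hp.1 hp.2, hp.2⟩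
  exact ((P.continuous_U μ c f E.hs).continuousOn.add (w_.cont.mono fun p hp => hp.2)).prodMk
    continuousOn_snd

lemma leaf_dt {t y : ℝ} (ht : |t| < L) (hy : 0 < y) :
    HasDerivAt (fun t => 𝛕 t y) ((𝐔t (𝛕 t y) y)⁻¹ * (𝐔t t y + wt t y)) t := by
  have h1 := (E.hasDerivAt t y).fun_add (w_.dt t y hy)
  have h := (E.hasFDerivAt_X W hL hr hl (hv t y ht hy.le) hy).comp_hasDerivAt
    (f := fun t => (𝐔 t y + w t y, y)) t (h1.prodMk (hasDerivAt_const t y))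
  refine HasDerivAt.congr_deriv (f := fun t => 𝛕 t y) h ?_
  simp [leaf]

lemma leaf_dy {t y : ℝ} (ht : |t| < L) (hy : 0 < y) :
    HasDerivAt (fun y => 𝛕 t y)
      ((𝐔t (𝛕 t y) y)⁻¹ * (𝐔y t y + wy t y - 𝐔y (𝛕 t y) y)) y := by
  have h1 := (P.hasDerivAt_U_y μ c f E.hs hy t).fun_add (w_.dy t y hy)
  have h := (E.hasFDerivAt_X W hL hr hl (hv t y ht hy.le) hy).comp_hasDerivAt
    (f := fun y => (𝐔 t y + w t y, y)) y (h1.prodMk (hasDerivAt_id y))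
  refine HasDerivAt.congr_deriv (f := fun y => 𝛕 t y) h ?_
  simp [leaf]

lemma flux_dt {t y : ℝ} (ht : |t| < L) (hy : 0 < y) :
    HasDerivAt (fun t => y ^ (1 - 2 * s) *
        (qf (2 * μ) t * (P.GG μ s c f (𝛕 t y) y - P.GG μ s c f t y)))
      (y ^ (1 - 2 * s) * (qf (2 * μ) t * (2 * μ * tanh t *
          (P.GG μ s c f (𝛕 t y) y - P.GG μ s c f t y) +
        (𝐔t (𝛕 t y) y * (𝐔t t y + wt t y) - 𝐔t t y ^ 2)))) t := by
  have h1 := (P.hasDerivAt_GG μ c f E.hs hy (𝛕 t y)).comp t (E.leaf_dt W hL hr hl w_ hv ht hy)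
  have hp := E.Ut_pos W (E.leaf_spec hL hr hl hv ht hy.le).1 hy.le
  have h : HasDerivAt (fun t => y ^ (1 - 2 * s) *
        (qf (2 * μ) t * (P.GG μ s c f (𝛕 t y) y - P.GG μ s c f t y))) _ t :=
    ((hasDerivAt_qf (2 * μ) t).fun_mul
      (h1.fun_sub (P.hasDerivAt_GG μ c f E.hs hy t))).const_mul (y ^ (1 - 2 * s))
  refine h.congr_deriv ?_
  simp only [Function.comp_apply]
  field_simp
  try ring

lemma flux_dy {t y : ℝ} (hT : |t| < L) (hy : 0 < y) :
    HasDerivAt (fun y => qf (2 * μ) t * (y ^ (1 - 2 * s) *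
        (P.MM μ s c f (𝛕 t y) y - P.MM μ s c f t y)))
      (qf (2 * μ) t * (y ^ (1 - 2 * s) * (𝐔y (𝛕 t y) y * (𝐔y t y + wy t y - 𝐔y (𝛕 t y) y) +
        ((𝐔y (𝛕 t y) y ^ 2 - 𝐔t (𝛕 t y) y ^ 2) / 2 - (𝐔y t y ^ 2 - 𝐔t t y ^ 2) / 2) -
        (P.BB μ s c f (𝛕 t y) y - P.BB μ s c f t y)))) y := by
  have hτ := (E.leaf_spec hL hr hl hv hT hy.le).1
  have hp := E.Ut_pos W hτ hy.le
  have h1 := (P.hasFDerivAt_MM μ c f E.hs (x := 𝛕 t y) hy).comp_hasDerivAt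
    (f := fun y => (𝛕 t y, y)) y
    ((E.leaf_dy W hL hr hl w_ hv hT hy).prodMk (hasDerivAt_id y))
  have h2 := P.hasDerivAt_MM_y μ c f E.hs hy t
  have h3 := hasDerivAt_rpow_const (p := 1 - 2 * s) (Or.inl hy.ne')
  have h : HasDerivAt (fun y => qf (2 * μ) t * (y ^ (1 - 2 * s) *
        (P.MM μ s c f (𝛕 t y) y - P.MM μ s c f t y))) _ y :=
    (h3.fun_mul (h1.fun_sub h2)).const_mul (qf (2 * μ) t)
  refine h.congr_deriv ?_
  rw [rpow_sub_one hy.ne']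
  simp only [Function.comp_apply, _root_.add_apply, _root_.smul_apply,
    ContinuousLinearMap.coe_fst', ContinuousLinearMap.coe_snd',
    smul_eq_mul, mul_one]
  rw [P.MM_y_eq μ c f E.hs E.hVf hτ.le hy, P.MM_y_eq μ c f E.hs E.hVf hT.le hy]
  field_simp
  ring

omit W hL hr hl hv in
lemma dens_continuousOn : ContinuousOn (dens P μ s c f wt wy) ℍ := by
  have c1 := P.continuousOn_Ut μ c f E.hs
  have c2 := P.continuousOn_Uy μ f E.hs
  have c3 : ContinuousOn (fun p : ℝ² => p.2 ^ (1 - 2 * s)) ℍ :=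
    continuousOn_snd.rpow_const fun p hp => Or.inl (ne_of_gt hp)
  have c4 := ((continuous_qf (2 * μ)).comp continuous_fst).continuousOn
    (s := ℍ)
  exact c3.mul (c4.mul ((((c1.add w_.ct).pow 2).add ((c2.add w_.cy).pow 2)).div_const 2))

/-- The calibration inequality away from `y = 0`. -/
lemma rect_le {ε : ℝ} (hTL : T < L) (hε : 0 < ε) (hεT : ε ≤ T) :
    -∫ t in Icc (-T) T, qf (2 * μ) t * (ε ^ (1 - 2 * s) *
      (P.MM μ s c f (𝛕 t ε) ε - P.MM μ s c f t ε)) ≤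
    ∫ p in Icc (-T) T ×ˢ Icc ε T, (dens P μ s c f wt wy p - dens P μ s c f 0 0 p) := by
  have hT : 0 < T := hε.trans_le hεT
  have hab : ∀ t ∈ Icc (-T) T, |t| < L := fun t ht => (abs_le.2 ht).trans_lt hTL
  set R := Icc (-T) T ×ˢ Icc ε T with hR
  have hRc : IsCompact R := isCompact_Icc.prod isCompact_Icc
  have hRu : R ⊆ ℍ := fun p hp => hε.trans_le hp.2.1
  have cτ : ContinuousOn (fun p : ℝ² => (𝛕 p.1 p.2, p.2)) R :=
    ((E.leaf_continuousOn W hL hr hl w_ hv).mono fun p hp =>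
      ⟨hab _ hp.1, (hRu hp).le⟩).prodMk continuousOn_snd
  have key : ∀ g : ℝ → ℝ → ℝ, ContinuousOn (fun p : ℝ² => g p.1 p.2) ℍ →
      ContinuousOn (fun p : ℝ² => g p.1 p.2) R ∧
      ContinuousOn (fun p : ℝ² => g (𝛕 p.1 p.2) p.2) R := fun g hg =>
    ⟨hg.mono hRu, hg.comp cτ fun p hp => show 0 < p.2 from hRu hp⟩
  obtain ⟨g1, g2⟩ := key _ (P.continuousOn_GG μ c f E.hs)
  obtain ⟨b1, b2⟩ := key _ (P.continuousOn_BB μ c f E.hs)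
  obtain ⟨t1, t2⟩ := key _ (P.continuousOn_Ut μ c f E.hs)
  obtain ⟨y1, y2⟩ := key _ (P.continuousOn_Uy μ f E.hs)
  have c3 : ContinuousOn (fun p : ℝ² => p.2 ^ (1 - 2 * s)) R :=
    continuousOn_snd.rpow_const fun p hp => Or.inl (ne_of_gt (hRu hp))
  have c4 := ((continuous_qf (2 * μ)).comp continuous_fst).continuousOn (s := R)
  have c5 := (continuous_tanh.comp continuous_fst).continuousOn (s := R)
  have cA := c3.mul (c4.mul ((((continuousOn_const (c := 2 * μ)).mul c5).mul (g2.sub g1)).add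
    ((t2.mul (t1.add (w_.ct.mono hRu))).sub (t1.pow 2))))
  have cB := c4.mul (c3.mul (((y2.mul ((y1.add (w_.cy.mono hRu)).sub y2)).add
    ((((y2.pow 2).sub (t2.pow 2)).div_const 2).sub (((y1.pow 2).sub (t1.pow 2)).div_const 2))).sub
    (b2.sub b1)))
  have hτT : ∀ t ∈ Icc (-T) T, ∀ y ∈ Icc ε T, (T ≤ |t| ∨ T ≤ y) → 𝛕 t y = t :=
    fun t ht y hy h => E.leaf_eq W hL hr hl w_ (hab t ht) (hε.le.trans hy.1) h
  have h := integral_div_rect hT.le hεT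
    (fun t ht y hy => E.flux_dt W hL hr hl w_ hv (hab t ht) (hε.trans_le hy.1))
    (fun t ht y hy => E.flux_dy W hL hr hl w_ hv (hab t ht) (hε.trans_le hy.1)) cA cB
    (fun y hy => by
      rw [hτT T ⟨by linarith, le_rfl⟩ y hy (Or.inl (le_abs_self T)),
        hτT (-T) ⟨le_rfl, by linarith⟩ y hy (Or.inl (by rw [abs_neg]; exact le_abs_self T))]
      simp)
    (fun t ht => by rw [hτT t ht T ⟨hεT, le_rfl⟩ (Or.inr le_rfl)]; simp)
  rw [← h]
  refine setIntegral_mono_on ((cA.add cB).integrableOn_compact hRc)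
    ((((E.dens_continuousOn w_).sub (E.dens_continuousOn (Pert.zero_pert T))).mono hRu).integrableOn_compact hRc)
    (measurableSet_Icc.prod measurableSet_Icc) fun p hp => ?_
  have hy : 0 < p.2 := hRu hp
  have h1 := P.GG_le_BB μ c f E.hs E.hμ hy p.1 (𝛕 p.1 p.2)
  have h2 : 0 ≤ p.2 ^ (1 - 2 * s) * qf (2 * μ) p.1 :=
    mul_nonneg (rpow_nonneg hy.le _) (qf_pos _ _).le
  have h3 : 2 * μ * tanh p.1 *
          (P.GG μ s c f (𝛕 p.1 p.2) p.2 - P.GG μ s c f p.1 p.2) +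
        (𝐔t (𝛕 p.1 p.2) p.2 * (𝐔t p.1 p.2 + wt p.1 p.2) - 𝐔t p.1 p.2 ^ 2) +
      (𝐔y (𝛕 p.1 p.2) p.2 * (𝐔y p.1 p.2 + wy p.1 p.2 - 𝐔y (𝛕 p.1 p.2) p.2) +
        ((𝐔y (𝛕 p.1 p.2) p.2 ^ 2 - 𝐔t (𝛕 p.1 p.2) p.2 ^ 2) / 2 -
          (𝐔y p.1 p.2 ^ 2 - 𝐔t p.1 p.2 ^ 2) / 2) -
        (P.BB μ s c f (𝛕 p.1 p.2) p.2 - P.BB μ s c f p.1 p.2)) ≤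
      ((𝐔t p.1 p.2 + wt p.1 p.2) ^ 2 + (𝐔y p.1 p.2 + wy p.1 p.2) ^ 2) / 2 -
        (𝐔t p.1 p.2 ^ 2 + 𝐔y p.1 p.2 ^ 2) / 2 := by
    linarith [sq_nonneg (𝐔t p.1 p.2 + wt p.1 p.2 - 𝐔t (𝛕 p.1 p.2) p.2),
      sq_nonneg (𝐔y p.1 p.2 + wy p.1 p.2 - 𝐔y (𝛕 p.1 p.2) p.2)]
  refine le_trans (le_of_eq ?_) ((mul_le_mul_of_nonneg_left h3 h2).trans (le_of_eq ?_))
  · ring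
  · simp only [dens, Pi.zero_apply]; ring

omit W hL hr hl w_ hv

lemma continuous_Ut : Continuous fun p : ℝ² => 𝐔t p.1 p.2 := by
  obtain ⟨H, α, hα, hαs, hH⟩ := E.holder
  have h1 := P.Nt_cont E.hs hα hαs hH
  have h2 := P.N_cont f E.hs
  have h3 (m : ℝ) := (continuous_qf m).comp (continuous_fst (X := ℝ) (Y := ℝ))
  exact (continuous_const.mul (h3 _)).add ((h3 _).mul (h1.sub
    ((continuous_const.mul (continuous_tanh.comp continuous_fst)).mul h2)))

lemma Ut_le : ∃ C, 0 ≤ C ∧ ∀ t y, |𝐔t t y| ≤ C := by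
  obtain ⟨H, α, hα, hαs, hH⟩ := E.holder
  obtain ⟨C, hC⟩ := P.Nt_le E.hs hα hαs hH
  have hB : 0 ≤ P.CN s * ‖f‖ := mul_nonneg (P.CN_nonneg E.hs) (norm_nonneg f)
  have hC0 := (abs_nonneg _).trans (hC 0 0)
  refine ⟨c + (C + μ * (P.CN s * ‖f‖)), by have := E.hc; have := E.hμ; positivity, fun t y => ?_⟩
  have h1 := qf_neg_le_one (m := 2 * μ) (by linarith [E.hμ]) t
  have h2 := qf_neg_le_one E.hμ.le t
  have h3 : |P.Nt s f t y - μ * tanh t * P.N s f t y| ≤ C + μ * (P.CN s * ‖f‖) := by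
    refine (abs_sub _ _).trans (add_le_add (hC t y) ?_)
    rw [abs_mul, abs_mul, abs_of_pos E.hμ]
    have h4 := mul_le_mul (abs_tanh_le t) (P.N_le f E.hs t y) (abs_nonneg _) zero_le_one
    rw [one_mul] at h4
    rw [mul_assoc]
    exact mul_le_mul_of_nonneg_left h4 E.hμ.le
  refine (abs_add_le _ _).trans (add_le_add ?_ ?_)
  · rw [abs_mul, abs_of_pos E.hc, abs_of_pos (qf_pos _ _)]
    exact mul_le_of_le_one_right E.hc.le h1
  · rw [abs_mul, abs_of_pos (qf_pos _ _)]
    exact (mul_le_of_le_one_left (abs_nonneg _) h2).trans h3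

lemma yUy_le {y : ℝ} (hy : 0 < y) (t : ℝ) : |y ^ (1 - 2 * s) * 𝐔y t y| ≤ P.KK * ‖f‖ := by
  have h := P.yNy_le f E.hs hy t
  rw [Pot.Uy, mul_left_comm, abs_mul, abs_of_pos (qf_pos _ _)]
  exact (mul_le_of_le_one_left (abs_nonneg _) (qf_neg_le_one E.hμ.le t)).trans h

lemma integrableOn_dens (w_ : Pert T w wt wy) :
    IntegrableOn (dens P μ s c f wt wy) (Icc (-T) T ×ˢ Ioc 0 T) := by
  obtain ⟨C₁, h0, hC₁⟩ := E.Ut_le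
  obtain ⟨C, hC⟩ := w_.bdd
  have hs := E.hs
  have i1 := (integrableOn_rpow_snd (T := T) (r := 1 - 2 * s) (by linarith [hs.2])).const_mul
    (qf (2 * μ) T * (C₁ ^ 2 + C ^ 2 + C ^ 2))
  have i2 := (integrableOn_rpow_snd (T := T) (r := -(1 - 2 * s)) (by linarith [hs.1])).const_mul
    (qf (2 * μ) T * (P.KK * ‖f‖) ^ 2)
  refine (i1.add i2).mono' (((E.dens_continuousOn w_).mono fun p hp => hp.2.1).aestronglyMeasurable
    (measurableSet_Icc.prod measurableSet_Ioc)) ((ae_restrict_iff'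
      (measurableSet_Icc.prod measurableSet_Ioc)).2 (ae_of_all _ fun p hp => ?_))
  obtain ⟨t, y⟩ := p
  have hy : 0 < y := hp.2.1
  have ha := rpow_pos_of_pos hy (1 - 2 * s)
  have hq : qf (2 * μ) t ≤ qf (2 * μ) T :=
    qf_le_of_abs_le (by linarith [E.hμ]) ((abs_le.2 hp.1).trans (le_abs_self T))
  have h1 := sq_le_sq' (abs_le.1 (hC₁ t y)).1 (abs_le.1 (hC₁ t y)).2
  have h2 := sq_le_sq' (abs_le.1 (hC t y hy).1).1 (abs_le.1 (hC t y hy).1).2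
  have h3 := sq_le_sq' (abs_le.1 (hC t y hy).2).1 (abs_le.1 (hC t y hy).2).2
  have h4 := sq_le_sq' (abs_le.1 (E.yUy_le hy t)).1 (abs_le.1 (E.yUy_le hy t)).2
  have hn : 0 ≤ ((𝐔t t y + wt t y) ^ 2 + (𝐔y t y + wy t y) ^ 2) / 2 := by positivity
  rw [norm_eq_abs, dens, abs_of_nonneg (by have := qf_pos (2 * μ) t; positivity)]
  calc y ^ (1 - 2 * s) * (qf (2 * μ) t * (((𝐔t t y + wt t y) ^ 2 + (𝐔y t y + wy t y) ^ 2) / 2))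
      ≤ y ^ (1 - 2 * s) * (qf (2 * μ) T * (((C₁ ^ 2 + C ^ 2) + C ^ 2) + 𝐔y t y ^ 2)) := by
        refine mul_le_mul_of_nonneg_left (mul_le_mul hq ?_ hn (qf_pos _ _).le) ha.le
        linarith [sq_nonneg (𝐔t t y - wt t y), sq_nonneg (𝐔y t y - wy t y)]
    _ = qf (2 * μ) T * (C₁ ^ 2 + C ^ 2 + C ^ 2) * y ^ (1 - 2 * s) +
        qf (2 * μ) T * (y ^ (1 - 2 * s) * 𝐔y t y) ^ 2 * y ^ (-(1 - 2 * s)) := by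
        rw [rpow_neg hy.le]; field_simp
    _ ≤ _ := by
        have := qf_pos (2 * μ) T
        have := rpow_pos_of_pos hy (-(1 - 2 * s))
        change _ ≤ qf (2 * μ) T * (C₁ ^ 2 + C ^ 2 + C ^ 2) * y ^ (1 - 2 * s) +
          qf (2 * μ) T * (P.KK * ‖f‖) ^ 2 * y ^ (-(1 - 2 * s))
        gcongr

lemma flux_eq {y : ℝ} (hy : 0 < y) (t x : ℝ) :
    y ^ (1 - 2 * s) * (P.MM μ s c f x y - P.MM μ s c f t y) =
      ∫ z in t..x, 𝐔t z y * (y ^ (1 - 2 * s) * 𝐔y z y) := by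
  have c1 : Continuous fun z => 𝐔t z y * 𝐔y z y :=
    (continuous_slice (P.continuousOn_Ut μ c f E.hs) hy).mul
      (continuous_slice (P.continuousOn_Uy μ f E.hs) hy)
  rw [Pot.MM, Pot.MM, integral_interval_sub_left (c1.intervalIntegrable _ _)
    (c1.intervalIntegrable _ _), ← intervalIntegral.integral_const_mul]
  exact integral_congr fun z _ => by ring

lemma flux_le : ∃ C, ∀ t x y, 0 < y →
    |y ^ (1 - 2 * s) * (P.MM μ s c f x y - P.MM μ s c f t y)| ≤ C * |x - t| := by
  obtain ⟨C₁, h0, hC₁⟩ := E.Ut_le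
  refine ⟨C₁ * (P.KK * ‖f‖), fun t x y hy => ?_⟩
  rw [E.flux_eq hy]
  refine intervalIntegral.norm_integral_le_of_norm_le_const (E := ℝ)
    (f := fun z => 𝐔t z y * (y ^ (1 - 2 * s) * 𝐔y z y)) fun z _ => ?_
  rw [norm_mul]
  exact mul_le_mul (hC₁ z y) (E.yUy_le hy z) (abs_nonneg _) h0

include W hL hr hl w_ hv

lemma flux_tendsto {t : ℝ} (ht : |t| < L) :
    Tendsto (fun y => y ^ (1 - 2 * s) * (P.MM μ s c f (𝛕 t y) y - P.MM μ s c f t y)) (𝓝[>] 0)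
      (𝓝 (F (𝐔 t 0 + w t 0) - F (𝐔 t 0))) := by
  obtain ⟨C, hC⟩ := E.flux_le
  obtain ⟨C₁, h0, hC₁⟩ := E.Ut_le
  have hpos : ∀ᶠ y in 𝓝[>] (0:ℝ), 0 < y := self_mem_nhdsWithin
  have hτ := E.leaf_spec hL hr hl hv ht le_rfl
  have hz : ∀ z ∈ uIcc t (𝛕 t 0), |z| ≤ L := fun z hz =>
    abs_le.2 (uIcc_subset_Icc (abs_le.1 ht.le) (abs_le.1 hτ.1.le) hz)
  have cU0 : Continuous fun z => 𝐔 z 0 :=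
    (P.continuous_U μ c f E.hs).comp (f := fun x : ℝ => (x, (0:ℝ))) (by fun_prop)
  have cUt0 : Continuous fun z => 𝐔t z 0 := E.continuous_Ut.comp (f := fun x : ℝ => (x, (0:ℝ)))
    (by fun_prop)
  have h1 : Tendsto (fun y => ∫ z in t..(𝛕 t 0), 𝐔t z y * (y ^ (1 - 2 * s) * 𝐔y z y)) (𝓝[>] 0)
      (𝓝 (∫ z in t..(𝛕 t 0), 𝐔t z 0 * F' (𝐔 z 0))) := by
    refine intervalIntegral.tendsto_integral_filter_of_dominated_convergence
      (fun _ => C₁ * (P.KK * ‖f‖)) ?_ ?_ intervalIntegrable_const ?_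
    · filter_upwards [hpos] with y hy
      exact ((continuous_slice (P.continuousOn_Ut μ c f E.hs) hy).mul (continuous_const.mul
        (continuous_slice (P.continuousOn_Uy μ f E.hs) hy))).aestronglyMeasurable
    · filter_upwards [hpos] with y hy
      refine ae_of_all _ fun z _ => ?_
      rw [norm_mul]
      exact mul_le_mul (hC₁ z y) (E.yUy_le hy z) (abs_nonneg _) h0
    · refine ae_of_all _ fun z hz' => ?_
      rw [← E.bc (hz z (uIoc_subset_uIcc hz'))]
      refine Tendsto.mul ?_ (P.tendsto_yUy μ f E.hs z)
      exact ((E.continuous_Ut.comp (f := fun y : ℝ => (z, y)) (by fun_prop)).tendsto 0).mono_left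
        nhdsWithin_le_nhds
  rw [integral_eq_sub_of_hasDerivAt (f := fun z => F (𝐔 z 0))
    (fun z _ => ((W.hd _).comp z (E.hasDerivAt z 0)).congr_deriv (mul_comm _ _))
    ((cUt0.mul (W.cont'.comp cU0)).intervalIntegrable _ _), hτ.2] at h1
  have h2 : Tendsto (fun y => y ^ (1 - 2 * s) *
      (P.MM μ s c f (𝛕 t y) y - P.MM μ s c f (𝛕 t 0) y)) (𝓝[>] 0) (𝓝 0) := by
    have h3 : Tendsto (fun y => C * |𝛕 t y - 𝛕 t 0|) (𝓝[>] 0) (𝓝 0) := by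
      have h4 : ContinuousOn (fun y => 𝛕 t y) (Ici 0) :=
        (E.leaf_continuousOn W hL hr hl w_ hv).comp (f := fun y : ℝ => (t, y)) (by fun_prop)
          fun y hy => ⟨ht, hy⟩
      have h4 : Tendsto (fun y => 𝛕 t y) (𝓝[>] 0) (𝓝 (𝛕 t 0)) :=
        (h4 0 self_mem_Ici).mono_left (nhdsWithin_mono _ Ioi_subset_Ici_self)
      have := ((h4.sub_const (𝛕 t 0)).abs).const_mul C
      simpa using this
    exact squeeze_zero_norm' (hpos.mono fun y hy => hC _ _ _ hy) h3
  have h3 := h1.add h2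
  rw [add_zero] at h3
  refine h3.congr' ?_
  filter_upwards [hpos] with y hy
  rw [← E.flux_eq hy]; ring

theorem calibration (hT : 0 < T) (hTL : T < L) :
    0 ≤ (∫ p in Icc (-T) T ×ˢ Ioc 0 T, (dens P μ s c f wt wy p - dens P μ s c f 0 0 p)) +
      ∫ t in Icc (-T) T, qf (2 * μ) t * (F (𝐔 t 0 + w t 0) - F (𝐔 t 0)) := by
  obtain ⟨C, hC⟩ := E.flux_le
  set e : ℕ → ℝ := fun k => T / ((k:ℝ) + 1) with he
  have he0 : ∀ k, 0 < e k := fun k => by positivity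
  have heT : ∀ k, e k ≤ T := fun k => div_le_self hT.le (by linarith [k.cast_nonneg (α := ℝ)])
  have het : Tendsto e atTop (𝓝[>] 0) := tendsto_nhdsWithin_iff.2
    ⟨by simpa [he, div_eq_mul_inv] using
      (tendsto_one_div_add_atTop_nhds_zero_nat (𝕜 := ℝ)).const_mul T, .of_forall he0⟩
  have hanti : Antitone e := fun i j hij => by
    simp only [he]; gcongr
  have hab : ∀ t ∈ Icc (-T) T, |t| < L := fun t ht => (abs_le.2 ht).trans_lt hTL
  have hU : ⋃ k, Icc (-T) T ×ˢ Icc (e k) T = Icc (-T) T ×ˢ Ioc 0 T := by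
    rw [← prod_iUnion]
    congr 1
    ext y
    simp only [mem_iUnion, mem_Icc, mem_Ioc]
    refine ⟨fun ⟨k, h1, h2⟩ => ⟨(he0 k).trans_le h1, h2⟩, fun ⟨h1, h2⟩ => ?_⟩
    obtain ⟨k, hk⟩ := ((tendsto_nhds_of_tendsto_nhdsWithin het).eventually_lt_const h1).exists
    exact ⟨k, hk.le, h2⟩
  have h1 := tendsto_setIntegral_of_monotone (μ := volume)
    (f := fun p => dens P μ s c f wt wy p - dens P μ s c f 0 0 p)
    (s := fun k => Icc (-T) T ×ˢ Icc (e k) T)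
    (fun k => measurableSet_Icc.prod measurableSet_Icc)
    (fun i j hij => prod_mono_right (Icc_subset_Icc_left (hanti hij)))
    (by rw [hU]; exact (E.integrableOn_dens w_).sub (E.integrableOn_dens (Pert.zero_pert T)))
  rw [hU] at h1
  have h2 : Tendsto (fun k => ∫ t in Icc (-T) T, qf (2 * μ) t * (e k ^ (1 - 2 * s) *
      (P.MM μ s c f (𝛕 t (e k)) (e k) - P.MM μ s c f t (e k)))) atTop
      (𝓝 (∫ t in Icc (-T) T, qf (2 * μ) t * (F (𝐔 t 0 + w t 0) - F (𝐔 t 0)))) := by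
    have hC0 : 0 ≤ C := by
      have := (abs_nonneg _).trans (hC 0 1 1 one_pos)
      simpa using this
    refine tendsto_integral_of_dominated_convergence (fun _ => qf (2 * μ) T * (C * (2 * L))) ?_
      (integrableOn_const measure_Icc_lt_top.ne) ?_ ?_
    · intro k
      have cM : ContinuousOn (fun p : ℝ² => P.MM μ s c f p.1 p.2) ℍ :=
        fun p hp => (P.hasFDerivAt_MM μ c f E.hs (x := p.1) hp).continuousAt.continuousWithinAt
      have c1 : ContinuousOn (fun t => P.MM μ s c f (𝛕 t (e k)) (e k)) (Icc (-T) T) :=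
        cM.comp (f := fun t => (𝛕 t (e k), e k)) (((E.leaf_continuousOn W hL hr hl w_ hv).comp
          (f := fun t : ℝ => (t, e k)) (by fun_prop) fun t ht => ⟨hab t ht, (he0 k).le⟩).prodMk
          continuousOn_const) fun t _ => he0 k
      exact ((continuous_qf _).continuousOn.mul (continuousOn_const.mul
        (c1.sub (continuous_slice cM (he0 k)).continuousOn))).aestronglyMeasurable
        measurableSet_Icc
    · intro k
      refine (ae_restrict_iff' measurableSet_Icc).2 (ae_of_all _ fun t ht => ?_)
      have hτ := E.leaf_spec hL hr hl hv (hab t ht) (he0 k).le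
      rw [norm_mul, norm_eq_abs, abs_of_pos (qf_pos _ _)]
      refine mul_le_mul (qf_le_of_abs_le (by linarith [E.hμ]) ((abs_le.2 ht).trans (le_abs_self T)))
        ((hC _ _ _ (he0 k)).trans (mul_le_mul_of_nonneg_left ?_ hC0)) (norm_nonneg _) (qf_pos _ _).le
      exact (abs_sub _ _).trans (by linarith [hab t ht, hτ.1])
    · refine (ae_restrict_iff' measurableSet_Icc).2 (ae_of_all _ fun t ht => ?_)
      exact ((E.flux_tendsto W hL hr hl w_ hv (hab t ht)).comp het).const_mul _
  have h3 := le_of_tendsto_of_tendsto' h2.neg h1 fun k =>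
    E.rect_le W hL hr hl w_ hv hTL (he0 k) (heT k)
  linarith

end
end Layer

lemma Pert.smul {T : ℝ} {w wt wy : ℝ → ℝ → ℝ} (w_ : Pert T w wt wy) (r : ℝ) :
    Pert T (fun t y => r * w t y) (fun t y => r * wt t y) (fun t y => r * wy t y) where
  cont := continuousOn_const.mul w_.cont
  dt t y hy := (w_.dt t y hy).const_mul r
  dy t y hy := (w_.dy t y hy).const_mul r
  ct := continuousOn_const.mul w_.ct
  cy := continuousOn_const.mul w_.cy
  bdd := by
    obtain ⟨C, hC⟩ := w_.bdd
    refine ⟨|r| * C, fun t y hy => ?_⟩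
    rw [abs_mul, abs_mul]
    exact ⟨mul_le_mul_of_nonneg_left (hC t y hy).1 (abs_nonneg r),
      mul_le_mul_of_nonneg_left (hC t y hy).2 (abs_nonneg r)⟩
  zero t y hy h := by rw [w_.zero t y hy h, mul_zero]

section
variable {T : ℝ} (hT : 0 < T)

include hT
lemma closure_SHalf_subset : closure (SHalf T) ⊆ {p : ℝ² | |p.1| ≤ T ∧ 0 ≤ p.2} :=
  closure_minimal (fun p hp => ⟨(abs_lt_of_sq_lt_sq (by nlinarith [hp.1, sq_nonneg p.2]) hT.le).le,
    hp.2.le⟩) ((isClosed_le (f := fun p : ℝ² => |p.1|) (g := fun _ => T) (by fun_prop)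
      (by fun_prop)).inter (isClosed_le (f := fun _ : ℝ² => (0:ℝ)) (g := fun p => p.2)
        (by fun_prop) (by fun_prop)))

omit hT in
lemma mem_closure_SHalf {t : ℝ} (ht : |t| < T) : (t, (0:ℝ)) ∈ closure (SHalf T) := by
  have h : Continuous fun y : ℝ => (t, y) := by fun_prop
  refine mem_closure_of_tendsto (b := 𝓝[>] (0:ℝ)) ((h.tendsto 0).mono_left nhdsWithin_le_nhds) ?_
  have h1 : ∀ᶠ y in 𝓝 (0:ℝ), t ^ 2 + y ^ 2 < T ^ 2 := by
    refine (show Continuous fun y : ℝ => t ^ 2 + y ^ 2 by fun_prop).continuousAt.eventually_lt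
      continuousAt_const ?_
    have := sq_lt_sq' (abs_lt.1 ht).1 (abs_lt.1 ht).2
    simpa using this
  filter_upwards [nhdsWithin_le_nhds h1, self_mem_nhdsWithin] with y hy hy' using ⟨hy, hy'⟩

lemma trace_SHalf : {t : ℝ | (t, (0:ℝ)) ∈ closure (SHalf T)} = Icc (-T) T := by
  refine subset_antisymm (fun t ht => abs_le.1 (closure_SHalf_subset hT ht).1) ?_
  rw [← closure_Ioo (by linarith : -T ≠ T)]
  exact closure_minimal (fun t ht => mem_closure_SHalf (abs_lt.2 ht))
    (isClosed_closure.preimage (by fun_prop : Continuous fun t : ℝ => (t, (0:ℝ))))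

omit hT in
lemma isOpen_SHalf : IsOpen (SHalf T) :=
  (isOpen_lt (f := fun p : ℝ² => p.1 ^ 2 + p.2 ^ 2) (g := fun _ => T ^ 2) (by fun_prop)
    (by fun_prop)).inter (isOpen_lt (f := fun _ : ℝ² => (0:ℝ)) (g := fun p => p.2)
      (by fun_prop) (by fun_prop))

variable {ψ : ℝ → ℝ → ℝ} (hψ : ContDiffOn ℝ 1 (fun p : ℝ² => ψ p.1 p.2) {p : ℝ² | 0 ≤ p.2})
  {K : Set ℝ²} (hK : IsCompact K) (hKT : K ⊆ SHalf T ∪ {p : ℝ² | |p.1| < T ∧ p.2 = 0})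
  (hψK : ∀ p : ℝ², 0 ≤ p.2 → p ∉ K → ψ p.1 p.2 = 0)

omit hT in
include hψ in
lemma hasDerivAt_of_contDiffOn {t y : ℝ} (hy : 0 < y) :
    HasDerivAt (fun t => ψ t y) (fderiv ℝ (fun p : ℝ² => ψ p.1 p.2) (t, y) (1, 0)) t ∧
    HasDerivAt (fun y => ψ t y) (fderiv ℝ (fun p : ℝ² => ψ p.1 p.2) (t, y) (0, 1)) y := by
  have hn : {p : ℝ² | 0 ≤ p.2} ∈ 𝓝 (t, y) :=
    mem_of_superset (isOpen_upper.mem_nhds hy) fun p hp => (show (0:ℝ) ≤ p.2 from le_of_lt hp)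
  have h := ((hψ.differentiableOn one_ne_zero).differentiableAt hn).hasFDerivAt
  exact ⟨h.comp_hasDerivAt (f := fun t => (t, y)) t
      ((hasDerivAt_id t).prodMk (hasDerivAt_const t y)),
    h.comp_hasDerivAt (f := fun y => (t, y)) y ((hasDerivAt_const y t).prodMk (hasDerivAt_id y))⟩

omit hT in
include hK hψK in
lemma deriv_eq_zero_off {t y : ℝ} (hy : 0 < y) (h : (t, y) ∉ K) : pt ψ t y = 0 ∧ py ψ t y = 0 := by
  have hn : ∀ᶠ p in 𝓝 (t, y), ψ p.1 p.2 = 0 := by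
    filter_upwards [isOpen_upper.mem_nhds hy, hK.isClosed.isOpen_compl.mem_nhds h] with p h1 h2
      using hψK p (le_of_lt h1) h2
  have h1 : (fun t => ψ t y) =ᶠ[𝓝 t] fun _ => 0 :=
    ((show Continuous fun t : ℝ => (t, y) by fun_prop).tendsto t).eventually hn
  have h2 : (fun y => ψ t y) =ᶠ[𝓝 y] fun _ => 0 :=
    ((show Continuous fun y : ℝ => (t, y) by fun_prop).tendsto y).eventually hn
  exact ⟨by rw [pt, h1.deriv_eq, deriv_const], by rw [py, h2.deriv_eq, deriv_const]⟩

include hψ hK hKT hψK in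
lemma pert_of_contDiffOn : Pert T ψ (pt ψ) (py ψ) := by
  have hu : UniqueDiffOn ℝ {p : ℝ² | 0 ≤ p.2} := by
    refine (uniqueDiffOn_convex ?_ ⟨(0, 1), ?_⟩)
    · exact (convex_Ici (0:ℝ)).is_linear_preimage (f := Prod.snd) (LinearMap.snd ℝ ℝ ℝ).isLinear
    · exact mem_interior_iff_mem_nhds.2 (mem_of_superset (isOpen_upper.mem_nhds
        (show (0:ℝ) < 1 from one_pos)) fun p hp => (show (0:ℝ) ≤ p.2 from le_of_lt hp))
  set g := fun p : ℝ² => ψ p.1 p.2 with hg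
  have hcw : ContinuousOn (fderivWithin ℝ g {p : ℝ² | 0 ≤ p.2}) {p : ℝ² | 0 ≤ p.2} :=
    hψ.continuousOn_fderivWithin hu le_rfl
  have hfe : ∀ p ∈ ℍ, fderivWithin ℝ g {p : ℝ² | 0 ≤ p.2} p = fderiv ℝ g p :=
    fun p hp => fderivWithin_of_mem_nhds (mem_of_superset (isOpen_upper.mem_nhds hp)
      fun p hp => (show (0:ℝ) ≤ p.2 from le_of_lt hp))
  have hct : ContinuousOn (fderiv ℝ g) ℍ :=
    (hcw.mono fun p (hp : 0 < p.2) => (show (0:ℝ) ≤ p.2 from hp.le)).congr fun p hp => (hfe p hp).symm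
  have ht : ∀ t y, 0 < y → pt ψ t y = fderiv ℝ g (t, y) (1, 0) := fun t y hy =>
    (hasDerivAt_of_contDiffOn hψ hy).1.deriv
  have hy' : ∀ t y, 0 < y → py ψ t y = fderiv ℝ g (t, y) (0, 1) := fun t y hy =>
    (hasDerivAt_of_contDiffOn hψ hy).2.deriv
  refine ⟨hψ.continuousOn, fun t y hy => ?_, fun t y hy => ?_, ?_, ?_, ?_, fun t y hy h => ?_⟩
  · rw [ht t y hy]; exact (hasDerivAt_of_contDiffOn hψ hy).1
  · rw [hy' t y hy]; exact (hasDerivAt_of_contDiffOn hψ hy).2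
  · exact (hct.clm_apply continuousOn_const).congr fun p hp => ht p.1 p.2 hp
  · exact (hct.clm_apply continuousOn_const).congr fun p hp => hy' p.1 p.2 hp
  · obtain ⟨C, hC⟩ := hK.exists_bound_of_continuousOn (hcw.mono fun p hp => by
      rcases hKT hp with h | h
      exacts [h.2.le, h.2.ge])
    refine ⟨max C 0, fun t y hy => ?_⟩
    by_cases h : (t, y) ∈ K
    · have h1 := hC _ h
      rw [hfe _ hy] at h1
      rw [ht t y hy, hy' t y hy]
      have h2 := (fderiv ℝ g (t, y)).le_of_opNorm_le h1 (1, 0)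
      have h3 := (fderiv ℝ g (t, y)).le_of_opNorm_le h1 (0, 1)
      simp only [Prod.norm_mk, norm_one, norm_zero, max_eq_left, max_eq_right, zero_le_one,
        mul_one] at h2 h3
      exact ⟨h2.trans (le_max_left _ _), h3.trans (le_max_left _ _)⟩
    · rw [(deriv_eq_zero_off hK hψK hy h).1, (deriv_eq_zero_off hK hψK hy h).2]
      simp
  · refine hψK (t, y) hy fun hp => ?_
    rcases hKT hp with h' | h'
    · have h1 : t ^ 2 + y ^ 2 < T ^ 2 := h'.1
      rcases h with h | h
      · have := pow_le_pow_left₀ hT.le h 2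
        rw [sq_abs] at this
        linarith [sq_nonneg y]
      · linarith [sq_nonneg t, pow_le_pow_left₀ hT.le h 2]
    · rcases h with h | h
      · exact absurd h'.1 (not_lt.2 h)
      · have : y = 0 := h'.2
        linarith

end

namespace Layer
section
variable {l Λ : ℝ} {P : Pot l Λ} {μ s c L κ T : ℝ} {F F' : ℝ → ℝ} {f : Cb}
  {w wt wy : ℝ → ℝ → ℝ}
  (E : Layer P μ s c L F' f) (W : Well F F' κ)
  (hL : 0 < L) (hr : ∀ y, P.U μ s c f L y = 1) (hl : ∀ y, P.U μ s c f (-L) y = -1)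
  (hT : 0 < T) (hTL : T < L)
include E W hL hr hl hT hTL

lemma minimal_of_pert (w_ : Pert T w wt wy)
    (hv : ∀ t y, |t| < L → 0 ≤ y → |P.U μ s c f t y + w t y| ≤ 1) :
    0 ≤ (∫ p in Icc (-T) T ×ˢ Ioc 0 T, (dens P μ s c f wt wy p - dens P μ s c f 0 0 p)) +
      ∫ t in Icc (-T) T, qf (2 * μ) t * (F (P.U μ s c f t 0 + w t 0) - F (P.U μ s c f t 0)) := by
  have i1 := E.integrableOn_dens w_
  have i0 := E.integrableOn_dens (Pert.zero_pert T)
  set D := ∫ p in Icc (-T) T ×ˢ Ioc 0 T, (dens P μ s c f wt wy p - dens P μ s c f 0 0 p) with hD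
  set B : ℝ → ℝ := fun r => ∫ t in Icc (-T) T,
    qf (2 * μ) t * (F (P.U μ s c f t 0 + r * w t 0) - F (P.U μ s c f t 0)) with hB
  have hr1 : ∀ r ∈ Ico (0:ℝ) 1, 0 ≤ r * D + B r := fun r hr' => by
    have h := E.calibration W hL hr hl (w_.smul r) (fun t y ht hy => by
      have h1 := abs_lt.1 (E.U_abs_lt W ht hy)
      have h2 := abs_le.1 (hv t y ht hy)
      have h3 := sub_pos.2 hr'.2
      rw [abs_lt]
      constructor <;> nlinarith [hr'.1]) hT hTL
    refine h.trans (add_le_add_left ?_ _)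
    rw [hD, ← integral_const_mul]
    refine setIntegral_mono_on ((E.integrableOn_dens (w_.smul r)).sub i0)
      ((i1.sub i0).const_mul r) (measurableSet_Icc.prod measurableSet_Ioc) fun p hp => ?_
    have hy : 0 < p.2 := hp.2.1
    have h2 : 0 ≤ p.2 ^ (1 - 2 * s) * qf (2 * μ) p.1 :=
      mul_nonneg (rpow_nonneg hy.le _) (qf_pos _ _).le
    simp only [dens, Pi.zero_apply]
    have h3 : 0 ≤ r * (1 - r) * (wt p.1 p.2 ^ 2 + wy p.1 p.2 ^ 2) / 2 := by
      have := sub_pos.2 hr'.2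
      have := hr'.1
      positivity
    have := mul_nonneg h2 h3
    linear_combination this
  have cU : Continuous fun t => P.U μ s c f t 0 :=
    (P.continuous_U μ c f E.hs).comp (f := fun x : ℝ => (x, (0:ℝ))) (by fun_prop)
  have cw : Continuous fun t => w t 0 :=
    continuousOn_univ.1 (w_.cont.comp (f := fun x : ℝ => (x, (0:ℝ))) (by fun_prop)
      fun x _ => show (0:ℝ) ≤ 0 from le_rfl)
  have cF : Continuous F := W.continuous
  have cB : Continuous B := by
    refine continuous_parametric_integral_of_continuous ?_ isCompact_Icc
    have := continuous_qf (2 * μ)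
    simp only [Function.uncurry_def]
    fun_prop
  have h1 : Tendsto (fun r => r * D + B r) (𝓝[<] 1) (𝓝 (1 * D + B 1)) :=
    ((by fun_prop : Continuous fun r => r * D + B r).tendsto 1).mono_left nhdsWithin_le_nhds
  have h2 := ge_of_tendsto h1 (by
    filter_upwards [Ioo_mem_nhdsLT (zero_lt_one' ℝ)] with r hr' using hr1 r ⟨hr'.1.le, hr'.2⟩)
  simpa [hB] using h2

theorem minimal {n : ℕ} (hn : 2 ≤ n) (hμ : μ = ((n:ℝ) - 1) / 2) {ψ : ℝ → ℝ → ℝ}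
    (hψ : ContDiffOn ℝ 1 (fun p : ℝ² => ψ p.1 p.2) {p : ℝ² | 0 ≤ p.2})
    {K : Set ℝ²} (hK : IsCompact K) (hKT : K ⊆ SHalf T ∪ {p : ℝ² | |p.1| < T ∧ p.2 = 0})
    (hψK : ∀ p : ℝ², 0 ≤ p.2 → p ∉ K → ψ p.1 p.2 = 0)
    (hb : ∀ p ∈ SHalf T, -1 ≤ P.U μ s c f p.1 p.2 + ψ p.1 p.2 ∧
      P.U μ s c f p.1 p.2 + ψ p.1 p.2 ≤ 1) :
    energy n (1 - 2 * s) F (SHalf T) (P.U μ s c f) ≤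
      energy n (1 - 2 * s) F (SHalf T) (fun t y => P.U μ s c f t y + ψ t y) := by
  have w_ := pert_of_contDiffOn hT hψ hK hKT hψK
  have hcl := closure_SHalf_subset hT
  have hKc : K ⊆ closure (SHalf T) := fun p hp => by
    rcases hKT hp with h | h
    · exact subset_closure h
    · have := mem_closure_SHalf h.1
      rwa [show p = (p.1, 0) from Prod.ext rfl h.2]
  have cv : ContinuousOn (fun p : ℝ² => P.U μ s c f p.1 p.2 + ψ p.1 p.2) (closure (SHalf T)) :=
    (P.continuous_U μ c f E.hs).continuousOn.add (hψ.continuousOn.mono fun p hp => (hcl hp).2)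
  have hv : ∀ t y, |t| < L → 0 ≤ y → |P.U μ s c f t y + ψ t y| ≤ 1 := fun t y ht hy => by
    by_cases h : (t, y) ∈ K
    · exact abs_le.2 ⟨le_on_closure (fun p hp => (hb p hp).1) continuousOn_const cv (hKc h),
        le_on_closure (fun p hp => (hb p hp).2) cv continuousOn_const (hKc h)⟩
    · rw [hψK (t, y) hy h, add_zero]
      exact E.bd t y ht.le hy
  have hm := E.minimal_of_pert W hL hr hl hT hTL w_ hv
  have hq : ∀ t, qf (2 * μ) t = cosh t ^ (n - 1) := fun t => by
    rw [qf, hμ, ← rpow_natCast, Nat.cast_sub (by omega)]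
    congr 1
    push_cast; ring
  have hSQ : SHalf T ⊆ Icc (-T) T ×ˢ Ioc 0 T := fun p hp =>
    ⟨abs_le.1 (hcl (subset_closure hp)).1, hp.2,
      (le_abs_self p.2).trans (abs_le_of_sq_le_sq (by linarith [hp.1, sq_nonneg p.1]) hT.le)⟩
  have i1 := (E.integrableOn_dens w_).mono_set hSQ
  have i0 := (E.integrableOn_dens (Pert.zero_pert T)).mono_set hSQ
  have hmS := (isOpen_SHalf (T := T)).measurableSet
  rw [setIntegral_eq_of_subset_of_forall_sdiff_eq_zero (measurableSet_Icc.prod measurableSet_Ioc)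
    hSQ, integral_sub i1 i0] at hm
  · have e1 : ∫ p in SHalf T, ((pt (fun t y => P.U μ s c f t y + ψ t y) p.1 p.2) ^ 2 +
        (py (fun t y => P.U μ s c f t y + ψ t y) p.1 p.2) ^ 2) / 2 * p.2 ^ (1 - 2 * s)
        * cosh p.1 ^ (n - 1) = ∫ p in SHalf T, dens P μ s c f (pt ψ) (py ψ) p := by
      refine setIntegral_congr_fun hmS fun p hp => ?_
      have h1 := ((E.hasDerivAt p.1 p.2).fun_add (w_.dt p.1 p.2 hp.2)).deriv
      have h2 := ((P.hasDerivAt_U_y μ c f E.hs hp.2 p.1).fun_add (w_.dy p.1 p.2 hp.2)).deriv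
      simp only [pt, py] at h1 h2 ⊢
      rw [dens, h1, h2, hq]
      simp only [pt, py]; ring
    have e0 : ∫ p in SHalf T, ((pt (P.U μ s c f) p.1 p.2) ^ 2 +
        (py (P.U μ s c f) p.1 p.2) ^ 2) / 2 * p.2 ^ (1 - 2 * s)
        * cosh p.1 ^ (n - 1) = ∫ p in SHalf T, dens P μ s c f 0 0 p := by
      refine setIntegral_congr_fun hmS fun p hp => ?_
      have h1 := (E.hasDerivAt p.1 p.2).deriv
      have h2 := (P.hasDerivAt_U_y μ c f E.hs hp.2 p.1).deriv
      simp only [pt, py] at h1 h2 ⊢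
      simp only [dens, h1, h2, hq, Pi.zero_apply]
      ring
    have cU : Continuous fun t => P.U μ s c f t 0 :=
      (P.continuous_U μ c f E.hs).comp (f := fun x : ℝ => (x, (0:ℝ))) (by fun_prop)
    have cw : Continuous fun t => ψ t 0 :=
      continuousOn_univ.1 (w_.cont.comp (f := fun x : ℝ => (x, (0:ℝ))) (by fun_prop)
        fun x _ => show (0:ℝ) ≤ 0 from le_rfl)
    have cF : Continuous F := W.continuous
    have e2 : ∫ t in Icc (-T) T, qf (2 * μ) t * (F (P.U μ s c f t 0 + ψ t 0) -
        F (P.U μ s c f t 0)) = (∫ t in Icc (-T) T, F (P.U μ s c f t 0 + ψ t 0) *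
          cosh t ^ (n - 1)) - ∫ t in Icc (-T) T, F (P.U μ s c f t 0) * cosh t ^ (n - 1) := by
      rw [← integral_sub]
      · exact integral_congr_ae (ae_of_all _ fun t => by simp only [hq]; ring)
      · exact (by fun_prop : Continuous fun t => F (P.U μ s c f t 0 + ψ t 0) *
          cosh t ^ (n - 1)).integrableOn_Icc
      · exact (by fun_prop : Continuous fun t => F (P.U μ s c f t 0) *
          cosh t ^ (n - 1)).integrableOn_Icc
    rw [e2] at hm
    rw [energy, energy, trace_SHalf hT, e1, e0]
    linarith
  · rintro p ⟨hpQ, hpS⟩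
    have hy : 0 < p.2 := hpQ.2.1
    have h : (p.1, p.2) ∉ K := fun h => by
      rcases hKT h with h | h
      · exact hpS h
      · exact hy.ne' h.2
    have := deriv_eq_zero_off hK hψK hy h
    simp [dens, this]

end
end Layer

namespace Pot
lemma N_holder {l Λ s : ℝ} (hs : s ∈ Ioo (0:ℝ) 1) : ∃ C, 0 ≤ C ∧ ∀ (P : Pot l Λ) (f : Cb)
    (p p' : ℝ²), |P.N s f p.1 p.2 - P.N s f p'.1 p'.2| ≤ C * ‖f‖ * dist p p' ^ s := by
  obtain ⟨C, hC, hN⟩ := Pot.N_holder_t hs (l := l) (Λ := Λ)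
  set D := cs s * (Λ / l * ∫ r in Ioi (0:ℝ), rexp (-(l * r)) * r ^ (s / 2 - 1)) with hD
  refine ⟨C * 3 + |D|, by positivity, fun P f p p' => ?_⟩
  have h1 := hN P f (2 * ‖f‖) 0 le_rfl (by linarith [hs.2]) (fun t t' => by
    have h1 := f.norm_coe_le_norm t
    have h2 := f.norm_coe_le_norm t'
    rw [norm_eq_abs] at h1 h2
    rw [rpow_zero, mul_one]
    exact (abs_sub _ _).trans (by linarith)) p.1 p'.1 p.2
  have h2 := P.N_holder_y f hs p'.1 p.2 p'.2
  rw [zero_add] at h1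
  rw [KK, ← hD] at h2
  have hf := norm_nonneg f
  have e1 : |p.1 - p'.1| ^ s ≤ dist p p' ^ s :=
    rpow_le_rpow (abs_nonneg _) (le_max_left (dist p.1 p'.1) _) hs.1.le
  have e2 : |p.2 - p'.2| ^ s ≤ dist p p' ^ s :=
    rpow_le_rpow (abs_nonneg _) (le_max_right _ (dist p.2 p'.2)) hs.1.le
  calc _ ≤ |P.N s f p.1 p.2 - P.N s f p'.1 p.2| + |P.N s f p'.1 p.2 - P.N s f p'.1 p'.2| :=
        abs_sub_le _ _ _
    _ ≤ C * (2 * ‖f‖ + ‖f‖) * |p.1 - p'.1| ^ s + |D| * ‖f‖ * |p.2 - p'.2| ^ s :=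
        add_le_add h1 (h2.trans (by gcongr; exact le_abs_self D))
    _ ≤ C * (2 * ‖f‖ + ‖f‖) * dist p p' ^ s + |D| * ‖f‖ * dist p p' ^ s := by gcongr
    _ = _ := by ring

lemma U_holder {l Λ s μ c T : ℝ} (hs : s ∈ Ioo (0:ℝ) 1) (hμ : 0 < μ) (P : Pot l Λ) (f : Cb) :
    ∃ C, 0 ≤ C ∧ ∀ p p' : ℝ², |p.1| ≤ T → |p'.1| ≤ T →
      |P.U μ s c f p.1 p.2 - P.U μ s c f p'.1 p'.2| ≤ C * dist p p' ^ s := by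
  obtain ⟨C, hC, hN⟩ := N_holder hs (l := l) (Λ := Λ)
  refine ⟨|c| * |2 * T| ^ (1 - s) + C * ‖f‖ + μ * |2 * T| ^ (1 - s) * (P.CN s * ‖f‖),
    by have := P.CN_nonneg hs; positivity, fun p p' hp hp' => ?_⟩
  have hd : |p.1 - p'.1| ≤ |2 * T| ^ (1 - s) * dist p p' ^ s := by
    have h1 : |p.1 - p'.1| ≤ |2 * T| :=
      (abs_sub _ _).trans (by linarith [le_abs_self (2 * T)])
    calc |p.1 - p'.1| = |p.1 - p'.1| ^ (1 - s) * |p.1 - p'.1| ^ s := by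
          rw [← rpow_add_of_nonneg (abs_nonneg _) (by linarith [hs.2]) hs.1.le]; simp
      _ ≤ _ := mul_le_mul (rpow_le_rpow (abs_nonneg _) h1 (by linarith [hs.2]))
          (rpow_le_rpow (abs_nonneg _) (le_max_left (dist p.1 p'.1) _) hs.1.le)
          (by positivity) (by positivity)
  have hH : |Hf μ p.1 - Hf μ p'.1| ≤ 1 * |p.1 - p'.1| :=
    convex_univ.norm_image_sub_le_of_norm_hasDerivWithin_le
      (fun x _ => (hasDerivAt_Hf μ x).hasDerivWithinAt)
      (fun x _ => by
        rw [norm_eq_abs, abs_of_pos (qf_pos _ _)]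
        exact qf_neg_le_one (by linarith) x) (mem_univ _) (mem_univ _)
  have hq : |qf (-μ) p.1 - qf (-μ) p'.1| ≤ μ * |p.1 - p'.1| :=
    convex_univ.norm_image_sub_le_of_norm_hasDerivWithin_le
      (fun x _ => (hasDerivAt_qf (-μ) x).hasDerivWithinAt)
      (fun x _ => by
        rw [norm_eq_abs, abs_mul, abs_mul, abs_neg, abs_of_pos hμ, abs_of_pos (qf_pos _ _)]
        have h1 := qf_neg_le_one hμ.le x
        have h2 : |tanh x| ≤ 1 := (abs_tanh_lt_one x).le
        have h3 := qf_pos (-μ) x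
        have h4 : |tanh x| * qf (-μ) x ≤ 1 * 1 := by gcongr
        rw [mul_assoc]
        nlinarith) (mem_univ _) (mem_univ _)
  have e : P.U μ s c f p.1 p.2 - P.U μ s c f p'.1 p'.2 = c * (Hf μ p.1 - Hf μ p'.1) +
      qf (-μ) p.1 * (P.N s f p.1 p.2 - P.N s f p'.1 p'.2) +
      (qf (-μ) p.1 - qf (-μ) p'.1) * P.N s f p'.1 p'.2 := by
    rw [U, U]; ring
  rw [e]
  have h1 := qf_neg_le_one hμ.le p.1
  have h2 := (qf_pos (-μ) p.1)
  calc _ ≤ |c| * |Hf μ p.1 - Hf μ p'.1| + qf (-μ) p.1 * |P.N s f p.1 p.2 - P.N s f p'.1 p'.2| +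
        |qf (-μ) p.1 - qf (-μ) p'.1| * |P.N s f p'.1 p'.2| := by
        rw [← abs_mul, ← abs_mul, ← abs_of_pos h2, ← abs_mul, abs_of_pos h2]
        exact abs_add_three _ _ _
    _ ≤ |c| * (1 * (|2 * T| ^ (1 - s) * dist p p' ^ s)) + 1 * (C * ‖f‖ * dist p p' ^ s) +
        μ * (|2 * T| ^ (1 - s) * dist p p' ^ s) * (P.CN s * ‖f‖) := by
        refine add_le_add (add_le_add ?_ ?_) ?_
        · exact mul_le_mul_of_nonneg_left (hH.trans (by linarith)) (abs_nonneg c)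
        · exact mul_le_mul h1 (hN P f p p') (abs_nonneg _) zero_le_one
        · exact mul_le_mul (hq.trans (mul_le_mul_of_nonneg_left hd hμ.le)) (P.N_le f hs _ _)
            (abs_nonneg _) (by positivity)
    _ = _ := by ring
end Pot

lemma holderOnWith_of_dist_le {u : ℝ² → ℝ} {A : Set ℝ²} {C s : ℝ} (hC : 0 ≤ C) (hs : 0 ≤ s)
    (h : ∀ p ∈ A, ∀ p' ∈ A, |u p - u p'| ≤ C * dist p p' ^ s) :
    HolderOnWith C.toNNReal s.toNNReal u A := fun p hp q hq => by
  rw [edist_dist, edist_dist, coe_toNNReal _ hs, ENNReal.ofReal_rpow_of_nonneg dist_nonneg hs]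
  change _ ≤ ENNReal.ofReal C * _
  rw [← ENNReal.ofReal_mul hC]
  exact ENNReal.ofReal_le_ofReal (h p hp q hq)

/-- The potential of the strip `[-L, L]`. -/
noncomputable def potL (μ : ℝ) (hμ : 0 < μ) (L : ℝ) : Pot (lf μ) (Lf μ) :=
  potOf μ hμ (fold L) continuous_fold

section
variable {F F' : ℝ → ℝ} {κ μ s : ℝ} (W : Well F F' κ) (hμ : 0 < μ) (hs : s ∈ Ioo (0:ℝ) 1)

include hs in
lemma strip_potL {L : ℝ} (hL : 0 < L) : Strip (potL μ hμ L) μ s (1 / Hf μ L) L where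
  hs := hs
  hμ := hμ
  hL := hL
  hV t := by
    have := reflE_fold hL t
    exact ⟨congrArg (Vf μ) this.1, congrArg (Vf μ) this.2⟩
  hVf t ht := congrArg (Vf μ) (fold_eq hL ht)
  hc := one_div_mul_cancel (Hf_pos μ hL).ne'

include W hs in
lemma exists_layer {L : ℝ} (hL : 0 < L) : ∃ f : Cb,
    Layer (potL μ hμ L) μ s (1 / Hf μ L) L F' f ∧
    (∀ y, (potL μ hμ L).N s f L y = 0) ∧ (∀ y, (potL μ hμ L).N s f (-L) y = 0) ∧
    ∀ L₀, 0 < L₀ → L₀ ≤ L → ‖f‖ ≤ κ / 2 * Strip.bd μ s (lf μ) κ L₀ := by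
  have S := strip_potL hμ hs hL
  obtain ⟨f, hf, hfF, hB⟩ := S.exists_solution W
  exact ⟨f, ⟨hs, hμ, Pot.c_pos hL S.hc, S.hVf, hfF, hf.2.1, hf.2.2, S.exists_holder W hf hfF⟩,
    fun y => Pot.N_right _ S.hV hf.1 y, fun y => Pot.N_left _ S.hV hf.1 y,
    fun L₀ h0 h => (S.bound W h0 h hf hfF hB).2⟩

include W hs in
lemma exists_approx {T : ℝ} (hT : 0 < T) : ∃ (L : ℝ) (f : Cb), T < L ∧
    Layer (potL μ hμ L) μ s (1 / Hf μ L) L F' f ∧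
    (∀ y, (potL μ hμ L).U μ s (1 / Hf μ L) f L y = 1) ∧
    (∀ y, (potL μ hμ L).U μ s (1 / Hf μ L) f (-L) y = -1) ∧
    (∀ L₀, 0 < L₀ → L₀ ≤ T → ‖f‖ ≤ κ / 2 * Strip.bd μ s (lf μ) κ L₀) ∧
    ∃ t₀ ∈ Ioo (-T) T, (potL μ hμ L).U μ s (1 / Hf μ L) f t₀ 0 = 0 := by
  obtain ⟨C, hC, hN⟩ := Pot.N_holder hs (l := lf μ) (Λ := Lf μ)
  set M := κ / 2 * Strip.bd μ s (lf μ) κ T with hM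
  have hlim : Tendsto (fun L => 1 / Hf μ L * Hf μ T - C * M * |L - T| ^ s) (𝓝[>] T) (𝓝 1) := by
    have h1 : ContinuousAt (fun L => 1 / Hf μ L * Hf μ T) T :=
      (continuousAt_const.div (continuous_Hf μ).continuousAt (Hf_pos μ hT).ne').mul
        continuousAt_const
    have h2 : ContinuousAt (fun L => C * M * |L - T| ^ s) T :=
      continuousAt_const.mul ((by fun_prop : ContinuousAt (fun x => |x - T|) T).rpow_const
        (Or.inr hs.1.le))
    have h : Tendsto (fun L => 1 / Hf μ L * Hf μ T - C * M * |L - T| ^ s) (𝓝 T)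
        (𝓝 (1 / Hf μ T * Hf μ T - C * M * |T - T| ^ s)) := (h1.sub h2).tendsto
    rw [sub_self, abs_zero, zero_rpow hs.1.ne', mul_zero, sub_zero,
      one_div_mul_cancel (Hf_pos μ hT).ne'] at h
    exact h.mono_left nhdsWithin_le_nhds
  obtain ⟨L, hL, hLT⟩ := ((hlim.eventually (lt_mem_nhds one_pos)).and self_mem_nhdsWithin).exists
  have hLT : T < L := hLT
  have hL0 : 0 < L := hT.trans hLT
  obtain ⟨f, E, hr, hl, hb⟩ := exists_layer W hμ hs hL0
  have hfM : ‖f‖ ≤ M := hb T hT hLT.le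
  have hd : (1 / Hf μ L) * Hf μ L = 1 := one_div_mul_cancel (Hf_pos μ hL0).ne'
  refine ⟨L, f, hLT, E, fun y => ?_, fun y => ?_, fun L₀ h0 h => hb L₀ h0 (h.trans hLT.le), ?_⟩
  · rw [Pot.U, hr, hd]; ring
  · rw [Pot.U, hl, Hf_neg, mul_neg, hd]; ring
  have hq := qf_neg_le_one hμ.le T
  have hq0 := qf_pos (-μ) T
  have key (n : ℝ) (hn : |n| ≤ C * ‖f‖ * |L - T| ^ s) : |qf (-μ) T * n| ≤ C * M * |L - T| ^ s := by
    rw [abs_mul, abs_of_pos hq0]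
    calc _ ≤ 1 * (C * ‖f‖ * |L - T| ^ s) := mul_le_mul hq hn (abs_nonneg _) zero_le_one
      _ ≤ _ := by rw [one_mul]; gcongr
  have k1 := key _ (by
    have := hN (potL μ hμ L) f (T, 0) (L, 0)
    rw [hr, sub_zero] at this
    simpa [Prod.dist_eq, Real.dist_eq, abs_sub_comm] using this)
  have k2 := key _ (by
    have := hN (potL μ hμ L) f (-T, 0) (-L, 0)
    rw [hl, sub_zero] at this
    simpa [Prod.dist_eq, Real.dist_eq, abs_sub_comm, neg_add_eq_sub] using this)
  have u1 : 0 < (potL μ hμ L).U μ s (1 / Hf μ L) f T 0 := by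
    rw [Pot.U]; linarith [(abs_le.1 k1).1]
  have u2 : (potL μ hμ L).U μ s (1 / Hf μ L) f (-T) 0 < 0 := by
    rw [Pot.U, Hf_neg, qf_neg]; linarith [(abs_le.1 k2).2]
  have cU : Continuous fun t => (potL μ hμ L).U μ s (1 / Hf μ L) f t 0 :=
    ((potL μ hμ L).continuous_U μ _ f hs).comp (f := fun x : ℝ => (x, (0:ℝ))) (by fun_prop)
  obtain ⟨t, ht, h0⟩ := intermediate_value_Icc (by linarith : -T ≤ T) cU.continuousOn ⟨u2.le, u1.le⟩
  refine ⟨t, ⟨lt_of_le_of_ne ht.1 ?_, lt_of_le_of_ne ht.2 ?_⟩, h0⟩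
  · rintro rfl; simp only at h0; linarith
  · rintro rfl; simp only at h0; linarith

end

/-- The potential of the whole line. -/
noncomputable def potR (μ : ℝ) (hμ : 0 < μ) : Pot (lf μ) (Lf μ) := potOf μ hμ id continuous_id

section
variable {F F' : ℝ → ℝ} {κ μ s M : ℝ} (W : Well F F' κ) (hμ : 0 < μ) (hs : s ∈ Ioo (0:ℝ) 1)
  {L : ℕ → ℝ} {f : ℕ → Cb} (hLt : Tendsto L atTop atTop)
  (E : ∀ k, Layer (potL μ hμ (L k)) μ s (1 / Hf μ (L k)) (L k) F' (f k)) (hM : ∀ k, ‖f k‖ ≤ M)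

include W hs hLt E hM
lemma exists_limit : ∃ (φ : ℕ → ℕ) (g : Cb), StrictMono φ ∧
    (∀ R, Layer (potR μ hμ) μ s (1 / Hinf μ) R F' g) ∧
    ∀ t y, Tendsto (fun k => (potL μ hμ (L (φ k))).N s (f (φ k)) t y) atTop
      (𝓝 ((potR μ hμ).N s g t y)) := by
  obtain ⟨C, hC, hN⟩ := Pot.N_holder hs (l := lf μ) (Λ := Lf μ)
  have hM0 : 0 ≤ M := (norm_nonneg _).trans (hM 0)
  obtain ⟨v, φ, hφ, hv⟩ := exists_subseq_tendsto
    (v := fun k t => (potL μ hμ (L k)).N s (f k) t 0) (M := (potR μ hμ).CN s * M) (H := C * M)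
    hs.1 (fun k t => ((potL μ hμ (L k)).N_le (f k) hs t 0).trans
      (mul_le_mul_of_nonneg_left (hM k) (Pot.CN_nonneg _ hs))) (fun k t t' => by
      have h := hN (potL μ hμ (L k)) (f k) (t, 0) (t', 0)
      simp only [Prod.dist_eq, Real.dist_eq, sub_self, abs_zero] at h
      rw [max_eq_left (abs_nonneg (t - t'))] at h
      exact h.trans (by have := hM k; gcongr))
  have hvc : Continuous v := continuous_of_holder (H := C * M) hs.1 fun t t' =>
    le_of_tendsto ((hv t).sub (hv t')).abs (Eventually.of_forall fun k => by
      have h := hN (potL μ hμ (L (φ k))) (f (φ k)) (t, 0) (t', 0)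
      simp only [Prod.dist_eq, Real.dist_eq, sub_self, abs_zero] at h
      rw [max_eq_left (abs_nonneg (t - t'))] at h
      exact h.trans (by have := hM (φ k); gcongr))
  have hLφ : Tendsto (fun k => L (φ k)) atTop atTop := hLt.comp hφ.tendsto_atTop
  have hcφ : Tendsto (fun k => 1 / Hf μ (L (φ k))) atTop (𝓝 (1 / Hinf μ)) :=
    have h0 : Tendsto (fun k => Hf μ (L (φ k))) atTop (𝓝 (Hinf μ)) := (tendsto_Hf hμ).comp hLφ
    (tendsto_const_nhds (x := (1:ℝ))).div h0 (Hinf_pos hμ).ne'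
  have hU0 (t : ℝ) : Tendsto (fun k => (potL μ hμ (L (φ k))).U μ s (1 / Hf μ (L (φ k))) (f (φ k)) t 0)
      atTop (𝓝 (1 / Hinf μ * Hf μ t + qf (-μ) t * v t)) :=
    (hcφ.mul_const _).add ((hv t).const_mul _)
  have hev (t : ℝ) : ∀ᶠ k in atTop, |t| ≤ L (φ k) := hLφ.eventually_ge_atTop _
  have hf (t : ℝ) : Tendsto (fun k => f (φ k) t) atTop
      (𝓝 (-(qf μ t * F' (1 / Hinf μ * Hf μ t + qf (-μ) t * v t)))) := by
    have h := (((W.cont'.tendsto _).comp (hU0 t)).const_mul (qf μ t)).neg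
    refine h.congr' ?_
    filter_upwards [hev t] with k hk using ((E (φ k)).hfF t hk).symm
  have hcH := continuous_Hf μ
  have hcq := continuous_qf μ
  have hcq' := continuous_qf (-μ)
  have hcF := W.cont'
  let g : Cb := ofNormedAddCommGroup
    (fun t => -(qf μ t * F' (1 / Hinf μ * Hf μ t + qf (-μ) t * v t))) (by fun_prop) M
    fun t => le_of_tendsto (hf t).norm (Eventually.of_forall fun k =>
      ((f (φ k)).norm_coe_le_norm t).trans (hM _))
  have hg (t : ℝ) : Tendsto (fun k => f (φ k) t) atTop (𝓝 (g t)) := hf t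
  have hV (t : ℝ) : Tendsto (fun k => (potL μ hμ (L (φ k))).V t) atTop (𝓝 ((potR μ hμ).V t)) := by
    refine tendsto_const_nhds.congr' ?_
    filter_upwards [hev t, hLφ.eventually_gt_atTop 0] with k hk h0
    exact congrArg (Vf μ) (fold_eq h0 hk).symm
  have hNl (t y : ℝ) := Pot.tendsto_N (potR μ hμ) hs hV hg (fun k => hM (φ k)) t y
  have hvN (t : ℝ) : v t = (potR μ hμ).N s g t 0 := tendsto_nhds_unique (hv t) (hNl t 0)
  have hU (t y : ℝ) : Tendsto (fun k => (potL μ hμ (L (φ k))).U μ s (1 / Hf μ (L (φ k))) (f (φ k)) t y)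
      atTop (𝓝 ((potR μ hμ).U μ s (1 / Hinf μ) g t y)) :=
    (hcφ.mul_const _).add ((hNl t y).const_mul _)
  have hb (t y : ℝ) (hy : 0 ≤ y) : |(potR μ hμ).U μ s (1 / Hinf μ) g t y| ≤ 1 :=
    le_of_tendsto (hU t y).abs (by
      filter_upwards [hev t] with k hk using (E (φ k)).bd t y hk hy)
  have hfF (t : ℝ) : g t = -(qf μ t * F' ((potR μ hμ).U μ s (1 / Hinf μ) g t 0)) := by
    rw [Pot.U, ← hvN]; rfl
  refine ⟨φ, g, hφ, fun R => ⟨hs, hμ, one_div_pos.2 (Hinf_pos hμ), fun t _ => rfl, fun t _ => hfF t,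
    fun t y _ hy => hb t y hy, fun t' t y _ h _ hy => ?_, ?_⟩, hNl⟩
  · refine le_of_tendsto_of_tendsto (hU t' y) (hU t y) ?_
    filter_upwards [hev t, hev t'] with k hk hk'
    exact (E (φ k)).mono t' t y (abs_le.1 hk').1 h (abs_le.1 hk).2 hy
  · exact (potR μ hμ).exists_holder W hμ hs (S := univ) (fun t _ => abs_le.1 (hb t 0 le_rfl))
      (fun t _ => hfF t) fun H α _ _ h => ⟨H, fun t t' => h t trivial t' trivial⟩

end

lemma tendstoUniformlyOn_U {μ s M c : ℝ} (hμ : 0 < μ) (hs : s ∈ Ioo (0:ℝ) 1) {l Λ : ℝ}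
    {P : ℕ → Pot l Λ} {Q : Pot l Λ} {f : ℕ → Cb} {g : Cb} {b : ℕ → ℝ} (hM : ∀ k, ‖f k‖ ≤ M)
    (hb : Tendsto b atTop (𝓝 c))
    (hN : ∀ t y, Tendsto (fun k => (P k).N s (f k) t y) atTop (𝓝 (Q.N s g t y)))
    {K : Set ℝ²} (hK : IsCompact K) :
    TendstoUniformlyOn (fun k p => (P k).U μ s (b k) (f k) p.1 p.2)
      (fun p => Q.U μ s c g p.1 p.2) atTop K := by
  obtain ⟨C, hC, hH⟩ := Pot.N_holder hs (l := l) (Λ := Λ)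
  have hM0 : 0 ≤ M := (norm_nonneg _).trans (hM 0)
  have heq : Equicontinuous fun k (p : ℝ²) => (P k).N s (f k) p.1 p.2 := by
    refine Metric.equicontinuous_of_continuity_modulus (fun d => C * M * d ^ s) ?_ _
      fun p p' k => (hH (P k) (f k) p p').trans (by have := hM k; gcongr)
    have : ContinuousAt (fun d : ℝ => C * M * d ^ s) 0 :=
      continuousAt_const.mul (continuousAt_id.rpow_const (Or.inr hs.1.le))
    simpa [ContinuousAt, zero_rpow hs.1.ne'] using this
  have hu : TendstoUniformlyOn (fun k (p : ℝ²) => (P k).N s (f k) p.1 p.2)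
      (fun p => Q.N s g p.1 p.2) atTop K := by
    have := (EquicontinuousOn.tendsto_uniformOnFun_iff_pi' (𝔖 := {K}) (by simpa using hK)
      (by simpa using heq.equicontinuousOn K) atTop
      (UniformOnFun.ofFun {K} fun p : ℝ² => Q.N s g p.1 p.2)).2
      (tendsto_pi_nhds.2 fun p => hN _ _)
    exact UniformOnFun.tendsto_iff_tendstoUniformlyOn.1 this K rfl
  rw [Metric.tendstoUniformlyOn_iff] at hu ⊢
  intro ε hε
  have h1 : Tendsto (fun k => |c - b k| * K0 μ) atTop (𝓝 0) := by
    have := ((tendsto_const_nhds (x := c)).sub hb).abs.mul_const (K0 μ)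
    simpa using this
  filter_upwards [hu (ε / 2) (half_pos hε), h1.eventually (gt_mem_nhds (half_pos hε))]
    with k hk hk' p hp
  have h2 := hk p hp
  rw [Real.dist_eq] at h2 ⊢
  have e : Q.U μ s c g p.1 p.2 - (P k).U μ s (b k) (f k) p.1 p.2 = (c - b k) * Hf μ p.1 +
      qf (-μ) p.1 * (Q.N s g p.1 p.2 - (P k).N s (f k) p.1 p.2) := by
    rw [Pot.U, Pot.U]; ring
  have h3 : |Hf μ p.1| ≤ K0 μ := by
    refine abs_le'.2 ⟨Hf_le hμ _, ?_⟩
    rw [← Hf_neg]; exact Hf_le hμ _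
  rw [e]
  have h4 := qf_pos (-μ) p.1
  calc _ ≤ |c - b k| * |Hf μ p.1| +
        qf (-μ) p.1 * |Q.N s g p.1 p.2 - (P k).N s (f k) p.1 p.2| := by
        refine (abs_add_le _ _).trans ?_
        rw [abs_mul, abs_mul, abs_of_pos h4]
    _ ≤ |c - b k| * K0 μ + 1 * |Q.N s g p.1 p.2 - (P k).N s (f k) p.1 p.2| := by
        gcongr
        exact qf_neg_le_one hμ.le _
    _ < ε := by linarith

section
variable {F F' : ℝ → ℝ} {μ s : ℝ} {hμ : 0 < μ} {g : Cb}
  (E : ∀ R, Layer (potR μ hμ) μ s (1 / Hinf μ) R F' g)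

local notation "𝐮" => Pot.U (potR μ hμ) μ s (1 / Hinf μ) g

include E in
lemma limit_atTop : Tendsto (fun t => 𝐮 t 0) atTop (𝓝 1) ∧
    Tendsto (fun t => 𝐮 t 0) atBot (𝓝 (-1)) := by
  have hs := (E 1).hs
  have hq : Tendsto (qf (-μ)) atTop (𝓝 0) := by
    refine (tendsto_qf hμ).inv_tendsto_atTop.congr fun t => ?_
    exact (rpow_neg (cosh_pos t).le μ).symm
  have hN (τ : ℝ → ℝ) : Tendsto (fun t => qf (-μ) t * (potR μ hμ).N s g (τ t) 0) atTop (𝓝 0) := by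
    refine squeeze_zero_norm (fun t => ?_) (by simpa using hq.mul_const ((potR μ hμ).CN s * ‖g‖))
    rw [norm_mul, norm_eq_abs, norm_eq_abs, abs_of_pos (qf_pos _ _)]
    exact mul_le_mul_of_nonneg_left ((potR μ hμ).N_le g hs _ _) (qf_pos _ _).le
  have hH : Tendsto (fun t => 1 / Hinf μ * Hf μ t) atTop (𝓝 1) := by
    have := (tendsto_Hf hμ).const_mul (1 / Hinf μ)
    rwa [one_div_mul_cancel (Hinf_pos hμ).ne'] at this
  have h1 := hH.add (hN id)
  rw [add_zero] at h1
  refine ⟨h1, ?_⟩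
  have h := (hH.neg.add (hN fun t => -t)).comp tendsto_neg_atBot_atTop
  rw [add_zero] at h
  refine h.congr fun t => ?_
  simp only [Function.comp, neg_neg, Hf_neg, qf_neg, Pot.U]
  ring

include E in
lemma limit_solution {n : ℕ} (hnμ : μ = ((n:ℝ) - 1) / 2) (hF' : deriv F = F') :
    BRSolution n (1 - 2 * s) F (𝐮) where
  bounded := ⟨1, fun t y hy => (E |t|).bd t y le_rfl hy⟩
  cont := ((potR μ hμ).continuous_U μ _ g (E 1).hs).continuousOn
  smooth := by
    have hs := (E 1).hs
    have h1 : ContDiff ℝ 2 (qf (-μ)) := contDiff_cosh.rpow_const_of_ne fun t => (cosh_pos t).ne'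
    have h2 : ContDiff ℝ 2 (Hf μ) := by
      refine contDiff_succ_iff_deriv (n := 1).2 ⟨fun t => (hasDerivAt_Hf μ t).differentiableAt,
        by simp, ?_⟩
      rw [funext fun t => (hasDerivAt_Hf μ t).deriv]
      exact contDiff_cosh.rpow_const_of_ne fun t => (cosh_pos t).ne'
    exact ((contDiff_const.mul (h2.comp contDiff_fst)).contDiffOn).add
      ((h1.comp contDiff_fst).contDiffOn.mul ((potR μ hμ).N_smooth g hs))
  eqn t y hy := by
    have hs := (E 1).hs
    have h := (potR μ hμ).U_eqn (s := s) (1 / Hinf μ) g (t := t) (μ := μ) rfl hy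
    have e1 (t : ℝ) : pt (𝐮) t y =
      (potR μ hμ).Ut μ s (1 / Hinf μ) g t y := ((potR μ hμ).hasDerivAt_U_t μ _ g hs hy t).deriv
    have e2 (z : ℝ) (hz : 0 < z) : py (𝐮) t z =
      (potR μ hμ).Uy μ s g t z := ((potR μ hμ).hasDerivAt_U_y μ _ g hs hz t).deriv
    have e3 : ptt (𝐮) t y = (potR μ hμ).Utt μ s (1 / Hinf μ) g t y := by
      rw [ptt, funext e1]; exact ((potR μ hμ).hasDerivAt_Ut_t μ _ g hs hy t).deriv
    have e4 : pyy (𝐮) t y = (potR μ hμ).Uyy μ s g t y :=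
      (((potR μ hμ).hasDerivAt_Uy_y μ g hs hy t).congr_of_eventuallyEq (by
        filter_upwards [lt_mem_nhds hy] with z hz using e2 z hz)).deriv
    have hn : (n:ℝ) - 1 = 2 * μ := by linarith
    rw [Ha, e1, e2 y hy, e3, e4, hn]
    exact h
  pt_cont := by
    rw [show (fun p : ℝ² => pt (𝐮) p.1 p.2) = fun p : ℝ² =>
      (potR μ hμ).Ut μ s (1 / Hinf μ) g p.1 p.2 from funext fun p => ((E 1).hasDerivAt p.1 p.2).deriv]
    exact (E 1).continuous_Ut.continuousOn
  bc t := by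
    rw [hF', ← (E |t|).bc le_rfl]
    refine ((potR μ hμ).tendsto_yUy μ g (E 1).hs t).congr' ?_
    filter_upwards [self_mem_nhdsWithin] with y hy
    rw [py, ((potR μ hμ).hasDerivAt_U_y μ _ g (E 1).hs hy t).deriv]

end

lemma exists_well {F : ℝ → ℝ} (hF : DoubleWell F) : ∃ κ, Well F (deriv F) κ := by
  obtain ⟨hs, h0, h1, hp, h2, h3, -, -⟩ := hF
  have hd : ContDiff ℝ 1 (deriv F) :=
    ((contDiff_infty_iff_deriv.1 hs).2).of_le (by exact_mod_cast le_top)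
  obtain ⟨C, hC⟩ := (isCompact_Icc (a := (-1:ℝ)) (b := 1)).exists_bound_of_continuousOn
    (hd.continuous_deriv le_rfl).continuousOn
  have hC0 : 0 ≤ C := (norm_nonneg _).trans (hC 0 (by simp))
  refine ⟨2 * C + 1, by positivity, fun x => (hs.differentiable (by simp) x).hasDerivAt,
    hd.continuous, fun x hx y hy => ?_, h1, h0, h3, h2, fun x hx => ?_⟩
  · have h := (convex_Icc (-1:ℝ) 1).norm_image_sub_le_of_norm_deriv_le
      (fun z _ => hd.differentiable one_ne_zero z) hC hy hx
    exact h.trans (mul_le_mul_of_nonneg_right (by linarith) (norm_nonneg _))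
  · rcases hx.1.eq_or_lt with rfl | ha
    · exact h0.ge
    rcases hx.2.eq_or_lt with rfl | hb
    · exact h1.ge
    exact (hp x ⟨ha, hb⟩).le

end BR

open scoped NNReal in
/-- For every `T > 0` there is a `β`-Hölder function `u^T` on `cl(S_T^+)`, with values in
`(-1,1)`, vanishing at some `(t₀,0)`, nondecreasing in `t`, minimizing the reduced energy
with respect to compactly supported `C¹` perturbations keeping the range in `[-1,1]`;
moreover along a sequence `T_k → ∞` the `u^{T_k}` converge locally uniformly on
`ℝ × [0,∞)` to a layer solution of the boundary reaction problem. -/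
theorem stmt3 (n : ℕ) (hn : 2 ≤ n) (a : ℝ) (ha : a ∈ Set.Ioo (-1:ℝ) 1)
    (F : ℝ → ℝ) (hF : DoubleWell F) :
    ∃ β : ℝ≥0, 0 < β ∧ β < 1 ∧
      ∃ U : ℝ → (ℝ → ℝ → ℝ),
        (∀ T : ℝ, 0 < T →
          (∃ C : ℝ≥0, HolderOnWith C β (fun p : ℝ × ℝ => U T p.1 p.2) (closure (SHalf T))) ∧
          (∀ p ∈ closure (SHalf T), -1 < U T p.1 p.2 ∧ U T p.1 p.2 < 1) ∧
          (∃ t₀ ∈ Set.Ioo (-T) T, U T t₀ 0 = 0) ∧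
          (∀ p ∈ SHalf T, DifferentiableAt ℝ (fun s => U T s p.2) p.1) ∧
          ContinuousOn (fun p : ℝ × ℝ => pt (U T) p.1 p.2) (SHalf T) ∧
          (∀ p ∈ SHalf T, 0 ≤ pt (U T) p.1 p.2) ∧
          (∀ ψ : ℝ → ℝ → ℝ,
            ContDiffOn ℝ 1 (fun p : ℝ × ℝ => ψ p.1 p.2) {p : ℝ × ℝ | 0 ≤ p.2} →
            (∃ K : Set (ℝ × ℝ), IsCompact K ∧
              K ⊆ SHalf T ∪ {p : ℝ × ℝ | |p.1| < T ∧ p.2 = 0} ∧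
              ∀ p : ℝ × ℝ, 0 ≤ p.2 → p ∉ K → ψ p.1 p.2 = 0) →
            (∀ p ∈ SHalf T, -1 ≤ U T p.1 p.2 + ψ p.1 p.2 ∧ U T p.1 p.2 + ψ p.1 p.2 ≤ 1) →
            energy n a F (SHalf T) (U T) ≤ energy n a F (SHalf T) (fun t y => U T t y + ψ t y))) ∧
        ∃ Tk : ℕ → ℝ, Tendsto Tk atTop atTop ∧
          ∃ u : ℝ → ℝ → ℝ, BRSolution n a F u ∧
            (∀ t : ℝ, 0 < pt u t 0) ∧
            Tendsto (fun t => u t 0) atTop (𝓝 1) ∧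
            Tendsto (fun t => u t 0) atBot (𝓝 (-1)) ∧
            ∀ K : Set (ℝ × ℝ), IsCompact K → K ⊆ {p : ℝ × ℝ | 0 ≤ p.2} →
              TendstoUniformlyOn (fun k (p : ℝ × ℝ) => U (Tk k) p.1 p.2)
                (fun p : ℝ × ℝ => u p.1 p.2) atTop K := by
  obtain ⟨κ, W⟩ := BR.exists_well hF
  obtain ⟨s, rfl⟩ : ∃ s, a = 1 - 2 * s := ⟨(1 - a) / 2, by ring⟩
  have hs : s ∈ Ioo (0:ℝ) 1 := ⟨by linarith [ha.2], by linarith [ha.1]⟩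
  obtain ⟨μ, hμn⟩ : ∃ μ, μ = ((n:ℝ) - 1) / 2 := ⟨_, rfl⟩
  have hn2 : (2:ℝ) ≤ n := by exact_mod_cast hn
  have hμ : 0 < μ := by rw [hμn]; linarith
  choose L f hL E hr hl hf hz using fun T (hT : 0 < T) => BR.exists_approx W hμ hs hT
  refine ⟨s.toNNReal, Real.toNNReal_pos.2 hs.1, Real.toNNReal_lt_one.2 hs.2, fun T =>
    if hT : 0 < T then (BR.potL μ hμ (L T hT)).U μ s (1 / BR.Hf μ (L T hT)) (f T hT) else 0,
    fun T hT => ?_, ?_⟩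
  · simp only [dif_pos hT]
    have E := E T hT
    have hTL := hL T hT
    have hcl := BR.closure_SHalf_subset hT
    have hpt (t y : ℝ) : pt ((BR.potL μ hμ (L T hT)).U μ s (1 / BR.Hf μ (L T hT)) (f T hT)) t y =
      (BR.potL μ hμ (L T hT)).Ut μ s (1 / BR.Hf μ (L T hT)) (f T hT) t y := (E.hasDerivAt t y).deriv
    obtain ⟨C, hC, hH⟩ := BR.Pot.U_holder (c := 1 / BR.Hf μ (L T hT)) (T := T) hs hμ
      (BR.potL μ hμ (L T hT)) (f T hT)
    refine ⟨⟨_, BR.holderOnWith_of_dist_le hC hs.1.le fun p hp p' hp' =>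
        hH p p' (hcl hp).1 (hcl hp').1⟩,
      fun p hp => abs_lt.1 (E.U_abs_lt W ((hcl hp).1.trans_lt hTL) (hcl hp).2), hz T hT,
      fun p _ => (E.hasDerivAt p.1 p.2).differentiableAt, ?_, fun p hp => ?_, ?_⟩
    · simp only [hpt]
      exact E.continuous_Ut.continuousOn
    · have hp' := hcl (subset_closure hp)
      rw [hpt]
      exact (E.Ut_pos W (hp'.1.trans_lt hTL) hp'.2).le
    · rintro ψ hψ ⟨K, hK, hKT, hψK⟩ hb
      exact E.minimal W (hT.trans hTL) (hr T hT) (hl T hT) hT hTL hn hμn hψ hK hKT hψK hb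
  · have hk (k : ℕ) : (0:ℝ) < k + 1 := k.cast_add_one_pos
    have hLt : Tendsto (fun k : ℕ => L (k + 1) (hk k)) atTop atTop :=
      tendsto_atTop_mono (fun k => (hL _ (hk k)).le)
        (tendsto_atTop_add_const_right _ _ tendsto_natCast_atTop_atTop)
    have hM (k : ℕ) := hf (k + 1) (hk k) 1 one_pos (by simp)
    obtain ⟨φ, g, hφ, hE, hN⟩ := BR.exists_limit W hμ hs hLt (fun k => E (k + 1) (hk k)) hM
    obtain ⟨h1, h2⟩ := BR.limit_atTop hE
    refine ⟨fun k => (φ k : ℝ) + 1, tendsto_atTop_add_const_right _ _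
      (tendsto_natCast_atTop_atTop.comp hφ.tendsto_atTop), _, BR.limit_solution hE hμn rfl,
      fun t => ?_, h1, h2, fun K hK _ => ?_⟩
    · rw [pt, ((hE 1).hasDerivAt t 0).deriv]
      exact (hE (|t| + 1)).Ut_pos W (lt_add_one _) le_rfl
    · simp only [dif_pos (hk _)]
      have h0 : Tendsto (fun k => BR.Hf μ (L (φ k + 1) (hk (φ k)))) atTop (𝓝 (BR.Hinf μ)) :=
        (BR.tendsto_Hf hμ).comp (hLt.comp hφ.tendsto_atTop)
      exact BR.tendstoUniformlyOn_U hμ hs (fun k => hM (φ k))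
        ((tendsto_const_nhds (x := (1:ℝ))).div h0 (BR.Hinf_pos hμ).ne') hN hK
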